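/- Let k be a finite field of characteristic p ≠ 2, suppose n = 2r with r ≥ 1, let R be an algebraically closed field of characteristic different from p, and let ρ be a supercuspidal irreducible R-representation of GL_n(k). Then the following are equivalent: (1) ρ is selfdual, i.e. ρ ≅ ρ^∨; (2) ρ is (GL_r × GL_r)(k)-distinguished, i.e. Hom_{(GL_r × GL_r)(k)}(ρ, 1) ≠ 0; (3) the R-vector space Hom_{(GL_r × GL_r)(k)}(ρ, 1) has dimension 1. -/

import Mathlib

open Matrix

section InvariantForms

variable {R : Type} [CommRing R] {G : Type} [Monoid G] {V : Type} [AddCommGroup V] [Module R V]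

/-- The space of `H`-invariant `R`-linear forms on a representation `ρ`. -/
def invariantForms (ρ : Representation R G V) (H : Set G) : Submodule R (V →ₗ[R] R) where
  carrier := {φ | ∀ g ∈ H, ∀ v : V, φ (ρ g v) = φ v}
  add_mem' := by
    intro φ ψ hφ hψ g hg v
    simp only [LinearMap.add_apply, hφ g hg v, hψ g hg v]
  zero_mem' := by intro g hg v; simp
  smul_mem' := by
    intro c φ hφ g hg v
    simp only [LinearMap.smul_apply, hφ g hg v]

/-- A representation is irreducible if it is nonzero and its only invariant submodules
are `⊥` and `⊤`. -/
def IsIrreducibleRep (ρ : Representation R G V) : Prop :=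
  (⊥ : Submodule R V) ≠ ⊤ ∧
    ∀ W : Submodule R V, (∀ g : G, ∀ v ∈ W, ρ g v ∈ W) → W = ⊥ ∨ W = ⊤

/-- Two representations are isomorphic if there is an equivariant linear equivalence. -/
def RepIso {W : Type} [AddCommGroup W] [Module R W]
    (ρ : Representation R G V) (τ : Representation R G W) : Prop :=
  ∃ e : V ≃ₗ[R] W, ∀ (g : G) (v : V), e (ρ g v) = τ g (e v)

/-- `ρ` is (isomorphic to) a subquotient of `τ`:  there is a `τ`-invariant submodule `q`
together with an equivariant surjection from `q` onto the space of `ρ`. -/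
def IsSubquotientOf {W : Type} [AddCommGroup W] [Module R W]
    (ρ : Representation R G V) (τ : Representation R G W) : Prop :=
  ∃ (q : Submodule R W) (hq : ∀ g : G, ∀ w ∈ q, τ g w ∈ q) (f : ↥q →ₗ[R] V),
    Function.Surjective f ∧
      ∀ (g : G) (w : ↥q), f ⟨τ g w.1, hq g w.1 w.2⟩ = ρ g (f w)

end InvariantForms
section RightRegular

variable {R : Type} [CommRing R] {G : Type} [Group G] {V : Type} [AddCommGroup V] [Module R V]

/-- The right-translation representation of `G` on a translation-invariant submodule of
the space of `V`-valued functions on `G`. -/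
def rightRegular (C : Submodule R (G → V))
    (hC : ∀ g : G, ∀ f ∈ C, (fun x => f (x * g)) ∈ C) :
    Representation R G ↥C where
  toFun g := LinearMap.restrict
    { toFun := fun (f : G → V) => (fun x => f (x * g))
      map_add' := fun _ _ => rfl
      map_smul' := fun _ _ => by rfl } (fun f hf => hC g f hf)
  map_one' := by
    apply LinearMap.ext
    intro f
    apply Subtype.ext
    funext x
    simp [LinearMap.restrict_apply]
  map_mul' := by
    intro g g'
    apply LinearMap.ext
    intro f
    apply Subtype.ext
    funext x
    simp [LinearMap.restrict_apply, mul_assoc]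

/-- The space of the representation of `G` induced from a representation `τ` of a
subgroup `P`. -/
def indCarrier {W : Type} [AddCommGroup W] [Module R W]
    (P : Subgroup G) (τ : Representation R ↥P W) : Submodule R (G → W) where
  carrier := {f | ∀ (p : ↥P) (g : G), f (↑p * g) = τ p (f g)}
  add_mem' := by
    intro f₁ f₂ h₁ h₂ p g
    simp [h₁ p g, h₂ p g]
  zero_mem' := by intro p g; simp
  smul_mem' := by
    intro c f hf p g
    simp [hf p g]

/-- The representation of `G` induced from a representation `τ` of a subgroup `P`,
realized on functions `f : G → W` with `f (p * g) = τ p (f g)`, with `G` acting by right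
translation. -/
def inducedRep {W : Type} [AddCommGroup W] [Module R W]
    (P : Subgroup G) (τ : Representation R ↥P W) :
    Representation R G ↥(indCarrier P τ) :=
  rightRegular (indCarrier P τ) (by
    intro g f hf p x
    simpa [mul_assoc] using hf p (x * g))

end RightRegular
section Parabolic

variable (k : Type) [Field k]

/-- The block upper-triangular parabolic subgroup of `GL n k` attached to a
block function `B`. -/
def parabolic (n r : ℕ) (B : Fin n → Fin r) : Subgroup (GL (Fin n) k) where
  carrier := {g | Matrix.BlockTriangular (g : Matrix (Fin n) (Fin n) k) B}
  one_mem' := by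
    simpa using Matrix.blockTriangular_one (b := B)
  mul_mem' := by
    intro a b ha hb
    have h : ((a * b : GL (Fin n) k) : Matrix (Fin n) (Fin n) k)
        = (a : Matrix (Fin n) (Fin n) k) * (b : Matrix (Fin n) (Fin n) k) := rfl
    simpa [Set.mem_setOf_eq, h] using Matrix.BlockTriangular.mul ha hb
  inv_mem' := by
    intro a ha
    have h : ((a⁻¹ : GL (Fin n) k) : Matrix (Fin n) (Fin n) k)
        = (a : Matrix (Fin n) (Fin n) k)⁻¹ := by
      simp [Matrix.coe_units_inv]
    haveI : Invertible (a : Matrix (Fin n) (Fin n) k) := a.invertible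
    simpa [Set.mem_setOf_eq, h] using Matrix.blockTriangular_inv_of_blockTriangular ha

/-- A representation of `GL n k` is supercuspidal if it does not occur as a subquotient of
any representation induced from a proper parabolic subgroup, from a representation inflated
from the corresponding block-diagonal Levi subgroup (i.e. trivial on the unipotent radical). -/
def IsSupercuspidal {R : Type} [CommRing R] {n : ℕ} {V : Type} [AddCommGroup V] [Module R V]
    (ρ : Representation R (GL (Fin n) k) V) : Prop :=
  ∀ (r : ℕ), 2 ≤ r → ∀ B : Fin n → Fin r, Monotone B → Function.Surjective B →
    ∀ (W : Type) [AddCommGroup W] [Module R W],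
      ∀ τ : Representation R ↥(parabolic k n r B) W,
        (∀ u : ↥(parabolic k n r B),
            (∀ i j : Fin n, B i = B j →
              ((u : GL (Fin n) k) : Matrix (Fin n) (Fin n) k) i j
                = (1 : Matrix (Fin n) (Fin n) k) i j) → τ u = 1) →
        ¬ IsSubquotientOf ρ (inducedRep (parabolic k n r B) τ)

end Parabolic

section Levi

variable (k : Type) [Field k]

lemma levi_mem_iff {n r : ℕ} (B : Fin n → Fin r) (M : Matrix (Fin n) (Fin n) k) :
    (∀ i j, B i ≠ B j → M i j = 0) ↔
      (Matrix.BlockTriangular M B ∧ Matrix.BlockTriangular M (OrderDual.toDual ∘ B)) := by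
  constructor
  · intro h
    refine ⟨fun i j hij => h i j (ne_of_gt hij), fun i j hij => h i j (ne_of_lt ?_)⟩
    exact OrderDual.toDual_lt_toDual.mp hij
  · rintro ⟨h₁, h₂⟩ i j hij
    rcases lt_or_gt_of_ne hij with hlt | hgt
    · exact h₂ (by simpa using hlt)
    · exact h₁ hgt

/-- The block-diagonal Levi subgroup of `GL n k` attached to a block function `B`. -/
def levi (n r : ℕ) (B : Fin n → Fin r) : Subgroup (GL (Fin n) k) where
  carrier := {g | ∀ i j, B i ≠ B j → (g : Matrix (Fin n) (Fin n) k) i j = 0}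
  one_mem' := by
    intro i j hij
    have hne : i ≠ j := fun h => hij (by rw [h])
    simp [Matrix.one_apply, hne]
  mul_mem' := by
    intro a b ha hb
    have h : ((a * b : GL (Fin n) k) : Matrix (Fin n) (Fin n) k)
        = (a : Matrix (Fin n) (Fin n) k) * (b : Matrix (Fin n) (Fin n) k) := rfl
    rw [Set.mem_setOf_eq] at ha hb ⊢
    rw [levi_mem_iff] at ha hb ⊢
    rw [h]
    exact ⟨ha.1.mul hb.1, ha.2.mul hb.2⟩
  inv_mem' := by
    intro a ha
    have h : ((a⁻¹ : GL (Fin n) k) : Matrix (Fin n) (Fin n) k)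
        = (a : Matrix (Fin n) (Fin n) k)⁻¹ := by
      simp [Matrix.coe_units_inv]
    rw [Set.mem_setOf_eq] at ha ⊢
    rw [levi_mem_iff] at ha ⊢
    rw [h]
    haveI : Invertible (a : Matrix (Fin n) (Fin n) k) := a.invertible
    exact ⟨Matrix.blockTriangular_inv_of_blockTriangular ha.1,
      Matrix.blockTriangular_inv_of_blockTriangular ha.2⟩

end Levi
/-- The block function on `Fin n` describing two consecutive blocks, the first of size `r`. -/
def twoBlocks (n r : ℕ) : Fin n → Fin 2 := fun i => if (i : ℕ) < r then 0 else 1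

set_option linter.unusedSectionVars false

section GroupAction

variable {𝕂 : Type} [Field 𝕂] {G : Type} [Group G] [Fintype G]
  {V : Type} [AddCommGroup V] [Module 𝕂 V] {V' : Type} [AddCommGroup V'] [Module 𝕂 V']

/-- The action of a function on the group (an element of the group algebra). -/
def act (ρ : Representation 𝕂 G V) : (G → 𝕂) →ₗ[𝕂] Module.End 𝕂 V where
  toFun x := ∑ g, x g • ρ g
  map_add' x y := by simp [add_smul, Finset.sum_add_distrib]
  map_smul' c x := by simp [Finset.smul_sum, smul_smul]

lemma act_def (ρ : Representation 𝕂 G V) (x : G → 𝕂) : act ρ x = ∑ g, x g • ρ g := rfl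

lemma act_apply (ρ : Representation 𝕂 G V) (x : G → 𝕂) (v : V) :
    act ρ x v = ∑ g, x g • ρ g v := by
  simp [act_def, LinearMap.sum_apply]

lemma act_single [DecidableEq G] (ρ : Representation 𝕂 G V) (g : G) :
    act ρ (Pi.single g 1) = ρ g := by
  simp [act_def, Pi.single_apply]

lemma act_translate (ρ : Representation 𝕂 G V) (x : G → 𝕂) (a b : G) :
    act ρ (fun g => x (a * g * b)) = ρ a⁻¹ * act ρ x * ρ b⁻¹ := by
  rw [act_def, act_def, Finset.mul_sum, Finset.sum_mul]
  refine Fintype.sum_equiv ((Equiv.mulLeft a).trans (Equiv.mulRight b)) _ _ fun g => ?_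
  simp [← map_mul, mul_assoc]

/-- A subspace of functions stable under left and right translations. -/
def IsTwoSided (I : Submodule 𝕂 (G → 𝕂)) : Prop :=
  ∀ x ∈ I, ∀ a b : G, (fun g => x (a * g * b)) ∈ I

lemma isTwoSided_ker (ρ : Representation 𝕂 G V) : IsTwoSided (LinearMap.ker (act ρ)) := by
  intro x hx a b
  rw [LinearMap.mem_ker] at hx ⊢
  rw [act_translate, hx]; simp

/-- Convolution of functions. -/
def conv (x y : G → 𝕂) : G → 𝕂 := fun g => ∑ h, x h * y (h⁻¹ * g)

lemma act_conv (ρ : Representation 𝕂 G V) (x y : G → 𝕂) :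
    act ρ (conv x y) = act ρ x * act ρ y := by
  classical
  have h : conv x y = ∑ h, x h • (fun g => y (h⁻¹ * g * 1)) := by
    ext g; simp [conv, Finset.sum_apply]
  rw [h, map_sum, act_def ρ x, Finset.sum_mul]
  refine Finset.sum_congr rfl fun a _ => ?_
  rw [map_smul, act_translate]
  simp

lemma conv_mem_right {I : Submodule 𝕂 (G → 𝕂)} (hI : IsTwoSided I) (x : G → 𝕂) {y : G → 𝕂}
    (hy : y ∈ I) : conv x y ∈ I := by
  have h : conv x y = ∑ h, x h • (fun g => y (h⁻¹ * g * 1)) := by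
    ext g; simp [conv, Finset.sum_apply]
  rw [h]
  exact Submodule.sum_mem _ fun a _ => I.smul_mem _ (hI y hy _ _)

lemma conv_mem_left {I : Submodule 𝕂 (G → 𝕂)} (hI : IsTwoSided I) {x : G → 𝕂} (y : G → 𝕂)
    (hx : x ∈ I) : conv x y ∈ I := by
  have h : conv x y = ∑ h, y h • (fun g => x (1 * g * h⁻¹)) := by
    ext g
    simp only [conv, Finset.sum_apply, Pi.smul_apply, smul_eq_mul]
    refine Fintype.sum_equiv ((Equiv.inv G).trans (Equiv.mulRight g)) _ _ fun a => ?_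
    simp [mul_comm]
  rw [h]
  exact Submodule.sum_mem _ fun a _ => I.smul_mem _ (hI x hx _ _)

/-- `I` acts through all endomorphisms. -/
def ActsFully (ρ : Representation 𝕂 G V) (I : Submodule 𝕂 (G → 𝕂)) : Prop :=
  ∀ f : Module.End 𝕂 V, ∃ x ∈ I, act ρ x = f

lemma ActsFully.inf {ρ : Representation 𝕂 G V} {I J : Submodule 𝕂 (G → 𝕂)}
    (hI : ActsFully ρ I) (hJ : ActsFully ρ J) (h1 : IsTwoSided I) (h2 : IsTwoSided J) :
    ActsFully ρ (I ⊓ J) := by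
  intro f
  obtain ⟨x, hx, hx1⟩ := hI 1
  obtain ⟨y, hy, hy1⟩ := hJ f
  exact ⟨conv x y, ⟨conv_mem_left h1 y hx, conv_mem_right h2 x hy⟩, by
    rw [act_conv, hx1, hy1, one_mul]⟩

lemma IsTwoSided.inf {I J : Submodule 𝕂 (G → 𝕂)} (h1 : IsTwoSided I) (h2 : IsTwoSided J) :
    IsTwoSided (I ⊓ J) := fun x hx a b => ⟨h1 x hx.1 a b, h2 x hx.2 a b⟩

lemma IsTwoSided.iInf {ι : Sort*} {I : ι → Submodule 𝕂 (G → 𝕂)} (h : ∀ i, IsTwoSided (I i)) :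
    IsTwoSided (⨅ i, I i) := by
  intro x hx a b
  rw [Submodule.mem_iInf] at hx ⊢
  exact fun i => h i x (hx i) a b

lemma ActsFully.finset_iInf {ι : Type*} {ρ : Representation 𝕂 G V}
    (hT : ActsFully ρ ⊤) (s : Finset ι) {I : ι → Submodule 𝕂 (G → 𝕂)}
    (hI : ∀ i, IsTwoSided (I i)) (hf : ∀ i, ActsFully ρ (I i)) :
    ActsFully ρ (⨅ i ∈ s, I i) := by
  classical
  induction s using Finset.induction_on with
  | empty => simpa using hT
  | insert i s hi ih =>
    rw [Finset.iInf_insert]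
    have h2 : IsTwoSided (⨅ j ∈ s, I j) := by
      apply IsTwoSided.iInf
      intro j
      apply IsTwoSided.iInf
      exact fun _ => hI j
    exact (hf i).inf ih (hI i) h2

lemma ActsFully.iInf {ι : Type*} [Finite ι] {ρ : Representation 𝕂 G V}
    (hT : ActsFully ρ ⊤) {I : ι → Submodule 𝕂 (G → 𝕂)}
    (hI : ∀ i, IsTwoSided (I i)) (hf : ∀ i, ActsFully ρ (I i)) :
    ActsFully ρ (⨅ i, I i) := by
  have := Fintype.ofFinite ι
  have h := hT.finset_iInf Finset.univ hI hf
  simp only [Finset.mem_univ, iInf_pos] at h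
  exact h

lemma IsIrreducibleRep.nontrivial {ρ : Representation 𝕂 G V} (h : IsIrreducibleRep ρ) :
    Nontrivial V := by
  by_contra hn
  rw [not_nontrivial_iff_subsingleton] at hn
  exact h.1 (Subsingleton.elim _ _)

lemma IsIrreducibleRep.finiteDimensional {ρ : Representation 𝕂 G V} (h : IsIrreducibleRep ρ) :
    FiniteDimensional 𝕂 V := by
  have := h.nontrivial
  obtain ⟨v, hv⟩ := exists_ne (0 : V)
  have hW := h.2 (Submodule.span 𝕂 (Set.range fun g => ρ g v)) (by
    intro g w hw
    induction hw using Submodule.span_induction with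
    | mem w hw =>
      obtain ⟨a, rfl⟩ := hw
      exact Submodule.subset_span ⟨g * a, by simp⟩
    | zero => simp
    | add a b _ _ ha hb => rw [map_add]; exact add_mem ha hb
    | smul c a _ ha => rw [map_smul]; exact Submodule.smul_mem _ _ ha)
  rcases hW with hW | hW
  · exact absurd ((Submodule.mem_bot 𝕂).1 (hW ▸ Submodule.subset_span ⟨1, by simp⟩)) hv
  · exact ⟨⟨(Set.finite_range fun g => ρ g v).toFinset, by simpa using hW⟩⟩

/-- A nonzero equivariant map between irreducible representations is an isomorphism. -/
lemma repIso_of_ne_zero {ρ : Representation 𝕂 G V} {ρ' : Representation 𝕂 G V'}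
    (h : IsIrreducibleRep ρ) (h' : IsIrreducibleRep ρ') (f : V →ₗ[𝕂] V') (hf : f ≠ 0)
    (hfe : ∀ g v, f (ρ g v) = ρ' g (f v)) : RepIso ρ ρ' := by
  have hk : LinearMap.ker f = ⊥ := by
    rcases h.2 (LinearMap.ker f) (fun g v hv => by
      rw [LinearMap.mem_ker] at hv ⊢; rw [hfe, hv, map_zero]) with h1 | h1
    · exact h1
    · exact absurd (LinearMap.ker_eq_top.1 h1) hf
  have hr : LinearMap.range f = ⊤ := by
    rcases h'.2 (LinearMap.range f) (by rintro g _ ⟨v, rfl⟩; exact ⟨ρ g v, hfe g v⟩) with h1 | h1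
    · exact absurd (LinearMap.range_eq_bot.1 h1) hf
    · exact h1
  exact ⟨LinearEquiv.ofBijective f ⟨LinearMap.ker_eq_bot.1 hk, LinearMap.range_eq_top.1 hr⟩, hfe⟩

lemma RepIso.symm {ρ : Representation 𝕂 G V} {ρ' : Representation 𝕂 G V'}
    (h : RepIso ρ ρ') : RepIso ρ' ρ := by
  obtain ⟨e, he⟩ := h
  refine ⟨e.symm, fun g v => ?_⟩
  rw [LinearEquiv.symm_apply_eq, he, e.apply_symm_apply]

end GroupAction

section Burnside

variable {𝕂 : Type} [Field 𝕂] {V : Type} [AddCommGroup V] [Module 𝕂 V]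

/-- The rank-one operator `v ↦ ξ v • w`. -/
abbrev rankOne (w : V) (ξ : V →ₗ[𝕂] 𝕂) : Module.End 𝕂 V := ξ.smulRight w

lemma eq_sum_rankOne [FiniteDimensional 𝕂 V] (f : Module.End 𝕂 V) :
    f = ∑ i, rankOne (f (Module.finBasis 𝕂 V i)) ((Module.finBasis 𝕂 V).coord i) := by
  ext v
  conv_lhs => rw [← (Module.finBasis 𝕂 V).sum_repr v, map_sum]
  simp

lemma trace_rankOne [FiniteDimensional 𝕂 V] (w : V) (ξ : V →ₗ[𝕂] 𝕂) : LinearMap.trace 𝕂 V (rankOne w ξ) = ξ w :=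
  LinearMap.trace_smulRight ξ w

lemma exists_trace_mul_ne_zero [FiniteDimensional 𝕂 V] {P : Module.End 𝕂 V} (hP : P ≠ 0) :
    ∃ f : Module.End 𝕂 V, LinearMap.trace 𝕂 V (f * P) ≠ 0 := by
  obtain ⟨v, hv⟩ : ∃ v, P v ≠ 0 := by
    by_contra! h; exact hP (LinearMap.ext h)
  obtain ⟨ξ, hξ⟩ : ∃ ξ : Module.Dual 𝕂 V, ξ (P v) ≠ 0 := by
    by_contra! h; exact hv ((Module.forall_dual_apply_eq_zero_iff 𝕂 _).1 h)
  refine ⟨rankOne v ξ, ?_⟩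
  rw [LinearMap.trace_mul_comm]
  have : P * rankOne v ξ = rankOne (P v) ξ := by ext; simp
  rwa [this, trace_rankOne]

variable {G : Type} [Group G] [Fintype G] [IsAlgClosed 𝕂]

/-- Burnside's theorem. -/
lemma actsFully_top {ρ : Representation 𝕂 G V} (h : IsIrreducibleRep ρ) : ActsFully ρ ⊤ := by
  have := h.nontrivial
  have := h.finiteDimensional
  classical
  let A : Subalgebra 𝕂 (Module.End 𝕂 V) := Algebra.adjoin 𝕂 (Set.range ρ)
  have hA : ∀ f ∈ A, ∃ x : G → 𝕂, act ρ x = f := by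
    intro f hf
    induction hf using Algebra.adjoin_induction with
    | mem f hf => obtain ⟨g, rfl⟩ := hf; exact ⟨_, act_single ρ g⟩
    | algebraMap r =>
      exact ⟨r • Pi.single 1 1, by rw [map_smul, act_single, map_one, Algebra.algebraMap_eq_smul_one]⟩
    | add f g _ _ hf hg =>
      obtain ⟨x, rfl⟩ := hf; obtain ⟨y, rfl⟩ := hg; exact ⟨x + y, map_add _ _ _⟩
    | mul f g _ _ hf hg =>
      obtain ⟨x, rfl⟩ := hf; obtain ⟨y, rfl⟩ := hg; exact ⟨conv x y, act_conv ρ x y⟩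
  have hs : IsSimpleModule A V := by
    rw [isSimpleModule_iff]
    refine { exists_pair_ne := ⟨⊥, ⊤, bot_ne_top⟩, eq_bot_or_eq_top := fun W => ?_ }
    rcases h.2 (W.restrictScalars 𝕂) (fun g v hv =>
      W.smul_mem (⟨ρ g, Algebra.subset_adjoin ⟨g, rfl⟩⟩ : A) hv) with h1 | h1
    · left; ext v; rw [← Submodule.restrictScalars_mem 𝕂, h1]; simp
    · right; ext v; rw [← Submodule.restrictScalars_mem 𝕂, h1]; simp
  have hb := IsSimpleModule.algebraMap_end_bijective_of_isAlgClosed (A := A) (V := V) 𝕂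
  intro f
  let F : Module.End (Module.End A V) V :=
    { toFun := f
      map_add' := f.map_add
      map_smul' := by
        intro t v
        obtain ⟨c, rfl⟩ := hb.2 t
        exact f.map_smul c v }
  obtain ⟨a, ha⟩ := jacobson_density F (Finset.univ.image (Module.finBasis 𝕂 V))
  obtain ⟨x, hx⟩ := hA a.1 a.2
  refine ⟨x, trivial, (Module.finBasis 𝕂 V).ext fun i => ?_⟩
  rw [hx]
  exact (ha _ (Finset.mem_image_of_mem _ (Finset.mem_univ i))).symm

/-- A two-sided ideal not killing an irreducible representation acts through all
endomorphisms. -/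
lemma actsFully_of_ne_zero {ρ : Representation 𝕂 G V} (h : IsIrreducibleRep ρ)
    {I : Submodule 𝕂 (G → 𝕂)} (hI : IsTwoSided I) {x : G → 𝕂} (hx : x ∈ I)
    (hne : act ρ x ≠ 0) : ActsFully ρ I := by
  have := h.finiteDimensional
  intro f
  obtain ⟨v, hv⟩ : ∃ v, act ρ x v ≠ 0 := by
    by_contra! h; exact hne (LinearMap.ext h)
  obtain ⟨ξ, hξ⟩ : ∃ ξ : Module.Dual 𝕂 V, ξ (act ρ x v) ≠ 0 := by
    by_contra! h; exact hv ((Module.forall_dual_apply_eq_zero_iff 𝕂 _).1 h)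
  have key : ∀ (w : V) (η : V →ₗ[𝕂] 𝕂), ∃ y ∈ I, act ρ y = rankOne w η := by
    intro w η
    obtain ⟨a, -, ha⟩ := actsFully_top h (rankOne ((ξ (act ρ x v))⁻¹ • w) ξ)
    obtain ⟨b, -, hb⟩ := actsFully_top h (rankOne v η)
    refine ⟨conv (conv a x) b, conv_mem_left hI _ (conv_mem_right hI _ hx), ?_⟩
    rw [act_conv, act_conv, ha, hb]
    ext u
    simp [smul_smul, mul_assoc, mul_inv_cancel₀ hξ]
  choose y hy hyf using key
  refine ⟨∑ i, y (f (Module.finBasis 𝕂 V i)) ((Module.finBasis 𝕂 V).coord i),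
    Submodule.sum_mem _ fun _ _ => hy _ _, ?_⟩
  rw [map_sum]
  simp_rw [hyf]
  exact (eq_sum_rankOne f).symm

variable {V' : Type} [AddCommGroup V'] [Module 𝕂 V']

/-- The annihilator of an irreducible representation acts fully on any other one. -/
lemma actsFully_ker_of_not_repIso {ρ : Representation 𝕂 G V} {ρ' : Representation 𝕂 G V'}
    (h : IsIrreducibleRep ρ) (h' : IsIrreducibleRep ρ') (hni : ¬ RepIso ρ' ρ) :
    ActsFully ρ (LinearMap.ker (act ρ')) := by
  have := h.nontrivial
  have := h.finiteDimensional
  have := h'.finiteDimensional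
  by_cases hx : ∃ x ∈ LinearMap.ker (act ρ'), act ρ x ≠ 0
  · obtain ⟨x, hx, hne⟩ := hx
    exact actsFully_of_ne_zero h (isTwoSided_ker ρ') hx hne
  exfalso
  push Not at hx
  apply hni
  obtain ⟨v, hv⟩ := exists_ne (0 : V)
  choose s _ hs using actsFully_top h'
  have hwd : ∀ x y, act ρ' x = act ρ' y → act ρ x = act ρ y := by
    intro x y hxy
    have := hx (x - y) (by rw [LinearMap.mem_ker, map_sub, hxy, sub_self])
    rwa [map_sub, sub_eq_zero] at this
  let L : Module.End 𝕂 V' →ₗ[𝕂] V :=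
    { toFun := fun f => act ρ (s f) v
      map_add' := fun f f' => by
        rw [hwd (s (f + f')) (s f + s f') (by rw [hs, map_add, hs, hs]), map_add]; rfl
      map_smul' := fun c f => by
        rw [hwd (s (c • f)) (c • s f) (by rw [hs, map_smul, hs]), map_smul]; rfl }
  have hL : ∀ g f, L (ρ' g * f) = ρ g (L f) := by
    intro g f
    classical
    change act ρ _ v = ρ g (act ρ _ v)
    rw [hwd (s (ρ' g * f)) (conv (Pi.single g 1) (s f)) (by rw [hs, act_conv, act_single, hs]),
      act_conv, act_single]; rfl
  obtain ⟨w, ξ, hwξ⟩ : ∃ w ξ, L (rankOne w ξ) ≠ 0 := by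
    by_contra! h0
    have h1 : L 1 = 0 := by
      rw [eq_sum_rankOne (1 : Module.End 𝕂 V'), map_sum]
      exact Finset.sum_eq_zero fun i _ => h0 _ _
    classical
    have h2 : L 1 = v := by
      change act ρ _ v = v
      rw [hwd (s 1) (Pi.single 1 1) (by rw [hs, act_single, map_one]), act_single]; simp
    exact hv (h2 ▸ h1)
  refine repIso_of_ne_zero h' h (L ∘ₗ
    { toFun := fun w => rankOne w ξ
      map_add' := fun a b => by ext; simp
      map_smul' := fun a b => by ext; simp [smul_smul, mul_comm] }) ?_ ?_
  · intro h0
    exact hwξ (congrArg (fun f => f w) h0)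
  · intro g u
    simp only [LinearMap.comp_apply, LinearMap.coe_mk, AddHom.coe_mk]
    rw [← hL]
    congr 1
    ext; simp

/-- Irreducible representations with a common nonzero matrix coefficient are isomorphic. -/
lemma repIso_of_trace_eq {ρ : Representation 𝕂 G V} {ρ' : Representation 𝕂 G V'}
    (h : IsIrreducibleRep ρ) (h' : IsIrreducibleRep ρ') {P : Module.End 𝕂 V} (hP : P ≠ 0)
    (P' : Module.End 𝕂 V')
    (ht : ∀ g, LinearMap.trace 𝕂 V (ρ g * P) = LinearMap.trace 𝕂 V' (ρ' g * P')) :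
    RepIso ρ' ρ := by
  by_contra hni
  have := h.finiteDimensional
  have := h'.finiteDimensional
  obtain ⟨f, hf⟩ := exists_trace_mul_ne_zero hP
  obtain ⟨x, hx, rfl⟩ := actsFully_ker_of_not_repIso h h' hni f
  rw [LinearMap.mem_ker] at hx
  have : LinearMap.trace 𝕂 V (act ρ x * P) = LinearMap.trace 𝕂 V' (act ρ' x * P') := by
    simp only [act_def, Finset.sum_mul, map_sum, smul_mul_assoc, map_smul, ht]
  rw [this, hx] at hf
  simp at hf

end Burnside

section Unipotent

variable (k : Type) [Field k] (n : ℕ)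

/-- The unipotent radical of the standard maximal parabolic subgroup of type `(j, n - j)`. -/
def uniRad (j : ℕ) : Subgroup (GL (Fin n) k) where
  carrier := {g | ∀ a b : Fin n, ¬ ((a : ℕ) < j ∧ j ≤ (b : ℕ)) →
    (g : Matrix (Fin n) (Fin n) k) a b = (1 : Matrix (Fin n) (Fin n) k) a b}
  one_mem' := fun a b _ => rfl
  mul_mem' := by
    intro g h hg hh a b hab
    change ((g : Matrix (Fin n) (Fin n) k) * (h : Matrix (Fin n) (Fin n) k)) a b = _
    rw [Matrix.mul_apply]
    by_cases ha : (a : ℕ) < j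
    · rw [Finset.sum_eq_single b]
      · rw [hh b b (by omega), Matrix.one_apply_eq, mul_one, hg a b hab]
      · intro c _ hc
        rw [hh c b (by omega), Matrix.one_apply_ne hc, mul_zero]
      · simp
    · rw [Finset.sum_eq_single a]
      · rw [hg a a (by omega), Matrix.one_apply_eq, one_mul, hh a b hab]
      · intro c _ hc
        rw [hg a c (by omega), Matrix.one_apply_ne (Ne.symm hc), zero_mul]
      · simp
  inv_mem' := by
    intro g hg a b hab
    have key : (g : Matrix (Fin n) (Fin n) k) * (2 - (g : Matrix (Fin n) (Fin n) k)) = 1 := by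
      have hX : ((g : Matrix (Fin n) (Fin n) k) - 1) * ((g : Matrix (Fin n) (Fin n) k) - 1) = 0 := by
        ext c d
        rw [Matrix.mul_apply, Matrix.zero_apply]
        refine Finset.sum_eq_zero fun e _ => ?_
        rw [Matrix.sub_apply, Matrix.sub_apply]
        by_cases he : (e : ℕ) < j
        · rw [hg c e (by omega)]; simp
        · rw [hg e d (by omega)]; simp
      have : (g : Matrix (Fin n) (Fin n) k) * (2 - (g : Matrix (Fin n) (Fin n) k)) =
        1 - ((g : Matrix (Fin n) (Fin n) k) - 1) * ((g : Matrix (Fin n) (Fin n) k) - 1) := by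
        noncomm_ring
      rw [this, hX, sub_zero]
    have h2 : ((g⁻¹ : GL (Fin n) k) : Matrix (Fin n) (Fin n) k)
        = 2 - (g : Matrix (Fin n) (Fin n) k) := by
      calc ((g⁻¹ : GL (Fin n) k) : Matrix (Fin n) (Fin n) k)
          = ((g⁻¹ : GL (Fin n) k) : Matrix (Fin n) (Fin n) k) *
            ((g : Matrix (Fin n) (Fin n) k) * (2 - (g : Matrix (Fin n) (Fin n) k))) := by
              rw [key, mul_one]
        _ = _ := by
          rw [← mul_assoc, ← Units.val_mul, inv_mul_cancel, Units.val_one, one_mul]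
    rw [h2, Matrix.sub_apply, hg a b hab, ← one_add_one_eq_two, Matrix.add_apply]
    ring

variable {k n}

lemma mem_uniRad {j : ℕ} {g : GL (Fin n) k} : g ∈ uniRad k n j ↔
    ∀ a b : Fin n, ¬ ((a : ℕ) < j ∧ j ≤ (b : ℕ)) → g.val a b = (1 : Matrix (Fin n) (Fin n) k) a b :=
  Iff.rfl

lemma twoBlocks_lt {j : ℕ} (a b : Fin n) :
    twoBlocks n j a < twoBlocks n j b ↔ (a : ℕ) < j ∧ j ≤ (b : ℕ) := by
  unfold twoBlocks
  split_ifs <;> simp <;> omega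

lemma twoBlocks_eq {j : ℕ} (a b : Fin n) :
    twoBlocks n j a = twoBlocks n j b ↔ ((a : ℕ) < j ↔ (b : ℕ) < j) := by
  unfold twoBlocks
  split_ifs with h1 h2 h2 <;> simp <;> omega

lemma mem_uniRad_of_parabolic {j : ℕ} {g : GL (Fin n) k}
    (hg : g ∈ parabolic k n 2 (twoBlocks n j))
    (h : ∀ a b : Fin n, twoBlocks n j a = twoBlocks n j b →
      g.val a b = (1 : Matrix (Fin n) (Fin n) k) a b) : g ∈ uniRad k n j := by
  intro a b hab
  by_cases h1 : twoBlocks n j a = twoBlocks n j b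
  · exact h a b h1
  · have h2 : twoBlocks n j b < twoBlocks n j a := by
      rw [twoBlocks_lt]; rw [twoBlocks_eq] at h1; omega
    rw [hg h2, Matrix.one_apply_ne]
    rintro rfl; exact lt_irrefl _ h2

lemma conj_mem_uniRad {j : ℕ} {g u : GL (Fin n) k}
    (hg : g ∈ parabolic k n 2 (twoBlocks n j)) (hu : u ∈ uniRad k n j) :
    g * u * g⁻¹ ∈ uniRad k n j := by
  have hg' := (parabolic k n 2 (twoBlocks n j)).inv_mem hg
  intro a b hab
  have hX : (g * u * g⁻¹ : GL (Fin n) k).val = 1 + g.val * (u.val - 1) * (g⁻¹).val := by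
    have h1 : g.val * (g⁻¹).val = 1 := by rw [← Units.val_mul, mul_inv_cancel, Units.val_one]
    rw [Units.val_mul, Units.val_mul, mul_sub, sub_mul, mul_one, h1]
    abel
  rw [hX, Matrix.add_apply, Matrix.mul_apply, Finset.sum_eq_zero, add_zero]
  intro d _
  rw [Matrix.mul_apply, Finset.sum_mul]
  refine Finset.sum_eq_zero fun c _ => ?_
  rw [Matrix.sub_apply]
  by_cases hcd : (c : ℕ) < j ∧ j ≤ (d : ℕ)
  · by_cases ha : (a : ℕ) < j
    · have : (g⁻¹).val d b = 0 := hg' (by rw [twoBlocks_lt]; omega)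
      rw [this, mul_zero]
    · have : g.val a c = 0 := hg (by rw [twoBlocks_lt]; omega)
      rw [this, zero_mul, zero_mul]
  · rw [hu c d hcd, sub_self, mul_zero, zero_mul]

lemma uniRad_pow {j : ℕ} {g : GL (Fin n) k} (hg : g ∈ uniRad k n j) (m : ℕ) :
    (g ^ m).val = 1 + (m : k) • (g.val - 1) := by
  have hX : (g.val - 1) * (g.val - 1) = 0 := by
    ext c d
    rw [Matrix.mul_apply, Matrix.zero_apply]
    refine Finset.sum_eq_zero fun e _ => ?_
    rw [Matrix.sub_apply, Matrix.sub_apply]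
    by_cases he : (e : ℕ) < j
    · rw [hg c e (by omega)]; simp
    · rw [hg e d (by omega)]; simp
  induction m with
  | zero => simp
  | succ m ih =>
    rw [pow_succ, Units.val_mul, ih]
    have : g.val = 1 + (g.val - 1) := by abel
    conv_lhs => enter [2]; rw [this]
    rw [add_mul, mul_add, mul_add, smul_mul_assoc, smul_mul_assoc, hX]
    push_cast
    rw [add_smul, one_smul]
    simp; abel

lemma isPGroup_uniRad (p : ℕ) [Fact p.Prime] [CharP k p] (j : ℕ) :
    IsPGroup p (uniRad k n j) := by
  intro g
  refine ⟨1, ?_⟩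
  ext1
  apply Units.ext
  rw [pow_one, Subgroup.coe_pow, uniRad_pow g.2]
  simp

end Unipotent

lemma exists_factor_range {R : Type} [Field R] {A B C : Type} [AddCommGroup A] [Module R A]
    [AddCommGroup B] [Module R B] [AddCommGroup C] [Module R C] (F : A →ₗ[R] B) (e : A →ₗ[R] C)
    (h : LinearMap.ker F ≤ LinearMap.ker e) :
    ∃ f : LinearMap.range F →ₗ[R] C, ∀ x, f ⟨F x, LinearMap.mem_range_self _ _⟩ = e x := by
  obtain ⟨t, ht⟩ := F.rangeRestrict.exists_rightInverse_of_surjective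
    (LinearMap.range_rangeRestrict _)
  refine ⟨e ∘ₗ t, fun x => ?_⟩
  have h1 := congrArg (fun f => f ⟨F x, LinearMap.mem_range_self _ _⟩) ht
  simp only [LinearMap.comp_apply, LinearMap.id_apply] at h1
  have h2 : F (t ⟨F x, LinearMap.mem_range_self _ _⟩ - x) = 0 := by
    rw [map_sub, sub_eq_zero]
    exact congrArg Subtype.val h1
  have h3 := h h2
  rw [LinearMap.mem_ker, map_sub, sub_eq_zero] at h3
  exact h3

lemma isSubquotientOf_of_map {R : Type} [Field R] [IsAlgClosed R] {G : Type} [Group G] [Fintype G]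
    {V : Type} [AddCommGroup V] [Module R V] {W : Type} [AddCommGroup W] [Module R W]
    {ρ : Representation R G V} (hirr : IsIrreducibleRep ρ) {v : V} (hv : v ≠ 0)
    (τ : Representation R G W) (F : (G → R) →ₗ[R] W)
    (hF : ∀ x g, τ g (F x) = F (fun a => x (g⁻¹ * a * 1)))
    (hker : ∀ x, F x = 0 → act ρ x v = 0) : IsSubquotientOf ρ τ := by
  let ev : (G → R) →ₗ[R] V := (LinearMap.applyₗ v) ∘ₗ act ρ
  have hev : ∀ x, ev x = act ρ x v := fun x => rfl
  obtain ⟨f, hf⟩ := exists_factor_range F ev (fun x hx => hker x hx)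
  have := hirr.finiteDimensional
  refine ⟨LinearMap.range F, ?_, f, ?_, ?_⟩
  · rintro g _ ⟨x, rfl⟩
    rw [hF]
    exact LinearMap.mem_range_self _ _
  · intro w
    obtain ⟨ξ, hξ⟩ : ∃ ξ : Module.Dual R V, ξ v ≠ 0 := by
      by_contra! h; exact hv ((Module.forall_dual_apply_eq_zero_iff R _).1 h)
    obtain ⟨x, -, hx⟩ := actsFully_top hirr (rankOne ((ξ v)⁻¹ • w) ξ)
    refine ⟨_, (hf x).trans ?_⟩
    rw [hev, hx]
    simp [smul_smul, mul_inv_cancel₀ hξ]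
  · rintro g ⟨_, x, rfl⟩
    have hf' : ∀ w (hw : w ∈ LinearMap.range F) x, w = F x → f ⟨w, hw⟩ = ev x := by
      rintro _ hw x rfl
      exact hf x
    rw [hf, hf' _ _ _ (hF x g), hev, hev, act_translate]
    simp

section Cuspidal

variable {k : Type} [Field k] [Fintype k] {n : ℕ}
  {R : Type} [Field R] {V : Type} [AddCommGroup V] [Module R V]

noncomputable instance instFintypeGL : Fintype (GL (Fin n) k) := Fintype.ofFinite _

noncomputable instance instFintypeSubgroup {G : Type} [Group G] [Fintype G] (H : Subgroup G) :
    Fintype H := Fintype.ofFinite _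

lemma card_uniRad_ne_zero (p : ℕ) [Fact p.Prime] [CharP k p] (hR : (p : R) ≠ 0) (j : ℕ) :
    (Fintype.card (uniRad k n j) : R) ≠ 0 := by
  obtain ⟨m, hm⟩ := (IsPGroup.iff_card).1 (isPGroup_uniRad (k := k) (n := n) p j)
  rw [← Nat.card_eq_fintype_card, hm]
  push_cast
  exact pow_ne_zero _ hR

variable (k R n) in
/-- Functions whose averages over all two-sided translates of `uniRad k n j` vanish. -/
def aIdeal (j : ℕ) : Submodule R (GL (Fin n) k → R) where
  carrier := {x | ∀ a h : GL (Fin n) k, ∑ u : uniRad k n j, x (a * u * h) = 0}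
  add_mem' := by
    intro x y hx hy a h
    simp [Finset.sum_add_distrib, hx a h, hy a h]
  zero_mem' := by intro a h; simp
  smul_mem' := by
    intro c x hx a h
    simp [← Finset.mul_sum, hx a h]

lemma isTwoSided_aIdeal (j : ℕ) : IsTwoSided (aIdeal k n R j) := by
  intro x hx a b c d
  have := hx (a * c) (d * b)
  simpa [mul_assoc] using this

variable (k R n) in
/-- The intersection of the ideals `aIdeal k n R j` for `0 < j < n`. -/
def cuspIdeal : Submodule R (GL (Fin n) k → R) := ⨅ i : Fin (n - 1), aIdeal k n R (i + 1)

lemma isTwoSided_cuspIdeal : IsTwoSided (cuspIdeal k n R) :=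
  IsTwoSided.iInf fun _ => isTwoSided_aIdeal _

lemma mem_aIdeal_of_mem_cuspIdeal {x : GL (Fin n) k → R} (hx : x ∈ cuspIdeal k n R) {j : ℕ}
    (h0 : 0 < j) (hj : j < n) : x ∈ aIdeal k n R j := by
  have h := (Submodule.mem_iInf _).1 hx ⟨j - 1, by omega⟩
  simpa [Nat.sub_add_cancel h0] using h

lemma act_mul_sum_uniRad (ρ : Representation R (GL (Fin n) k) V) {j : ℕ} {x : GL (Fin n) k → R}
    (hx : x ∈ aIdeal k n R j) : act ρ x * ∑ u : uniRad k n j, ρ u = 0 := by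
  have h1 : ∀ u : uniRad k n j, act ρ x * ρ u = act ρ (fun g => x (1 * g * (u : GL (Fin n) k)⁻¹)) := by
    intro u; rw [act_translate]; simp
  rw [Finset.mul_sum]
  simp_rw [h1]
  rw [← map_sum]
  convert map_zero (act ρ) using 2
  ext g
  rw [Finset.sum_apply, Pi.zero_apply, ← hx g 1]
  refine Fintype.sum_equiv (Equiv.inv _) _ _ fun u => ?_
  simp

/-- All sums over unipotent radicals of proper parabolic subgroups vanish. -/
def IsCuspidal (ρ : Representation R (GL (Fin n) k) V) : Prop :=
  ∀ j, 0 < j → j < n → ∑ u : uniRad k n j, ρ (u : GL (Fin n) k) = 0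

lemma IsCuspidal.eq_zero_of_fixed {ρ : Representation R (GL (Fin n) k) V} (h : IsCuspidal ρ)
    (p : ℕ) [Fact p.Prime] [CharP k p] (hR : (p : R) ≠ 0) {j : ℕ} (h0 : 0 < j) (hj : j < n)
    {v : V} (hv : ∀ u ∈ uniRad k n j, ρ u v = v) : v = 0 := by
  have h1 := congrArg (fun f => f v) (h j h0 hj)
  simp only [LinearMap.sum_apply, LinearMap.zero_apply] at h1
  rw [Finset.sum_congr rfl fun u _ => hv u.1 u.2] at h1
  rw [Finset.sum_const, Finset.card_univ, ← Nat.cast_smul_eq_nsmul R] at h1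
  exact (smul_eq_zero.1 h1).resolve_left (card_uniRad_ne_zero p hR j)

section Embedding

variable (k R n) in
/-- Functions on `P × G` invariant under left translation by the unipotent radical. -/
def pairCarrier (j : ℕ) :
    Submodule R (parabolic k n 2 (twoBlocks n j) × GL (Fin n) k → R) where
  carrier := {φ | ∀ (u p : parabolic k n 2 (twoBlocks n j)) (h : GL (Fin n) k),
    u.1 ∈ uniRad k n j → φ (u * p, h) = φ (p, h)}
  add_mem' := by
    intro x y hx hy u p h hu
    simp [hx u p h hu, hy u p h hu]
  zero_mem' := by intro u p h hu; rfl
  smul_mem' := by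
    intro c x hx u p h hu
    simp [hx u p h hu]

variable (k R n) in
/-- Right translation on the first variable. -/
def pairRep (j : ℕ) :
    Representation R (parabolic k n 2 (twoBlocks n j)) (pairCarrier k n R j) where
  toFun p' := LinearMap.restrict
    { toFun := fun φ => fun z => φ (z.1 * p', z.2)
      map_add' := fun _ _ => rfl
      map_smul' := fun _ _ => rfl } (by
        intro φ hφ u p h hu
        simp only [LinearMap.coe_mk, AddHom.coe_mk]
        rw [mul_assoc, hφ u (p * p') h hu])
  map_one' := by
    apply LinearMap.ext; intro φ; apply Subtype.ext; funext z
    simp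
  map_mul' := by
    intro a b
    apply LinearMap.ext; intro φ; apply Subtype.ext; funext z
    change φ.1 (z.1 * (a * b), z.2) = φ.1 (z.1 * a * b, z.2)
    rw [mul_assoc]

lemma pairRep_apply (j : ℕ) (p' : parabolic k n 2 (twoBlocks n j)) (φ : pairCarrier k n R j)
    (z) : (pairRep k n R j p' φ).1 z = φ.1 (z.1 * p', z.2) := rfl

variable (k R n) in
/-- The map from functions on `G` to the induced representation. -/
noncomputable def toInd (j : ℕ) : (GL (Fin n) k → R) →ₗ[R]
    indCarrier (parabolic k n 2 (twoBlocks n j)) (pairRep k n R j) where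
  toFun x := ⟨fun g => ⟨fun z => ∑ u : uniRad k n j, x (g⁻¹ * (z.1 : GL (Fin n) k)⁻¹ * u * z.2), by
      intro u p h hu
      refine Fintype.sum_equiv (Equiv.mulLeft (⟨u.1, hu⟩ : uniRad k n j)⁻¹) _ _ fun w => ?_
      simp [mul_assoc]⟩, by
    intro p g
    apply Subtype.ext
    funext z
    rw [pairRep_apply]
    simp [mul_assoc]⟩
  map_add' x y := by
    apply Subtype.ext; funext g; apply Subtype.ext; funext z
    simp [Finset.sum_add_distrib]
  map_smul' c x := by
    apply Subtype.ext; funext g; apply Subtype.ext; funext z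
    simp [Finset.mul_sum]

lemma toInd_apply (j : ℕ) (x : GL (Fin n) k → R) (g : GL (Fin n) k) (z) :
    ((toInd k n R j x).1 g).1 z =
      ∑ u : uniRad k n j, x (g⁻¹ * (z.1 : GL (Fin n) k)⁻¹ * u * z.2) := rfl

lemma toInd_ker (j : ℕ) : LinearMap.ker (toInd k n R j) = aIdeal k n R j := by
  ext x
  rw [LinearMap.mem_ker]
  constructor
  · intro hx a h
    have := congrArg (fun F => (F.1 a⁻¹).1 (1, h)) hx
    simpa [toInd_apply] using this
  · intro hx
    apply Subtype.ext; funext g; apply Subtype.ext; funext z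
    rw [toInd_apply, hx]; rfl

lemma toInd_equivariant (j : ℕ) (x : GL (Fin n) k → R) (g : GL (Fin n) k) :
    inducedRep _ (pairRep k n R j) g (toInd k n R j x) =
      toInd k n R j (fun a => x (g⁻¹ * a * 1)) := by
  apply Subtype.ext; funext a; apply Subtype.ext; funext z
  rw [toInd_apply]
  change ((toInd k n R j x).1 (a * g)).1 z = _
  rw [toInd_apply]
  simp [mul_assoc]

end Embedding

lemma IsSupercuspidal.actsFully_aIdeal [IsAlgClosed R] {ρ : Representation R (GL (Fin n) k) V}
    (hirr : IsIrreducibleRep ρ) (hsc : IsSupercuspidal k ρ) {j : ℕ} (h0 : 0 < j) (hj : j < n) :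
    ActsFully ρ (aIdeal k n R j) := by
  classical
  by_cases hx : ∃ x ∈ aIdeal k n R j, act ρ x ≠ 0
  · obtain ⟨x, hx, hne⟩ := hx
    exact actsFully_of_ne_zero hirr (isTwoSided_aIdeal j) hx hne
  exfalso
  push Not at hx
  have := hirr.nontrivial
  obtain ⟨v, hv⟩ := exists_ne (0 : V)
  refine hsc 2 le_rfl (twoBlocks n j) ?_ ?_ (pairCarrier k n R j) (pairRep k n R j) ?_ ?_
  · intro a b hab
    have : (a : ℕ) ≤ b := hab
    unfold twoBlocks
    split_ifs <;> simp <;> omega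
  · intro c
    fin_cases c
    · exact ⟨⟨0, by omega⟩, by simp [twoBlocks, h0]⟩
    · exact ⟨⟨j, hj⟩, by simp [twoBlocks]⟩
  · intro u hu
    have hu' := mem_uniRad_of_parabolic u.2 hu
    apply LinearMap.ext; intro φ; apply Subtype.ext; funext z
    rw [pairRep_apply]
    have := φ.2 (z.1 * u * z.1⁻¹) z.1 z.2 (by
      simpa using conj_mem_uniRad z.1.2 hu')
    simpa using this
  · refine isSubquotientOf_of_map hirr hv _ (toInd k n R j) (toInd_equivariant j) fun x hx' => ?_
    rw [← LinearMap.mem_ker, toInd_ker] at hx'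
    rw [hx x hx']; rfl

lemma IsSupercuspidal.actsFully_cuspIdeal [IsAlgClosed R]
    {ρ : Representation R (GL (Fin n) k) V}
    (hirr : IsIrreducibleRep ρ) (hsc : IsSupercuspidal k ρ) :
    ActsFully ρ (cuspIdeal k n R) :=
  (actsFully_top hirr).iInf (fun _ => isTwoSided_aIdeal _)
    fun i => hsc.actsFully_aIdeal hirr (Nat.succ_pos _) (by omega)

lemma IsCuspidal.of_actsFully {ρ : Representation R (GL (Fin n) k) V}
    (h : ActsFully ρ (cuspIdeal k n R)) : IsCuspidal ρ := by
  intro j h0 hj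
  obtain ⟨x, hx, hx1⟩ := h 1
  have := act_mul_sum_uniRad ρ (mem_aIdeal_of_mem_cuspIdeal hx h0 hj)
  rwa [hx1, one_mul] at this

end Cuspidal

section UpperUnipotent

variable {k : Type} [Field k] {n : ℕ}

lemma one_add_col_mul_one_sub_col (i : Fin n) (x : Fin n → k) :
    (Matrix.of fun a b => (1 : Matrix (Fin n) (Fin n) k) a b + if b = i ∧ a < i then x a else 0) *
      (Matrix.of fun a b =>
        (1 : Matrix (Fin n) (Fin n) k) a b - if b = i ∧ a < i then x a else 0) = 1 := by
  ext a b
  rw [Matrix.mul_apply]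
  by_cases hb : b = i
  · subst hb
    simp only [Matrix.of_apply, add_mul, mul_sub, Finset.sum_sub_distrib, Matrix.one_apply, ite_mul,
      mul_ite, one_mul, zero_mul, mul_one, mul_zero, Finset.sum_ite_eq', Finset.mem_univ, if_true]
    simp only [true_and]
    rw [Finset.sum_eq_single a]
    · by_cases hab : a < b
      · simp [hab, hab.ne]
      · simp [hab]
    · intro c _ hc
      by_cases hcb : c < b
      · simp [hcb, hcb.ne, Ne.symm hc]
      · simp [hcb]
    · simp
  · simp [Matrix.one_apply, hb]

/-- The unipotent matrix with entries `x a` above the diagonal in column `i`. -/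
def colU (i : Fin n) (x : Fin n → k) : GL (Fin n) k where
  val := Matrix.of fun a b => (1 : Matrix (Fin n) (Fin n) k) a b + if b = i ∧ a < i then x a else 0
  inv := Matrix.of fun a b => (1 : Matrix (Fin n) (Fin n) k) a b - if b = i ∧ a < i then x a else 0
  val_inv := one_add_col_mul_one_sub_col i x
  inv_val := mul_eq_one_comm.1 (one_add_col_mul_one_sub_col i x)

lemma colU_apply (i : Fin n) (x : Fin n → k) (a b : Fin n) : (colU i x).val a b =
    (1 : Matrix (Fin n) (Fin n) k) a b + if b = i ∧ a < i then x a else 0 := rfl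

lemma colU_mul_apply (i : Fin n) (x : Fin n → k) (g : Matrix (Fin n) (Fin n) k) (a b : Fin n) :
    ((colU i x).val * g) a b = g a b + if a < i then x a * g i b else 0 := by
  simp only [Matrix.mul_apply, colU_apply, add_mul, Finset.sum_add_distrib, Matrix.one_apply,
    ite_mul, one_mul, zero_mul, Finset.sum_ite_eq, Finset.mem_univ, if_true]
  congr 1
  rw [Finset.sum_eq_single i]
  · simp
  · intro c _ hc; simp [hc]
  · simp

lemma mul_colU_apply (i : Fin n) (x : Fin n → k) (g : Matrix (Fin n) (Fin n) k) (a b : Fin n) :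
    (g * (colU i x).val) a b = g a b + if b = i then ∑ c, (if c < i then g a c * x c else 0) else 0 := by
  simp only [Matrix.mul_apply, colU_apply, mul_add, Finset.sum_add_distrib, Matrix.one_apply,
    mul_ite, mul_one, mul_zero, Finset.sum_ite_eq', Finset.mem_univ, if_true]
  congr 1
  by_cases hb : b = i <;> simp [hb]

lemma colU_zero (i : Fin n) : colU i (0 : Fin n → k) = 1 := by
  ext a b; rw [colU_apply]; simp

lemma colU_add (i : Fin n) (x y : Fin n → k) : colU i (x + y) = colU i x * colU i y := by
  ext a b
  rw [Units.val_mul, colU_mul_apply, colU_apply, colU_apply, colU_apply]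
  by_cases hb : b = i
  · subst hb
    by_cases ha : a < b <;> simp [ha]
    ring
  · simp [hb, Matrix.one_apply, Ne.symm hb]

variable (k n) in
/-- The group of upper unitriangular matrices. -/
def upperUni : Subgroup (GL (Fin n) k) where
  carrier := {g | ∀ a b : Fin n, b ≤ a → g.val a b = (1 : Matrix (Fin n) (Fin n) k) a b}
  one_mem' := fun a b _ => rfl
  mul_mem' := by
    intro g h hg hh a b hab
    rw [Units.val_mul, Matrix.mul_apply, Finset.sum_eq_single b]
    · rw [hg a b hab, hh b b le_rfl]; simp
    · intro c _ hc
      by_cases hcb : b ≤ c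
      · rw [hh c b hcb, Matrix.one_apply_ne hc, mul_zero]
      · have hcb : c < b := not_le.1 hcb
        rw [hg a c (hcb.le.trans hab), Matrix.one_apply_ne, zero_mul]
        rintro rfl; exact absurd hab (not_le.2 hcb)
    · simp
  inv_mem' := by
    intro g hg
    have hbt : Matrix.BlockTriangular g.val id := by
      intro a b hab
      have hba : b < a := hab
      rw [hg a b hba.le, Matrix.one_apply_ne hba.ne']
    have hbt' : Matrix.BlockTriangular (g⁻¹).val id := by
      have : Invertible g.val := g.invertible
      rw [Matrix.coe_units_inv]
      exact Matrix.blockTriangular_inv_of_blockTriangular hbt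
    intro a b hab
    rcases hab.lt_or_eq with h | rfl
    · rw [hbt' h, Matrix.one_apply_ne (ne_of_gt h)]
    · have h1 : (g.val * (g⁻¹).val) b b = 1 := by
        rw [← Units.val_mul, mul_inv_cancel]; simp
      rw [Matrix.mul_apply, Finset.sum_eq_single b] at h1
      · rw [hg b b le_rfl, Matrix.one_apply_eq, one_mul] at h1
        rw [h1, Matrix.one_apply_eq]
      · intro c _ hc
        rcases lt_or_gt_of_ne hc with h | h
        · rw [hbt h, zero_mul]
        · rw [hbt' h, mul_zero]
      · simp

lemma mem_upperUni {g : GL (Fin n) k} : g ∈ upperUni k n ↔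
    ∀ a b : Fin n, b ≤ a → g.val a b = (1 : Matrix (Fin n) (Fin n) k) a b := Iff.rfl

lemma colU_mem_upperUni (i : Fin n) (x : Fin n → k) : colU i x ∈ upperUni k n := by
  intro a b hab
  rw [colU_apply, if_neg, add_zero]
  rintro ⟨rfl, h⟩; exact absurd hab (not_le.2 h)

/-- Subgroups of upper unitriangular matrices closed under taking columns are generated by
column matrices. -/
lemma le_closure_colU (S : Subgroup (GL (Fin n) k)) (hS : S ≤ upperUni k n)
    (hcol : ∀ u ∈ S, ∀ t, colU t (fun a => u.val a t) ∈ S) :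
    S ≤ Subgroup.closure {g | g ∈ S ∧ ∃ t x, g = colU t x} := by
  have main : ∀ t : ℕ, ∀ u ∈ S, (∀ a b : Fin n, t ≤ b → u.val a b =
      (1 : Matrix (Fin n) (Fin n) k) a b) →
      u ∈ Subgroup.closure {g | g ∈ S ∧ ∃ t x, g = colU t x} := by
    intro t
    induction t with
    | zero =>
      intro u _ h
      have : u = 1 := by ext a b; rw [h a b (Nat.zero_le _)]; rfl
      rw [this]; exact Subgroup.one_mem _
    | succ t ih =>
      intro u hu h
      by_cases ht : t < n
      · set i : Fin n := ⟨t, ht⟩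
        have hc := hcol u⁻¹ (S.inv_mem hu) i
        set c := colU i (fun a => (u⁻¹).val a i) with hcdef
        have hmem : u * c ∈ Subgroup.closure {g | g ∈ S ∧ ∃ t x, g = colU t x} := by
          refine ih _ (S.mul_mem hu hc) fun a b hb => ?_
          rw [Units.val_mul, hcdef, mul_colU_apply]
          by_cases hbi : b = i
          · subst hbi
            have h1 : (u.val * (u⁻¹).val) a i = (1 : Matrix (Fin n) (Fin n) k) a i := by
              rw [← Units.val_mul, mul_inv_cancel]; rfl
            rw [← h1, Matrix.mul_apply, if_pos rfl]
            have h2 : ∀ c, u.val a c * (u⁻¹).val c i =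
                (if c = i then u.val a i else 0) +
                  if c < i then u.val a c * (u⁻¹).val c i else 0 := by
              intro c
              rcases lt_trichotomy c i with h3 | h3 | h3
              · simp [h3, h3.ne]
              · subst h3
                rw [hS (S.inv_mem hu) i i le_rfl]; simp
              · rw [hS (S.inv_mem hu) c i h3.le, Matrix.one_apply_ne h3.ne']
                simp [h3.ne', not_lt.2 h3.le]
            rw [Finset.sum_congr rfl fun c _ => h2 c, Finset.sum_add_distrib]
            simp
          · rw [if_neg hbi, add_zero]
            refine h a b ?_
            have : (b : ℕ) ≠ t := fun h => hbi (Fin.ext h)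
            omega
        have h3 : u = u * c * c⁻¹ := by group
        rw [h3]
        exact Subgroup.mul_mem _ hmem (Subgroup.inv_mem _ (Subgroup.subset_closure ⟨hc, _, _, rfl⟩))
      · exact ih u hu fun a b hb => absurd b.2 (by omega)
  intro u hu
  exact main n u hu fun a b hb => absurd b.2 (by omega)

lemma uniRad_le_upperUni (j : ℕ) : uniRad k n j ≤ upperUni k n := by
  intro u hu a b hab
  refine hu a b ?_
  have : (b : ℕ) ≤ a := hab
  omega

lemma uniRad_le_closure_colU (j : ℕ) : uniRad k n j ≤
    Subgroup.closure {g | g ∈ uniRad k n j ∧ ∃ t x, g = colU t x} := by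
  refine le_closure_colU _ (uniRad_le_upperUni j) fun u hu t a b hab => ?_
  rw [colU_apply]
  split_ifs with h
  · obtain ⟨rfl, h⟩ := h
    rw [hu a b hab, Matrix.one_apply_ne h.ne, add_zero]
  · rw [add_zero]

lemma upperUni_le_closure_colU : upperUni k n ≤
    Subgroup.closure {g | g ∈ upperUni k n ∧ ∃ t x, g = colU t x} :=
  le_closure_colU _ le_rfl fun _ _ _ => colU_mem_upperUni _ _

/-- The sum of the entries just above the diagonal. -/
def superDiag (g : Matrix (Fin n) (Fin n) k) : k :=
  ∑ a : Fin n, ∑ b : Fin n, if (b : ℕ) = (a : ℕ) + 1 then g a b else 0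

lemma superDiag_mul {g h : GL (Fin n) k} (hg : g ∈ upperUni k n) (hh : h ∈ upperUni k n) :
    superDiag (g * h).val = superDiag g.val + superDiag h.val := by
  simp only [superDiag, ← Finset.sum_add_distrib]
  refine Finset.sum_congr rfl fun a _ => Finset.sum_congr rfl fun b _ => ?_
  split_ifs with hab
  · have hne : a ≠ b := by rintro rfl; omega
    rw [Units.val_mul, Matrix.mul_apply,
      ← Finset.sum_subset (Finset.subset_univ {a, b}), Finset.sum_pair hne, hg a a le_rfl,
      hh b b le_rfl, Matrix.one_apply_eq, Matrix.one_apply_eq, one_mul, mul_one, add_comm]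
    intro c _ hc
    simp only [Finset.mem_insert, Finset.mem_singleton, not_or] at hc
    by_cases hca : c < a
    · rw [hg a c hca.le, Matrix.one_apply_ne (Ne.symm hc.1), zero_mul]
    · have : b ≤ c := by
        have h1 : (c : ℕ) ≠ a := fun h => hc.1 (Fin.ext h)
        have h2 : ¬ (c : ℕ) < a := hca
        change (b : ℕ) ≤ c; omega
      rw [hh c b this, Matrix.one_apply_ne hc.2, mul_zero]
  · simp

lemma superDiag_one : superDiag (1 : Matrix (Fin n) (Fin n) k) = 0 := by
  refine Finset.sum_eq_zero fun a _ => Finset.sum_eq_zero fun b _ => ?_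
  split_ifs with h
  · rw [Matrix.one_apply_ne]; rintro rfl; omega
  · rfl

/-- The anti-involution `g ↦ w₀ gᵀ w₀`. -/
def sig (g : GL (Fin n) k) : GL (Fin n) k where
  val := (g.valᵀ).submatrix Fin.rev Fin.rev
  inv := ((g⁻¹).valᵀ).submatrix Fin.rev Fin.rev
  val_inv := by
    change (g.valᵀ).submatrix Fin.revPerm Fin.revPerm * ((g⁻¹).valᵀ).submatrix Fin.revPerm Fin.revPerm = 1
    rw [Matrix.submatrix_mul_equiv, ← Matrix.transpose_mul, ← Units.val_mul]
    simp
  inv_val := by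
    change ((g⁻¹).valᵀ).submatrix Fin.revPerm Fin.revPerm * (g.valᵀ).submatrix Fin.revPerm Fin.revPerm = 1
    rw [Matrix.submatrix_mul_equiv, ← Matrix.transpose_mul, ← Units.val_mul]
    simp

lemma sig_apply (g : GL (Fin n) k) (a b : Fin n) : (sig g).val a b = g.val b.rev a.rev := rfl

lemma sig_sig (g : GL (Fin n) k) : sig (sig g) = g := by
  ext a b; simp [sig_apply]

lemma sig_mul (g h : GL (Fin n) k) : sig (g * h) = sig h * sig g := by
  ext a b
  rw [sig_apply, Units.val_mul, Units.val_mul, Matrix.mul_apply, Matrix.mul_apply]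
  refine Fintype.sum_equiv Fin.revPerm _ _ fun c => ?_
  simp [sig_apply, mul_comm]

lemma sig_one : sig (1 : GL (Fin n) k) = 1 := by
  ext a b
  simp [sig_apply, Matrix.one_apply, eq_comm]

lemma sig_inv (g : GL (Fin n) k) : sig g⁻¹ = (sig g)⁻¹ := by
  rw [eq_inv_iff_mul_eq_one, ← sig_mul, mul_inv_cancel, sig_one]

lemma sig_mem_upperUni {g : GL (Fin n) k} (hg : g ∈ upperUni k n) : sig g ∈ upperUni k n := by
  intro a b hab
  rw [sig_apply, hg _ _ (Fin.rev_le_rev.2 hab)]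
  simp [Matrix.one_apply, eq_comm]

lemma superDiag_sig (g : GL (Fin n) k) : superDiag (sig g).val = superDiag g.val := by
  unfold superDiag
  rw [Finset.sum_comm]
  refine Fintype.sum_equiv Fin.revPerm _ _ fun a => Fintype.sum_equiv Fin.revPerm _ _ fun b => ?_
  rw [sig_apply]
  simp only [Fin.revPerm_apply]
  refine if_congr ?_ rfl rfl
  rw [Fin.val_rev, Fin.val_rev]
  omega

end UpperUnipotent

section Bruhat

variable {k : Type} [Field k] {n : ℕ}

/-- The unipotent matrix with entries `z b` to the right of the diagonal in row `t`. -/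
lemma exists_row (t : Fin n) (z : Fin n → k) : ∃ r ∈ upperUni k n,
    ∀ (g : Matrix (Fin n) (Fin n) k) (a b : Fin n),
      (g * r.val) a b = g a b + if t < b then g a t * z b else 0 := by
  refine ⟨sig (colU t.rev fun a => z a.rev), sig_mem_upperUni (colU_mem_upperUni _ _), fun g a b => ?_⟩
  simp only [Matrix.mul_apply, sig_apply, colU_apply, mul_add, Finset.sum_add_distrib]
  congr 1
  · simp [Matrix.one_apply]
  · rw [Finset.sum_eq_single t]
    · simp [Fin.rev_lt_rev]
    · intro c _ hc; simp [hc]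
    · simp

/-- Every invertible matrix becomes monomial after multiplying by upper unitriangular
matrices on both sides. -/
lemma exists_monomial (g : GL (Fin n) k) : ∃ u ∈ upperUni k n, ∃ w ∈ upperUni k n,
    ∃ v : Fin n → Fin n, Function.Bijective v ∧
      ∀ a b, (u * g * w).val a b ≠ 0 ↔ a = v b := by
  have main : ∀ t : ℕ, t ≤ n → ∃ u ∈ upperUni k n, ∃ w ∈ upperUni k n, ∀ b : Fin n, (b : ℕ) < t →
      ∃ a, (u * g * w).val a b ≠ 0 ∧ (∀ a', a' ≠ a → (u * g * w).val a' b = 0) ∧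
        ∀ b', b' ≠ b → (u * g * w).val a b' = 0 := by
    intro t
    induction t with
    | zero => exact fun _ => ⟨1, one_mem _, 1, one_mem _, fun b hb => absurd hb (Nat.not_lt_zero _)⟩
    | succ t ih =>
      intro ht
      obtain ⟨u, hu, w, hw, h⟩ := ih (by omega)
      set M := u * g * w with hM
      set s : Fin n := ⟨t, by omega⟩ with hs
      obtain ⟨a0, ha0⟩ : ∃ a, M.val a s ≠ 0 := by
        by_contra! h0
        have h1 : ((M⁻¹).val * M.val) s s = 1 := by
          rw [← Units.val_mul, inv_mul_cancel]; simp
        rw [Matrix.mul_apply, Finset.sum_eq_zero] at h1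
        · exact zero_ne_one h1
        · intro c _; rw [h0, mul_zero]
      obtain ⟨i, hi, himax⟩ : ∃ i, M.val i s ≠ 0 ∧ ∀ j, i < j → M.val j s = 0 := by
        classical
        obtain ⟨i, hi, hmax⟩ := Finset.exists_max_image
          (Finset.univ.filter fun a => M.val a s ≠ 0) id ⟨a0, by simpa using ha0⟩
        refine ⟨i, by simpa using hi, fun j hj => ?_⟩
        by_contra hne
        exact absurd (hmax j (by simpa using hne)) (not_le.2 hj)
      obtain ⟨r, hr, hrow⟩ := exists_row s (fun b => - (M.val i b / M.val i s))
      set c := colU i (fun a => - (M.val a s / M.val i s)) with hc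
      refine ⟨c * u, mul_mem (colU_mem_upperUni _ _) hu, w * r, mul_mem hw hr, ?_⟩
      have hM' : c * u * g * (w * r) = c * M * r := by rw [hM]; group
      have hent : ∀ a b, (c * u * g * (w * r)).val a b =
          (M.val a b + if a < i then -(M.val a s / M.val i s) * M.val i b else 0) +
            if s < b then (M.val a s + if a < i then -(M.val a s / M.val i s) * M.val i s else 0) *
              -(M.val i b / M.val i s) else 0 := by
        intro a b
        rw [hM', Units.val_mul, hrow, Units.val_mul, hc, colU_mul_apply, colU_mul_apply]
      have hcol : ∀ a, (M.val a s + if a < i then -(M.val a s / M.val i s) * M.val i s else 0) =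
          if a = i then M.val i s else 0 := by
        intro a
        rcases lt_trichotomy a i with h1 | h1 | h1
        · rw [if_pos h1, if_neg h1.ne]; field_simp; ring
        · subst h1; simp
        · rw [if_neg (not_lt.2 h1.le), if_neg h1.ne', himax a h1, add_zero]
      have hent2 : ∀ a b, (c * u * g * (w * r)).val a b =
          (M.val a b + if a < i then -(M.val a s / M.val i s) * M.val i b else 0) +
            if s < b then (if a = i then - M.val i b else 0) else 0 := by
        intro a b
        rw [hent, hcol]
        congr 2
        by_cases h1 : a = i
        · simp only [h1, if_true]; field_simp
        · simp [h1]
      have hlow : ∀ b : Fin n, (b : ℕ) < t → M.val i b = 0 := by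
        intro b hb
        obtain ⟨a, h1, h2, h3⟩ := h b hb
        refine h2 i ?_
        rintro rfl
        exact hi (h3 s (by rintro rfl; simp [hs] at hb))
      intro b hb
      rcases Nat.lt_succ_iff_lt_or_eq.1 hb with hb | hb
      · obtain ⟨a, h1, h2, h3⟩ := h b hb
        have hsb : ¬ s < b := by
          intro h4; have : t < (b : ℕ) := h4; omega
        have hbs : s ≠ b := by rintro rfl; simp [hs] at hb
        have hai : a ≠ i := by rintro rfl; exact h1 (hlow b hb)
        refine ⟨a, ?_, fun a' ha' => ?_, fun b' hb' => ?_⟩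
        · rw [hent2, if_neg hsb, hlow b hb]; simpa using h1
        · rw [hent2, if_neg hsb, hlow b hb, h2 a' ha']; simp
        · rw [hent2, h3 b' hb', if_neg hai, h3 s hbs]; simp
      · have hbs : b = s := Fin.ext hb
        subst hbs
        refine ⟨i, ?_, fun a' ha' => ?_, fun b' hb' => ?_⟩
        · rw [hent2]; simpa using hi
        · rw [hent2, hcol]; simp [ha']
        · rw [hent2]
          rcases lt_or_gt_of_ne hb' with h4 | h4
          · rw [hlow b' h4]; simp
          · simp [h4]
  obtain ⟨u, hu, w, hw, h⟩ := main n le_rfl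
  choose v hv using fun b : Fin n => h b b.2
  have hiff : ∀ a b, (u * g * w).val a b ≠ 0 ↔ a = v b := by
    intro a b
    constructor
    · intro hne
      by_contra hab
      exact hne ((hv b).2.1 a hab)
    · rintro rfl; exact (hv b).1
  refine ⟨u, hu, w, hw, v, ?_, hiff⟩
  rw [← Finite.injective_iff_bijective]
  intro b b' hbb
  by_contra hne
  have := (hv b).2.2 b' (Ne.symm hne)
  rw [hbb] at this
  exact (hv b').1 this

/-- The combinatorial core of the uniqueness of Whittaker models. -/
lemma involutive_of_descents {T : Type} (u : ℕ → ℕ) (t : ℕ → T) (hu : ∀ a, a < n → u a < n)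
    (hinj : ∀ a < n, ∀ b < n, u a = u b → a = b)
    (hsurj : ∀ c < n, ∃ a < n, u a = c)
    (h : ∀ a b, a < b → b < n → u b < u a → (b = a + 1 ↔ u a = u b + 1) ∧ (b = a + 1 → t a = t b)) :
    ∀ a < n, u (u a) = a ∧ t (u a) = t a := by
  have main : ∀ d i, n - i = d → i ≤ n → (∀ a < i, u a < i) → ∀ a, i ≤ a → a < n →
      u (u a) = a ∧ t (u a) = t a := by
    intro d
    induction d using Nat.strong_induction_on with
    | _ d ih =>
    intro i hd hin hpre a hia han
    have hige : ∀ c, i ≤ c → c < n → i ≤ u c := by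
      intro c hc hcn
      by_contra hlt
      push Not at hlt
      -- the first `i` values are already taken
      have hsub : (Finset.range i).image u = Finset.range i := by
        apply Finset.eq_of_subset_of_card_le
        · intro x hx
          simp only [Finset.mem_image, Finset.mem_range] at hx ⊢
          obtain ⟨y, hy, rfl⟩ := hx; exact hpre y hy
        · rw [Finset.card_image_of_injOn]
          intro x hx y hy hxy
          simp only [Finset.coe_range, Set.mem_Iio] at hx hy
          exact hinj x (by omega) y (by omega) hxy
      have : u c ∈ (Finset.range i).image u := by rw [hsub]; simpa using hlt
      simp only [Finset.mem_image, Finset.mem_range] at this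
      obtain ⟨y, hy, hyc⟩ := this
      have := hinj y (by omega) c hcn hyc
      omega
    have hci := hige i le_rfl (by omega)
    have hcn := hu i (by omega)
    set c := u i with hc
    have hrun : ∀ d, i + d ≤ c → ∀ e ≤ d, u (i + e) = c - e ∧ t (i + e) = t i := by
      intro d
      induction d with
      | zero =>
        intro _ e he
        obtain rfl : e = 0 := by omega
        exact ⟨hc.symm, rfl⟩
      | succ d ihd =>
        intro hd e he
        have ihd := ihd (by omega)
        rcases Nat.lt_or_ge e (d + 1) with he' | he'
        · exact ihd e (by omega)
        obtain rfl : e = d + 1 := by omega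
        obtain ⟨hd1, hd2⟩ := ihd d le_rfl
        obtain ⟨b, hb, hbv⟩ := hsurj (c - d - 1) (by omega)
        have hbi : i ≤ b := by
          by_contra hlt
          have := hpre b (by omega)
          omega
        have hbd : i + d < b := by
          by_contra hle
          obtain ⟨e, rfl⟩ := Nat.exists_eq_add_of_le hbi
          have := (ihd e (by omega)).1
          omega
        obtain ⟨h1, h2⟩ := h (i + d) b hbd hb (by omega)
        have hb1 : b = i + d + 1 := h1.2 (by omega)
        rw [← add_assoc, ← hb1]
        exact ⟨by omega, by rw [← h2 hb1, hd2]⟩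
    have hrun' : ∀ e, i + e ≤ c → u (i + e) = c - e ∧ t (i + e) = t i :=
      fun e he => hrun e he e le_rfl
    rcases Nat.lt_or_ge c a with hac | hac
    · refine ih (n - (c + 1)) (by omega) (c + 1) rfl (by omega) ?_ a (by omega) han
      intro b hb
      rcases Nat.lt_or_ge b i with hbi | hbi
      · have := hpre b hbi; omega
      · obtain ⟨e, rfl⟩ := Nat.exists_eq_add_of_le hbi
        have := (hrun' e (by omega)).1
        omega
    · obtain ⟨e, rfl⟩ := Nat.exists_eq_add_of_le hia
      obtain ⟨h1, h2⟩ := hrun' e hac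
      obtain ⟨h3, h4⟩ := hrun' (c - e - i) (by omega)
      have h5 : i + (c - e - i) = c - e := by omega
      rw [h5] at h3 h4
      rw [h1, h3, h4, h2]
      exact ⟨by omega, rfl⟩
  intro a ha
  exact main n 0 (by omega) (by omega) (fun a ha => absurd ha (Nat.not_lt_zero _)) a (Nat.zero_le _) ha

end Bruhat

section Whittaker

variable {k : Type} [Field k] [Fintype k] {n : ℕ} {R : Type} [Field R]
  {V : Type} [AddCommGroup V] [Module R V]

lemma exists_addChar_ne_one [IsAlgClosed R] (hq : (Fintype.card k : R) ≠ 0) :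
    ∃ ψ : AddChar k R, ψ ≠ 1 := by
  classical
  have hexp : ((Monoid.exponent (Multiplicative k) : ℕ) : R) ≠ 0 := by
    intro h
    obtain ⟨c, hc⟩ := Group.exponent_dvd_card (G := Multiplicative k)
    refine hq ?_
    rw [← Fintype.card_multiplicative k, hc, Nat.cast_mul, h, zero_mul]
  have : NeZero ((Monoid.exponent (Multiplicative k) : ℕ) : R) := ⟨hexp⟩
  obtain ⟨φ, hφ⟩ := CommGroup.exists_apply_ne_one_of_hasEnoughRootsOfUnity (Multiplicative k) R
    (a := Multiplicative.ofAdd (1 : k)) (by simp [← ofAdd_zero])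
  refine ⟨⟨fun x => (φ (Multiplicative.ofAdd x) : R), by simp, fun a b => by simp [ofAdd_add]⟩, ?_⟩
  intro h
  apply hφ
  have := DFunLike.congr_fun h (1 : k)
  exact Units.ext this

lemma AddChar.eq_zero_of_forall_mul {ψ : AddChar k R} (hψ : ψ ≠ 1) {s : k}
    (h : ∀ t, ψ (s * t) = 1) : s = 0 := by
  by_contra hs
  apply hψ
  ext t
  have := h (s⁻¹ * t)
  rw [mul_inv_cancel_left₀ hs] at this
  rw [this]; rfl

/-- The eigenspace of a family of operators for the additive character `x ↦ ψ (ξ ⬝ x)`. -/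
def charSpace (A : (Fin n → k) → Module.End R V) (ψ : AddChar k R) (ξ : Fin n → k) :
    Submodule R V where
  carrier := {v | ∀ x, A x v = ψ (ξ ⬝ᵥ x) • v}
  add_mem' := by intro v w hv hw x; rw [map_add, hv x, hw x, smul_add]
  zero_mem' := by intro x; simp
  smul_mem' := by intro c v hv x; rw [map_smul, hv x, smul_comm]

open Classical in
lemma sum_addChar_dotProduct {ψ : AddChar k R} (hψ : ψ ≠ 1) (ξ : Fin n → k) :
    ∑ x : Fin n → k, ψ (ξ ⬝ᵥ x) = if ξ = 0 then (Fintype.card (Fin n → k) : R) else 0 := by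
  classical
  split_ifs with h
  · subst h; simp
  · obtain ⟨a, ha⟩ : ∃ a, ξ a ≠ 0 := by
      by_contra! h0; exact h (funext h0)
    have h1 : ∃ t, ψ (ξ a * t) ≠ 1 := by
      by_contra! h1; exact ha (AddChar.eq_zero_of_forall_mul hψ h1)
    obtain ⟨t, ht⟩ := h1
    have h2 : ψ (ξ a * t) * ∑ x : Fin n → k, ψ (ξ ⬝ᵥ x) = ∑ x : Fin n → k, ψ (ξ ⬝ᵥ x) := by
      rw [Finset.mul_sum]
      refine Fintype.sum_equiv (Equiv.addLeft (Pi.single a t)) _ _ fun x => ?_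
      rw [Equiv.coe_addLeft, dotProduct_add, AddChar.map_add_eq_mul, dotProduct_single]
    have h3 : (ψ (ξ a * t) - 1) * ∑ x : Fin n → k, ψ (ξ ⬝ᵥ x) = 0 := by rw [sub_mul, h2]; ring
    exact (mul_eq_zero.1 h3).resolve_left (sub_ne_zero.2 ht)

/-- The projector onto `charSpace A ψ ξ`. -/
def charProj (A : (Fin n → k) → Module.End R V) (ψ : AddChar k R) (ξ : Fin n → k) :
    Module.End R V :=
  (Fintype.card (Fin n → k) : R)⁻¹ • ∑ x : Fin n → k, ψ (-(ξ ⬝ᵥ x)) • A x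

variable {A : (Fin n → k) → Module.End R V} {ψ : AddChar k R}

lemma charProj_apply (ξ : Fin n → k) (v : V) : charProj A ψ ξ v =
    (Fintype.card (Fin n → k) : R)⁻¹ • ∑ x : Fin n → k, ψ (-(ξ ⬝ᵥ x)) • A x v := by
  simp [charProj, LinearMap.sum_apply]

lemma charProj_mem (hA : ∀ x y, A (x + y) = A x * A y) (ξ : Fin n → k) (v : V) :
    charProj A ψ ξ v ∈ charSpace A ψ ξ := by
  intro y
  rw [charProj_apply, map_smul, map_sum, smul_comm]
  congr 1
  rw [Finset.smul_sum]
  refine Fintype.sum_equiv (Equiv.addLeft y) _ _ fun x => ?_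
  rw [Equiv.coe_addLeft, map_smul, smul_smul, hA, dotProduct_add, neg_add, AddChar.map_add_eq_mul,
    ← mul_assoc, ← AddChar.map_add_eq_mul, add_neg_cancel, AddChar.map_zero_eq_one, one_mul]
  rfl

open Classical in
lemma charProj_apply_of_mem (hψ : ψ ≠ 1) (hq : (Fintype.card k : R) ≠ 0) {ξ η : Fin n → k} {v : V}
    (hv : v ∈ charSpace A ψ ξ) : charProj A ψ η v = if ξ = η then v else 0 := by
  rw [charProj_apply]
  have hc : (Fintype.card (Fin n → k) : R) ≠ 0 := by
    rw [Fintype.card_fun, Nat.cast_pow]; exact pow_ne_zero _ hq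
  have h : ∀ x, ψ (-(η ⬝ᵥ x)) • A x v = ψ ((ξ - η) ⬝ᵥ x) • v := by
    intro x
    rw [hv x, smul_smul, ← AddChar.map_add_eq_mul, sub_dotProduct, add_comm, sub_eq_add_neg]
  rw [Finset.sum_congr rfl fun x _ => h x, ← Finset.sum_smul, sum_addChar_dotProduct hψ]
  simp only [sub_eq_zero]
  split_ifs with h
  · rw [smul_smul, inv_mul_cancel₀ hc, one_smul]
  · simp

lemma sum_charProj (hψ : ψ ≠ 1) (hq : (Fintype.card k : R) ≠ 0) (h0 : A 0 = 1) (v : V) :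
    ∑ ξ : Fin n → k, charProj A ψ ξ v = v := by
  classical
  have hc : (Fintype.card (Fin n → k) : R) ≠ 0 := by
    rw [Fintype.card_fun, Nat.cast_pow]; exact pow_ne_zero _ hq
  simp only [charProj_apply, ← Finset.smul_sum]
  rw [Finset.sum_comm]
  have h : ∀ x : Fin n → k, ∑ ξ : Fin n → k, ψ (-(ξ ⬝ᵥ x)) • A x v =
      if x = 0 then (Fintype.card (Fin n → k) : R) • v else 0 := by
    intro x
    rw [← Finset.sum_smul]
    have : ∀ ξ : Fin n → k, ψ (-(ξ ⬝ᵥ x)) = ψ ((-x) ⬝ᵥ ξ) := fun ξ => by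
      rw [neg_dotProduct, dotProduct_comm]
    rw [Finset.sum_congr rfl fun ξ _ => this ξ, sum_addChar_dotProduct hψ]
    simp only [neg_eq_zero]
    split_ifs with h
    · rw [h, h0]; rfl
    · rw [zero_smul]
  rw [Finset.sum_congr rfl fun x _ => h x]
  rw [Finset.sum_ite_eq' Finset.univ, if_pos (Finset.mem_univ _), smul_smul, inv_mul_cancel₀ hc, one_smul]

lemma charProj_mem_of_stable {S : Submodule R V} (hS : ∀ x, ∀ v ∈ S, A x v ∈ S) (ξ : Fin n → k)
    {v : V} (hv : v ∈ S) : charProj A ψ ξ v ∈ S := by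
  rw [charProj_apply]
  exact S.smul_mem _ (S.sum_mem fun x _ => S.smul_mem _ (hS x v hv))

lemma finrank_eq_sum_charSpace [Module.Finite R V] (hψ : ψ ≠ 1) (hq : (Fintype.card k : R) ≠ 0)
    (h0 : A 0 = 1) (hA : ∀ x y, A (x + y) = A x * A y) (S : Submodule R V)
    (hS : ∀ x, ∀ v ∈ S, A x v ∈ S) :
    Module.finrank R S = ∑ ξ : Fin n → k, Module.finrank R ↥(S ⊓ charSpace A ψ ξ) := by
  classical
  let e : S ≃ₗ[R] ((ξ : Fin n → k) → ↥(S ⊓ charSpace A ψ ξ)) :=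
    { toFun := fun v ξ => ⟨charProj A ψ ξ v.1, charProj_mem_of_stable hS ξ v.2, charProj_mem hA ξ _⟩
      map_add' := fun v w => by ext ξ; simp
      map_smul' := fun c v => by ext ξ; simp
      invFun := fun f => ⟨∑ ξ, (f ξ).1, S.sum_mem fun ξ _ => (f ξ).2.1⟩
      left_inv := fun v => Subtype.ext (sum_charProj hψ hq h0 v.1)
      right_inv := fun f => by
        ext η
        simp only [map_sum]
        rw [Finset.sum_congr rfl fun ξ _ => charProj_apply_of_mem hψ hq (η := η) (f ξ).2.2]
        simp }
  rw [e.finrank_eq, Module.finrank_pi_fintype]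

/-- Vectors on which the columns `i ≥ max m 1` of the upper unitriangular group act through the
generic character. -/
def whSpace (ρ : Representation R (GL (Fin n) k) V) (ψ : AddChar k R) (m : ℕ) :
    Submodule R V where
  carrier := {v | ∀ i j : Fin n, m ≤ (i : ℕ) → (j : ℕ) + 1 = i → ∀ x, ρ (colU i x) v = ψ (x j) • v}
  add_mem' := by
    intro v w hv hw i j hi hj x
    rw [map_add, hv i j hi hj x, hw i j hi hj x, smul_add]
  zero_mem' := by intro i j hi hj x; simp
  smul_mem' := by
    intro c v hv i j hi hj x
    rw [map_smul, hv i j hi hj x, smul_comm]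

variable {ρ : Representation R (GL (Fin n) k) V} {ψ : AddChar k R}

lemma whSpace_of_le {m : ℕ} (hm : n ≤ m) : whSpace ρ ψ m = ⊤ := by
  rw [eq_top_iff]
  intro v _ i j hi
  have := i.2
  omega

lemma mem_whSpace_one {v : V} : v ∈ whSpace ρ ψ 1 ↔
    ∀ u ∈ upperUni k n, ρ u v = ψ (superDiag u.val) • v := by
  have hcol : ∀ (i j : Fin n) (x : Fin n → k), (j : ℕ) + 1 = i →
      superDiag (colU i x).val = x j := by
    intro i j x hij
    unfold superDiag
    rw [Finset.sum_eq_single j, Finset.sum_eq_single i, if_pos hij.symm, colU_apply,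
      if_pos ⟨rfl, show (j : ℕ) < i by omega⟩, Matrix.one_apply_ne, zero_add]
    · rintro rfl; omega
    · intro b _ hb
      rw [if_neg]; intro h; exact hb (Fin.ext (by omega))
    · simp
    · intro a _ ha
      refine Finset.sum_eq_zero fun b _ => ?_
      split_ifs with h
      · rw [colU_apply, Matrix.one_apply_ne, if_neg, add_zero]
        · rintro ⟨rfl, h1⟩; exact ha (Fin.ext (by omega))
        · rintro rfl; omega
      · rfl
    · simp
  constructor
  · intro hv u hu
    have := upperUni_le_closure_colU hu
    induction this using Subgroup.closure_induction'' with
    | mem g hg =>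
      obtain ⟨-, t, x, rfl⟩ := hg
      by_cases ht : (t : ℕ) = 0
      · have h1 : colU t x = 1 := by
          ext a b
          rw [colU_apply, if_neg, add_zero]; rfl
          rintro ⟨-, h⟩
          have : (a : ℕ) < t := h
          omega
        rw [h1]; simp [superDiag_one]
      · rw [hcol t ⟨t - 1, by omega⟩ x (by simp; omega),
          hv t ⟨t - 1, by omega⟩ (by omega) (by simp; omega) x]
    | inv_mem g hg =>
      obtain ⟨-, t, x, rfl⟩ := hg
      have hinv : (colU t x)⁻¹ = colU t (-x) := by
        rw [inv_eq_iff_mul_eq_one, ← colU_add, add_neg_cancel, colU_zero]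
      rw [hinv]
      by_cases ht : (t : ℕ) = 0
      · have h1 : colU t (-x) = 1 := by
          ext a b
          rw [colU_apply, if_neg, add_zero]; rfl
          rintro ⟨-, h⟩
          have : (a : ℕ) < t := h
          omega
        rw [h1]; simp [superDiag_one]
      · rw [hcol t ⟨t - 1, by omega⟩ (-x) (by simp; omega),
          hv t ⟨t - 1, by omega⟩ (by omega) (by simp; omega) (-x)]
    | one => simp [superDiag_one]
    | mul g h hg hh ihg ihh =>
      have hle : Subgroup.closure {g | g ∈ upperUni k n ∧ ∃ t x, g = colU t x} ≤ upperUni k n := by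
        rw [Subgroup.closure_le]; exact fun g hg => hg.1
      rw [map_mul, Module.End.mul_apply, ihh (hle hh), map_smul, ihg (hle hg),
        superDiag_mul (hle hg) (hle hh), AddChar.map_add_eq_mul, smul_smul, mul_comm]
  · intro h i j hi hj x
    rw [h _ (colU_mem_upperUni i x), hcol i j x hj]

/-- `g` is block diagonal with blocks of size `m` and `n - m`, the second one being `1`. -/
def IsCornerBlock (m : ℕ) (g : GL (Fin n) k) : Prop :=
  ∀ a b : Fin n, m ≤ (a : ℕ) ∨ m ≤ (b : ℕ) → g.val a b = (1 : Matrix (Fin n) (Fin n) k) a b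

lemma IsCornerBlock.mul_colU {m : ℕ} {g : GL (Fin n) k} (hg : ∀ a b : Fin n, m ≤ (a : ℕ) →
    g.val a b = (1 : Matrix (Fin n) (Fin n) k) a b) {i : Fin n} (hi : m ≤ (i : ℕ)) (x : Fin n → k) :
    g * colU i x = colU i (fun a => ∑ c, if c < i then g.val a c * x c else 0) * g := by
  ext a b
  rw [Units.val_mul, Units.val_mul, mul_colU_apply, colU_mul_apply, hg i b hi]
  congr 1
  by_cases hb : b = i
  · subst hb
    rw [if_pos rfl, Matrix.one_apply_eq, mul_one]
    split_ifs with hab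
    · rfl
    · refine Finset.sum_eq_zero fun c _ => ?_
      have hab' : (b : ℕ) ≤ a := not_lt.1 hab
      split_ifs with hc
      · rw [hg a c (by omega), Matrix.one_apply_ne, zero_mul]
        rintro rfl; exact hab hc
      · rfl
  · rw [if_neg hb, Matrix.one_apply_ne (Ne.symm hb)]; simp

lemma sum_corner {m : ℕ} {g : GL (Fin n) k} (hg : ∀ a b : Fin n, m ≤ (a : ℕ) →
    g.val a b = (1 : Matrix (Fin n) (Fin n) k) a b) {i j : Fin n} (hi : m ≤ (j : ℕ)) (hji : j < i)
    (x : Fin n → k) : (∑ c, if c < i then g.val j c * x c else 0) = x j := by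
  rw [Finset.sum_eq_single j, if_pos hji, hg j j hi]
  · simp
  · intro c _ hc
    rw [hg j c hi, Matrix.one_apply_ne (Ne.symm hc)]; simp
  · simp

lemma whSpace_stable {m : ℕ} {g : GL (Fin n) k} (hg : ∀ a b : Fin n, m ≤ (a : ℕ) →
    g.val a b = (1 : Matrix (Fin n) (Fin n) k) a b) {v : V}
    (hv : v ∈ whSpace ρ ψ (m + 1)) : ρ g v ∈ whSpace ρ ψ (m + 1) := by
  have hg' : ∀ a b : Fin n, m ≤ (a : ℕ) →
      (g⁻¹).val a b = (1 : Matrix (Fin n) (Fin n) k) a b := by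
    intro a b ha
    have h1 : (g.val * (g⁻¹).val) a b = (1 : Matrix (Fin n) (Fin n) k) a b := by
      rw [← Units.val_mul, mul_inv_cancel]; rfl
    rw [← h1, Matrix.mul_apply, Finset.sum_eq_single a, hg a a ha]
    · simp
    · intro c _ hc; rw [hg a c ha, Matrix.one_apply_ne (Ne.symm hc), zero_mul]
    · simp
  intro i j hi hj x
  have h1 := IsCornerBlock.mul_colU hg' (i := i) (by omega) x
  have h2 : colU i x * g = g * colU i (fun a => ∑ c, if c < i then (g⁻¹).val a c * x c else 0) := by
    rw [← mul_right_inj g⁻¹, ← mul_assoc, h1]; group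
  rw [← Module.End.mul_apply, ← map_mul, h2, map_mul, Module.End.mul_apply, hv i j hi hj _,
    sum_corner hg' (by omega) (show (j : ℕ) < i by omega), map_smul]

lemma IsCornerBlock.inv {m : ℕ} {g : GL (Fin n) k} (hg : IsCornerBlock m g) : IsCornerBlock m g⁻¹ := by
  intro a b hab
  rcases hab with ha | hb
  · have h1 : (g.val * (g⁻¹).val) a b = (1 : Matrix (Fin n) (Fin n) k) a b := by
      rw [← Units.val_mul, mul_inv_cancel]; rfl
    rw [← h1, Matrix.mul_apply, Finset.sum_eq_single a, hg a a (Or.inl ha)]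
    · simp
    · intro c _ hc; rw [hg a c (Or.inl ha), Matrix.one_apply_ne (Ne.symm hc), zero_mul]
    · simp
  · have h1 : ((g⁻¹).val * g.val) a b = (1 : Matrix (Fin n) (Fin n) k) a b := by
      rw [← Units.val_mul, inv_mul_cancel]; rfl
    rw [← h1, Matrix.mul_apply, Finset.sum_eq_single b, hg b b (Or.inr hb)]
    · simp
    · intro c _ hc; rw [hg c b (Or.inr hb), Matrix.one_apply_ne hc, mul_zero]
    · simp

/-- The operators of the `i`-th column. -/
def colOp (ρ : Representation R (GL (Fin n) k) V) (i : Fin n) (x : Fin n → k) : Module.End R V :=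
  ρ (colU i x)

lemma colOp_zero (i : Fin n) : colOp ρ i 0 = 1 := by rw [colOp, colU_zero, map_one]

lemma colOp_add (i : Fin n) (x y : Fin n → k) : colOp ρ i (x + y) = colOp ρ i x * colOp ρ i y := by
  rw [colOp, colU_add, map_mul]; rfl

lemma colOp_stable (i : Fin n) (x : Fin n → k) (v : V) (hv : v ∈ whSpace ρ ψ ((i : ℕ) + 1)) :
    colOp ρ i x v ∈ whSpace ρ ψ ((i : ℕ) + 1) := by
  refine whSpace_stable (fun a b ha => ?_) hv
  rw [colU_apply, if_neg, add_zero]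
  rintro ⟨-, h⟩
  have : (a : ℕ) < i := h
  omega

lemma support_of_charSpace_ne_bot (hψ : ψ ≠ 1) {i : Fin n} {ξ : Fin n → k} {v : V} (hv0 : v ≠ 0)
    (hv : v ∈ charSpace (colOp ρ i) ψ ξ) (a : Fin n) (ha : i ≤ a) : ξ a = 0 := by
  classical
  refine AddChar.eq_zero_of_forall_mul hψ fun t => ?_
  have h1 := hv (Pi.single a t)
  have h2 : colU i (Pi.single a t) = 1 := by
    ext b c
    rw [colU_apply]
    split_ifs with h
    · rw [Pi.single_eq_of_ne (h.2.trans_le ha).ne]; simp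
    · simp
  rw [colOp, h2, map_one, dotProduct_single] at h1
  have h3 : (ψ (ξ a * t) - 1) • v = 0 := by rw [sub_smul, ← h1]; simp
  exact sub_eq_zero.1 ((smul_eq_zero.1 h3).resolve_right hv0)

lemma IsCuspidal.charSpace_zero (hcusp : IsCuspidal ρ) (p : ℕ) [Fact p.Prime] [CharP k p]
    (hR : (p : R) ≠ 0) {i : Fin n} (hi : 0 < (i : ℕ)) {v : V} (hv : v ∈ whSpace ρ ψ ((i : ℕ) + 1))
    (hv0 : v ∈ charSpace (colOp ρ i) ψ 0) : v = 0 := by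
  refine hcusp.eq_zero_of_fixed p hR hi i.2 fun u hu => ?_
  have := uniRad_le_closure_colU _ hu
  have hgen : ∀ g ∈ {g | g ∈ uniRad k n (i : ℕ) ∧ ∃ t x, g = colU t x}, ρ g v = v := by
    rintro g ⟨hg, t, x, rfl⟩
    rcases lt_trichotomy (t : ℕ) i with h | h | h
    · have h1 : colU t x = 1 := by
        ext a b
        have h2 := hg a b
        by_cases hb : b = t
        · rw [h2 (by subst hb; omega)]; rfl
        · rw [colU_apply, if_neg (fun h => hb h.1), add_zero]; rfl
      rw [h1]; simp
    · obtain rfl : t = i := Fin.ext h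
      have := hv0 x
      simpa [colOp] using this
    · have hj : (t : ℕ) - 1 < n := by omega
      rw [hv t ⟨t - 1, hj⟩ (by omega) (by simp; omega)]
      have h2 := hg ⟨t - 1, hj⟩ t (by simp; omega)
      rw [colU_apply, if_pos ⟨rfl, show (t : ℕ) - 1 < t by omega⟩] at h2
      rw [add_eq_left.1 h2]; simp
  induction this using Subgroup.closure_induction'' with
  | mem g hg => exact hgen g hg
  | inv_mem g hg =>
    have := congrArg (ρ g⁻¹) (hgen g hg)
    rw [← Module.End.mul_apply, ← map_mul, inv_mul_cancel] at this
    simpa using this.symm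
  | one => simp
  | mul g h hg hh ihg ihh =>
    have hle : Subgroup.closure {g | g ∈ uniRad k n (i : ℕ) ∧ ∃ t x, g = colU t x} ≤
        uniRad k n (i : ℕ) := by
      rw [Subgroup.closure_le]; exact fun g hg => hg.1
    rw [map_mul, Module.End.mul_apply, ihh (hle hh), ihg (hle hg)]

lemma charSpace_of_single {i j : Fin n} (hj : (j : ℕ) + 1 = i) {v : V} :
    v ∈ whSpace ρ ψ (i : ℕ) ↔
      v ∈ whSpace ρ ψ ((i : ℕ) + 1) ∧ v ∈ charSpace (colOp ρ i) ψ (Pi.single j 1) := by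
  constructor
  · intro h
    refine ⟨fun a b ha => h a b (by omega), fun x => ?_⟩
    rw [single_dotProduct, one_mul]
    exact h i j le_rfl hj x
  · rintro ⟨h1, h2⟩ a b ha hab x
    rcases ha.lt_or_eq with ha | ha
    · exact h1 a b ha hab x
    · obtain rfl : i = a := Fin.ext ha
      obtain rfl : j = b := Fin.ext (by omega)
      have := h2 x
      rwa [single_dotProduct, one_mul] at this

/-- A covector is moved to a coordinate covector by a corner matrix, which can be chosen in the
parity subgroup when the covector is supported on indices of the right parity. -/
lemma exists_corner_row {i j : Fin n} (hj : (j : ℕ) + 1 = i) {ξ : Fin n → k} (hξ : ξ ≠ 0)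
    (hsupp : ∀ a, i ≤ a → ξ a = 0) : ∃ g : GL (Fin n) k, IsCornerBlock (i : ℕ) g ∧
      (∀ b, g.val j b = ξ b) ∧
      ((∀ a : Fin n, (a : ℕ) % 2 ≠ (j : ℕ) % 2 → ξ a = 0) →
        ∀ a b : Fin n, (a : ℕ) % 2 ≠ (b : ℕ) % 2 → g.val a b = 0) := by
  classical
  obtain ⟨c, hc⟩ : ∃ a, ξ a ≠ 0 := by
    by_contra! h0; exact hξ (funext h0)
  have hci : c < i := by
    by_contra h; exact hc (hsupp c (not_lt.1 h))
  have hci' : (c : ℕ) < i := hci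
  set N : Matrix (Fin n) (Fin n) k := (Matrix.updateRow 1 c ξ).submatrix (Equiv.swap c j) id with hN
  have hdet : N.det ≠ 0 := by
    rw [hN, Matrix.det_permute]
    have h1 : (Matrix.updateRow (1 : Matrix (Fin n) (Fin n) k) c ξ).det = ξ c := by
      have h2 := Matrix.cramer_transpose_apply (1 : Matrix (Fin n) (Fin n) k) ξ c
      rw [← h2]; simp
    rw [h1]
    refine mul_ne_zero ?_ hc
    rcases Int.units_eq_one_or (Equiv.Perm.sign (Equiv.swap c j)) with h | h <;> simp [h]
  have hval : ∀ a b, N a b = if a = j then ξ b else if a = c then (if j = b then 1 else 0) else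
      if a = b then 1 else 0 := by
    intro a b
    rw [hN, Matrix.submatrix_apply, id, Matrix.updateRow_apply]
    by_cases haj : a = j
    · subst haj; simp
    · by_cases hac : a = c
      · subst hac; simp [haj, Ne.symm haj, Matrix.one_apply]
      · rw [Equiv.swap_apply_of_ne_of_ne hac haj]; simp [haj, hac, Matrix.one_apply]
  refine ⟨Matrix.GeneralLinearGroup.mkOfDetNeZero N hdet, ?_, ?_, ?_⟩
  · intro a b hab
    change N a b = _
    rw [hval, Matrix.one_apply]
    rcases hab with h | h
    · rw [if_neg (by rintro rfl; omega), if_neg (by rintro rfl; omega)]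
    · split_ifs <;> first | rfl | exact hsupp b h | (subst_vars; omega)
  · intro b
    change N j b = _
    rw [hval, if_pos rfl]
  · intro hpar a b hab
    change N a b = 0
    have hcp : (c : ℕ) % 2 = (j : ℕ) % 2 := by
      by_contra h; exact hc (hpar c h)
    rw [hval]
    split_ifs with h1 h2 h3 h4
    · subst h1; exact hpar b (Ne.symm hab)
    · subst h2 h3; omega
    · rfl
    · subst h4; omega
    · rfl

lemma charSpace_corner {i j : Fin n} {ξ : Fin n → k} (hj : (j : ℕ) + 1 = i)
    (hsupp : ∀ a, i ≤ a → ξ a = 0) {g : GL (Fin n) k}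
    (hg : IsCornerBlock (i : ℕ) g) (hrow : ∀ b, g.val j b = ξ b) (v : V) :
    v ∈ whSpace ρ ψ ((i : ℕ) + 1) ⊓ charSpace (colOp ρ i) ψ ξ ↔ ρ g v ∈ whSpace ρ ψ (i : ℕ) := by
  rw [charSpace_of_single hj, Submodule.mem_inf]
  have hginv : ∀ w, ρ g⁻¹ (ρ g w) = w := fun w => by
    rw [← Module.End.mul_apply, ← map_mul, inv_mul_cancel]; simp
  have hdot : ∀ x : Fin n → k, (∑ c, if c < i then g.val j c * x c else 0) = ξ ⬝ᵥ x := by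
    intro x
    refine Finset.sum_congr rfl fun c _ => ?_
    split_ifs with h
    · rw [hrow]
    · rw [hsupp c (not_lt.1 h), zero_mul]
  refine and_congr ⟨fun h => whSpace_stable (fun a b ha => hg a b (Or.inl ha)) h, fun h => ?_⟩ ?_
  · rw [← hginv v]
    exact whSpace_stable (fun a b ha => hg.inv a b (Or.inl ha)) h
  · constructor
    · intro h x
      have h1 := IsCornerBlock.mul_colU (fun a b ha => hg.inv a b (Or.inl ha)) (i := i) le_rfl x
      set y : Fin n → k := fun a => ∑ c, if c < i then (g⁻¹).val a c * x c else 0 with hy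
      have h2 : colU i x * g = g * colU i y := by
        rw [← mul_right_inj g⁻¹, ← mul_assoc, h1]; group
      have h3 := IsCornerBlock.mul_colU (fun a b ha => hg a b (Or.inl ha)) (i := i) le_rfl y
      have h4 : colU i x = colU i (fun a => ∑ c, if c < i then g.val a c * y c else 0) := by
        rw [← mul_left_inj g, h2, h3]
      have h5 : x j = ξ ⬝ᵥ y := by
        have := congrArg (fun u : GL (Fin n) k => u.val j i) h4
        simp only [colU_apply, show j < i from show (j : ℕ) < i by omega, and_self, if_true,
          hdot] at this
        exact add_left_cancel this
      rw [single_dotProduct, one_mul, h5, colOp, ← Module.End.mul_apply, ← map_mul, h2, map_mul,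
        Module.End.mul_apply, ← colOp, h y, map_smul]
    · intro h x
      have h3 := IsCornerBlock.mul_colU (fun a b ha => hg a b (Or.inl ha)) (i := i) le_rfl x
      have h6 := h (fun a => ∑ c, if c < i then g.val a c * x c else 0)
      rw [single_dotProduct, one_mul, hdot, colOp, ← Module.End.mul_apply, ← map_mul, ← h3, map_mul,
        Module.End.mul_apply, ← map_smul] at h6
      have := congrArg (ρ g⁻¹) h6
      rwa [hginv, hginv] at this

/-- The number of nonzero covectors supported on the first `m` coordinates. -/
noncomputable def numCovectors (k : Type) [Field k] [Fintype k] (n m : ℕ) : ℕ :=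
  Nat.card {ξ : Fin n → k // ξ ≠ 0 ∧ ∀ a : Fin n, m ≤ (a : ℕ) → ξ a = 0}

lemma IsCuspidal.finrank_whSpace_succ [Module.Finite R V] (hcusp : IsCuspidal ρ) (p : ℕ)
    [Fact p.Prime] [CharP k p] (hR : (p : R) ≠ 0) (hψ : ψ ≠ 1) (hq : (Fintype.card k : R) ≠ 0)
    {i : Fin n} (hi : 0 < (i : ℕ)) :
    Module.finrank R ↥(whSpace ρ ψ ((i : ℕ) + 1)) =
      numCovectors k n i * Module.finrank R ↥(whSpace ρ ψ (i : ℕ)) := by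
  classical
  obtain ⟨j, hj⟩ : ∃ j : Fin n, (j : ℕ) + 1 = i := ⟨⟨i - 1, by omega⟩, by simp; omega⟩
  rw [finrank_eq_sum_charSpace hψ hq (colOp_zero i) (colOp_add i) _ (colOp_stable (ρ := ρ) (ψ := ψ) i)]
  have key : ∀ ξ : Fin n → k, Module.finrank R
      ↥(whSpace ρ ψ ((i : ℕ) + 1) ⊓ charSpace (colOp ρ i) ψ ξ) =
      if ξ ≠ 0 ∧ ∀ a : Fin n, (i : ℕ) ≤ (a : ℕ) → ξ a = 0 then
        Module.finrank R ↥(whSpace ρ ψ (i : ℕ)) else 0 := by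
    intro ξ
    split_ifs with h
    · obtain ⟨g, hg, hrow, -⟩ := exists_corner_row hj h.1 h.2
      have hinv : ∀ w, ρ g (ρ g⁻¹ w) = w := fun w => by
        rw [← Module.End.mul_apply, ← map_mul, mul_inv_cancel]; simp
      have hinv' : ∀ w, ρ g⁻¹ (ρ g w) = w := fun w => by
        rw [← Module.End.mul_apply, ← map_mul, inv_mul_cancel]; simp
      refine LinearEquiv.finrank_eq
        { toFun := fun v => ⟨ρ g v.1, (charSpace_corner hj h.2 hg hrow v.1).1 v.2⟩
          map_add' := fun v w => Subtype.ext (map_add _ _ _)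
          map_smul' := fun c v => Subtype.ext (map_smul _ _ _)
          invFun := fun w => ⟨ρ g⁻¹ w.1, (charSpace_corner hj h.2 hg hrow _).2 (by
            rw [hinv]; exact w.2)⟩
          left_inv := fun v => Subtype.ext (hinv' v.1)
          right_inv := fun w => Subtype.ext (hinv w.1) }
    · rw [show whSpace ρ ψ ((i : ℕ) + 1) ⊓ charSpace (colOp ρ i) ψ ξ = ⊥ from ?_, finrank_bot]
      rw [eq_bot_iff]
      intro v hv
      rw [Submodule.mem_bot]
      by_contra hv0
      have hs := support_of_charSpace_ne_bot hψ hv0 hv.2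
      by_cases hξ : ξ = 0
      · subst hξ
        exact hv0 (hcusp.charSpace_zero p hR hi hv.1 hv.2)
      · exact h ⟨hξ, hs⟩
  rw [Finset.sum_congr rfl fun ξ _ => key ξ, ← Finset.sum_filter, Finset.sum_const, smul_eq_mul,
    numCovectors, Nat.card_eq_fintype_card, Fintype.card_subtype]

/-- The dimension of an irreducible cuspidal representation. -/
noncomputable def cuspidalDim (k : Type) [Field k] [Fintype k] (n : ℕ) : ℕ :=
  ∏ m ∈ Finset.Ico 1 n, numCovectors k n m

lemma IsCuspidal.finrank_eq [Module.Finite R V] (hcusp : IsCuspidal ρ) (p : ℕ)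
    [Fact p.Prime] [CharP k p] (hR : (p : R) ≠ 0) (hψ : ψ ≠ 1) (hq : (Fintype.card k : R) ≠ 0)
    (hn : 1 ≤ n) :
    Module.finrank R V = cuspidalDim k n * Module.finrank R ↥(whSpace ρ ψ 1) := by
  have : ∀ m, 1 ≤ m → m ≤ n → Module.finrank R ↥(whSpace ρ ψ m) =
      (∏ m ∈ Finset.Ico 1 m, numCovectors k n m) * Module.finrank R ↥(whSpace ρ ψ 1) := by
    intro m hm
    induction m, hm using Nat.le_induction with
    | base => simp
    | succ m hm ih =>
      intro hmn
      have h1 := hcusp.finrank_whSpace_succ p hR hψ hq (i := ⟨m, by omega⟩) hm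
      rw [h1, Finset.prod_Ico_succ_top hm, ih (by omega)]
      ring
  rw [cuspidalDim, ← this n hn le_rfl, whSpace_of_le le_rfl, finrank_top]

lemma cuspidalDim_pos (n : ℕ) : 0 < cuspidalDim k n := by
  classical
  refine Finset.prod_pos fun m hm => ?_
  rw [Finset.mem_Ico] at hm
  rw [numCovectors]
  have : Nonempty {ξ : Fin n → k // ξ ≠ 0 ∧ ∀ a : Fin n, m ≤ (a : ℕ) → ξ a = 0} := by
    refine ⟨Pi.single ⟨0, by omega⟩ 1, ?_, ?_⟩
    · intro h
      have := congrFun h ⟨0, by omega⟩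
      simp at this
    · intro a ha
      rw [Pi.single_eq_of_ne]
      rintro rfl; simp at ha; omega
  exact Nat.card_pos

/-- The block function of the parity subgroup. -/
def parityBlocks (n : ℕ) : Fin n → Fin 2 := fun i => if (i : ℕ) % 2 = 0 then 0 else 1

lemma mem_levi_parity {g : GL (Fin n) k} : g ∈ levi k n 2 (parityBlocks n) ↔
    ∀ a b : Fin n, (a : ℕ) % 2 ≠ (b : ℕ) % 2 → g.val a b = 0 := by
  refine forall₂_congr fun a b => imp_congr_left ?_
  unfold parityBlocks
  split_ifs <;> simp <;> omega

/-- An invariant form under the parity subgroup is determined by its restriction to Whittaker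
vectors. -/
lemma IsCuspidal.form_eq_zero (hcusp : IsCuspidal ρ) (p : ℕ)
    [Fact p.Prime] [CharP k p] (hR : (p : R) ≠ 0) (hψ : ψ ≠ 1) (hq : (Fintype.card k : R) ≠ 0)
    (hn : 1 ≤ n) {l : V →ₗ[R] R}
    (hl : l ∈ invariantForms ρ (levi k n 2 (parityBlocks n) : Set (GL (Fin n) k)))
    (h1 : ∀ v ∈ whSpace ρ ψ 1, l v = 0) : l = 0 := by
  classical
  have : ∀ m, 1 ≤ m → m ≤ n → ∀ v ∈ whSpace ρ ψ m, l v = 0 := by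
    intro m hm
    induction m, hm using Nat.le_induction with
    | base => exact fun _ => h1
    | succ m hm ih =>
      intro hmn v hv
      set i : Fin n := ⟨m, by omega⟩ with hi
      obtain ⟨j, hj⟩ : ∃ j : Fin n, (j : ℕ) + 1 = i := ⟨⟨m - 1, by omega⟩, by simp [hi]; omega⟩
      rw [← sum_charProj hψ hq (colOp_zero (ρ := ρ) i) v, map_sum]
      refine Finset.sum_eq_zero fun ξ _ => ?_
      have hm1 := charProj_mem_of_stable (ψ := ψ) (colOp_stable (ρ := ρ) (ψ := ψ) i) ξ hv
      have hm2 := charProj_mem (ψ := ψ) (colOp_add (ρ := ρ) i) ξ v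
      set w := charProj (colOp ρ i) ψ ξ v
      by_contra hlw
      have hw0 : w ≠ 0 := by intro h; rw [h] at hlw; simp at hlw
      have hs := support_of_charSpace_ne_bot hψ hw0 hm2
      have hpar : ∀ a : Fin n, (a : ℕ) % 2 ≠ (j : ℕ) % 2 → ξ a = 0 := by
        intro a ha
        refine AddChar.eq_zero_of_forall_mul hψ fun t => ?_
        have h2 := hm2 (Pi.single a t)
        rw [dotProduct_single] at h2
        have h3 : l (colOp ρ i (Pi.single a t) w) = l w := by
          refine hl _ (mem_levi_parity.2 fun b c hbc => ?_) w
          rw [colU_apply, Matrix.one_apply_ne (by rintro rfl; exact hbc rfl), zero_add]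
          split_ifs with h
          · obtain ⟨rfl, -⟩ := h
            rw [Pi.single_eq_of_ne]
            rintro rfl; omega
          · rfl
        rw [h2, map_smul, smul_eq_mul] at h3
        have h4 : (ψ (ξ a * t) - 1) * l w = 0 := by rw [sub_mul, h3]; ring
        exact sub_eq_zero.1 ((mul_eq_zero.1 h4).resolve_right hlw)
      have hξ : ξ ≠ 0 := by
        rintro hξ
        rw [hξ] at hm2
        exact hw0 (hcusp.charSpace_zero p hR (i := i) (by simp [hi]; omega) hm1 hm2)
      obtain ⟨g, hg, hrow, hgp⟩ := exists_corner_row hj hξ hs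
      have h5 := ih (by omega) (ρ g w) ((charSpace_corner hj hs hg hrow w).1 ⟨hm1, hm2⟩)
      rw [hl g (mem_levi_parity.2 (hgp hpar))] at h5
      exact hlw h5
  ext v
  exact this n hn le_rfl v (by rw [whSpace_of_le le_rfl]; trivial)

end Whittaker

section Gelfand

variable {k : Type} [Field k] [Fintype k] {n : ℕ} {R : Type} [Field R]

lemma superDiag_colU {i j : Fin n} (hij : (j : ℕ) + 1 = i) (x : Fin n → k) :
    superDiag (colU i x).val = x j := by
  unfold superDiag
  rw [Finset.sum_eq_single j, Finset.sum_eq_single i, if_pos hij.symm, colU_apply,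
    if_pos ⟨rfl, show (j : ℕ) < i by omega⟩, Matrix.one_apply_ne, zero_add]
  · rintro rfl; omega
  · intro b _ hb
    rw [if_neg]; intro h; exact hb (Fin.ext (by omega))
  · simp
  · intro a _ ha
    refine Finset.sum_eq_zero fun b _ => ?_
    split_ifs with h
    · rw [colU_apply, Matrix.one_apply_ne, if_neg, add_zero]
      · rintro ⟨rfl, h1⟩; exact ha (Fin.ext (by omega))
      · rintro rfl; omega
    · rfl
  · simp

open Classical in
lemma superDiag_colU_single {a i : Fin n} (hai : a < i) (s : k) :
    superDiag (colU i (Pi.single a s)).val = if (i : ℕ) = a + 1 then s else 0 := by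
  have hai' : (a : ℕ) < i := hai
  rw [superDiag_colU (j := ⟨i - 1, by omega⟩) (by simp; omega), Pi.single_apply]
  refine if_congr ?_ rfl rfl
  rw [Fin.ext_iff]
  simp only
  omega

/-- Functions that transform through the generic character on both sides are supported on
monomial double cosets fixed by `sig`. -/
lemma sig_eq_of_ne_zero {ψ : AddChar k R} (hψ : ψ ≠ 1) {F : GL (Fin n) k → R}
    (hl : ∀ u ∈ upperUni k n, ∀ g, F (u * g) = ψ (superDiag u.val) * F g)
    (hr : ∀ u ∈ upperUni k n, ∀ g, F (g * u) = ψ (superDiag u.val) * F g)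
    {M : GL (Fin n) k} {v : Fin n → Fin n} (hv : Function.Bijective v)
    (hM : ∀ a b, M.val a b ≠ 0 ↔ a = v b) (hF : F M ≠ 0) : sig M = M := by
  classical
  have ht : ∀ b, M.val (v b) b ≠ 0 := fun b => (hM _ _).2 rfl
  have hdesc : ∀ a b : Fin n, a < b → v a < v b →
      ((b : ℕ) = a + 1 ↔ (v b : ℕ) = v a + 1) ∧
        ((b : ℕ) = a + 1 → M.val (v a) a = M.val (v b) b) := by
    intro a b hab hvab
    have hcomm : ∀ s : k, colU (v b) (Pi.single (v a) s) * M =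
        M * colU b (Pi.single a (s * M.val (v b) b / M.val (v a) a)) := by
      intro s
      ext c d
      rw [Units.val_mul, Units.val_mul, colU_mul_apply, mul_colU_apply]
      congr 1
      have hsum : (∑ e, if e < b then M.val c e *
          (Pi.single a (s * M.val (v b) b / M.val (v a) a) : Fin n → k) e else 0) =
          M.val c a * (s * M.val (v b) b / M.val (v a) a) := by
        rw [Finset.sum_eq_single a, if_pos hab, Pi.single_eq_same]
        · intro e _ he; simp [Pi.single_eq_of_ne he]
        · simp
      rw [hsum]
      by_cases hc : c = v a
      · subst hc
        rw [if_pos hvab, Pi.single_eq_same]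
        by_cases hd : d = b
        · subst hd; rw [if_pos rfl]; have := ht a; field_simp
        · rw [if_neg hd]
          have : M.val (v b) d = 0 := by
            by_contra h; exact hd (hv.1 ((hM _ _).1 h)).symm
          rw [this, mul_zero]
      · have : M.val c a = 0 := by
          by_contra h; exact hc ((hM _ _).1 h)
        rw [Pi.single_eq_of_ne hc, this]; simp
    have hz : (if (v b : ℕ) = v a + 1 then (1 : k) else 0) -
        (if (b : ℕ) = a + 1 then M.val (v b) b / M.val (v a) a else 0) = 0 := by
      refine AddChar.eq_zero_of_forall_mul hψ fun s => ?_
      have h1 := hl _ (colU_mem_upperUni (v b) (Pi.single (v a) s)) M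
      rw [hcomm, hr _ (colU_mem_upperUni _ _), superDiag_colU_single hab,
        superDiag_colU_single hvab] at h1
      have h2 := mul_right_cancel₀ hF h1
      rw [sub_mul, sub_eq_add_neg, AddChar.map_add_eq_mul,
        show ((if (v b : ℕ) = v a + 1 then (1 : k) else 0) * s) =
          if (v b : ℕ) = v a + 1 then s else 0 by split_ifs <;> simp,
        show ((if (b : ℕ) = a + 1 then M.val (v b) b / M.val (v a) a else 0) * s) =
          if (b : ℕ) = a + 1 then s * M.val (v b) b / M.val (v a) a else 0 by
            split_ifs <;> ring, ← h2, ← AddChar.map_add_eq_mul, add_neg_cancel,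
        AddChar.map_zero_eq_one]
    have hta := ht a
    have htb := ht b
    split_ifs at hz with h1 h2 h2
    · refine ⟨by tauto, fun _ => ?_⟩
      field_simp at hz
      rw [mul_zero] at hz
      exact sub_eq_zero.1 hz
    · simp at hz
    · exfalso
      rw [zero_sub, neg_eq_zero, div_eq_zero_iff] at hz
      tauto
    · exact ⟨by tauto, by tauto⟩
  have key := involutive_of_descents (n := n)
    (fun a => if h : a < n then ((v ⟨a, h⟩).rev : ℕ) else 0)
    (fun a => if h : a < n then M.val (v ⟨a, h⟩) ⟨a, h⟩ else 0)
    (fun a ha => by simp only [dif_pos ha]; exact Fin.is_lt _)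
    (fun a ha b hb hab => by
      simp only [dif_pos ha, dif_pos hb] at hab
      have := hv.1 (Fin.rev_injective (Fin.ext hab))
      simpa using this)
    (fun c hc => by
      obtain ⟨a, ha⟩ := hv.2 (Fin.rev ⟨c, hc⟩)
      refine ⟨a, a.2, ?_⟩
      simp [ha])
    (fun a b hab hb hlt => by
      have ha : a < n := by omega
      simp only [dif_pos ha, dif_pos hb] at hlt ⊢
      have h1 : v ⟨a, ha⟩ < v ⟨b, hb⟩ := by
        rw [← Fin.rev_lt_rev]; exact hlt
      obtain ⟨h2, h3⟩ := hdesc ⟨a, ha⟩ ⟨b, hb⟩ hab h1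
      refine ⟨h2.trans ?_, h3⟩
      have := (v ⟨a, ha⟩).2
      have := (v ⟨b, hb⟩).2
      rw [Fin.val_rev, Fin.val_rev]
      omega)
  have hinv : ∀ a : Fin n, (v (v a).rev).rev = a ∧
      M.val (v (v a).rev) (v a).rev = M.val (v a) a := by
    intro a
    have := key a a.2
    simp only [dif_pos a.2, Fin.eta, dif_pos (Fin.is_lt _)] at this
    exact ⟨Fin.ext this.1, this.2⟩
  ext c d
  rw [sig_apply]
  by_cases hcd : c = v d
  · subst hcd
    have h1 := (hinv d).1
    have h2 : d.rev = v (v d).rev := by rw [← h1, Fin.rev_rev, h1]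
    rw [h2, (hinv d).2]
  · have h1 : M.val c d = 0 := by
      by_contra h; exact hcd ((hM _ _).1 h)
    rw [h1]
    by_contra h
    have h2 := (hM _ _).1 h
    apply hcd
    have h3 := (hinv c.rev).1
    rw [← h2, Fin.rev_rev] at h3
    have h4 : (v d).rev = c.rev := h3
    exact (Fin.rev_injective h4).symm

lemma apply_sig_eq {ψ : AddChar k R} (hψ : ψ ≠ 1) {F : GL (Fin n) k → R}
    (hl : ∀ u ∈ upperUni k n, ∀ g, F (u * g) = ψ (superDiag u.val) * F g)
    (hr : ∀ u ∈ upperUni k n, ∀ g, F (g * u) = ψ (superDiag u.val) * F g)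
    (g : GL (Fin n) k) : F (sig g) = F g := by
  obtain ⟨u, hu, w, hw, v, hv, hM⟩ := exists_monomial g
  set M := u * g * w with hMdef
  have hsigM : F (sig M) = F M := by
    by_cases hF : F M = 0
    · by_contra hne
      rw [hF] at hne
      obtain ⟨v', hv', hM'⟩ : ∃ v' : Fin n → Fin n, Function.Bijective v' ∧
          ∀ a b, (sig M).val a b ≠ 0 ↔ a = v' b := by
        let e := Equiv.ofBijective v hv
        refine ⟨fun b => (e.symm b.rev).rev, ?_, fun a b => ?_⟩
        · exact (Fin.revPerm.trans (e.symm.trans Fin.revPerm)).bijective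
        · rw [sig_apply, hM, ← Fin.rev_inj (i := a), Fin.rev_rev, Equiv.eq_symm_apply]
          exact eq_comm
      have := sig_eq_of_ne_zero hψ hl hr hv' hM' hne
      rw [sig_sig] at this
      rw [← this] at hne
      exact hne hF
    · rw [sig_eq_of_ne_zero hψ hl hr hv hM hF]
  have h1 : F M = ψ (superDiag w.val) * (ψ (superDiag u.val) * F g) := by
    rw [hMdef, hr w hw, hl u hu]
  have h2 : F (sig M) = ψ (superDiag w.val) * (ψ (superDiag u.val) * F (sig g)) := by
    rw [hMdef, sig_mul, sig_mul, hl _ (sig_mem_upperUni hw), hr _ (sig_mem_upperUni hu),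
      superDiag_sig, superDiag_sig]
  rw [h1, h2] at hsigM
  have hne : ∀ x, ψ x ≠ 0 := fun x h => by
    have := AddChar.map_add_eq_mul ψ x (-x)
    rw [h, add_neg_cancel, AddChar.map_zero_eq_one, zero_mul] at this
    exact one_ne_zero this
  exact mul_left_cancel₀ (hne _) (mul_left_cancel₀ (hne _) hsigM)

lemma isPGroup_upperUni (p : ℕ) [Fact p.Prime] [CharP k p] : IsPGroup p (upperUni k n) := by
  rintro ⟨u, hu⟩
  refine ⟨n, Subtype.ext (Units.ext ?_)⟩
  have hu' := mem_upperUni.1 hu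
  have hchar : u.val.charpoly = (Polynomial.X - Polynomial.C 1) ^ n := by
    rw [Matrix.charpoly_of_isUpperTriangular]
    · rw [Finset.prod_congr rfl (g := fun _ => Polynomial.X - Polynomial.C (1 : k))]
      · simp
      · intro i _
        rw [hu' i i le_rfl, Matrix.one_apply_eq]
    · intro i j hij
      have hij' : j < i := hij
      rw [hu' i j hij'.le, Matrix.one_apply_ne hij'.ne']
  have hCH := Matrix.aeval_self_charpoly u.val
  rw [hchar] at hCH
  simp only [map_pow, map_sub, Polynomial.aeval_X, map_one] at hCH
  have hle : n ≤ p ^ n := (Nat.lt_pow_self (Fact.out : p.Prime).one_lt).le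
  have h0 : (u.val - 1) ^ p ^ n = 0 := by
    rw [← Nat.add_sub_of_le hle, pow_add, hCH, zero_mul]
  have hcp : CharP (Matrix (Fin n) (Fin n) k) p ∨ n = 0 := by
    rcases Nat.eq_zero_or_pos n with h | h
    · exact Or.inr h
    · have : Nonempty (Fin n) := ⟨⟨0, h⟩⟩
      exact Or.inl inferInstance
  rcases hcp with hcp | rfl
  · rw [sub_pow_char_pow_of_commute _ _ (Commute.one_right _), one_pow, sub_eq_zero] at h0
    simpa using h0
  · exact Subsingleton.elim _ _

lemma card_upperUni_ne_zero (p : ℕ) [Fact p.Prime] [CharP k p] (hR : (p : R) ≠ 0) :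
    (Fintype.card (upperUni k n) : R) ≠ 0 := by
  obtain ⟨m, hm⟩ := IsPGroup.iff_card.1 (isPGroup_upperUni (k := k) (n := n) p)
  rw [← Nat.card_eq_fintype_card, hm]
  push_cast
  exact pow_ne_zero _ hR

end Gelfand

section Dual

variable {𝕂 : Type} [Field 𝕂] {G : Type} [Group G] [Fintype G] {V : Type} [AddCommGroup V] [Module 𝕂 V]

lemma IsIrreducibleRep.of_transpose [FiniteDimensional 𝕂 V] {ρ : Representation 𝕂 G V}
    (h : IsIrreducibleRep ρ) {τ : Representation 𝕂 G (Module.Dual 𝕂 V)} (s : G → G)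
    (hs : Function.Surjective s) (hτ : ∀ g l v, τ g l v = l (ρ (s g) v)) : IsIrreducibleRep τ := by
  refine ⟨?_, fun W hW => ?_⟩
  · have := h.nontrivial
    exact bot_ne_top
  · have hinv : ∀ g, ∀ v ∈ W.dualCoannihilator, ρ g v ∈ W.dualCoannihilator := by
      intro g v hv
      obtain ⟨g, rfl⟩ := hs g
      rw [Submodule.mem_dualCoannihilator] at hv ⊢
      intro l hl
      rw [← hτ]
      exact hv _ (hW g l hl)
    have h2 : W.dualCoannihilator.dualAnnihilator = W :=
      Subspace.dualCoannihilator_dualAnnihilator_eq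
    rcases h.2 _ hinv with h1 | h1
    · right; rw [← h2, h1]; simp
    · left; rw [← h2, h1]; simp

end Dual

section Theta

variable {k : Type} [Field k] [Fintype k] {n : ℕ} {R : Type} [Field R]
  {V : Type} [AddCommGroup V] [Module R V]

/-- The contragredient twisted by `sig`. -/
def sigDual (ρ : Representation R (GL (Fin n) k) V) :
    Representation R (GL (Fin n) k) (Module.Dual R V) where
  toFun g := Module.Dual.transpose (ρ (sig g))
  map_one' := by ext; simp [sig_one, Module.Dual.transpose_apply]
  map_mul' g h := by ext l v; simp [sig_mul, Module.Dual.transpose_apply]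

lemma sigDual_apply (ρ : Representation R (GL (Fin n) k) V) (g : GL (Fin n) k)
    (l : Module.Dual R V) (v : V) : sigDual ρ g l v = l (ρ (sig g) v) := rfl

variable {ρ : Representation R (GL (Fin n) k) V} {ψ : AddChar k R}

/-- Irreducible generic representations are isomorphic to their `sig`-twisted dual. -/
lemma IsIrreducibleRep.repIso_sigDual [IsAlgClosed R] (h : IsIrreducibleRep ρ) (hψ : ψ ≠ 1)
    (p : ℕ) [Fact p.Prime] [CharP k p] (hR : (p : R) ≠ 0) (hw : whSpace ρ ψ 1 ≠ ⊥) :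
    RepIso ρ (sigDual ρ) := by
  classical
  have := h.finiteDimensional
  set P : Module.End R V := ∑ u : upperUni k n, ψ (-superDiag u.1.val) • ρ u.1 with hP
  have hlP : ∀ u ∈ upperUni k n, ρ u * P = ψ (superDiag u.val) • P := by
    intro u hu
    rw [hP, Finset.mul_sum, Finset.smul_sum]
    refine Fintype.sum_equiv (Equiv.mulLeft (⟨u, hu⟩ : upperUni k n)) _ _ fun w => ?_
    rw [Equiv.coe_mulLeft, mul_smul_comm, ← map_mul, smul_smul, Subgroup.coe_mul,
      superDiag_mul hu w.2, neg_add, AddChar.map_add_eq_mul, ← mul_assoc, ← AddChar.map_add_eq_mul,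
      add_neg_cancel, AddChar.map_zero_eq_one, one_mul]
  have hrP : ∀ u ∈ upperUni k n, P * ρ u = ψ (superDiag u.val) • P := by
    intro u hu
    rw [hP, Finset.sum_mul, Finset.smul_sum]
    refine Fintype.sum_equiv (Equiv.mulRight (⟨u, hu⟩ : upperUni k n)) _ _ fun w => ?_
    rw [Equiv.coe_mulRight, smul_mul_assoc, ← map_mul, smul_smul, Subgroup.coe_mul,
      superDiag_mul w.2 hu, neg_add, add_comm, AddChar.map_add_eq_mul, ← mul_assoc,
      ← AddChar.map_add_eq_mul, add_neg_cancel, AddChar.map_zero_eq_one, one_mul]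
  have hP0 : P ≠ 0 := by
    obtain ⟨v, hv, hv0⟩ := Submodule.exists_mem_ne_zero_of_ne_bot hw
    rw [mem_whSpace_one] at hv
    intro h0
    have h1 : P v = (Fintype.card (upperUni k n) : R) • v := by
      rw [hP, LinearMap.sum_apply]
      rw [Finset.sum_congr rfl (g := fun _ => v)]
      · simp [Nat.cast_smul_eq_nsmul]
      · intro u _
        rw [LinearMap.smul_apply, hv u.1 u.2, smul_smul, ← AddChar.map_add_eq_mul, neg_add_cancel,
          AddChar.map_zero_eq_one, one_smul]
    rw [h0, LinearMap.zero_apply] at h1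
    refine (smul_ne_zero ?_ hv0) h1.symm
    exact card_upperUni_ne_zero p hR
  refine RepIso.symm (repIso_of_trace_eq (ρ' := sigDual ρ) h
    (h.of_transpose (fun g => sig g) (fun g => ⟨sig g, sig_sig g⟩) fun g l v => rfl) hP0
      (Module.Dual.transpose P) fun g => ?_)
  · have h1 : sigDual ρ g * Module.Dual.transpose P = Module.Dual.transpose (P * ρ (sig g)) := by
      ext l v; rfl
    rw [h1, LinearMap.trace_transpose', LinearMap.trace_mul_comm _ P]
    refine (apply_sig_eq (F := fun g => LinearMap.trace R V (ρ g * P)) hψ ?_ ?_ g).symm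
    · intro u hu g
      rw [map_mul ρ, mul_assoc, LinearMap.trace_mul_comm, mul_assoc, hrP u hu, mul_smul_comm,
        map_smul, smul_eq_mul]
    · intro u hu g
      rw [map_mul ρ, mul_assoc, hlP u hu, mul_smul_comm, map_smul, smul_eq_mul]

lemma IsIrreducibleRep.whSpace_unique [IsAlgClosed R] (h : IsIrreducibleRep ρ) (hψ : ψ ≠ 1)
    (p : ℕ) [Fact p.Prime] [CharP k p] (hR : (p : R) ≠ 0) : Module.finrank R (whSpace ρ ψ 1) ≤ 1 := by
  by_cases hw : whSpace ρ ψ 1 = ⊥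
  · rw [hw]; simp
  obtain ⟨e, he⟩ := h.repIso_sigDual hψ p hR hw
  have := h.finiteDimensional
  obtain ⟨w, hw1, hw0⟩ := Submodule.exists_mem_ne_zero_of_ne_bot hw
  refine finrank_le_one ⟨w, hw1⟩ fun ⟨v, hv⟩ => ?_
  rw [mem_whSpace_one] at hw1 hv
  have hsym : ∀ g, e w (ρ g v) = e (ρ g w) v := by
    intro g
    rw [he, sigDual_apply]
    refine (apply_sig_eq (F := fun g => e w (ρ g v)) hψ ?_ ?_ g).symm
    · intro u hu g
      have h1 : e w (ρ u (ρ g v)) = sigDual ρ (sig u) (e w) (ρ g v) := by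
        rw [sigDual_apply, sig_sig]
      rw [map_mul, Module.End.mul_apply, h1, ← he, hw1 _ (sig_mem_upperUni hu), superDiag_sig,
        map_smul, LinearMap.smul_apply, smul_eq_mul]
    · intro u hu g
      rw [map_mul, Module.End.mul_apply, hv u hu, map_smul, map_smul, smul_eq_mul]
  have hsym' : ∀ f : Module.End R V, e w (f v) = e (f w) v := by
    intro f
    obtain ⟨x, -, rfl⟩ := actsFully_top h f
    simp only [act_apply, map_sum, map_smul, hsym, LinearMap.sum_apply, LinearMap.smul_apply]
  obtain ⟨z, hz⟩ : ∃ z, e w z ≠ 0 := by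
    by_contra! h0
    exact hw0 (e.injective (by rw [map_zero]; ext z; exact h0 z))
  by_contra! hne
  have hv' : v ∉ Submodule.span R {w} := by
    rw [Submodule.mem_span_singleton]
    rintro ⟨c, hc⟩
    exact hne c (Subtype.ext hc)
  obtain ⟨l, hl, hlw⟩ := Submodule.exists_le_ker_of_notMem hv'
  have h1 := hsym' (rankOne z l)
  have h2 : l w = 0 := by
    have := hlw (Submodule.mem_span_singleton_self w)
    simpa using this
  simp only [rankOne, LinearMap.smulRight_apply, h2, zero_smul, map_zero, map_smul, smul_eq_mul,
    LinearMap.zero_apply] at h1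
  rcases mul_eq_zero.1 h1 with h3 | h3
  · exact hl h3
  · exact hz h3

end Theta

section Restrict

variable {R : Type} [CommRing R] {G : Type} [Monoid G] {V : Type} [AddCommGroup V] [Module R V]

/-- The restriction of a representation to an invariant submodule. -/
def restrictRep (ρ : Representation R G V) (W : Submodule R V) (hW : ∀ g, ∀ v ∈ W, ρ g v ∈ W) :
    Representation R G W where
  toFun g := (ρ g).restrict (hW g)
  map_one' := by ext; simp [LinearMap.restrict_apply]
  map_mul' g h := by ext; simp [LinearMap.restrict_apply]

@[simp] lemma restrictRep_coe (ρ : Representation R G V) (W : Submodule R V)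
    (hW : ∀ g, ∀ v ∈ W, ρ g v ∈ W) (g : G) (w : W) : (restrictRep ρ W hW g w : V) = ρ g w := rfl

end Restrict

section Uniqueness

variable {k : Type} [Field k] [Fintype k] {n : ℕ} {R : Type} [Field R]
  {V : Type} [AddCommGroup V] [Module R V] {ρ : Representation R (GL (Fin n) k) V}

lemma card_field_ne_zero (p : ℕ) [Fact p.Prime] [CharP k p] (hR : (p : R) ≠ 0) :
    (Fintype.card k : R) ≠ 0 := by
  obtain ⟨m, -, hm⟩ := FiniteField.card k p
  rw [hm]
  push_cast
  exact pow_ne_zero _ hR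

lemma IsCuspidal.restrictRep (hcusp : IsCuspidal ρ) (W : Submodule R V)
    (hW : ∀ g, ∀ v ∈ W, ρ g v ∈ W) : IsCuspidal (restrictRep ρ W hW) := by
  intro j h0 hj
  ext w
  have := congrArg (fun f => f (w : V)) (hcusp j h0 hj)
  simpa [LinearMap.sum_apply] using this

lemma IsIrreducibleRep.whSpace_ne_bot [IsAlgClosed R] (h : IsIrreducibleRep ρ)
    (hcusp : IsCuspidal ρ) (p : ℕ) [Fact p.Prime] [CharP k p] (hR : (p : R) ≠ 0) (hn : 1 ≤ n)
    {ψ : AddChar k R} (hψ : ψ ≠ 1) : whSpace ρ ψ 1 ≠ ⊥ := by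
  intro h0
  have := h.finiteDimensional
  have := h.nontrivial
  have h1 := hcusp.finrank_eq p hR hψ (card_field_ne_zero p hR) hn
  rw [h0, finrank_bot, mul_zero] at h1
  exact (Module.finrank_pos (R := R) (M := V)).ne' h1

lemma IsIrreducibleRep.finrank_eq_cuspidalDim [IsAlgClosed R] (h : IsIrreducibleRep ρ)
    (hcusp : IsCuspidal ρ) (p : ℕ) [Fact p.Prime] [CharP k p] (hR : (p : R) ≠ 0) (hn : 1 ≤ n) :
    Module.finrank R V = cuspidalDim k n := by
  obtain ⟨ψ, hψ⟩ := exists_addChar_ne_one (card_field_ne_zero (k := k) p hR)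
  have := h.finiteDimensional
  have h1 := h.whSpace_unique hψ p hR
  have h2 := (Submodule.one_le_finrank_iff (R := R)).2 (h.whSpace_ne_bot hcusp p hR hn hψ)
  rw [hcusp.finrank_eq p hR hψ (card_field_ne_zero p hR) hn, le_antisymm h1 h2, mul_one]

lemma IsCuspidal.isIrreducibleRep [IsAlgClosed R] (hcusp : IsCuspidal ρ)
    (hdim : Module.finrank R V = cuspidalDim k n) (p : ℕ) [Fact p.Prime] [CharP k p]
    (hR : (p : R) ≠ 0) (hn : 1 ≤ n) : IsIrreducibleRep ρ := by
  obtain ⟨ψ, hψ⟩ := exists_addChar_ne_one (card_field_ne_zero (k := k) p hR)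
  have hfin : FiniteDimensional R V := by
    apply FiniteDimensional.of_finrank_pos
    rw [hdim]; exact cuspidalDim_pos n
  constructor
  · intro h
    have : Module.finrank R V = 0 := by
      rw [← finrank_top R V, ← h, finrank_bot]
    have := cuspidalDim_pos (k := k) n
    omega
  · intro W hW
    by_cases h0 : W = ⊥
    · exact Or.inl h0
    right
    apply Submodule.eq_top_of_finrank_eq
    refine le_antisymm (Submodule.finrank_le W) ?_
    have h1 := (hcusp.restrictRep W hW).finrank_eq p hR hψ (card_field_ne_zero p hR) hn
    rw [hdim, h1]
    refine Nat.le_mul_of_pos_right _ (Nat.pos_of_ne_zero fun h => ?_)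
    rw [h, mul_zero] at h1
    exact h0 (Submodule.finrank_eq_zero.1 h1)

lemma exists_perm_twoBlocks (r : ℕ) (hn : n = 2 * r) :
    ∃ e : Equiv.Perm (Fin n), ∀ i, parityBlocks n (e i) = twoBlocks n r i := by
  have hinj : Function.Injective (fun i : Fin n =>
      (⟨if (i : ℕ) < r then 2 * i else 2 * (i - r) + 1, by
        have := i.2; split_ifs <;> omega⟩ : Fin n)) := by
    intro i j hij
    simp only [Fin.mk.injEq] at hij
    ext
    split_ifs at hij <;> omega
  refine ⟨Equiv.ofBijective _ (Finite.injective_iff_bijective.1 hinj), fun i => ?_⟩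
  simp only [Equiv.ofBijective_apply, parityBlocks, twoBlocks]
  refine if_congr ?_ rfl rfl
  split_ifs with h <;> simp [h]

/-- The block Levi subgroup with two equal blocks is conjugate to the parity subgroup. -/
lemma exists_conj_mem_levi (r : ℕ) (hn : n = 2 * r) : ∃ w : GL (Fin n) k,
    ∀ g ∈ levi k n 2 (parityBlocks n), w * g * w⁻¹ ∈ levi k n 2 (twoBlocks n r) := by
  obtain ⟨e, he⟩ := exists_perm_twoBlocks r hn
  let w : GL (Fin n) k := ⟨e.toPEquiv.toMatrix, e.symm.toPEquiv.toMatrix, by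
    rw [PEquiv.toMatrix_toPEquiv_mul]
    ext i j; simp [PEquiv.toMatrix_apply, Matrix.one_apply, Matrix.submatrix], by
    rw [PEquiv.toMatrix_toPEquiv_mul]
    ext i j; simp [PEquiv.toMatrix_apply, Matrix.one_apply, Matrix.submatrix]⟩
  refine ⟨w, fun g hg i j hij => ?_⟩
  have : (w * g * w⁻¹).val = g.val.submatrix e e := by
    change e.toPEquiv.toMatrix * g.val * e.symm.toPEquiv.toMatrix = _
    rw [PEquiv.toMatrix_toPEquiv_mul, PEquiv.mul_toMatrix_toPEquiv]
    rfl
  rw [this]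
  exact hg _ _ (by rwa [he, he])

lemma IsIrreducibleRep.finrank_invariantForms_le [IsAlgClosed R] (h : IsIrreducibleRep ρ)
    (hcusp : IsCuspidal ρ) (p : ℕ) [Fact p.Prime] [CharP k p] (hR : (p : R) ≠ 0) (hn1 : 1 ≤ n)
    (r : ℕ) (hn : n = 2 * r) : Module.finrank R
      (invariantForms ρ (levi k n 2 (twoBlocks n r) : Set (GL (Fin n) k))) ≤ 1 := by
  obtain ⟨ψ, hψ⟩ := exists_addChar_ne_one (card_field_ne_zero (k := k) p hR)
  have := h.finiteDimensional
  obtain ⟨w, hw⟩ := exists_conj_mem_levi (k := k) r hn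
  let f : invariantForms ρ (levi k n 2 (twoBlocks n r) : Set (GL (Fin n) k)) →ₗ[R]
      Module.Dual R (whSpace ρ ψ 1) :=
    { toFun l := l.1 ∘ₗ ρ w ∘ₗ (whSpace ρ ψ 1).subtype
      map_add' l l' := by ext; simp
      map_smul' c l := by ext; simp }
  have hf : Function.Injective f := by
    rw [injective_iff_map_eq_zero]
    intro l hl
    have h1 : l.1 ∘ₗ ρ w = 0 := by
      refine hcusp.form_eq_zero p hR hψ (card_field_ne_zero p hR) hn1 ?_ fun v hv => ?_
      · intro g hg v
        have h2 := l.2 _ (hw g hg) (ρ w v)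
        rw [← Module.End.mul_apply, ← map_mul, inv_mul_cancel_right, map_mul] at h2
        exact h2
      · exact congrArg (fun f => f ⟨v, hv⟩) hl
    ext v
    have h2 := congrArg (fun f => f (ρ w⁻¹ v)) h1
    simpa using h2
  refine (LinearMap.finrank_le_finrank_of_injective hf).trans ?_
  rw [Subspace.dual_finrank_eq]
  exact h.whSpace_unique hψ p hR

end Uniqueness

noncomputable instance (priority := 10) instFintypeOfFinite (α : Type) [Finite α] : Fintype α :=
  Fintype.ofFinite α

section Hyperplane

variable {K : Type} [Field K] {V : Type} [AddCommGroup V] [Module K V]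

instance instFiniteLinearMap {W : Type} [AddCommGroup W] [Module K W] [Finite V] [Finite W] :
    Finite (V →ₗ[K] W) := DFunLike.finite _

instance instFiniteLinearEquiv {W : Type} [AddCommGroup W] [Module K W] [Finite V] [Finite W] :
    Finite (V ≃ₗ[K] W) := DFunLike.finite _

instance instFiniteSubmodule (W : Submodule K V) [Finite V] : Finite W :=
  Finite.of_injective _ W.injective_subtype

noncomputable instance instFintypeSubmodule (W : Submodule K V) [Finite V] : Fintype W :=
  Fintype.ofFinite W

/-- The projection onto the kernel of `ξ` along a vector `z` with `ξ z = 1`. -/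
def kerProj (ξ : Module.Dual K V) (z : V) (hz : ξ z = 1) : V →ₗ[K] LinearMap.ker ξ :=
  LinearMap.codRestrict _ (LinearMap.id - ξ.smulRight z) fun v => by simp [hz]

@[simp] lemma kerProj_coe (ξ : Module.Dual K V) (z : V) (hz : ξ z = 1) (v : V) :
    (kerProj ξ z hz v : V) = v - ξ v • z := rfl

/-- The endomorphism with image in `ker ξ` acting as `μ` on `ker ξ` and mapping `z` to `w`. -/
def hypExt (ξ : Module.Dual K V) (z : V) (hz : ξ z = 1) (μ : Module.End K (LinearMap.ker ξ))
    (w : LinearMap.ker ξ) : Module.End K V :=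
  (LinearMap.ker ξ).subtype ∘ₗ (μ ∘ₗ kerProj ξ z hz + ξ.smulRight w)

variable {ξ : Module.Dual K V} {z : V} {hz : ξ z = 1} {μ : Module.End K (LinearMap.ker ξ)}
  {w : LinearMap.ker ξ}

lemma kerProj_ker (x : LinearMap.ker ξ) : kerProj ξ z hz x = x := by
  ext; rw [kerProj_coe, LinearMap.mem_ker.1 x.2]; simp

lemma kerProj_self : kerProj ξ z hz z = 0 := by
  ext; rw [kerProj_coe, hz]; simp

@[simp] lemma hypExt_ker (x : LinearMap.ker ξ) : hypExt ξ z hz μ w x = μ x := by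
  simp only [hypExt, LinearMap.comp_apply, LinearMap.add_apply, kerProj_ker,
    LinearMap.smulRight_apply, LinearMap.mem_ker.1 x.2, zero_smul, add_zero, Submodule.subtype_apply]

@[simp] lemma hypExt_self : hypExt ξ z hz μ w z = w := by
  simp [hypExt, kerProj_self, hz]

lemma apply_hypExt (v : V) : ξ (hypExt ξ z hz μ w v) = 0 :=
  LinearMap.mem_ker.1 ((μ ∘ₗ kerProj ξ z hz + ξ.smulRight w) v).2

lemma end_ext_ker (hz : ξ z = 1) {M : Type} [AddCommGroup M] [Module K M] {f g : V →ₗ[K] M}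
    (h : ∀ x : LinearMap.ker ξ, f x = g x) (h' : f z = g z) : f = g := by
  ext v
  have hv : v = (kerProj ξ z hz v : V) + ξ v • z := by simp
  rw [hv, map_add, map_add, map_smul, map_smul, h, h']

lemma exists_eq_hypExt (hz : ξ z = 1) {ν : Module.End K V} (hν : ∀ v, ξ (ν v) = 0) :
    ∃ μ w, ν = hypExt ξ z hz μ w := by
  refine ⟨ν.restrict (p := LinearMap.ker ξ) (q := LinearMap.ker ξ) fun v _ => hν v, ⟨ν z, hν z⟩, ?_⟩
  refine end_ext_ker hz (fun x => ?_) ?_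
  · rw [hypExt_ker]; rfl
  · rw [hypExt_self]

lemma hypExt_injective {μ' : Module.End K (LinearMap.ker ξ)} {w' : LinearMap.ker ξ}
    (h : hypExt ξ z hz μ w = hypExt ξ z hz μ' w') : μ = μ' ∧ w = w' := by
  refine ⟨LinearMap.ext fun x => Subtype.ext ?_, Subtype.ext ?_⟩
  · rw [← hypExt_ker (hz := hz) (w := w), h, hypExt_ker]
  · rw [← hypExt_self (hz := hz) (μ := μ), h, hypExt_self]

lemma hypExt_pow_ker (j : ℕ) (x : LinearMap.ker ξ) :
    (hypExt ξ z hz μ w ^ j) x = ((μ ^ j) x : LinearMap.ker ξ) := by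
  induction j generalizing x with
  | zero => rfl
  | succ j ih => rw [pow_succ, pow_succ, Module.End.mul_apply, hypExt_ker, ih]; rfl

lemma isNilpotent_hypExt : IsNilpotent (hypExt ξ z hz μ w) ↔ IsNilpotent μ := by
  constructor
  · rintro ⟨j, hj⟩
    refine ⟨j, LinearMap.ext fun x => Subtype.ext ?_⟩
    rw [← hypExt_pow_ker (hz := hz) (w := w), hj]; rfl
  · rintro ⟨j, hj⟩
    refine ⟨j + 1, LinearMap.ext fun x => ?_⟩
    rw [pow_succ, Module.End.mul_apply]
    have : hypExt ξ z hz μ w x = ((⟨_, apply_hypExt x⟩ : LinearMap.ker ξ) : V) := rfl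
    rw [this, hypExt_pow_ker, hj]; rfl

lemma finrank_ker_add_one [FiniteDimensional K V] (hz : ξ z = 1) :
    Module.finrank K (LinearMap.ker ξ) + 1 = Module.finrank K V := by
  have h := LinearMap.finrank_range_add_finrank_ker ξ
  have : LinearMap.range ξ = ⊤ := by
    rw [LinearMap.range_eq_top]
    intro c
    exact ⟨c • z, by simp [hz]⟩
  rw [this, finrank_top, Module.finrank_self] at h
  omega

lemma range_hypExt : LinearMap.range (hypExt ξ z hz μ w) =
    (LinearMap.range μ ⊔ Submodule.span K {w}).map (LinearMap.ker ξ).subtype := by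
  rw [hypExt, LinearMap.range_comp]
  congr 1
  apply le_antisymm
  · rintro _ ⟨v, rfl⟩
    refine Submodule.add_mem_sup ⟨_, rfl⟩ ?_
    exact Submodule.smul_mem _ _ (Submodule.mem_span_singleton_self w)
  · refine sup_le ?_ ?_
    · rintro _ ⟨x, rfl⟩
      refine ⟨x, ?_⟩
      simp [kerProj_ker, LinearMap.mem_ker.1 x.2]
    · rw [Submodule.span_singleton_le_iff_mem]
      exact ⟨z, by simp [kerProj_self, hz]⟩

open Classical in
lemma finrank_ker_hypExt [FiniteDimensional K V] :
    Module.finrank K (LinearMap.ker (hypExt ξ z hz μ w)) =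
      Module.finrank K (LinearMap.ker μ) + if w ∈ LinearMap.range μ then 1 else 0 := by
  have h1 := LinearMap.finrank_range_add_finrank_ker (hypExt ξ z hz μ w)
  have h2 := LinearMap.finrank_range_add_finrank_ker μ
  have h3 := finrank_ker_add_one hz
  rw [range_hypExt, LinearEquiv.finrank_eq (Submodule.equivMapOfInjective _ (Submodule.injective_subtype _) _).symm] at h1
  split_ifs with hw
  · rw [sup_eq_left.2 (by rwa [Submodule.span_singleton_le_iff_mem])] at h1
    omega
  · rw [Submodule.finrank_sup_span_singleton hw] at h1
    omega

variable {F : Type} [AddCommMonoid F]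

open Classical in
lemma sum_hypExt [Finite V] (hz : ξ z = 1) (g : Module.End K V → F) :
    ∑ ν : Module.End K V with IsNilpotent ν ∧ ∀ v, ξ (ν v) = 0, g ν =
      ∑ μ : Module.End K (LinearMap.ker ξ) with IsNilpotent μ, ∑ w, g (hypExt ξ z hz μ w) := by
  rw [← Finset.sum_product']
  symm
  refine Finset.sum_bij (fun x _ => hypExt ξ z hz x.1 x.2) ?_ ?_ ?_ ?_
  · rintro ⟨μ, w⟩ h
    simp only [Finset.mem_product, Finset.mem_filter, Finset.mem_univ, true_and, and_true] at h ⊢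
    exact ⟨isNilpotent_hypExt.2 h, apply_hypExt⟩
  · rintro ⟨μ, w⟩ h ⟨μ', w'⟩ h' e
    obtain ⟨h1, h2⟩ := hypExt_injective e
    simp only at h1 h2
    rw [h1, h2]
  · intro ν hν
    simp only [Finset.mem_filter, Finset.mem_univ, true_and] at hν
    obtain ⟨μ, w, rfl⟩ := exists_eq_hypExt hz hν.2
    exact ⟨(μ, w), by simpa using isNilpotent_hypExt.1 hν.1, rfl⟩
  · intros; rfl

end Hyperplane

section NilSum

variable {K : Type} [Field K] {V : Type} [AddCommGroup V] [Module K V] {A : Type} [CommRing A]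

/-- The sum of `g (dim ker ν)` over all nilpotent endomorphisms `ν`. -/
noncomputable def nilSum (K V : Type) [Field K] [AddCommGroup V] [Module K V] [Finite V]
    {A : Type} [CommRing A] (g : ℕ → A) : A :=
  open Classical in
  ∑ ν : Module.End K V with IsNilpotent ν, g (Module.finrank K (LinearMap.ker ν))

lemma isNilpotent_conj {W : Type} [AddCommGroup W] [Module K W] (e : V ≃ₗ[K] W)
    {ν : Module.End K V} : IsNilpotent (e.conj ν) ↔ IsNilpotent ν :=
  IsNilpotent.map_iff (f := e.conjRingEquiv) e.conjRingEquiv.injective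

lemma finrank_ker_conj {W : Type} [AddCommGroup W] [Module K W] (e : V ≃ₗ[K] W)
    (ν : Module.End K V) :
    Module.finrank K (LinearMap.ker (e.conj ν)) = Module.finrank K (LinearMap.ker ν) := by
  have : LinearMap.ker (e.conj ν) = (LinearMap.ker ν).map (e : V →ₗ[K] W) := by
    ext w
    rw [Submodule.mem_map_equiv, LinearMap.mem_ker, LinearMap.mem_ker, LinearEquiv.conj_apply_apply]
    simp
  rw [this]
  exact (LinearEquiv.finrank_map_eq e _)

lemma nilSum_congr {W : Type} [AddCommGroup W] [Module K W] [Finite V] [Finite W]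
    (h : Module.finrank K V = Module.finrank K W) (g : ℕ → A) : nilSum K V g = nilSum K W g := by
  classical
  let e := LinearEquiv.ofFinrankEq V W h
  refine Finset.sum_equiv e.conj.toEquiv (fun ν => ?_) fun ν _ => ?_
  · simp only [Finset.mem_filter, Finset.mem_univ, true_and]
    exact (isNilpotent_conj e).symm
  · exact congrArg g (finrank_ker_conj e ν).symm

lemma nilSum_sub [Finite V] (f g : ℕ → A) :
    nilSum K V (fun t => f t - g t) = nilSum K V f - nilSum K V g := Finset.sum_sub_distrib ..

lemma nilSum_const_mul [Finite V] (c : A) (g : ℕ → A) :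
    nilSum K V (fun t => c * g t) = c * nilSum K V g := (Finset.mul_sum ..).symm

lemma map_nilSum [Finite V] {B : Type} [CommRing B] (φ : A →+* B) (g : ℕ → A) :
    φ (nilSum K V g) = nilSum K V (fun t => φ (g t)) := map_sum ..

lemma finrank_ker_pos_of_isNilpotent [Nontrivial V] [FiniteDimensional K V] {ν : Module.End K V}
    (h : IsNilpotent ν) : 0 < Module.finrank K (LinearMap.ker ν) := by
  rw [Nat.pos_iff_ne_zero]
  intro h0
  have h1 := LinearMap.ker_eq_bot.1 (Submodule.finrank_eq_zero.1 h0)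
  obtain ⟨j, hj⟩ := h
  have h2 : Function.Injective (ν ^ j) := by
    rw [Module.End.coe_pow]; exact h1.iterate j
  obtain ⟨v, hv⟩ := exists_ne (0 : V)
  exact hv (h2 (by rw [hj]; simp))

lemma nilSum_congr_fun [Finite V] {f g : ℕ → A} (hV : 0 < Module.finrank K V)
    (h : ∀ t, 1 ≤ t → t ≤ Module.finrank K V → f t = g t) : nilSum K V f = nilSum K V g := by
  classical
  have : Nontrivial V := Module.finrank_pos_iff.1 hV
  refine Finset.sum_congr rfl fun ν hν => ?_
  simp only [Finset.mem_filter, Finset.mem_univ, true_and] at hν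
  exact h _ (finrank_ker_pos_of_isNilpotent hν) (Submodule.finrank_le _)

lemma nilSum_of_finrank_eq_one [Finite V] (hV : Module.finrank K V = 1) (g : ℕ → A) :
    nilSum K V g = g 1 := by
  classical
  rw [nilSum, Finset.sum_eq_single 0]
  · congr 1
    rw [LinearMap.ker_zero, finrank_top, hV]
  · intro ν hν h
    exfalso
    simp only [Finset.mem_filter, Finset.mem_univ, true_and] at hν
    have : Nontrivial V := Module.finrank_pos_iff.1 (by rw [hV]; exact one_pos)
    have h1 := finrank_ker_pos_of_isNilpotent hν
    refine h (LinearMap.ker_eq_top.1 (Submodule.eq_top_of_finrank_eq ?_))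
    have := Submodule.finrank_le (LinearMap.ker ν)
    omega
  · intro h; exact absurd (by simp) h

variable [Finite K]

lemma natCard_range_eq [Finite V] (μ : Module.End K V) :
    (Nat.card (LinearMap.range μ)) =
      Nat.card K ^ (Module.finrank K V - Module.finrank K (LinearMap.ker μ)) := by
  rw [Module.natCard_eq_pow_finrank (K := K)]
  congr 1
  have := LinearMap.finrank_range_add_finrank_ker μ
  omega

open Classical in
lemma sum_ite_mem [Finite V] (p : V → Prop) (S : Set V) (hp : ∀ v, p v ↔ v ∈ S) (a b : A) :
    ∑ w : V, (if p w then a else b) = (Nat.card S : A) * a + ((Nat.card V : A) - Nat.card S) * b := by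
  have h1 : ∀ w : V, (if p w then a else b) = b + if w ∈ S then (a - b) else 0 := by
    intro w; simp only [hp]; split_ifs <;> ring
  simp only [h1, Finset.sum_add_distrib, Finset.sum_const, Finset.card_univ, ← Finset.sum_filter]
  rw [← Nat.card_eq_fintype_card]
  have h2 : (Finset.univ.filter (· ∈ S)).card = Nat.card S := by
    rw [Nat.card_eq_fintype_card, Fintype.card_subtype]
  rw [h2, nsmul_eq_mul, nsmul_eq_mul]
  ring

open Classical in
/-- Double counting of pairs of a nilpotent endomorphism and a covector killing its image. -/
lemma nilSum_succ [Finite V] {W : Type} [AddCommGroup W] [Module K W] [Finite W]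
    (hV : Module.finrank K V = Module.finrank K W + 1) (g : ℕ → A) :
    nilSum K V (fun t => ((Nat.card K : A) ^ t - 1) * g t) =
      ((Nat.card K : A) ^ Module.finrank K V - 1) * nilSum K W (fun s =>
        (Nat.card K : A) ^ (Module.finrank K W - s) * g (s + 1) +
        ((Nat.card K : A) ^ Module.finrank K W - (Nat.card K : A) ^ (Module.finrank K W - s)) * g s) := by
  have hann : ∀ ν : Module.End K V, ((Nat.card K : A) ^ Module.finrank K (LinearMap.ker ν) - 1) =
      ∑ ξ : Module.Dual K V with ξ ≠ 0, if ∀ v, ξ (ν v) = 0 then 1 else 0 := by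
    intro ν
    have h1 : ∀ ξ : Module.Dual K V, (∀ v, ξ (ν v) = 0) ↔
        ξ ∈ ((LinearMap.range ν).dualAnnihilator : Set (Module.Dual K V)) := by
      intro ξ
      rw [SetLike.mem_coe, Submodule.mem_dualAnnihilator]
      constructor
      · rintro h _ ⟨v, rfl⟩; exact h v
      · intro h v; exact h _ ⟨v, rfl⟩
    have h2 := sum_ite_mem (A := A) _ _ h1 1 0
    rw [← Finset.sum_erase_add _ _ (Finset.mem_univ (0 : Module.Dual K V))] at h2
    rw [show (Finset.univ.filter fun ξ : Module.Dual K V => ξ ≠ 0) = Finset.univ.erase 0 by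
      ext; simp]
    refine Eq.trans ?_ ((Finset.sum_congr rfl fun ξ _ => by congr).trans (eq_sub_of_add_eq h2)).symm
    have h3 : Nat.card ((LinearMap.range ν).dualAnnihilator : Set (Module.Dual K V)) =
        Nat.card K ^ Module.finrank K (LinearMap.ker ν) := by
      rw [show Nat.card ((LinearMap.range ν).dualAnnihilator : Set (Module.Dual K V)) =
        Nat.card (LinearMap.range ν).dualAnnihilator from rfl, Module.natCard_eq_pow_finrank (K := K)]
      congr 1
      have h4 := Subspace.finrank_add_finrank_dualAnnihilator_eq (LinearMap.range ν)
      have h5 := LinearMap.finrank_range_add_finrank_ker ν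
      omega
    rw [h3]
    simp
  rw [nilSum, Finset.sum_congr rfl fun ν _ => by rw [hann, Finset.sum_mul], Finset.sum_comm]
  have hcard : (((Finset.univ.filter fun ξ : Module.Dual K V => ξ ≠ 0).card : ℕ) : A) =
      (Nat.card K : A) ^ Module.finrank K V - 1 := by
    rw [show (Finset.univ.filter fun ξ : Module.Dual K V => ξ ≠ 0) = Finset.univ.erase 0 by
      ext; simp, Finset.card_erase_of_mem (Finset.mem_univ _), Finset.card_univ,
      ← Nat.card_eq_fintype_card, Module.natCard_eq_pow_finrank (K := K), Subspace.dual_finrank_eq,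
      Nat.cast_sub (Nat.one_le_pow _ _ Nat.card_pos)]
    push_cast
    rfl
  rw [← hcard, ← nsmul_eq_mul, ← Finset.sum_const]
  refine Finset.sum_congr rfl fun ξ hξ => ?_
  simp only [Finset.mem_filter, Finset.mem_univ, true_and] at hξ
  obtain ⟨z, hz⟩ : ∃ z, ξ z = 1 := by
    obtain ⟨v, hv⟩ : ∃ v, ξ v ≠ 0 := by
      by_contra! h; exact hξ (LinearMap.ext h)
    exact ⟨(ξ v)⁻¹ • v, by simp [hv]⟩
  have hW : Module.finrank K (LinearMap.ker ξ) = Module.finrank K W := by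
    have := finrank_ker_add_one hz
    omega
  rw [← nilSum_congr hW, nilSum]
  simp only [ite_mul, one_mul, zero_mul]
  rw [← Finset.sum_filter, Finset.filter_filter]
  refine (Finset.sum_congr (by ext; simp) fun _ _ => rfl).trans ((sum_hypExt hz fun ν =>
    g (Module.finrank K (LinearMap.ker ν))).trans ?_)
  refine Finset.sum_congr rfl fun μ _ => ?_
  have h1 := sum_ite_mem (A := A) (fun w => w ∈ LinearMap.range μ) (LinearMap.range μ : Set _)
    (fun w => Iff.rfl) (g (Module.finrank K (LinearMap.ker μ) + 1))
    (g (Module.finrank K (LinearMap.ker μ)))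
  have h2 : Nat.card ((LinearMap.range μ : Set (LinearMap.ker ξ))) = _ := natCard_range_eq μ
  rw [h2, Module.natCard_eq_pow_finrank (K := K) (V := LinearMap.ker ξ), hW] at h1
  push_cast at h1
  rw [← h1]
  refine Finset.sum_congr (by ext; simp) fun w _ => ?_
  rw [finrank_ker_hypExt]
  split_ifs <;> rfl

end NilSum

section QSeries

open Polynomial

variable {A : Type} [CommRing A]

/-- The `q`-Pochhammer symbol `∏_{i < t} (1 - y q ^ i)`. -/
def poch (q y : A) (t : ℕ) : A := ∏ i ∈ Finset.range t, (1 - y * q ^ i)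

/-- The product `∏_{1 ≤ i < t} (1 - q ^ i)`. -/
def phiQ (q : A) (t : ℕ) : A := poch q q (t - 1)

/-- The order of `GL_a` over a field with `q` elements. -/
def glOrd (q : A) (a : ℕ) : A := ∏ i ∈ Finset.range a, (q ^ a - q ^ i)

lemma poch_succ (q y : A) (t : ℕ) : poch q y (t + 1) = poch q y t * (1 - y * q ^ t) :=
  Finset.prod_range_succ ..

lemma poch_succ' (q y : A) (t : ℕ) : poch q y (t + 1) = (1 - y) * poch q (y * q) t := by
  rw [poch, Finset.prod_range_succ', mul_comm, poch]
  congr 1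
  · simp
  · exact Finset.prod_congr rfl fun i _ => by ring

lemma poch_one_of_pos (q : A) {t : ℕ} (ht : 1 ≤ t) : poch q 1 t = 0 := by
  obtain ⟨s, rfl⟩ := Nat.exists_eq_add_of_le' ht
  rw [poch_succ']; simp

lemma poch_zero_right (q : A) (t : ℕ) : poch q 0 t = 1 := by simp [poch]

lemma poch_add (q y : A) (s t : ℕ) : poch q y (s + t) = poch q y s * poch q (y * q ^ s) t := by
  rw [poch, Finset.prod_range_add, poch, poch]
  congr 1
  exact Finset.prod_congr rfl fun i _ => by ring

lemma phiQ_one (q : A) : phiQ q 1 = 1 := by simp [phiQ, poch]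

lemma phiQ_add (q : A) {s : ℕ} (hs : 1 ≤ s) (t : ℕ) :
    phiQ q (s + t) = phiQ q s * poch q (q ^ s) t := by
  obtain ⟨s, rfl⟩ := Nat.exists_eq_add_of_le' hs
  rw [phiQ, phiQ, show s + 1 + t - 1 = s + t by omega, poch_add]
  simp [pow_succ']

lemma phiQ_succ (q : A) {s : ℕ} (hs : 1 ≤ s) : phiQ q (s + 1) = phiQ q s * (1 - q ^ s) := by
  rw [phiQ_add q hs]; simp [poch]

lemma phiQ_two_mul (q : A) {t : ℕ} (ht : 1 ≤ t) :
    phiQ q (2 * t) = phiQ (q ^ 2) t * poch (q ^ 2) q t := by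
  induction t, ht using Nat.le_induction with
  | base => simp [phiQ, poch]
  | succ t ht ih =>
    rw [show 2 * (t + 1) = 2 * t + 1 + 1 by ring, phiQ_succ _ (by omega), phiQ_succ _ (by omega), ih,
      phiQ_succ _ ht, poch_succ]
    ring

lemma glOrd_succ (q : A) (a : ℕ) :
    glOrd q (a + 1) = (q ^ (a + 1) - 1) * q ^ a * glOrd q a := by
  rw [glOrd, Finset.prod_range_succ']
  rw [Finset.prod_congr rfl (g := fun i => q * (q ^ a - q ^ i)) fun i _ => by ring]
  rw [Finset.prod_mul_distrib, Finset.prod_const, Finset.card_range, glOrd]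
  ring

lemma map_poch {B : Type} [CommRing B] (f : A →+* B) (q y : A) (t : ℕ) :
    f (poch q y t) = poch (f q) (f y) t := by
  simp [poch, map_prod]

lemma map_phiQ {B : Type} [CommRing B] (f : A →+* B) (q : A) (t : ℕ) :
    f (phiQ q t) = phiQ (f q) t := map_poch ..

lemma map_glOrd {B : Type} [CommRing B] (f : A →+* B) (q : A) (t : ℕ) :
    f (glOrd q t) = glOrd (f q) t := by
  simp [glOrd, map_prod]

variable {K : Type} [Field K] [Finite K] {V : Type} [AddCommGroup V] [Module K V] [Finite V]

local notation "Q" => ((Nat.card K : ℕ) : A)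

lemma nilSum_congr_le {f g : ℕ → A} (h : ∀ t, t ≤ Module.finrank K V → f t = g t) :
    nilSum K V f = nilSum K V g :=
  Finset.sum_congr rfl fun _ _ => h _ (Submodule.finrank_le _)

lemma nilSum_pow_sub_one_mul_poch {a : ℕ} {W : Type} [AddCommGroup W] [Module K W] [Finite W]
    (hW : Module.finrank K W = a) (hV : Module.finrank K V = a + 1) (y : A) :
    nilSum K V (fun t => (Q ^ t - 1) * poch Q y t) =
      (Q ^ (a + 1) - 1) * Q ^ a * (1 - y) * nilSum K W (poch Q y) := by
  rw [nilSum_succ (W := W) (by rw [hV, hW]), hV, hW]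
  rw [nilSum_congr_le (K := K) (V := W) (g := fun s => (Q ^ a * (1 - y)) * poch Q y s),
    nilSum_const_mul]
  · ring
  intro s hs
  rw [hW] at hs
  obtain ⟨b, rfl⟩ := Nat.exists_eq_add_of_le hs
  rw [poch_succ, Nat.add_sub_cancel_left]
  ring

lemma poch_shift (q y : A) (t : ℕ) :
    (1 - y) * poch q (y * q) t = (1 - y) * poch q y t - y * ((q ^ t - 1) * poch q y t) := by
  rw [← poch_succ', poch_succ]; ring

lemma nilSum_poch_mul_natCard {a : ℕ} {W : Type} [AddCommGroup W] [Module K W] [Finite W]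
    (hW : Module.finrank K W = a) (hV : Module.finrank K V = a + 1) (y : A) :
    nilSum K V (poch Q (y * Q)) =
      nilSum K V (poch Q y) - y * ((Q ^ (a + 1) - 1) * Q ^ a) * nilSum K W (poch Q y) := by
  let f : ℤ[X] →+* A := Polynomial.eval₂RingHom (Int.castRingHom A) y
  have hX : f X = y := by simp [f]
  have key : nilSum K V (poch ((Nat.card K : ℕ) : ℤ[X]) ((X : ℤ[X]) * ((Nat.card K : ℕ) : ℤ[X]))) =
      nilSum K V (poch ((Nat.card K : ℕ) : ℤ[X]) X) - X * ((((Nat.card K : ℕ) : ℤ[X]) ^ (a + 1) - 1) *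
        ((Nat.card K : ℕ) : ℤ[X]) ^ a) * nilSum K W (poch ((Nat.card K : ℕ) : ℤ[X]) X) := by
    have h1 : (1 - X : ℤ[X]) ≠ 0 := by
      rw [sub_ne_zero]
      intro h
      have := congrArg (Polynomial.coeff · 1) h
      simp [Polynomial.coeff_one] at this
    apply mul_left_cancel₀ h1
    rw [← nilSum_const_mul]
    simp only [poch_shift]
    rw [nilSum_sub, nilSum_const_mul, nilSum_const_mul, nilSum_pow_sub_one_mul_poch hW hV]
    ring
  have := congrArg f key
  simpa only [map_sub, map_mul, map_nilSum, map_poch, map_pow, map_natCast, map_one, hX] using this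

lemma nilSum_poch_one (hV : 1 ≤ Module.finrank K V) : nilSum K V (poch Q 1) = 0 := by
  rw [nilSum_congr_fun hV (g := fun _ => 0 * 0) fun t ht _ => by rw [poch_one_of_pos _ ht]; simp,
    nilSum_const_mul, zero_mul]

lemma nilSum_poch_pow_of_lt {s : ℕ} : ∀ {V : Type} [AddCommGroup V] [Module K V] [Finite V],
    s < Module.finrank K V → nilSum K V (poch Q (Q ^ s)) = 0 := by
  induction s with
  | zero => intro V _ _ _ h; rw [pow_zero]; exact nilSum_poch_one h
  | succ s ih =>
    intro V _ _ _ h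
    have hW : Module.finrank K (Fin (Module.finrank K V - 1) → K) = Module.finrank K V - 1 := by simp
    rw [pow_succ, nilSum_poch_mul_natCard hW (by omega), ih (by omega), ih (by omega)]
    simp

lemma nilSum_poch_pow_succ {a : ℕ} {W : Type} [AddCommGroup W] [Module K W] [Finite W]
    (hW : Module.finrank K W = a) (hV : Module.finrank K V = a + 1) :
    nilSum K V (poch Q (Q ^ (a + 1))) =
      - (Q ^ (2 * a) * (Q ^ (a + 1) - 1)) * nilSum K W (poch Q (Q ^ a)) := by
  rw [pow_succ, nilSum_poch_mul_natCard hW hV, nilSum_poch_pow_of_lt (by omega)]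
  ring

lemma phiQ_mul_nilSum_poch {a : ℕ} (ha : 1 ≤ a) :
    phiQ Q a * nilSum K (Fin a → K) (poch Q (Q ^ a)) * (Q ^ a - 1) = - glOrd Q a ^ 2 := by
  induction a, ha using Nat.le_induction with
  | base =>
    rw [phiQ_one, nilSum_of_finrank_eq_one (by simp)]
    simp [poch, glOrd]; ring
  | succ a ha ih =>
    rw [nilSum_poch_pow_succ (W := Fin a → K) (by simp) (by simp), phiQ_succ _ ha, glOrd_succ]
    linear_combination (Q ^ (a + 1) - 1) ^ 2 * Q ^ (2 * a) * ih

open Classical in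
lemma nilSum_eq_apply_finrank {g : ℕ → A} (h : ∀ t, 1 ≤ t → t < Module.finrank K V → g t = 0)
    (hV : 1 ≤ Module.finrank K V) : nilSum K V g = g (Module.finrank K V) := by
  have : Nontrivial V := Module.finrank_pos_iff.1 hV
  rw [nilSum, Finset.sum_eq_single 0]
  · rw [LinearMap.ker_zero, finrank_top]
  · intro ν hν h0
    simp only [Finset.mem_filter, Finset.mem_univ, true_and] at hν
    refine h _ (finrank_ker_pos_of_isNilpotent hν) (Submodule.finrank_lt ?_)
    rwa [Ne, LinearMap.ker_eq_top]
  · intro h; exact absurd (by simp) h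

/-- The sum of `phiQ` over pairs of nilpotent endomorphisms. -/
noncomputable def nilSumPair (K V W A : Type) [Field K] [AddCommGroup V] [Module K V] [Finite V]
    [AddCommGroup W] [Module K W] [Finite W] [CommRing A] : A :=
  nilSum K V fun t => nilSum K W fun s => phiQ ((Nat.card K : ℕ) : A) (t + s)

lemma nilSumPair_comm {W : Type} [AddCommGroup W] [Module K W] [Finite W] :
    nilSumPair K V W A = nilSumPair K W V A := by
  rw [nilSumPair, nilSumPair, nilSum]
  simp only [nilSum]
  rw [Finset.sum_comm]
  simp only [add_comm]

lemma nilSumPair_eq {W : Type} [AddCommGroup W] [Module K W] [Finite W]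
    (hV : 1 ≤ Module.finrank K V) :
    nilSumPair K V W A = nilSum K V fun t => phiQ Q t * nilSum K W (poch Q (Q ^ t)) := by
  refine nilSum_congr_fun hV fun t ht _ => ?_
  rw [← nilSum_const_mul]
  exact nilSum_congr_le fun s _ => phiQ_add _ ht s

lemma nilSumPair_eq_zero_of_lt {W : Type} [AddCommGroup W] [Module K W] [Finite W]
    (hV : 1 ≤ Module.finrank K V) (h : Module.finrank K V < Module.finrank K W) :
    nilSumPair K V W A = 0 := by
  rw [nilSumPair_eq hV, nilSum_congr_le (g := fun _ => 0 * 0), nilSum_const_mul, zero_mul]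
  intro t ht
  rw [nilSum_poch_pow_of_lt (by omega)]
  ring

lemma nilSumPair_eq_zero {W : Type} [AddCommGroup W] [Module K W] [Finite W]
    (hV : 1 ≤ Module.finrank K V) (hW : 1 ≤ Module.finrank K W)
    (h : Module.finrank K V ≠ Module.finrank K W) : nilSumPair K V W A = 0 := by
  rcases lt_or_gt_of_ne h with h | h
  · exact nilSumPair_eq_zero_of_lt hV h
  · rw [nilSumPair_comm]; exact nilSumPair_eq_zero_of_lt hW h

lemma nilSumPair_self {W : Type} [AddCommGroup W] [Module K W] [Finite W] {a : ℕ} (ha : 1 ≤ a)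
    (hV : Module.finrank K V = a) (hW : Module.finrank K W = a) :
    nilSumPair K V W A * (Q ^ a - 1) = - glOrd Q a ^ 2 := by
  rw [nilSumPair_eq (by omega), nilSum_eq_apply_finrank, hV, nilSum_congr (W := Fin a → K) (by simp [hW]),
    phiQ_mul_nilSum_poch ha]
  · intro t _ ht
    rw [nilSum_poch_pow_of_lt (by omega), mul_zero]
  · omega

lemma nilSum_pow_sub_one_mul_phiQ_mul_poch (y : A) {a : ℕ} (ha : 1 ≤ a) :
    nilSum K (Fin a → K) (fun t => (Q ^ t - 1) * (phiQ Q t * poch Q y t)) =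
      y ^ (a - 1) * (1 - y) * glOrd Q a := by
  induction a, ha using Nat.le_induction with
  | base =>
    rw [nilSum_of_finrank_eq_one (by simp)]
    simp [poch, glOrd, phiQ]; ring
  | succ a ha ih =>
    rw [nilSum_succ (W := Fin a → K) (by simp)]
    rw [nilSum_congr_fun (g := fun s => (y * Q ^ a) * ((Q ^ s - 1) * (phiQ Q s * poch Q y s)))
      (by rw [Module.finrank_fin_fun]; exact ha), nilSum_const_mul, ih, glOrd_succ]
    · obtain ⟨b, rfl⟩ := Nat.exists_eq_add_of_le' ha
      simp
      ring
    · intro s hs hs'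
      simp only [Module.finrank_fin_fun] at hs' ⊢
      obtain ⟨b, rfl⟩ := Nat.exists_eq_add_of_le hs'
      rw [poch_succ, phiQ_succ _ hs, Nat.add_sub_cancel_left]
      ring

lemma nilSum_phiQ_mul_poch_mul_natCard (y : A) {a : ℕ} (ha : 1 ≤ a) :
    nilSum K (Fin a → K) (fun t => phiQ Q t * poch Q (y * Q) t) =
      nilSum K (Fin a → K) (fun t => phiQ Q t * poch Q y t) - y ^ a * glOrd Q a := by
  let f : ℤ[X] →+* A := Polynomial.eval₂RingHom (Int.castRingHom A) y
  have hX : f X = y := by simp [f]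
  have key : nilSum K (Fin a → K) (fun t => phiQ ((Nat.card K : ℕ) : ℤ[X]) t *
        poch ((Nat.card K : ℕ) : ℤ[X]) ((X : ℤ[X]) * ((Nat.card K : ℕ) : ℤ[X])) t) =
      nilSum K (Fin a → K) (fun t => phiQ ((Nat.card K : ℕ) : ℤ[X]) t *
        poch ((Nat.card K : ℕ) : ℤ[X]) X t) - X ^ a * glOrd ((Nat.card K : ℕ) : ℤ[X]) a := by
    have h1 : (1 - X : ℤ[X]) ≠ 0 := by
      rw [sub_ne_zero]
      intro h
      have := congrArg (Polynomial.coeff · 1) h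
      simp [Polynomial.coeff_one] at this
    apply mul_left_cancel₀ h1
    rw [← nilSum_const_mul]
    simp only [mul_left_comm (1 - X : ℤ[X]), poch_shift, mul_sub]
    rw [nilSum_sub, nilSum_congr_le (f := fun t => phiQ ((Nat.card K : ℕ) : ℤ[X]) t * (X * _))
      (g := fun t => X * ((((Nat.card K : ℕ) : ℤ[X]) ^ t - 1) * (phiQ ((Nat.card K : ℕ) : ℤ[X]) t *
        poch ((Nat.card K : ℕ) : ℤ[X]) X t))) fun t _ => by ring, nilSum_const_mul,
      nilSum_pow_sub_one_mul_phiQ_mul_poch _ ha]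
    obtain ⟨b, rfl⟩ := Nat.exists_eq_add_of_le' ha
    rw [Nat.add_sub_cancel, ← nilSum_const_mul]
    simp only [mul_left_comm (1 - X : ℤ[X])]
    ring
  have := congrArg f key
  simpa only [map_sub, map_mul, map_nilSum, map_poch, map_phiQ, map_glOrd, map_pow, map_natCast,
    map_one, hX] using this

lemma nilSum_phiQ_mul_poch (y : A) {a : ℕ} (ha : 1 ≤ a) (hV : Module.finrank K V = a) :
    (Q ^ a - 1) * nilSum K V (fun t => phiQ Q t * poch Q y t) = (1 - y ^ a) * glOrd Q a := by
  rw [nilSum_congr (W := Fin a → K) (by simp [hV])]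
  let f : ℤ[X] →+* A := Polynomial.eval₂RingHom (Int.castRingHom A) y
  have hX : f X = y := by simp [f]
  let M : ℤ[X] → ℤ[X] := fun z => nilSum K (Fin a → K) (fun t => phiQ ((Nat.card K : ℕ) : ℤ[X]) t *
        poch ((Nat.card K : ℕ) : ℤ[X]) z t)
  let P : ℤ[X] := (((Nat.card K : ℕ) : ℤ[X]) ^ a - 1) * M X + X ^ a * glOrd ((Nat.card K : ℕ) : ℤ[X]) a
  have hcomp : P.comp (C ((Nat.card K : ℕ) : ℤ) * X) = P := by
    have h1 : (M X).comp (C ((Nat.card K : ℕ) : ℤ) * X) = M ((X : ℤ[X]) * ((Nat.card K : ℕ) : ℤ[X])) := by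
      change Polynomial.compRingHom _ _ = _
      simp only [M, map_nilSum, map_mul, map_phiQ, map_poch, map_natCast]
      simp [mul_comm]
    have h2 : (glOrd ((Nat.card K : ℕ) : ℤ[X]) a).comp (C ((Nat.card K : ℕ) : ℤ) * X) =
        glOrd ((Nat.card K : ℕ) : ℤ[X]) a := by
      change Polynomial.compRingHom _ _ = _
      simp only [map_glOrd, map_natCast]
    have h3 : M ((X : ℤ[X]) * ((Nat.card K : ℕ) : ℤ[X])) = _ := nilSum_phiQ_mul_poch_mul_natCard (X : ℤ[X]) ha
    simp only [P, add_comp, mul_comp, sub_comp, pow_comp, natCast_comp, one_comp, X_comp, h1, h2, h3]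
    simp only [M, map_natCast]
    ring
  have hcoeff : ∀ i, i ≠ 0 → P.coeff i = 0 := by
    intro i hi
    have h1 := congrArg (Polynomial.coeff · i) hcomp
    simp only [Polynomial.comp_C_mul_X_coeff] at h1
    have h2 : (1 : ℤ) < ((Nat.card K : ℕ) : ℤ) ^ i :=
      one_lt_pow₀ (by exact_mod_cast Finite.one_lt_card) hi
    by_contra h
    have h3 := mul_left_cancel₀ h (h1.trans (mul_one _).symm)
    omega
  have hP : P = C (P.coeff 0) := by
    ext i
    rw [coeff_C]
    split_ifs with h
    · rw [h]
    · exact hcoeff i h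
  have hP1 : P.eval 1 = glOrd ((Nat.card K : ℕ) : ℤ) a := by
    have h1 : (M X).eval 1 = 0 := by
      change Polynomial.evalRingHom _ _ = _
      simp only [M, map_nilSum, map_mul, map_phiQ, map_poch, map_natCast]
      rw [nilSum_congr_fun (by rw [Module.finrank_fin_fun]; exact ha) (g := fun _ => 0 * 0), nilSum_const_mul, zero_mul]
      intro t ht _
      simp [poch_one_of_pos _ ht]
    have h2 : (glOrd ((Nat.card K : ℕ) : ℤ[X]) a).eval 1 = glOrd ((Nat.card K : ℕ) : ℤ) a := by
      change Polynomial.evalRingHom _ _ = _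
      simp only [map_glOrd, map_natCast]
    simp only [P, eval_add, eval_mul, h1, h2, eval_pow, eval_X]
    ring
  have hP2 : P = glOrd ((Nat.card K : ℕ) : ℤ[X]) a := by
    rw [hP, eval_C] at hP1
    rw [hP, hP1, ← map_natCast (C : ℤ →+* ℤ[X]), ← map_glOrd]
  have := congrArg f hP2
  simp only [P, M, map_sub, map_add, map_mul, map_nilSum, map_poch, map_phiQ, map_glOrd, map_pow,
    map_natCast, map_one, hX] at this
  linear_combination this

lemma nilSum_phiQ {a : ℕ} (ha : 1 ≤ a) (hV : Module.finrank K V = a) :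
    (Q ^ a - 1) * nilSum K V (phiQ Q) = glOrd Q a := by
  have := nilSum_phiQ_mul_poch (A := A) 0 ha hV
  simpa [poch_zero_right, Nat.one_le_iff_ne_zero.1 ha] using this

end QSeries

section CuspFun

variable {K : Type} [Field K] [Finite K] {V : Type} [AddCommGroup V] [Module K V] [Finite V]
  {F : Type} [Field F]

open Classical in
lemma sum_addChar_dual {ψ : AddChar K F} (hψ : ψ ≠ 1) (U : Submodule K V) (w : V) :
    ∑ η : Module.Dual K V with (∀ u ∈ U, η u = 0), ψ (η w) =
      if w ∈ U then ((Nat.card K : ℕ) : F) ^ (Module.finrank K V - Module.finrank K U) else 0 := by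
  split_ifs with hw
  · rw [Finset.sum_congr rfl (g := fun _ => 1) fun η hη => by
      rw [(Finset.mem_filter.1 hη).2 w hw, AddChar.map_zero_eq_one], Finset.sum_const, nsmul_one]
    have h1 : (Finset.univ.filter fun η : Module.Dual K V => ∀ u ∈ U, η u = 0).card =
        Nat.card U.dualAnnihilator := by
      rw [← Fintype.card_subtype, ← Nat.card_eq_fintype_card]
      exact Nat.card_congr (Equiv.subtypeEquivRight fun η => (Submodule.mem_dualAnnihilator η).symm)
    rw [h1, Module.natCard_eq_pow_finrank (K := K)]
    push_cast
    congr 1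
    have := Subspace.finrank_add_finrank_dualAnnihilator_eq U
    omega
  · obtain ⟨η, h1, h2⟩ := Submodule.exists_le_ker_of_notMem hw
    obtain ⟨t, ht⟩ : ∃ t, ψ (η w * t) ≠ 1 := by
      by_contra! h; exact h1 (AddChar.eq_zero_of_forall_mul hψ h)
    have h3 : ∑ η : Module.Dual K V with (∀ u ∈ U, η u = 0), ψ (η w) =
        ψ (η w * t) * ∑ η : Module.Dual K V with (∀ u ∈ U, η u = 0), ψ (η w) := by
      rw [Finset.mul_sum]
      symm
      refine Finset.sum_equiv (Equiv.addLeft (t • η)) (fun θ => ?_) fun θ _ => ?_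
      · simp only [Finset.mem_filter, Finset.mem_univ, true_and, Equiv.coe_addLeft,
          LinearMap.add_apply, LinearMap.smul_apply]
        refine forall₂_congr fun u hu => ?_
        rw [LinearMap.mem_ker.1 (h2 hu)]
        simp
      · rw [← AddChar.map_add_eq_mul]
        simp [mul_comm]
    have h4 : (ψ (η w * t) - 1) * ∑ η : Module.Dual K V with (∀ u ∈ U, η u = 0), ψ (η w) = 0 := by
      rw [sub_mul, ← h3]; ring
    exact (mul_eq_zero.1 h4).resolve_left (sub_ne_zero.2 ht)

open Classical in
/-- Functions on nilpotent endomorphisms with image in `ker ξ` which are invariant under the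
stabilizer of `ξ` and cuspidal with respect to the subspaces of `ker ξ`. -/
structure IsCuspFun (ξ : Module.Dual K V) (f : Module.End K V → F) : Prop where
  inv : ∀ h : V ≃ₗ[K] V, (∀ v, ξ (h v) = ξ v) → ∀ ν : Module.End K V, IsNilpotent ν →
    (∀ v, ξ (ν v) = 0) → f (h.conj ν) = f ν
  cusp : ∀ W : Submodule K V, W ≠ ⊥ → (∀ w ∈ W, ξ w = 0) → ∀ ν : Module.End K V, IsNilpotent ν →
    (∀ v, ξ (ν v) = 0) → (∀ w ∈ W, ν w ∈ W) →
      ∑ θ : Module.End K V with (∀ w ∈ W, θ w = 0) ∧ (∀ v, θ v ∈ W), f (ν + θ) = 0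

variable {ξ : Module.Dual K V} {z : V} {hz : ξ z = 1} {μ : Module.End K (LinearMap.ker ξ)}
  {w : LinearMap.ker ξ} {f : Module.End K V → F} {ψ : AddChar K F}

/-- The partial Fourier transform of a function on endomorphisms with image in `ker ξ`. -/
noncomputable def partialFourier (hz : ξ z = 1) (ψ : AddChar K F) (f : Module.End K V → F)
    (η : Module.Dual K (LinearMap.ker ξ)) (μ : Module.End K (LinearMap.ker ξ)) : F :=
  ∑ w, f (hypExt ξ z hz μ w) * ψ (η w)

/-- The automorphism `v ↦ v + ξ(v) u` for `u` in `ker ξ`. -/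
def shearEquiv (ξ : Module.Dual K V) (u : V) (hu : ξ u = 0) : V ≃ₗ[K] V :=
  LinearEquiv.ofLinearMap (LinearMap.id + ξ.smulRight u) (LinearMap.id - ξ.smulRight u)
    (LinearMap.ext fun v => by simp [hu]) (LinearMap.ext fun v => by simp [hu])

lemma hypExt_add (μ' : Module.End K (LinearMap.ker ξ)) (w' : LinearMap.ker ξ) :
    hypExt ξ z hz (μ + μ') (w + w') = hypExt ξ z hz μ w + hypExt ξ z hz μ' w' := by
  refine end_ext_ker hz (fun x => ?_) ?_
  · rw [LinearMap.add_apply, hypExt_ker, hypExt_ker, hypExt_ker]; simp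
  · rw [LinearMap.add_apply, hypExt_self, hypExt_self, hypExt_self]; simp

lemma hypExt_zero_zero : hypExt ξ z hz 0 0 = 0 := by
  refine end_ext_ker hz (fun x => ?_) ?_
  · rw [hypExt_ker]; simp
  · rw [hypExt_self]; simp

lemma IsCuspFun.apply_hypExt_sub (hf : IsCuspFun ξ f) (hμ : IsNilpotent μ) (u : LinearMap.ker ξ) :
    f (hypExt ξ z hz μ (w - μ u)) = f (hypExt ξ z hz μ w) := by
  have hu : ξ u = 0 := u.2
  rw [← hf.inv (shearEquiv ξ u hu) (fun v => by simp [shearEquiv, hu]) (hypExt ξ z hz μ w)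
    (isNilpotent_hypExt.2 hμ) apply_hypExt]
  congr 1
  symm
  have hsymm : ∀ v, (shearEquiv ξ u hu).symm v = v - ξ v • (u : V) := fun v => rfl
  have happ : ∀ v, shearEquiv ξ u hu v = v + ξ v • (u : V) := fun v => rfl
  refine end_ext_ker hz (fun x => ?_) ?_
  · rw [LinearEquiv.conj_apply_apply, hsymm, happ, LinearMap.mem_ker.1 x.2, zero_smul, sub_zero,
      apply_hypExt, zero_smul, add_zero, hypExt_ker, hypExt_ker]
  · rw [LinearEquiv.conj_apply_apply, hsymm, happ, hz, one_smul, map_sub, hypExt_self, hypExt_self,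
      hypExt_ker]
    simp

lemma IsCuspFun.partialFourier_eq_zero (hf : IsCuspFun ξ f) (hψ : ψ ≠ 1) (hμ : IsNilpotent μ)
    {η : Module.Dual K (LinearMap.ker ξ)} (hη : ¬ ∀ v, η (μ v) = 0) :
    partialFourier hz ψ f η μ = 0 := by
  obtain ⟨u, hu⟩ := not_forall.1 hη
  obtain ⟨t, ht⟩ : ∃ t, ψ (η (μ u) * t) ≠ 1 := by
    by_contra! h; exact hu (AddChar.eq_zero_of_forall_mul hψ h)
  have h1 : partialFourier hz ψ f η μ = ψ (η (μ u) * t) * partialFourier hz ψ f η μ := by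
    rw [partialFourier, Finset.mul_sum]
    refine Fintype.sum_equiv (Equiv.subRight (μ (t • u))) _ _ fun w => ?_
    rw [Equiv.subRight_apply, hf.apply_hypExt_sub hμ, mul_left_comm, ← AddChar.map_add_eq_mul]
    congr 2
    simp [mul_comm]
  have h2 : (ψ (η (μ u) * t) - 1) * partialFourier hz ψ f η μ = 0 := by rw [sub_mul, ← h1]; ring
  exact (mul_eq_zero.1 h2).resolve_left (sub_ne_zero.2 ht)

lemma IsCuspFun.partialFourier_zero (hf : IsCuspFun ξ f) (hμ : IsNilpotent μ)
    (hW : LinearMap.ker ξ ≠ ⊥) : partialFourier hz ψ f 0 μ = 0 := by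
  have h := hf.cusp (LinearMap.ker ξ) hW (fun w hw => hw) (hypExt ξ z hz μ 0)
    (isNilpotent_hypExt.2 hμ) apply_hypExt (fun w _ => apply_hypExt w)
  refine Eq.trans ?_ h
  simp only [partialFourier, LinearMap.zero_apply, AddChar.map_zero_eq_one, mul_one]
  refine Finset.sum_bij (fun w _ => hypExt ξ z hz 0 w) ?_ ?_ ?_ ?_
  · intro w _
    simp only [Finset.mem_filter, Finset.mem_univ, true_and]
    refine ⟨fun x hx => ?_, fun v => apply_hypExt v⟩
    rw [show x = ((⟨x, hx⟩ : LinearMap.ker ξ) : V) from rfl, hypExt_ker]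
    simp
  · intro w _ w' _ e; exact (hypExt_injective e).2
  · intro θ hθ
    simp only [Finset.mem_filter, Finset.mem_univ, true_and] at hθ
    refine ⟨⟨θ z, hθ.2 z⟩, Finset.mem_univ _, end_ext_ker hz (fun x => ?_) ?_⟩
    · rw [hypExt_ker, hθ.1 x x.2]; simp
    · rw [hypExt_self]
  · intro w _; rw [← hypExt_add]; simp

/-- The extension of an automorphism of `ker ξ` fixing `z`. -/
def extEquiv (hz : ξ z = 1) (h : LinearMap.ker ξ ≃ₗ[K] LinearMap.ker ξ) : V ≃ₗ[K] V :=
  LinearEquiv.ofLinearMap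
    ((LinearMap.ker ξ).subtype ∘ₗ h.toLinearMap ∘ₗ kerProj ξ z hz + ξ.smulRight z)
    ((LinearMap.ker ξ).subtype ∘ₗ h.symm.toLinearMap ∘ₗ kerProj ξ z hz + ξ.smulRight z)
    (end_ext_ker hz (fun x => by simp [kerProj_ker, LinearMap.mem_ker.1 (Subtype.prop _)])
      (by simp [kerProj_self, hz]))
    (end_ext_ker hz (fun x => by simp [kerProj_ker, LinearMap.mem_ker.1 (Subtype.prop _)])
      (by simp [kerProj_self, hz]))

lemma extEquiv_ker (h : LinearMap.ker ξ ≃ₗ[K] LinearMap.ker ξ) (x : LinearMap.ker ξ) :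
    extEquiv hz h x = h x := by
  simp [extEquiv, kerProj_ker, LinearMap.mem_ker.1 x.2]

lemma extEquiv_self (h : LinearMap.ker ξ ≃ₗ[K] LinearMap.ker ξ) : extEquiv hz h z = z := by
  simp [extEquiv, kerProj_self, hz]

lemma apply_extEquiv (h : LinearMap.ker ξ ≃ₗ[K] LinearMap.ker ξ) (v : V) :
    ξ (extEquiv hz h v) = ξ v := by
  simp [extEquiv, hz, LinearMap.mem_ker.1 (Subtype.prop _)]

lemma extEquiv_conj (h : LinearMap.ker ξ ≃ₗ[K] LinearMap.ker ξ) :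
    (extEquiv hz h).conj (hypExt ξ z hz μ w) = hypExt ξ z hz (h.conj μ) (h w) := by
  refine end_ext_ker hz (fun x => ?_) ?_
  · obtain ⟨y, rfl⟩ := h.surjective x
    rw [← extEquiv_ker (hz := hz), LinearEquiv.conj_apply_apply, LinearEquiv.symm_apply_apply,
      extEquiv_ker, hypExt_ker, hypExt_ker, extEquiv_ker, LinearEquiv.conj_apply_apply,
      LinearEquiv.symm_apply_apply]
  · rw [hypExt_self, LinearEquiv.conj_apply_apply]
    rw [show (extEquiv hz h).symm z = z by rw [LinearEquiv.symm_apply_eq, extEquiv_self], hypExt_self,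
      extEquiv_ker]

lemma IsCuspFun.partialFourier_conj (hf : IsCuspFun ξ f) (hμ : IsNilpotent μ)
    {η η' : Module.Dual K (LinearMap.ker ξ)}
    (h : LinearMap.ker ξ ≃ₗ[K] LinearMap.ker ξ) (hη : ∀ v, η (h v) = η' v) :
    partialFourier hz ψ f η (h.conj μ) = partialFourier hz ψ f η' μ := by
  rw [partialFourier, partialFourier]
  symm
  refine Fintype.sum_equiv h.toEquiv _ _ fun w => ?_
  rw [LinearEquiv.coe_toEquiv, ← extEquiv_conj, hη,
    hf.inv _ (apply_extEquiv h) _ (isNilpotent_hypExt.2 hμ) apply_hypExt]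

lemma sum_add_right {M : Type} [AddCommGroup M] {_ : Fintype M} (a : M) (g : M → F) :
    ∑ w, g w = ∑ w, g (w + a) := (Equiv.sum_comp (Equiv.addRight a) g).symm

lemma IsCuspFun.partialFourier_isCuspFun [CharZero F] (hf : IsCuspFun ξ f)
    (η : Module.Dual K (LinearMap.ker ξ)) : IsCuspFun η (partialFourier hz ψ f η) where
  inv h hη ν hν _ := hf.partialFourier_conj hν h hη
  cusp W hW hWη ν hν hνη hνW := by
    classical
    have hcard : (Fintype.card W : F) ≠ 0 := Nat.cast_ne_zero.2 Fintype.card_ne_zero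
    refine ((mul_eq_zero (a := (Fintype.card W : F))).1 ?_).resolve_left hcard
    simp only [partialFourier]
    rw [Finset.sum_comm, ← nsmul_eq_mul, ← Finset.card_univ, ← Finset.sum_const]
    refine (Finset.sum_congr rfl fun (w'' : W) _ =>
      sum_add_right (F := F) (w'' : LinearMap.ker ξ) _).trans ?_
    rw [Finset.sum_comm]
    refine Finset.sum_eq_zero fun w _ => ?_
    rw [Finset.sum_comm]
    have hstab : ∀ v ∈ W.map (LinearMap.ker ξ).subtype, hypExt ξ z hz ν w v ∈
        W.map (LinearMap.ker ξ).subtype := by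
      rintro _ ⟨x, hx, rfl⟩
      rw [Submodule.subtype_apply, hypExt_ker]
      exact ⟨ν x, hνW x hx, rfl⟩
    have h2 := hf.cusp (W.map (LinearMap.ker ξ).subtype)
      (fun h => hW (Submodule.map_injective_of_injective (Submodule.injective_subtype _)
        (h.trans (Submodule.map_bot _).symm)))
      (by rintro _ ⟨x, _, rfl⟩; exact x.2) (hypExt ξ z hz ν w) (isNilpotent_hypExt.2 hν)
      apply_hypExt hstab
    rw [← mul_zero (ψ (η w)), ← h2, Finset.mul_sum, ← Finset.sum_product']
    refine Finset.sum_bij (fun x _ => hypExt ξ z hz x.1 x.2) ?_ ?_ ?_ ?_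
    · rintro ⟨θ, w''⟩ h
      simp only [Finset.mem_product, Finset.mem_filter, Finset.mem_univ, true_and, and_true] at h ⊢
      refine ⟨?_, fun v => ?_⟩
      · rintro _ ⟨x, hx, rfl⟩
        rw [Submodule.subtype_apply, hypExt_ker, h.1 x hx]; rfl
      · rw [hypExt]
        exact ⟨(θ ∘ₗ kerProj ξ z hz + ξ.smulRight (w'' : LinearMap.ker ξ)) v,
          W.add_mem (h.2 _) (W.smul_mem _ w''.2), rfl⟩
    · rintro ⟨θ, w''⟩ _ ⟨θ', w'''⟩ _ e
      obtain ⟨e1, e2⟩ := hypExt_injective e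
      exact Prod.ext e1 (Subtype.ext e2)
    · intro θ hθ
      simp only [Finset.mem_filter, Finset.mem_univ, true_and] at hθ
      obtain ⟨θ', w', rfl⟩ := exists_eq_hypExt hz (ν := θ) fun v => by
        obtain ⟨x, _, hx⟩ := hθ.2 v
        rw [← hx]; exact x.2
      have h3 : ∀ {x : LinearMap.ker ξ}, (x : V) ∈ W.map (LinearMap.ker ξ).subtype → x ∈ W := by
        rintro x ⟨y, hy, hxy⟩
        rwa [← Subtype.ext hxy]
      have hw' : w' ∈ W := h3 (by rw [← hypExt_self (hz := hz) (μ := θ')]; exact hθ.2 z)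
      refine ⟨(θ', ⟨w', hw'⟩), ?_, rfl⟩
      simp only [Finset.mem_product, Finset.mem_filter, Finset.mem_univ, true_and, and_true]
      refine ⟨fun x hx => Subtype.ext ?_, fun x => h3 ?_⟩
      · rw [← hypExt_ker (hz := hz) (w := w'), hθ.1 (x : V) ⟨x, hx, rfl⟩]; rfl
      · rw [← hypExt_ker (hz := hz) (w := w')]; exact hθ.2 _
    · rintro ⟨θ, w''⟩ _
      rw [← hypExt_add, mul_comm, map_add, hWη w'' w''.2, add_zero]

lemma exists_equiv_dual_eq {η η' : Module.Dual K V} (h : η ≠ 0) (h' : η' ≠ 0) :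
    ∃ e : V ≃ₗ[K] V, ∀ v, η' (e v) = η v := by
  obtain ⟨u, hu, hu'⟩ : ∃ u, η u ≠ 0 ∧ η' u ≠ 0 := by
    obtain ⟨a, ha⟩ : ∃ a, η a ≠ 0 := by by_contra! h0; exact h (LinearMap.ext h0)
    obtain ⟨b, hb⟩ : ∃ b, η' b ≠ 0 := by by_contra! h0; exact h' (LinearMap.ext h0)
    by_cases ha' : η' a = 0
    · by_cases hb' : η b = 0
      · exact ⟨a + b, by simpa [hb'], by simpa [ha']⟩
      · exact ⟨b, hb', hb⟩
    · exact ⟨a, ha, ha'⟩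
  refine ⟨LinearEquiv.ofLinearMap (LinearMap.id + (η - η').smulRight ((η' u)⁻¹ • u))
    (LinearMap.id + (η' - η).smulRight ((η u)⁻¹ • u)) ?_ ?_, fun v => ?_⟩
  iterate 2
    refine LinearMap.ext fun v => ?_
    simp only [LinearMap.comp_apply, LinearMap.add_apply, LinearMap.id_apply,
      LinearMap.smulRight_apply, LinearMap.sub_apply, map_add, map_smul]
    match_scalars
    · field_simp
    · field_simp
      ring
  simp [hu']

end CuspFun

section CuspFunMain

variable {K : Type} [Field K] [Finite K] {F : Type} [Field F] {ψ : AddChar K F}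

lemma exists_apply_eq_one {V : Type} [AddCommGroup V] [Module K V] {ξ : Module.Dual K V}
    (hξ : ξ ≠ 0) : ∃ z, ξ z = 1 := by
  obtain ⟨v, hv⟩ : ∃ v, ξ v ≠ 0 := by
    by_contra! h; exact hξ (LinearMap.ext h)
  exact ⟨(ξ v)⁻¹ • v, by simp [hv]⟩

variable {V : Type} [AddCommGroup V] [Module K V] [Finite V]

/-- The zeroth values of the partial Fourier transform determine `f 0`. -/
lemma IsCuspFun.partialFourier_apply_zero [CharZero F] {ξ : Module.Dual K V} {z : V}
    {f : Module.End K V → F} (hf : IsCuspFun ξ f) (hψ : ψ ≠ 1) (hz : ξ z = 1)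
    (hW : LinearMap.ker ξ ≠ ⊥) {η : Module.Dual K (LinearMap.ker ξ)} (hη : η ≠ 0) :
    (((Nat.card K : ℕ) : F) ^ Module.finrank K (LinearMap.ker ξ) - 1) * partialFourier hz ψ f η 0 =
      ((Nat.card K : ℕ) : F) ^ Module.finrank K (LinearMap.ker ξ) * f 0 := by
  classical
  have h1 : ∀ η' : Module.Dual K (LinearMap.ker ξ), η' ≠ 0 →
      partialFourier hz ψ f η' 0 = partialFourier hz ψ f η 0 := by
    intro η' hη'
    obtain ⟨e, he⟩ := exists_equiv_dual_eq hη hη'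
    rw [← hf.partialFourier_conj IsNilpotent.zero e he, map_zero]
  have h2 : ∑ η' : Module.Dual K (LinearMap.ker ξ), partialFourier hz ψ f η' 0 =
      ((Nat.card K : ℕ) : F) ^ Module.finrank K (LinearMap.ker ξ) * f 0 := by
    simp only [partialFourier]
    rw [Finset.sum_comm]
    simp only [← Finset.mul_sum]
    have h3 : ∀ w : LinearMap.ker ξ, ∑ η' : Module.Dual K (LinearMap.ker ξ), ψ (η' w) =
        if w = 0 then ((Nat.card K : ℕ) : F) ^ Module.finrank K (LinearMap.ker ξ) else 0 := by
      intro w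
      have := sum_addChar_dual hψ ⊥ w
      rw [Finset.filter_true_of_mem (fun η' _ u hu => by
        rw [(Submodule.mem_bot K).1 hu, map_zero])] at this
      rw [this]
      simp
    rw [Finset.sum_eq_single 0]
    · rw [h3, if_pos rfl, hypExt_zero_zero, mul_comm]
    · intro w _ hw; rw [h3, if_neg hw, mul_zero]
    · intro h; exact absurd (Finset.mem_univ _) h
  rw [← Finset.sum_erase_add _ _ (Finset.mem_univ (0 : Module.Dual K (LinearMap.ker ξ))),
    hf.partialFourier_zero IsNilpotent.zero hW, add_zero,
    Finset.sum_congr rfl fun η' h => h1 η' (Finset.ne_of_mem_erase h), Finset.sum_const,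
    Finset.card_erase_of_mem (Finset.mem_univ _), Finset.card_univ, ← Nat.card_eq_fintype_card,
    Module.natCard_eq_pow_finrank (K := K), Subspace.dual_finrank_eq, nsmul_eq_mul,
    Nat.cast_sub (Nat.one_le_pow _ _ Nat.card_pos)] at h2
  push_cast at h2
  exact h2

lemma partialFourier_inversion [CharZero F] {ξ : Module.Dual K V} {z : V}
    {f : Module.End K V → F} (hψ : ψ ≠ 1) (hz : ξ z = 1)
    (μ : Module.End K (LinearMap.ker ξ)) (w : LinearMap.ker ξ) :
    ∑ η, partialFourier hz ψ f η μ * ψ (- η w) =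
      ((Nat.card K : ℕ) : F) ^ Module.finrank K (LinearMap.ker ξ) * f (hypExt ξ z hz μ w) := by
  classical
  simp only [partialFourier, Finset.sum_mul]
  rw [Finset.sum_comm]
  have h3 : ∀ w' : LinearMap.ker ξ, ∑ η : Module.Dual K (LinearMap.ker ξ),
      f (hypExt ξ z hz μ w') * ψ (η w') * ψ (- η w) =
        if w' = w then ((Nat.card K : ℕ) : F) ^ Module.finrank K (LinearMap.ker ξ) *
          f (hypExt ξ z hz μ w) else 0 := by
    intro w'
    have := sum_addChar_dual hψ ⊥ (w' - w)
    rw [Finset.filter_true_of_mem (fun η' _ u hu => by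
      rw [(Submodule.mem_bot K).1 hu, map_zero])] at this
    simp only [mul_assoc, ← Finset.mul_sum, ← AddChar.map_add_eq_mul, ← sub_eq_add_neg, ← map_sub]
    rw [this]
    simp only [Submodule.mem_bot, sub_eq_zero, finrank_bot, tsub_zero]
    split_ifs with h
    · rw [h, mul_comm]
    · rw [mul_zero]
  rw [Finset.sum_eq_single w]
  · rw [h3, if_pos rfl]
  · intro w' _ hw; rw [h3, if_neg hw]
  · intro h; exact absurd (by simp) h

theorem IsCuspFun.apply_eq [CharZero F] (hψ : ψ ≠ 1) (a : ℕ) :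
    ∀ {V : Type} [AddCommGroup V] [Module K V] [Finite V] {ξ : Module.Dual K V}
      {f : Module.End K V → F}, Module.finrank K V = a → ξ ≠ 0 → IsCuspFun ξ f →
      ∀ {ν : Module.End K V}, IsNilpotent ν → (∀ v, ξ (ν v) = 0) →
        phiQ ((Nat.card K : ℕ) : F) a * f ν =
          f 0 * phiQ ((Nat.card K : ℕ) : F) (Module.finrank K (LinearMap.ker ν)) := by
  induction a with
  | zero =>
    intro V _ _ _ ξ f hV hξ
    have := Module.finrank_zero_iff.1 hV
    exact absurd (LinearMap.ext fun v => by rw [Subsingleton.elim v 0, map_zero, map_zero]) hξ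
  | succ b ih =>
    intro V _ _ _ ξ f hV hξ hf ν hν hξν
    classical
    obtain ⟨z, hz⟩ := exists_apply_eq_one hξ
    have hW : Module.finrank K (LinearMap.ker ξ) = b := by
      have := finrank_ker_add_one hz; omega
    rcases Nat.eq_zero_or_pos b with rfl | hb
    · have h1 : ν = 0 := by
        have : Nontrivial V := (Module.finrank_pos_iff (R := K)).1 (by omega)
        have h1 := finrank_ker_pos_of_isNilpotent hν
        refine LinearMap.ker_eq_top.1 (Submodule.eq_top_of_finrank_eq ?_)
        have := Submodule.finrank_le (LinearMap.ker ν)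
        omega
      rw [h1, LinearMap.ker_zero, finrank_top, hV, mul_comm]
    · obtain ⟨μ, w, rfl⟩ := exists_eq_hypExt hz hξν
      have hμ := isNilpotent_hypExt.1 hν
      have hWb : LinearMap.ker ξ ≠ ⊥ := by
        intro h; rw [h, finrank_bot] at hW; omega
      have hQ : (1 : ℕ) < Nat.card K := Finite.one_lt_card
      have hQb : (((Nat.card K : ℕ) : F) ^ b - 1) ≠ 0 := by
        rw [sub_ne_zero]
        exact_mod_cast (one_lt_pow₀ hQ hb.ne').ne'
      have hQ0 : ((Nat.card K : ℕ) : F) ^ b ≠ 0 :=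
        pow_ne_zero _ (Nat.cast_ne_zero.2 (by omega))
      set s := Module.finrank K (LinearMap.ker μ) with hs
      have hs1 : 1 ≤ s := by
        have : Nontrivial (LinearMap.ker ξ) := (Module.finrank_pos_iff (R := K)).1 (by omega)
        exact finrank_ker_pos_of_isNilpotent hμ
      have h1 : ∀ η : Module.Dual K (LinearMap.ker ξ),
          (((Nat.card K : ℕ) : F) ^ b - 1) * (phiQ ((Nat.card K : ℕ) : F) b *
            partialFourier hz ψ f η μ) =
          if η ≠ 0 ∧ ∀ v, η (μ v) = 0 then ((Nat.card K : ℕ) : F) ^ b * f 0 *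
            phiQ ((Nat.card K : ℕ) : F) s else 0 := by
        intro η
        split_ifs with h
        · rw [ih hW h.1 (hf.partialFourier_isCuspFun η) hμ h.2, ← mul_assoc, ← hW,
            hf.partialFourier_apply_zero hψ hz hWb h.1, hs]
        · rw [not_and_or, not_not] at h
          rcases h with rfl | h
          · rw [hf.partialFourier_zero hμ hWb]; ring
          · rw [hf.partialFourier_eq_zero hψ hμ h]; ring
      have h2 : ∑ η : Module.Dual K (LinearMap.ker ξ), (if η ≠ 0 ∧ ∀ v, η (μ v) = 0 then
          ((Nat.card K : ℕ) : F) ^ b * f 0 * phiQ ((Nat.card K : ℕ) : F) s else 0) * ψ (- η w) =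
          ((Nat.card K : ℕ) : F) ^ b * f 0 * phiQ ((Nat.card K : ℕ) : F) s *
            ((if w ∈ LinearMap.range μ then ((Nat.card K : ℕ) : F) ^ s else 0) - 1) := by
        have h3 := sum_addChar_dual hψ (LinearMap.range μ) (- w)
        rw [← Finset.sum_erase_add (a := 0) _ _ (by simp)] at h3
        simp only [ite_mul, zero_mul]
        rw [← Finset.sum_filter, ← Finset.mul_sum]
        congr 1
        rw [eq_sub_iff_add_eq]
        have h4 : Module.finrank K (LinearMap.ker ξ) - Module.finrank K (LinearMap.range μ) = s := by
          have := LinearMap.finrank_range_add_finrank_ker μ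
          omega
        simp only [LinearMap.zero_apply, h4, neg_mem_iff, map_neg] at h3
        rw [← h3, neg_zero, AddChar.map_zero_eq_one]
        congr 1
        refine Finset.sum_congr ?_ fun _ _ => rfl
        ext η
        have h7 : (∀ v, η (μ v) = 0) ↔ ∀ u ∈ LinearMap.range μ, η u = 0 :=
          ⟨by rintro h _ ⟨v, rfl⟩; exact h v, fun h v => h _ ⟨v, rfl⟩⟩
        rw [Finset.mem_erase, Finset.mem_filter, Finset.mem_filter, h7]
        tauto
      have h5 := partialFourier_inversion (f := f) hψ hz μ w
      rw [hW] at h5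
      have h6 : (((Nat.card K : ℕ) : F) ^ b - 1) * (phiQ ((Nat.card K : ℕ) : F) b *
          (((Nat.card K : ℕ) : F) ^ b * f (hypExt ξ z hz μ w))) =
          ((Nat.card K : ℕ) : F) ^ b * f 0 * phiQ ((Nat.card K : ℕ) : F) s *
            ((if w ∈ LinearMap.range μ then ((Nat.card K : ℕ) : F) ^ s else 0) - 1) := by
        rw [← h5, ← h2, Finset.mul_sum, Finset.mul_sum]
        refine Finset.sum_congr rfl fun η _ => ?_
        rw [← h1]; ring
      apply mul_left_cancel₀ hQ0
      rw [finrank_ker_hypExt, phiQ_succ _ hb]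
      split_ifs at h6 ⊢ with h
      · rw [← hs, phiQ_succ _ hs1]
        linear_combination - h6
      · rw [add_zero, ← hs]
        linear_combination - h6

open Classical in
/-- Invariant cuspidal functions on nilpotent endomorphisms are determined by their value
at zero. -/
theorem cuspFun_apply_eq [CharZero F] (hψ : ψ ≠ 1) (hV : 1 ≤ Module.finrank K V)
    {f : Module.End K V → F}
    (hinv : ∀ (h : V ≃ₗ[K] V) (ν : Module.End K V), IsNilpotent ν → f (h.conj ν) = f ν)
    (hcusp : ∀ W : Submodule K V, W ≠ ⊥ → W ≠ ⊤ → ∀ ν : Module.End K V, IsNilpotent ν →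
      (∀ w ∈ W, ν w ∈ W) →
        ∑ θ : Module.End K V with (∀ w ∈ W, θ w = 0) ∧ (∀ v, θ v ∈ W), f (ν + θ) = 0)
    {ν : Module.End K V} (hν : IsNilpotent ν) :
    phiQ ((Nat.card K : ℕ) : F) (Module.finrank K V) * f ν =
      f 0 * phiQ ((Nat.card K : ℕ) : F) (Module.finrank K (LinearMap.ker ν)) := by
  have : Nontrivial V := Module.finrank_pos_iff.1 hV
  have hlt : LinearMap.range ν < ⊤ := by
    rw [lt_top_iff_ne_top]
    intro h
    have h1 := LinearMap.finrank_range_add_finrank_ker ν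
    have h2 := finrank_ker_pos_of_isNilpotent hν
    rw [h, finrank_top] at h1
    omega
  obtain ⟨ξ, hξ, hle⟩ := Submodule.exists_le_ker_of_lt_top _ hlt
  refine IsCuspFun.apply_eq hψ _ rfl hξ (f := f) ⟨fun h _ ν hν _ => hinv h ν hν,
    fun W hW hWξ ν hν _ hνW => hcusp W hW ?_ ν hν hνW⟩ hν fun v => hle ⟨v, rfl⟩
  rintro rfl
  exact hξ (LinearMap.ext fun v => hWξ v trivial)

end CuspFunMain

section CommNilSum

variable {K : Type} [Field K] {V : Type} [AddCommGroup V] [Module K V] {A : Type} [CommRing A]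

/-- The sum of `g (dim ker ν)` over all nilpotent endomorphisms `ν` commuting with `T`. -/
noncomputable def commNilSum [Finite V] (T : Module.End K V) (g : ℕ → A) : A :=
  open Classical in
  ∑ ν : Module.End K V with IsNilpotent ν ∧ Commute T ν, g (Module.finrank K (LinearMap.ker ν))

lemma commute_conj {W : Type} [AddCommGroup W] [Module K W] (e : V ≃ₗ[K] W)
    {S T : Module.End K V} : Commute (e.conj S) (e.conj T) ↔ Commute S T := by
  constructor
  · intro h
    exact e.conjRingEquiv.injective (by
      rw [map_mul, map_mul]; exact h)
  · intro h
    exact h.map (e.conjRingEquiv : Module.End K V →* Module.End K W)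

lemma commNilSum_conj {W : Type} [AddCommGroup W] [Module K W] [Finite V] [Finite W]
    (e : V ≃ₗ[K] W) (T : Module.End K V) (g : ℕ → A) :
    commNilSum (e.conj T) g = commNilSum T g := by
  classical
  symm
  refine Finset.sum_equiv e.conj.toEquiv (fun ν => ?_) fun ν _ => ?_
  · simp only [Finset.mem_filter, Finset.mem_univ, true_and]
    exact and_congr (isNilpotent_conj e).symm (commute_conj e).symm
  · exact congrArg g (finrank_ker_conj e ν).symm

lemma commNilSum_smul [Finite V] {c : K} (hc : c ≠ 0) (T : Module.End K V) (g : ℕ → A) :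
    commNilSum (c • T) g = commNilSum T g := by
  classical
  refine Finset.sum_congr ?_ fun _ _ => rfl
  ext ν
  simp only [Finset.mem_filter, Finset.mem_univ, true_and, Commute.smul_left_iff₀ hc]

lemma commNilSum_one [Finite V] (g : ℕ → A) : commNilSum (1 : Module.End K V) g = nilSum K V g := by
  classical
  refine Finset.sum_congr ?_ fun _ _ => rfl
  ext ν
  simp only [Finset.mem_filter, Finset.mem_univ, true_and, Commute.one_left, and_true]

lemma commNilSum_neg [Finite V] (T : Module.End K V) (g : ℕ → A) :
    commNilSum (-T) g = commNilSum T g := by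
  classical
  refine Finset.sum_congr ?_ fun _ _ => rfl
  ext ν
  simp only [Finset.mem_filter, Finset.mem_univ, true_and, Commute.neg_left_iff]

open Classical in
/-- Orbit counting for conjugation of endomorphisms. -/
lemma card_conj_mul_card_commutant [Finite V] (T₀ : Module.End K V) (P : Module.End K V → Prop)
    (hP : ∀ T, P T ↔ ∃ h : V ≃ₗ[K] V, h.conj T₀ = T) :
    (Finset.univ.filter P).card *
      (Finset.univ.filter fun h : V ≃ₗ[K] V => h.conj T₀ = T₀).card = Fintype.card (V ≃ₗ[K] V) := by
  have hmaps : Set.MapsTo (fun h : V ≃ₗ[K] V => h.conj T₀)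
      ((Finset.univ : Finset (V ≃ₗ[K] V)) : Set (V ≃ₗ[K] V)) (Finset.univ.filter P) := by
    intro h _
    simpa using (hP _).2 ⟨h, rfl⟩
  refine Eq.symm ((Finset.card_eq_sum_card_fiberwise hmaps).trans (Finset.sum_const_nat ?_))
  · intro T hT
    obtain ⟨h₁, rfl⟩ := (hP T).1 (by simpa using hT)
    refine Finset.card_nbij' (fun h => h.trans h₁.symm) (fun h => h.trans h₁) ?_ ?_ ?_ ?_
    · intro h hh
      simp only [Finset.coe_filter, Finset.mem_univ, true_and, Set.mem_ofPred_eq] at hh ⊢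
      rw [← LinearEquiv.conj_trans, LinearEquiv.trans_apply, hh, LinearEquiv.conj_symm_conj]
    · intro h hh
      simp only [Finset.coe_filter, Finset.mem_univ, true_and, Set.mem_ofPred_eq] at hh ⊢
      rw [← LinearEquiv.conj_trans, LinearEquiv.trans_apply, hh]
    · intro h _; ext v; simp
    · intro h _; ext v; simp

open Classical in
lemma natCard_linearEquiv [Finite K] [Finite V] :
    ((Fintype.card (V ≃ₗ[K] V) : ℕ) : A) = glOrd ((Nat.card K : ℕ) : A) (Module.finrank K V) := by
  have e : (V ≃ₗ[K] V) ≃ GL (Fin (Module.finrank K V)) K :=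
    ((LinearMap.GeneralLinearGroup.generalLinearEquiv K V).symm.trans
      ((LinearMap.GeneralLinearGroup.congrLinearEquiv
        (LinearEquiv.ofFinrankEq V (Fin (Module.finrank K V) → K)
          (Module.finrank_fin_fun K).symm)).trans
        Matrix.GeneralLinearGroup.toLin.symm)).toEquiv
  have : Fintype K := Fintype.ofFinite K
  rw [← Nat.card_eq_fintype_card, Nat.card_congr e, Matrix.card_GL_field, glOrd,
    Finset.prod_range, Nat.cast_prod, Nat.card_eq_fintype_card]
  refine Finset.prod_congr rfl fun i _ => ?_
  rw [Nat.cast_sub (Nat.pow_le_pow_right Fintype.card_pos i.2.le)]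
  push_cast
  rfl

open Classical in
lemma sum_commNilSum_of_conj [Finite K] [Finite V] (T₀ : Module.End K V)
    (P : Module.End K V → Prop)
    (hP : ∀ T, P T ↔ ∃ h : V ≃ₗ[K] V, h.conj T₀ = T) (g : ℕ → A) :
    (∑ T : Module.End K V with P T, commNilSum T g) *
      (((Finset.univ.filter fun h : V ≃ₗ[K] V => h.conj T₀ = T₀).card : ℕ) : A) =
      glOrd ((Nat.card K : ℕ) : A) (Module.finrank K V) * commNilSum T₀ g := by
  rw [← natCard_linearEquiv, ← card_conj_mul_card_commutant T₀ P hP,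
    Finset.sum_congr rfl (g := fun _ => commNilSum T₀ g)]
  · rw [Finset.sum_const, nsmul_eq_mul]; push_cast; ring
  · intro T hT
    obtain ⟨h, rfl⟩ := (hP T).1 (by simpa using hT)
    exact commNilSum_conj h T₀ g

end CommNilSum

section Involutions

variable {K : Type} [Field K] {V : Type} [AddCommGroup V] [Module K V] {A : Type} [CommRing A]
  {U W : Type} [AddCommGroup U] [Module K U] [AddCommGroup W] [Module K W]

/-- The involution of `U × W` acting as `1` on `U` and as `-1` on `W`. -/
def prodInvolution (K U W : Type) [Field K] [AddCommGroup U] [Module K U] [AddCommGroup W]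
    [Module K W] : Module.End K (U × W) :=
  LinearMap.prodMap 1 (-1)

lemma prodInvolution_apply (x : U × W) : prodInvolution K U W x = (x.1, -x.2) := rfl

lemma eq_zero_of_eq_neg_self (h2 : (2 : K) ≠ 0) {x : V} (h : x = -x) : x = 0 := by
  have : (2 : K) • x = 0 := by
    rw [two_smul]; nth_rewrite 2 [h]; simp
  exact (smul_eq_zero.1 this).resolve_left h2

lemma commute_prodInvolution (h2 : (2 : K) ≠ 0) {f : Module.End K (U × W)} :
    Commute (prodInvolution K U W) f ↔
      ∃ (a : Module.End K U) (b : Module.End K W), LinearMap.prodMap a b = f := by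
  constructor
  · intro h
    have h' : ∀ x, prodInvolution K U W (f x) = f (prodInvolution K U W x) := fun x =>
      LinearMap.congr_fun h x
    refine ⟨LinearMap.fst K U W ∘ₗ f ∘ₗ LinearMap.inl K U W,
      LinearMap.snd K U W ∘ₗ f ∘ₗ LinearMap.inr K U W, ?_⟩
    have h1 : ∀ u : U, (f (u, 0)).2 = 0 := fun u => by
      have := congrArg Prod.snd (h' (u, 0))
      simp only [prodInvolution_apply, neg_zero] at this
      exact eq_zero_of_eq_neg_self h2 this.symm
    have h3 : ∀ w : W, (f (0, w)).1 = 0 := fun w => by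
      have := congrArg Prod.fst (h' (0, w))
      simp only [prodInvolution_apply] at this
      rw [show ((0 : U), -w) = -(0, w) by simp, map_neg] at this
      exact eq_zero_of_eq_neg_self h2 this
    refine LinearMap.prod_ext ?_ ?_
    · ext u
      · simp
      · simp [h1]
    · ext w
      · simp [h3]
      · simp
  · rintro ⟨a, b, rfl⟩
    ext <;> simp [prodInvolution]

lemma isNilpotent_prodMap {a : Module.End K U} {b : Module.End K W} :
    IsNilpotent (LinearMap.prodMap a b : Module.End K (U × W)) ↔ IsNilpotent a ∧ IsNilpotent b := by
  have hp : ∀ n, (LinearMap.prodMap a b : Module.End K (U × W)) ^ n =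
      LinearMap.prodMap (a ^ n) (b ^ n) := fun n => by
    induction n with
    | zero => rfl
    | succ n ih => rw [pow_succ, ih, pow_succ, pow_succ, LinearMap.prodMap_mul]
  constructor
  · rintro ⟨n, hn⟩
    rw [hp] at hn
    refine ⟨⟨n, ?_⟩, ⟨n, ?_⟩⟩
    · ext u
      simpa using congrArg Prod.fst (LinearMap.congr_fun hn (u, 0))
    · ext w
      simpa using congrArg Prod.snd (LinearMap.congr_fun hn (0, w))
  · rintro ⟨⟨n, hn⟩, ⟨m, hm⟩⟩
    refine ⟨n + m, ?_⟩
    rw [hp, pow_add, hn, pow_add b, hm, zero_mul, mul_zero]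
    rfl

/-- The product of two submodules is their external product. -/
def Submodule.prodEquiv' (p : Submodule K U) (q : Submodule K W) : p.prod q ≃ₗ[K] p × q where
  toFun x := (⟨x.1.1, x.2.1⟩, ⟨x.1.2, x.2.2⟩)
  invFun x := ⟨(x.1.1, x.2.1), x.1.2, x.2.2⟩
  map_add' _ _ := rfl
  map_smul' _ _ := rfl

lemma finrank_ker_prodMap [FiniteDimensional K U] [FiniteDimensional K W] (a : Module.End K U)
    (b : Module.End K W) :
    Module.finrank K (LinearMap.ker (LinearMap.prodMap a b : Module.End K (U × W))) =
      Module.finrank K (LinearMap.ker a) + Module.finrank K (LinearMap.ker b) := by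
  rw [LinearMap.ker_prodMap, LinearEquiv.finrank_eq (Submodule.prodEquiv' (LinearMap.ker a) (LinearMap.ker b)), Module.finrank_prod]

lemma prodMap_inj {a a' : Module.End K U} {b b' : Module.End K W}
    (h : LinearMap.prodMap a b = LinearMap.prodMap a' b') : a = a' ∧ b = b' := by
  constructor
  · ext u
    simpa using congrArg Prod.fst (LinearMap.congr_fun h (u, 0))
  · ext w
    simpa using congrArg Prod.snd (LinearMap.congr_fun h (0, w))

lemma commNilSum_prodInvolution [Finite U] [Finite W] (h2 : (2 : K) ≠ 0) (g : ℕ → A) :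
    commNilSum (prodInvolution K U W) g = nilSum K U fun t => nilSum K W fun s => g (t + s) := by
  classical
  simp only [nilSum]
  rw [← Finset.sum_product', commNilSum]
  symm
  refine Finset.sum_bij (fun x _ => LinearMap.prodMap x.1 x.2) ?_ ?_ ?_ ?_
  · rintro ⟨a, b⟩ hx
    simp only [Finset.mem_product, Finset.mem_filter, Finset.mem_univ, true_and] at hx ⊢
    exact ⟨isNilpotent_prodMap.2 hx, (commute_prodInvolution h2).2 ⟨a, b, rfl⟩⟩
  · rintro ⟨a, b⟩ _ ⟨a', b'⟩ _ h
    exact Prod.ext_iff.2 (prodMap_inj h)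
  · intro f hf
    simp only [Finset.mem_filter, Finset.mem_univ, true_and] at hf
    obtain ⟨a, b, rfl⟩ := (commute_prodInvolution h2).1 hf.2
    refine ⟨(a, b), ?_, rfl⟩
    simpa using isNilpotent_prodMap.1 hf.1
  · rintro ⟨a, b⟩ _
    rw [finrank_ker_prodMap]

lemma conj_eq_iff_commute (h : V ≃ₗ[K] V) (T : Module.End K V) :
    h.conj T = T ↔ Commute T (h : V →ₗ[K] V) := by
  constructor
  · intro hh
    ext v
    have := LinearMap.congr_fun hh (h v)
    simpa [LinearEquiv.conj_apply_apply] using this.symm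
  · intro hh
    ext v
    have := LinearMap.congr_fun hh (h.symm v)
    simpa [LinearEquiv.conj_apply_apply] using this.symm

open Classical in
lemma card_commutant_prodInvolution [Finite U] [Finite W] (h2 : (2 : K) ≠ 0) :
    (Finset.univ.filter fun h : (U × W) ≃ₗ[K] (U × W) =>
      h.conj (prodInvolution K U W) = prodInvolution K U W).card =
      Fintype.card (U ≃ₗ[K] U) * Fintype.card (W ≃ₗ[K] W) := by
  rw [← Fintype.card_prod, ← Finset.card_univ]
  symm
  refine Finset.card_bij (fun x _ => x.1.prodCongr x.2) ?_ ?_ ?_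
  · rintro ⟨a, b⟩ _
    simp only [Finset.mem_filter, Finset.mem_univ, true_and, conj_eq_iff_commute]
    exact (commute_prodInvolution h2).2 ⟨a, b, rfl⟩
  · rintro ⟨a, b⟩ _ ⟨a', b'⟩ _ h
    have := prodMap_inj (a := (a : U →ₗ[K] U)) (b := (b : W →ₗ[K] W)) (a' := (a' : U →ₗ[K] U))
      (b' := (b' : W →ₗ[K] W))
      (congrArg (fun e : (U × W) ≃ₗ[K] (U × W) => (e : (U × W) →ₗ[K] (U × W))) h)
    exact Prod.ext_iff.2 ⟨LinearEquiv.toLinearMap_injective this.1,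
      LinearEquiv.toLinearMap_injective this.2⟩
  · intro h hh
    simp only [Finset.mem_filter, Finset.mem_univ, true_and, conj_eq_iff_commute] at hh
    obtain ⟨a, b, hab⟩ := (commute_prodInvolution h2).1 hh
    have hinj : Function.Injective (LinearMap.prodMap a b) := by rw [hab]; exact h.injective
    have ha : Function.Injective a := fun x y hxy => by
      have := @hinj (x, 0) (y, 0) (by simp [hxy])
      simpa using this
    have hb : Function.Injective b := fun x y hxy => by
      have := @hinj (0, x) (0, y) (by simp [hxy])
      simpa using this
    refine ⟨(LinearEquiv.ofInjectiveEndo a ha, LinearEquiv.ofInjectiveEndo b hb),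
      Finset.mem_univ _, ?_⟩
    apply LinearEquiv.toLinearMap_injective
    rw [← hab]
    rfl

/-- An involution is conjugate to the standard one. -/
lemma exists_conj_prodInvolution (h2 : (2 : K) ≠ 0) {e : Module.End K V} (he : e * e = 1) :
    ∃ h : (LinearMap.ker (e - 1) × LinearMap.ker (e + 1)) ≃ₗ[K] V,
      h.conj (prodInvolution K _ _) = e := by
  have he' : ∀ v, e (e v) = v := fun v => LinearMap.congr_fun he v
  have hc : IsCompl (LinearMap.ker (e - 1)) (LinearMap.ker (e + 1)) := by
    constructor
    · rw [Submodule.disjoint_def]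
      intro x h1 h3
      simp only [LinearMap.mem_ker, LinearMap.sub_apply, LinearMap.add_apply, Module.End.one_apply,
        sub_eq_zero] at h1 h3
      rw [h1] at h3
      exact eq_zero_of_eq_neg_self h2 (eq_neg_of_add_eq_zero_left h3)
    · rw [codisjoint_iff, eq_top_iff]
      intro v _
      rw [show v = (2⁻¹ : K) • (e v + v) + (2⁻¹ : K) • (v - e v) by
        rw [← smul_add, show e v + v + (v - e v) = (2 : K) • v by rw [two_smul]; abel,
          inv_smul_smul₀ h2]]
      refine Submodule.add_mem_sup (Submodule.smul_mem _ _ ?_) (Submodule.smul_mem _ _ ?_)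
      · simp [he', add_comm]
      · simp [he']
  refine ⟨Submodule.prodEquivOfIsCompl _ _ hc, ?_⟩
  set h := Submodule.prodEquivOfIsCompl _ _ hc
  ext v
  obtain ⟨x, rfl⟩ := h.surjective v
  rw [LinearEquiv.conj_apply_apply, LinearEquiv.symm_apply_apply]
  have h1 : e x.1 = x.1 := by
    have := LinearMap.mem_ker.1 x.1.2
    rwa [LinearMap.sub_apply, sub_eq_zero] at this
  have h3 : e x.2 = - x.2 := by
    exact eq_neg_of_add_eq_zero_left (LinearMap.mem_ker.1 x.2.2)
  simp [h, prodInvolution_apply, h1, h3]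

end Involutions

section ConjModels

variable {K : Type} [Field K] {V : Type} [AddCommGroup V] [Module K V] {A : Type} [CommRing A]
  {V₀ : Type} [AddCommGroup V₀] [Module K V₀]

open Classical in
lemma card_commutant_conj [Finite V] [Finite V₀] (e : V₀ ≃ₗ[K] V) (T : Module.End K V₀) :
    (Finset.univ.filter fun h : V ≃ₗ[K] V => h.conj (e.conj T) = e.conj T).card =
      (Finset.univ.filter fun h : V₀ ≃ₗ[K] V₀ => h.conj T = T).card := by
  refine Finset.card_nbij' (fun h => e.trans (h.trans e.symm)) (fun h => e.symm.trans (h.trans e))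
    ?_ ?_ ?_ ?_
  · intro h hh
    simp only [Finset.coe_filter, Finset.mem_univ, true_and, Set.mem_ofPred_eq] at hh ⊢
    rw [← LinearEquiv.conj_trans, ← LinearEquiv.conj_trans, LinearEquiv.trans_apply,
      LinearEquiv.trans_apply, hh, LinearEquiv.conj_symm_conj]
  · intro h hh
    simp only [Finset.coe_filter, Finset.mem_univ, true_and, Set.mem_ofPred_eq] at hh ⊢
    rw [← LinearEquiv.conj_trans, ← LinearEquiv.conj_trans, LinearEquiv.trans_apply,
      LinearEquiv.trans_apply, LinearEquiv.conj_symm_conj, hh]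
  · intro h _; ext v; simp
  · intro h _; ext v; simp

open Classical in
lemma sum_commNilSum_of_conj' [Finite K] [Finite V] [Finite V₀] (h₀ : V₀ ≃ₗ[K] V)
    (T₀ : Module.End K V₀) (P : Module.End K V → Prop)
    [DecidablePred P] (hP : ∀ T, P T ↔ ∃ h : V₀ ≃ₗ[K] V, h.conj T₀ = T) (g : ℕ → A) :
    (∑ T : Module.End K V with P T, commNilSum T g) *
      (((Finset.univ.filter fun h : V₀ ≃ₗ[K] V₀ => h.conj T₀ = T₀).card : ℕ) : A) =
      glOrd ((Nat.card K : ℕ) : A) (Module.finrank K V) * commNilSum T₀ g := by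
  have key := sum_commNilSum_of_conj (h₀.conj T₀) P ?_ g
  · rw [card_commutant_conj h₀, commNilSum_conj] at key
    convert key
  intro T
  rw [hP]
  constructor
  · rintro ⟨h, rfl⟩
    refine ⟨h₀.symm.trans h, ?_⟩
    rw [← LinearEquiv.conj_trans, LinearEquiv.trans_apply, LinearEquiv.conj_symm_conj]
  · rintro ⟨h, rfl⟩
    exact ⟨h₀.trans h, by rw [← LinearEquiv.conj_trans, LinearEquiv.trans_apply]⟩

/-- A balanced involution: its two eigenspaces have the same dimension. -/
def IsBalanced (e : Module.End K V) : Prop :=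
  e * e = 1 ∧ 2 * Module.finrank K (LinearMap.ker (e - 1)) = Module.finrank K V

lemma finrank_ker_add_finrank_ker [Finite V] (h2 : (2 : K) ≠ 0) {e : Module.End K V}
    (he : e * e = 1) : Module.finrank K (LinearMap.ker (e - 1)) +
      Module.finrank K (LinearMap.ker (e + 1)) = Module.finrank K V := by
  obtain ⟨h, -⟩ := exists_conj_prodInvolution h2 he
  rw [← h.finrank_eq, Module.finrank_prod]

lemma IsBalanced.conj {e : Module.End K V₀} (he : IsBalanced e) (h : V₀ ≃ₗ[K] V) :
    IsBalanced (h.conj e) := by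
  have h1 : h.conj (1 : Module.End K V₀) = 1 := h.conjRingEquiv.map_one
  constructor
  · have := congrArg h.conjRingEquiv he.1
    rwa [map_mul, map_one] at this
  · rw [← h1, ← map_sub, finrank_ker_conj, he.2, h.finrank_eq]

lemma isBalanced_prodInvolution (h2 : (2 : K) ≠ 0) {U W : Type} [AddCommGroup U] [Module K U]
    [AddCommGroup W] [Module K W] [Finite U] [Finite W]
    (h : Module.finrank K U = Module.finrank K W) : IsBalanced (prodInvolution K U W) := by
  constructor
  · ext <;> simp [prodInvolution]
  · have : prodInvolution K U W - 1 = LinearMap.prodMap 0 ((-2 : K) • (1 : Module.End K W)) := by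
      ext
      · simp [prodInvolution]
      · simp [prodInvolution]
      · simp [prodInvolution]
      · simp [prodInvolution, neg_smul, two_smul, sub_eq_add_neg]
    rw [this, finrank_ker_prodMap, LinearMap.ker_smul _ _ (neg_ne_zero.2 h2), Module.finrank_prod,
      ← h]
    have : LinearMap.ker (1 : Module.End K W) = ⊥ := LinearMap.ker_id
    rw [this, LinearMap.ker_zero, finrank_top, finrank_bot]
    omega

open Classical in
lemma sum_isBalanced_commNilSum {F : Type} [Field F] [CharZero F] [Finite K] [Finite V]
    (h2 : (2 : K) ≠ 0) {a : ℕ} (ha : 1 ≤ a) (hV : Module.finrank K V = 2 * a) :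
    (∑ e : Module.End K V with IsBalanced e, commNilSum e (phiQ ((Nat.card K : ℕ) : F))) *
      (((Nat.card K : ℕ) : F) ^ a - 1) = - glOrd ((Nat.card K : ℕ) : F) (2 * a) := by
  let U := Fin a → K
  have hU : Module.finrank K U = a := by simp [U]
  have key := sum_commNilSum_of_conj' (A := F) (V := V)
    (LinearEquiv.ofFinrankEq (U × U) V (by rw [Module.finrank_prod, hU, hV]; omega))
    (prodInvolution K U U) IsBalanced ?_ (phiQ ((Nat.card K : ℕ) : F))
  · generalize hc : Finset.card _ = c at key
    have hc' : c = Fintype.card (U ≃ₗ[K] U) * Fintype.card (U ≃ₗ[K] U) := by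
      rw [← hc]
      convert card_commutant_prodInvolution (K := K) (U := U) (W := U) h2
    rw [hc', commNilSum_prodInvolution h2, hV] at key
    have h3 := nilSumPair_self (K := K) (V := U) (W := U) (A := F) ha hU hU
    rw [nilSumPair] at h3
    have h4 : glOrd ((Nat.card K : ℕ) : F) a ≠ 0 := by
      rw [← hU, ← natCard_linearEquiv]
      exact Nat.cast_ne_zero.2 Fintype.card_ne_zero
    push_cast at key
    rw [natCard_linearEquiv, hU] at key
    refine mul_right_cancel₀ (pow_ne_zero 2 h4) ?_
    linear_combination (((Nat.card K : ℕ) : F) ^ a - 1) * key + glOrd ((Nat.card K : ℕ) : F) (2 * a) * h3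
  · intro T
    constructor
    · intro hT
      obtain ⟨h, hh⟩ := exists_conj_prodInvolution h2 hT.1
      have h1 : Module.finrank K (LinearMap.ker (T - 1)) = a := by have := hT.2; omega
      have h3 : Module.finrank K (LinearMap.ker (T + 1)) = a := by
        have := finrank_ker_add_finrank_ker h2 hT.1; omega
      let u := LinearEquiv.ofFinrankEq U (LinearMap.ker (T - 1)) (by rw [h1, hU])
      let w := LinearEquiv.ofFinrankEq U (LinearMap.ker (T + 1)) (by rw [h3, hU])
      refine ⟨(u.prodCongr w).trans h, ?_⟩
      rw [← LinearEquiv.conj_trans, LinearEquiv.trans_apply]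
      refine Eq.trans (congrArg h.conj ?_) hh
      refine LinearMap.ext fun x => ?_
      rw [LinearEquiv.conj_apply_apply, prodInvolution_apply, prodInvolution_apply]
      refine Prod.ext ?_ ?_
      · simp
      · simp
    · rintro ⟨h, rfl⟩
      exact (isBalanced_prodInvolution h2 rfl).conj h

lemma not_isBalanced_of_odd {e : Module.End K V} (h : Odd (Module.finrank K V)) : ¬ IsBalanced e :=
  fun he => by
    have := he.2
    obtain ⟨b, hb⟩ := h
    omega

open Classical in
/-- The sum over all involutions. -/
lemma sum_involution_commNilSum [Finite K] [Finite V]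
    (h2 : (2 : K) ≠ 0) (hV : 1 ≤ Module.finrank K V) :
    ∑ e : Module.End K V with e * e = 1, commNilSum e (phiQ ((Nat.card K : ℕ) : A)) =
      ∑ e : Module.End K V with IsBalanced e, commNilSum e (phiQ ((Nat.card K : ℕ) : A)) +
        2 * nilSum K V (phiQ ((Nat.card K : ℕ) : A)) := by
  have : Nontrivial V := Module.finrank_pos_iff.1 hV
  have hne : (1 : Module.End K V) ≠ -1 := fun h => by
    obtain ⟨v, hv⟩ := exists_ne (0 : V)
    exact hv (eq_zero_of_eq_neg_self h2 (by simpa using LinearMap.congr_fun h v))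
  have hker1 : Module.finrank K (LinearMap.ker ((1 : Module.End K V) - 1)) = Module.finrank K V := by
    rw [sub_self, LinearMap.ker_zero, finrank_top]
  have hker2 : Module.finrank K (LinearMap.ker ((-1 : Module.End K V) + 1)) = Module.finrank K V := by
    rw [neg_add_cancel, LinearMap.ker_zero, finrank_top]
  have hk2 := finrank_ker_add_finrank_ker h2 (e := (-1 : Module.End K V)) (by simp)
  have hb1 : ¬ IsBalanced (1 : Module.End K V) := fun h => by have := h.2; omega
  have hb2 : ¬ IsBalanced (-1 : Module.End K V) := fun h => by have := h.2; omega
  have hsplit : ∑ e : Module.End K V with e * e = 1, commNilSum e (phiQ ((Nat.card K : ℕ) : A)) =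
      ∑ e ∈ ((Finset.univ.filter fun e : Module.End K V => IsBalanced e) ∪ {1, -1}),
        commNilSum e (phiQ ((Nat.card K : ℕ) : A)) := by
    symm
    refine Finset.sum_subset ?_ ?_
    · intro e he
      simp only [Finset.mem_union, Finset.mem_filter, Finset.mem_univ, true_and, Finset.mem_insert,
        Finset.mem_singleton] at he ⊢
      rcases he with he | rfl | rfl
      · exact he.1
      · simp
      · simp
    · intro e he he'
      simp only [Finset.mem_union, Finset.mem_filter, Finset.mem_univ, true_and, Finset.mem_insert,
        Finset.mem_singleton, not_or] at he he'
      obtain ⟨h, hh⟩ := exists_conj_prodInvolution h2 he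
      have hs := finrank_ker_add_finrank_ker h2 he
      rw [← hh, commNilSum_conj, commNilSum_prodInvolution h2]
      refine nilSumPair_eq_zero ?_ ?_ ?_
      · rw [Nat.one_le_iff_ne_zero]
        intro h0
        have h1 : LinearMap.ker (e + 1) = ⊤ := Submodule.eq_top_of_finrank_eq (by omega)
        exact he'.2.2 (eq_neg_of_add_eq_zero_left (LinearMap.ker_eq_top.1 h1))
      · rw [Nat.one_le_iff_ne_zero]
        intro h0
        have h1 : LinearMap.ker (e - 1) = ⊤ := Submodule.eq_top_of_finrank_eq (by omega)
        exact he'.2.1 (sub_eq_zero.1 (LinearMap.ker_eq_top.1 h1))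
      · intro h1
        exact he'.1 ⟨he, by omega⟩
  rw [hsplit, Finset.sum_union, Finset.sum_pair hne, commNilSum_neg, commNilSum_one, two_mul]
  rw [Finset.disjoint_right]
  intro e he
  simp only [Finset.mem_insert, Finset.mem_singleton, Finset.mem_filter, Finset.mem_univ, true_and] at he ⊢
  rcases he with rfl | rfl
  · exact hb1
  · exact hb2

end ConjModels

section ScalarExtension

variable {K K' : Type} [Field K] [Field K'] [Algebra K K'] {θ : K'}
  {V : Type} [AddCommGroup V] [Module K V] [Module K' V] [IsScalarTower K K' V]
  {A : Type} [CommRing A]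

lemma exists_restrictScalars_eq {V' : Type} [AddCommGroup V'] [Module K V'] [Module K' V']
    [IsScalarTower K K' V'] (hθ : Algebra.adjoin K {θ} = ⊤) {f : V →ₗ[K] V'}
    (hf : ∀ v, f (θ • v) = θ • f v) : ∃ f' : V →ₗ[K'] V', f'.restrictScalars K = f := by
  refine ⟨{ f with map_smul' := fun c v => ?_ }, rfl⟩
  have hc : c ∈ Algebra.adjoin K {θ} := hθ ▸ Algebra.mem_top
  simp only [RingHom.id_apply]
  induction hc using Algebra.adjoin_induction generalizing v with
  | mem x hx => rw [Set.mem_singleton_iff.1 hx]; exact hf v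
  | algebraMap r => simp
  | add x y _ _ hx hy => 
    have h1 := hx v
    have h2 := hy v
    simp only [AddHom.toFun_eq_coe, LinearMap.coe_toAddHom] at h1 h2 ⊢
    rw [add_smul, map_add, h1, h2, add_smul]
  | mul x y _ _ hx hy =>
    have h1 := hx (y • v)
    have h2 := hy v
    simp only [AddHom.toFun_eq_coe, LinearMap.coe_toAddHom] at h1 h2 ⊢
    rw [mul_smul, h1, h2, mul_smul]

lemma commute_lsmul_iff (hθ : Algebra.adjoin K {θ} = ⊤) {f : Module.End K V} :
    Commute (Algebra.lsmul K K V θ) f ↔ ∃ f' : Module.End K' V, f'.restrictScalars K = f := by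
  constructor
  · intro h
    exact exists_restrictScalars_eq hθ fun v => (LinearMap.congr_fun h v).symm
  · rintro ⟨f, rfl⟩
    ext v
    simp

lemma isNilpotent_restrictScalars {f : Module.End K' V} :
    IsNilpotent (f.restrictScalars K : Module.End K V) ↔ IsNilpotent f := by
  have hp : ∀ n, (f.restrictScalars K : Module.End K V) ^ n = (f ^ n).restrictScalars K := fun n => by
    induction n with
    | zero => rfl
    | succ n ih => rw [pow_succ, ih, pow_succ]; rfl
  constructor
  · rintro ⟨n, hn⟩
    exact ⟨n, LinearMap.restrictScalars_injective K (by rw [← hp, hn]; rfl)⟩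
  · rintro ⟨n, hn⟩
    exact ⟨n, by rw [hp, hn]; rfl⟩

lemma finrank_ker_restrictScalars (f : Module.End K' V) :
    Module.finrank K (LinearMap.ker (f.restrictScalars K : Module.End K V)) =
      Module.finrank K K' * Module.finrank K' (LinearMap.ker f) :=
  (Module.finrank_mul_finrank K K' (LinearMap.ker f)).symm

lemma commNilSum_lsmul [Finite V] (hθ : Algebra.adjoin K {θ} = ⊤) (g : ℕ → A) :
    commNilSum (Algebra.lsmul K K V θ) g = nilSum K' V fun t => g (Module.finrank K K' * t) := by
  classical
  symm
  refine Finset.sum_bij (fun f _ => f.restrictScalars K) ?_ ?_ ?_ ?_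
  · intro f hf
    simp only [Finset.mem_filter, Finset.mem_univ, true_and] at hf ⊢
    exact ⟨isNilpotent_restrictScalars.2 hf, (commute_lsmul_iff hθ).2 ⟨f, rfl⟩⟩
  · intro f _ g _ h
    exact LinearMap.restrictScalars_injective K h
  · intro f hf
    simp only [Finset.mem_filter, Finset.mem_univ, true_and] at hf
    obtain ⟨f', rfl⟩ := (commute_lsmul_iff hθ).1 hf.2
    exact ⟨f', by simpa using isNilpotent_restrictScalars.1 hf.1, rfl⟩
  · intro f _
    rw [finrank_ker_restrictScalars]

open Classical in
lemma card_commutant_lsmul [Finite V] (hθ : Algebra.adjoin K {θ} = ⊤) :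
    (Finset.univ.filter fun h : V ≃ₗ[K] V =>
      h.conj (Algebra.lsmul K K V θ) = Algebra.lsmul K K V θ).card =
      Fintype.card (V ≃ₗ[K'] V) := by
  rw [← Finset.card_univ]
  symm
  refine Finset.card_bij (fun f _ => f.restrictScalars K) ?_ ?_ ?_
  · intro f hf
    simp only [Finset.mem_filter, Finset.mem_univ, true_and, conj_eq_iff_commute]
    exact (commute_lsmul_iff hθ).2 ⟨f, rfl⟩
  · intro f _ g _ h
    exact LinearEquiv.restrictScalars_injective K h
  · intro h hh
    simp only [Finset.mem_filter, Finset.mem_univ, true_and, conj_eq_iff_commute] at hh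
    obtain ⟨f', hf⟩ := (commute_lsmul_iff hθ).1 hh
    have hb : Function.Bijective f' := by
      have : ⇑f' = ⇑h := funext fun v => LinearMap.congr_fun hf v
      rw [this]; exact h.bijective
    refine ⟨LinearEquiv.ofBijective f' hb, Finset.mem_univ _, ?_⟩
    apply LinearEquiv.toLinearMap_injective
    exact hf

end ScalarExtension

section SquareRoots

variable {K : Type} [Field K] {V : Type} [AddCommGroup V] [Module K V]

lemma exists_adjoinRoot_algHom {B : Type} [Ring B] [Algebra K B] (P : Polynomial K) (b : B)
    (hb : Polynomial.aeval b P = 0) : ∃ f : AdjoinRoot P →ₐ[K] B, f (AdjoinRoot.root P) = b := by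
  refine ⟨Ideal.Quotient.liftₐ (Ideal.span {P}) (Polynomial.aeval b) fun a ha => ?_, ?_⟩
  · obtain ⟨c, rfl⟩ := Ideal.mem_span_singleton'.1 ha
    rw [map_mul, hb, mul_zero]
  · exact Polynomial.aeval_X b

/-- Two square roots of a nonsquare scalar on spaces of equal dimension are conjugate. -/
lemma exists_conj_of_sq_eq {V' : Type} [AddCommGroup V'] [Module K V'] [FiniteDimensional K V]
    [FiniteDimensional K V'] {s : K} (hs : ¬ IsSquare s) {r : Module.End K V} {r' : Module.End K V'}
    (hr : r * r = s • 1) (hr' : r' * r' = s • 1)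
    (h : Module.finrank K V = Module.finrank K V') : ∃ e : V ≃ₗ[K] V', e.conj r = r' := by
  have hirr : Irreducible (Polynomial.X ^ 2 - Polynomial.C s) :=
    (X_pow_sub_C_irreducible_iff_of_prime Nat.prime_two).2 fun b hb => hs ⟨b, by rw [← hb, sq]⟩
  have : Fact (Irreducible (Polynomial.X ^ 2 - Polynomial.C s)) := ⟨hirr⟩
  let K' := AdjoinRoot (Polynomial.X ^ 2 - Polynomial.C s)
  obtain ⟨f, hf⟩ := exists_adjoinRoot_algHom (Polynomial.X ^ 2 - Polynomial.C s) r (by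
    simp [sq, hr, Algebra.algebraMap_eq_smul_one])
  obtain ⟨f', hf'⟩ := exists_adjoinRoot_algHom (Polynomial.X ^ 2 - Polynomial.C s) r' (by
    simp [sq, hr', Algebra.algebraMap_eq_smul_one])
  let : Module K' V := Module.compHom V (f : K' →+* Module.End K V)
  let : Module K' V' := Module.compHom V' (f' : K' →+* Module.End K V')
  have hsm : ∀ (c : K') (v : V), c • v = f c v := fun _ _ => rfl
  have hsm' : ∀ (c : K') (v : V'), c • v = f' c v := fun _ _ => rfl
  have : IsScalarTower K K' V := ⟨fun a c v => by rw [hsm, hsm, map_smul]; rfl⟩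
  have : IsScalarTower K K' V' := ⟨fun a c v => by rw [hsm', hsm', map_smul]; rfl⟩
  have hfin : Module.finrank K' V = Module.finrank K' V' := by
    have h1 := Module.finrank_mul_finrank K K' V
    have h3 := Module.finrank_mul_finrank K K' V'
    have h4 : 0 < Module.finrank K K' := by
      have : Module.Finite K K' := (AdjoinRoot.powerBasis hirr.ne_zero).finite
      exact Module.finrank_pos
    exact Nat.eq_of_mul_eq_mul_left h4 (by rw [h1, h3, h])
  have : FiniteDimensional K' V := Module.Finite.right K K' V
  have : FiniteDimensional K' V' := Module.Finite.right K K' V'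
  let e := LinearEquiv.ofFinrankEq V V' hfin
  refine ⟨e.restrictScalars K, ?_⟩
  ext v
  rw [LinearEquiv.conj_apply_apply, ← hf, ← hsm]
  change e (_ • e.symm v) = _
  rw [map_smul, LinearEquiv.apply_symm_apply, hsm', hf']

end SquareRoots

section FrobeniusPowers

variable {K : Type} [Field K] [Finite K] {B : Type} [Ring B] [Algebra K B]

lemma add_pow_natCard_pow {x y : B} (h : Commute x y) (N : ℕ) :
    (x + y) ^ (Nat.card K ^ N) = x ^ (Nat.card K ^ N) + y ^ (Nat.card K ^ N) := by
  rcases subsingleton_or_nontrivial B with hB | hB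
  · exact Subsingleton.elim _ _
  have : Fintype K := Fintype.ofFinite K
  obtain ⟨p, hp⟩ := CharP.exists K
  obtain ⟨n, hpr, hn⟩ := FiniteField.card K p
  have := Fact.mk hpr
  have : CharP B p := charP_of_injective_algebraMap (algebraMap K B).injective p
  rw [Nat.card_eq_fintype_card, hn, ← pow_mul]
  exact add_pow_char_pow_of_commute _ _ h

lemma smul_one_pow_natCard_pow (s : K) (N : ℕ) :
    (s • (1 : B)) ^ (Nat.card K ^ N) = s • 1 := by
  have : Fintype K := Fintype.ofFinite K
  rw [smul_pow, one_pow, Nat.card_eq_fintype_card, FiniteField.pow_card_pow]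

lemma odd_natCard (h2 : (2 : K) ≠ 0) : Odd (Nat.card K) := by
  have : Fintype K := Fintype.ofFinite K
  rw [Nat.card_eq_fintype_card, Nat.odd_iff]
  refine FiniteField.odd_card_of_char_ne_two fun h => h2 ?_
  have := CharP.cast_eq_zero K (ringChar K)
  rw [h] at this
  exact_mod_cast this

lemma pow_natCard_of_sq_eq (h2 : (2 : K) ≠ 0) {s : K} (hs : s ≠ 0) {r : B} (hr : r * r = s • 1)
    (N : ℕ) : r ^ (Nat.card K ^ (2 * N)) = r := by
  have : Fintype K := Fintype.ofFinite K
  obtain ⟨b, hb⟩ := odd_natCard h2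
  have h1 : r ^ Nat.card K = s ^ b • r := by
    rw [hb, pow_succ, pow_mul, sq, hr, smul_pow, one_pow, smul_one_mul]
  have h3 : s ^ b * s ^ b = 1 := by
    rw [← pow_add, ← two_mul, show 2 * b = Fintype.card K - 1 by
      rw [← Nat.card_eq_fintype_card]; omega]
    exact FiniteField.pow_card_sub_one_eq_one s hs
  have h4 : r ^ (Nat.card K ^ 2) = r := by
    rw [sq, pow_mul, h1, smul_pow, h1, smul_smul, Nat.card_eq_fintype_card, FiniteField.pow_card,
      h3, one_smul]
  induction N with
  | zero => simp
  | succ N ih => rw [mul_add, mul_one, pow_add, pow_mul, ih, h4]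

end FrobeniusPowers

section SquareRootSum

variable {K : Type} [Field K] {V : Type} [AddCommGroup V] [Module K V] {A : Type} [CommRing A]

lemma pow_eq_zero_of_isNilpotent [FiniteDimensional K V] {ν : Module.End K V} (h : IsNilpotent ν)
    {L : ℕ} (hL : Module.finrank K V ≤ L) : ν ^ L = 0 := by
  have h1 := LinearMap.aeval_self_charpoly ν
  rw [(LinearMap.charpoly_eq_X_pow_iff ν).2 fun m => ?_] at h1
  · rw [map_pow, Polynomial.aeval_X] at h1
    exact pow_eq_zero_of_le hL h1
  · obtain ⟨n, hn⟩ := h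
    exact ⟨n, by rw [hn]; rfl⟩

lemma finrank_ker_mul_of_isUnit [FiniteDimensional K V] {u μ : Module.End K V} (hu : IsUnit u) :
    Module.finrank K (LinearMap.ker (u * μ)) = Module.finrank K (LinearMap.ker μ) := by
  have : LinearMap.ker (u * μ) = LinearMap.ker μ :=
    LinearMap.ker_comp_of_ker_eq_bot _ (LinearMap.ker_eq_bot.2
      ((Module.End.isUnit_iff u).1 hu).1)
  rw [this]

open Classical in
/-- Summing over endomorphisms whose square is `s` up to a nilpotent. -/
lemma sum_sq_sub_isNilpotent [Finite K] [Finite V] (h2 : (2 : K) ≠ 0) {s : K} (hs : s ≠ 0)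
    (g : ℕ → A) :
    ∑ x : Module.End K V with IsNilpotent (x * x - s • 1),
        g (Module.finrank K (LinearMap.ker (x * x - s • 1))) =
      ∑ r : Module.End K V with r * r = s • 1, commNilSum r g := by
  simp only [commNilSum]
  rw [Finset.sum_sigma']
  symm
  set L := Nat.card K ^ (2 * Module.finrank K V) with hLdef
  have hL : Module.finrank K V ≤ L := by
    have h1 : 1 < Nat.card K := Finite.one_lt_card
    have := (Nat.lt_pow_self h1 (n := 2 * Module.finrank K V)).le
    omega
  have hdec : ∀ {r μ : Module.End K V}, r * r = s • 1 → IsNilpotent μ → Commute r μ →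
      (r + μ) * (r + μ) - s • 1 = ((2 : K) • r + μ) * μ := by
    intro r μ hr _ hc
    have : μ * r = r * μ := hc.eq.symm
    rw [mul_add, add_mul, add_mul, add_mul, hr, this, two_smul, add_mul]
    abel
  have hpow : ∀ {r μ : Module.End K V}, r * r = s • 1 → IsNilpotent μ → Commute r μ →
      (r + μ) ^ L = r := by
    intro r μ hr hμ hc
    rw [hLdef, add_pow_natCard_pow hc, pow_natCard_of_sq_eq h2 hs hr, ← hLdef,
      pow_eq_zero_of_isNilpotent hμ hL, add_zero]
  refine Finset.sum_bij' (fun x _ => x.1 + x.2) (fun x _ => ⟨x ^ L, x - x ^ L⟩) ?_ ?_ ?_ ?_ ?_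
  · rintro ⟨r, μ⟩ hx
    simp only [Finset.mem_sigma, Finset.mem_filter, Finset.mem_univ, true_and] at hx ⊢
    rw [hdec hx.1 hx.2.1 hx.2.2]
    refine Commute.isNilpotent_mul_left ?_ hx.2.1
    exact (hx.2.2.smul_left _).add_left (Commute.refl _)
  · intro x hx
    simp only [Finset.mem_sigma, Finset.mem_filter, Finset.mem_univ, true_and] at hx ⊢
    have hc : Commute (s • (1 : Module.End K V)) (x * x - s • 1) :=
      (Commute.one_left _).smul_left _
    have h1 : x ^ L * x ^ L = s • 1 := by
      rw [← (Commute.refl x).mul_pow]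
      have : x * x = s • 1 + (x * x - s • 1) := by abel
      rw [this, hLdef, add_pow_natCard_pow hc, smul_one_pow_natCard_pow, ← hLdef,
        pow_eq_zero_of_isNilpotent hx hL, add_zero]
    have hcx : Commute x (x ^ L) := (Commute.refl x).pow_right L
    refine ⟨h1, ⟨L, ?_⟩, hcx.symm.sub_right (Commute.refl _)⟩
    rw [sub_eq_add_neg, hLdef, add_pow_natCard_pow hcx.neg_right, ← hLdef,
      ((odd_natCard h2).pow (n := 2 * Module.finrank K V)).neg_pow, ← hLdef]
    nth_rewrite 2 [hLdef]
    rw [pow_natCard_of_sq_eq h2 hs h1]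
    exact add_neg_cancel _
  · rintro ⟨r, μ⟩ hx
    simp only [Finset.mem_sigma, Finset.mem_filter, Finset.mem_univ, true_and] at hx
    rw [hpow hx.1 hx.2.1 hx.2.2, add_sub_cancel_left]
  · intro x _
    simp
  · rintro ⟨r, μ⟩ hx
    simp only [Finset.mem_sigma, Finset.mem_filter, Finset.mem_univ, true_and] at hx
    rw [hdec hx.1 hx.2.1 hx.2.2, finrank_ker_mul_of_isUnit]
    refine IsNilpotent.isUnit_add_left_of_commute hx.2.1 ?_ (hx.2.2.symm.smul_right _)
    refine IsUnit.of_mul_eq_one ((2 * s)⁻¹ • r) ?_ 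
    rw [smul_mul_smul_comm, hx.1, smul_smul, mul_inv]
    field_simp
    simp

end SquareRootSum

section SquareRootIdentity

variable {K : Type} [Field K] [Finite K] {V : Type} [AddCommGroup V] [Module K V] [Finite V]
  {F : Type} [Field F] [CharZero F]

local notation "Q" => ((Nat.card K : ℕ) : F)

lemma natCard_pow_sub_one_ne_zero {a : ℕ} (ha : 1 ≤ a) : Q ^ a - 1 ≠ 0 := by
  have h : 1 < Nat.card K ^ a := Nat.one_lt_pow (by omega) Finite.one_lt_card
  rw [sub_ne_zero]
  exact_mod_cast h.ne'

open Classical in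
lemma sum_sq_eq_commNilSum_of_isSquare {b : K} (hb : b ≠ 0) (g : ℕ → F) :
    ∑ r : Module.End K V with r * r = (b * b) • 1, commNilSum r g =
      ∑ e : Module.End K V with e * e = 1, commNilSum e g := by
  symm
  refine Finset.sum_bij' (fun e _ => b • e) (fun r _ => b⁻¹ • r) ?_ ?_
    (fun e _ => inv_smul_smul₀ hb e) (fun e _ => smul_inv_smul₀ hb e)
    fun e _ => by rw [commNilSum_smul hb]
  · intro e he
    simp only [Finset.mem_filter, Finset.mem_univ, true_and] at he ⊢
    rw [smul_mul_smul_comm, he]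
  · intro r hr
    simp only [Finset.mem_filter, Finset.mem_univ, true_and] at hr ⊢
    rw [smul_mul_smul_comm, hr, smul_smul, ← mul_inv, inv_mul_cancel₀ (mul_ne_zero hb hb), one_smul]

open Classical in
lemma sum_sq_commNilSum_of_not_isSquare {s : K} (hs : ¬ IsSquare s) {a : ℕ}
    (ha : 1 ≤ a) (hV : Module.finrank K V = 2 * a) :
    (∑ r : Module.End K V with r * r = s • 1, commNilSum r (phiQ Q)) * (Q ^ (2 * a) - 1) =
      (1 - Q ^ a) * glOrd Q (2 * a) := by
  have hirr : Irreducible (Polynomial.X ^ 2 - Polynomial.C s) :=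
    (X_pow_sub_C_irreducible_iff_of_prime Nat.prime_two).2 fun b hb => hs ⟨b, by rw [← hb, sq]⟩
  have : Fact (Irreducible (Polynomial.X ^ 2 - Polynomial.C s)) := ⟨hirr⟩
  let K' := AdjoinRoot (Polynomial.X ^ 2 - Polynomial.C s)
  let θ : K' := AdjoinRoot.root _
  have hfin : Module.Finite K K' := (AdjoinRoot.powerBasis hirr.ne_zero).finite
  have : Finite K' := Module.finite_of_finite K
  have hdeg : Module.finrank K K' = 2 := by
    rw [(AdjoinRoot.powerBasis hirr.ne_zero).finrank, AdjoinRoot.powerBasis_dim,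
      Polynomial.natDegree_X_pow_sub_C]
  have hθ : Algebra.adjoin K {θ} = ⊤ := AdjoinRoot.adjoinRoot_eq_top
  have hθ2 : θ * θ = algebraMap K K' s := by
    have := AdjoinRoot.eval₂_root (Polynomial.X ^ 2 - Polynomial.C s)
    simp only [Polynomial.eval₂_sub, Polynomial.eval₂_X_pow, Polynomial.eval₂_C, sub_eq_zero] at this
    rw [← sq]; exact this
  let V₀ := Fin a → K'
  have hV₀ : Module.finrank K V₀ = 2 * a := by
    rw [← Module.finrank_mul_finrank K K' V₀, hdeg]; simp [V₀]
  have hV₀' : Module.finrank K' V₀ = a := by simp [V₀]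
  have hT : (Algebra.lsmul K K V₀ θ) * (Algebra.lsmul K K V₀ θ) = s • 1 := by
    rw [← map_mul, hθ2, AlgHom.commutes, Algebra.algebraMap_eq_smul_one]
  have hcard : Nat.card K' = Nat.card K ^ 2 := by
    rw [Module.natCard_eq_pow_finrank (K := K), hdeg]
  have key := sum_commNilSum_of_conj' (A := F) (V := V)
    (LinearEquiv.ofFinrankEq V₀ V (by rw [hV₀, hV]))
    (Algebra.lsmul K K V₀ θ) (fun r => r * r = s • 1) ?_ (phiQ Q)
  · generalize hc : Finset.card _ = c at key
    have hc' : c = Fintype.card (V₀ ≃ₗ[K'] V₀) := by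
      rw [← hc]
      convert card_commutant_lsmul (K := K) (V := V₀) hθ
    rw [hc', natCard_linearEquiv, commNilSum_lsmul hθ, hV, hV₀', hdeg, hcard] at key
    push_cast at key
    have h3 := nilSum_phiQ_mul_poch (K := K') (V := V₀) (A := F) Q ha hV₀'
    rw [hcard] at h3
    push_cast at h3
    have h4 : glOrd (Q ^ 2) a ≠ 0 := by
      have := natCard_linearEquiv (K := K') (V := V₀) (A := F)
      rw [hcard, hV₀'] at this
      push_cast at this
      rw [← this]
      exact Nat.cast_ne_zero.2 Fintype.card_ne_zero
    have h5 : nilSum K' V₀ (fun t => phiQ Q (2 * t)) =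
        nilSum K' V₀ (fun t => phiQ (Q ^ 2) t * poch (Q ^ 2) Q t) :=
      nilSum_congr_fun (by omega) fun t ht _ => phiQ_two_mul _ ht
    rw [h5] at key
    refine mul_right_cancel₀ h4 ?_
    rw [← pow_mul] at h3
    linear_combination (Q ^ (2 * a) - 1) * key + glOrd Q (2 * a) * h3
  · intro T
    constructor
    · intro hT'
      exact exists_conj_of_sq_eq hs hT hT' (by rw [hV₀, hV])
    · rintro ⟨h, rfl⟩
      have := congrArg h.conjRingEquiv hT
      rw [map_mul] at this
      refine this.trans ?_
      change h.conj (s • 1) = _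
      rw [map_smul]
      exact congrArg (s • ·) h.conjRingEquiv.map_one

lemma isSquare_of_sq_eq_smul_one {s : K} (hodd : Odd (Module.finrank K V)) {r : Module.End K V}
    (hr : r * r = s • 1) (hs : s ≠ 0) : IsSquare s := by
  obtain ⟨b, hb⟩ := hodd
  have := congrArg LinearMap.det hr
  rw [map_mul, LinearMap.det_smul, map_one, mul_one, hb] at this
  refine ⟨LinearMap.det r * (s ^ b)⁻¹, ?_⟩
  rw [mul_mul_mul_comm, this]
  field_simp
  ring

open Classical in
/-- The identity relating square roots of `s` and balanced involutions, weighted by `phiQ`. -/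
theorem sum_sq_sub_eq (h2 : (2 : K) ≠ 0) {s : K} (hs : s ≠ 0) (hV : 1 ≤ Module.finrank K V) :
    ∑ x : Module.End K V with IsNilpotent (x * x - s • 1),
        phiQ Q (Module.finrank K (LinearMap.ker (x * x - s • 1))) =
      ∑ e : Module.End K V with IsBalanced e, commNilSum e (phiQ Q) +
        (if IsSquare s ∨ Even (Module.finrank K V) then 2 else 0) * nilSum K V (phiQ Q) := by
  rw [sum_sq_sub_isNilpotent h2 hs]
  by_cases hsq : IsSquare s
  · obtain ⟨b, rfl⟩ := hsq
    rw [sum_sq_eq_commNilSum_of_isSquare (by rintro rfl; simp at hs),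
      sum_involution_commNilSum h2 hV, if_pos (Or.inl ⟨b, rfl⟩)]
  · rcases Nat.even_or_odd (Module.finrank K V) with he | ho
    · rw [if_pos (Or.inr he)]
      obtain ⟨a, ha⟩ := he
      have ha1 : 1 ≤ a := by omega
      have h1 := sum_sq_commNilSum_of_not_isSquare (F := F) hsq ha1 (by rw [ha]; ring)
      have h3 := sum_isBalanced_commNilSum (K := K) (V := V) (F := F) h2 ha1 (by rw [ha]; ring)
      have h4 := nilSum_phiQ (K := K) (V := V) (A := F) (a := 2 * a) (by omega) (by rw [ha]; ring)
      refine mul_right_cancel₀ (natCard_pow_sub_one_ne_zero (K := K) (F := F) (a := 2 * a)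
        (by omega)) ?_
      have h5 : Q ^ (2 * a) = Q ^ a * Q ^ a := by ring
      rw [h5] at *
      linear_combination h1 - (Q ^ a + 1) * h3 - 2 * h4
    · rw [if_neg (not_or.2 ⟨hsq, Nat.not_even_iff_odd.2 ho⟩), zero_mul, add_zero]
      rw [Finset.sum_eq_zero, Finset.sum_eq_zero]
      · intro e he
        exact absurd (Finset.mem_filter.1 he).2 (not_isBalanced_of_odd ho)
      · intro r hr
        exact absurd (isSquare_of_sq_eq_smul_one ho (Finset.mem_filter.1 hr).2 hs) hsq

end SquareRootIdentity

/-- Some iterate of the `q`-power map on a finite monoid is idempotent. -/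
lemma exists_pow_pow_idempotent (B : Type) [Monoid B] [Finite B] (q : ℕ) :
    ∃ m, 1 ≤ m ∧ ∀ x : B, (x ^ (q ^ m)) ^ (q ^ m) = x ^ (q ^ m) := by
  obtain ⟨i, j, hij, h⟩ := Finite.exists_ne_map_eq_of_infinite fun (i : ℕ) (x : B) => x ^ (q ^ i)
  wlog hlt : i < j generalizing i j
  · exact this j i hij.symm h.symm (lt_of_le_of_ne (not_lt.1 hlt) hij.symm)
  obtain ⟨d, hd, rfl⟩ : ∃ d, 1 ≤ d ∧ j = i + d := ⟨j - i, by omega, by omega⟩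
  have h1 : ∀ a, ∀ x : B, x ^ (q ^ (i + a + d)) = x ^ (q ^ (i + a)) := fun a x => by
    have := congrFun h x
    rw [show i + a + d = i + d + a by ring, pow_add q (i + d), pow_mul, ← this, ← pow_mul, ← pow_add]
  have h2 : ∀ c a, ∀ x : B, x ^ (q ^ (i + a + c * d)) = x ^ (q ^ (i + a)) := fun c => by
    induction c with
    | zero => intro a x; simp
    | succ c ih =>
      intro a x
      rw [show i + a + (c + 1) * d = i + (a + c * d) + d by ring, h1, ← ih a x, add_assoc i]
  refine ⟨d * (i + 1), Nat.mul_pos hd (by omega), fun x => ?_⟩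
  have h3 : i ≤ d * (i + 1) := by nlinarith
  obtain ⟨a, ha⟩ := Nat.exists_eq_add_of_le h3
  rw [← pow_mul, ← pow_add]
  have := h2 (i + 1) a x
  rw [show (i + 1) * d = d * (i + 1) by ring, ← ha] at this
  exact this

section OffDiag

variable {K : Type} [Field K] {V : Type} [AddCommGroup V] [Module K V]

/-- Endomorphisms killing `W` with image contained in `W`. -/
def offDiag (W : Submodule K V) : Submodule K (Module.End K V) where
  carrier := {θ | (∀ w ∈ W, θ w = 0) ∧ ∀ v, θ v ∈ W}
  add_mem' := fun ha hb => ⟨fun w hw => by simp [ha.1 w hw, hb.1 w hw],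
    fun v => W.add_mem (ha.2 v) (hb.2 v)⟩
  zero_mem' := ⟨fun _ _ => rfl, fun _ => W.zero_mem⟩
  smul_mem' := fun c θ h => ⟨fun w hw => by simp [h.1 w hw], fun v => W.smul_mem c (h.2 v)⟩

variable {W : Submodule K V}

lemma offDiag_mul {θ θ' : Module.End K V} (h : θ ∈ offDiag W) (h' : θ' ∈ offDiag W) :
    θ * θ' = 0 := LinearMap.ext fun v => h.1 _ (h'.2 v)

lemma stable_mul_offDiag {y θ : Module.End K V} (hy : ∀ w ∈ W, y w ∈ W) (h : θ ∈ offDiag W) :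
    y * θ ∈ offDiag W :=
  ⟨fun w hw => by rw [Module.End.mul_apply, h.1 w hw, map_zero], fun v => hy _ (h.2 v)⟩

lemma offDiag_mul_stable {y θ : Module.End K V} (hy : ∀ w ∈ W, y w ∈ W) (h : θ ∈ offDiag W) :
    θ * y ∈ offDiag W := ⟨fun w hw => h.1 _ (hy w hw), fun _ => h.2 _⟩

/-- The automorphism `1 + θ` for `θ` in `offDiag W`. -/
def oneAddEquiv {θ : Module.End K V} (h : θ ∈ offDiag W) : V ≃ₗ[K] V :=
  LinearEquiv.ofLinearMap (1 + θ) (1 - θ)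
    (by
      change (1 + θ) * (1 - θ) = 1
      rw [mul_sub, add_mul, add_mul, offDiag_mul h h]; simp)
    (by
      change (1 - θ) * (1 + θ) = 1
      rw [mul_add, sub_mul, sub_mul, offDiag_mul h h]; simp)

lemma oneAddEquiv_conj {θ : Module.End K V} (h : θ ∈ offDiag W) (y : Module.End K V) :
    (oneAddEquiv h).conj y = (1 + θ) * y * (1 - θ) := rfl

/-- The commutator `ζ ↦ ζ y - y ζ` -/
def adR (y : Module.End K V) : Module.End K (Module.End K V) :=
  LinearMap.mulRight K y - LinearMap.mulLeft K y

lemma adR_apply (y ζ : Module.End K V) : adR y ζ = ζ * y - y * ζ := rfl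

lemma adR_mem {y ζ : Module.End K V} (hy : ∀ w ∈ W, y w ∈ W) (h : ζ ∈ offDiag W) :
    adR y ζ ∈ offDiag W :=
  (offDiag W).sub_mem (offDiag_mul_stable hy h) (stable_mul_offDiag hy h)

lemma adR_pow [Finite K] (h2 : (2 : K) ≠ 0) (y : Module.End K V) (N : ℕ) :
    adR y ^ (Nat.card K ^ N) = adR (y ^ (Nat.card K ^ N)) := by
  have hc : Commute (LinearMap.mulRight K y) (-LinearMap.mulLeft K y) :=
    LinearMap.ext fun x => by simp [mul_assoc]
  have hn : (-LinearMap.mulLeft K y) ^ (Nat.card K ^ N) = -(LinearMap.mulLeft K y) ^ (Nat.card K ^ N) :=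
    Odd.neg_pow (α := Module.End K (Module.End K V)) (odd_natCard h2).pow (LinearMap.mulLeft K y)
  rw [adR, sub_eq_add_neg, add_pow_natCard_pow hc, hn,
    LinearMap.pow_mulRight, LinearMap.pow_mulLeft, ← sub_eq_add_neg]
  rfl

end OffDiag

section ClassFunctions

variable {K : Type} [Field K] {V : Type} [AddCommGroup V] [Module K V]
  {F : Type} [Field F]

/-- Conjugation invariant functions on endomorphisms, supported on the invertible ones,
with vanishing sums over unipotent radicals. -/
structure IsCuspClassFun [Finite V] (χ : Module.End K V → F) : Prop where
  conj : ∀ (h : V ≃ₗ[K] V) y, χ (h.conj y) = χ y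
  nonunit : ∀ y, ¬ IsUnit y → χ y = 0
  cusp : ∀ W : Submodule K V, W ≠ ⊥ → W ≠ ⊤ → ∀ y, ∑ θ : offDiag W, χ (y * (1 + θ.1)) = 0

variable [Finite V] {χ : Module.End K V → F} {W : Submodule K V}

lemma isUnit_one_add {θ : Module.End K V} (h : θ ∈ offDiag W) : IsUnit (1 + θ) :=
  ⟨⟨1 + θ, 1 - θ, by rw [mul_sub, add_mul, add_mul, offDiag_mul h h]; simp,
    by rw [mul_add, sub_mul, sub_mul, offDiag_mul h h]; simp⟩, rfl⟩

lemma map_eq_of_stable {y : Module.End K V} (hu : IsUnit y) (hy : ∀ w ∈ W, y w ∈ W) :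
    ∀ v, y v ∈ W → v ∈ W := by
  intro v hv
  have hinj : Function.Injective y := ((Module.End.isUnit_iff y).1 hu).1
  have hr : Function.Injective (y.restrict hy) := fun a b h => by
    have := congrArg Subtype.val h
    exact Subtype.ext (hinj this)
  have hs := Finite.surjective_of_injective hr
  obtain ⟨w, hw⟩ := hs ⟨y v, hv⟩
  have : y w = y v := congrArg Subtype.val hw
  rw [← hinj this]
  exact w.2

lemma IsCuspClassFun.sum_add (hχ : IsCuspClassFun χ) (hW : W ≠ ⊥) (hW' : W ≠ ⊤)
    {y : Module.End K V} (hy : ∀ w ∈ W, y w ∈ W) : ∑ θ : offDiag W, χ (y + θ.1) = 0 := by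
  by_cases hu : IsUnit y
  · rw [← hχ.cusp W hW hW' y]
    have hb : Function.Bijective fun θ : offDiag W =>
        (⟨y * θ.1, stable_mul_offDiag hy θ.2⟩ : offDiag W) := by
      refine Finite.injective_iff_bijective.1 fun a b h => ?_
      exact Subtype.ext (hu.mul_left_cancel (congrArg Subtype.val h))
    refine (Fintype.sum_bijective _ hb _ _ fun θ => ?_).symm
    simp only [mul_add, mul_one]
  · refine Finset.sum_eq_zero fun θ _ => hχ.nonunit _ fun hu' => hu ?_
    have hs : ∀ w ∈ W, (y + θ.1) w ∈ W := fun w hw => by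
      rw [LinearMap.add_apply, θ.2.1 w hw, add_zero]; exact hy w hw
    obtain ⟨u, hu''⟩ := hu'
    have h1 : (↑u⁻¹ : Module.End K V) * θ.1 ∈ offDiag W := by
      refine stable_mul_offDiag (fun w hw => ?_) θ.2
      refine map_eq_of_stable (y := (u : Module.End K V)) u.isUnit (hu'' ▸ hs) _ ?_
      rw [← Module.End.mul_apply, Units.mul_inv]
      exact hw
    have h2 : y = u * (1 + -(↑u⁻¹ * θ.1)) := by
      rw [mul_add, mul_one, mul_neg, Units.mul_inv_cancel_left, hu'']
      abel
    rw [h2]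
    exact u.isUnit.mul (isUnit_one_add ((offDiag W).neg_mem h1))

open Classical in
/-- Cuspidality along the part of the unipotent radical commuting with the semisimple part. -/
lemma IsCuspClassFun.sum_commute [CharZero F] [Finite K] (h2 : (2 : K) ≠ 0)
    (hχ : IsCuspClassFun χ) (hW : W ≠ ⊥) (hW' : W ≠ ⊤) {N : ℕ} (hN : 1 ≤ N)
    {y s : Module.End K V} (hys : y ^ (Nat.card K ^ N) = s) (hs : s ^ (Nat.card K ^ N) = s)
    (hy : ∀ w ∈ W, y w ∈ W) :
    ∑ θ : offDiag W with Commute s θ.1, χ (y + θ.1) = 0 := by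
  set L := Nat.card K ^ N with hL
  have hL2 : 2 ≤ L := (Finite.one_lt_card (α := K)).trans_le (Nat.le_self_pow (by omega) _)
  have hadp : ∀ n, ∀ η ∈ offDiag W, (adR y ^ n) η ∈ offDiag W := fun n => by
    induction n with
    | zero => intro η h; exact h
    | succ n ih =>
      intro η h
      rw [pow_succ', Module.End.mul_apply]
      exact adR_mem hy (ih η h)
  have htr : ∀ η ∈ offDiag W, ∀ ζ ∈ offDiag W, χ (y + η + adR y ζ) = χ (y + η) := by
    intro η hη ζ hζ
    rw [← hχ.conj (oneAddEquiv hζ) (y + η), oneAddEquiv_conj]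
    congr 1
    have e1 := offDiag_mul hζ hη
    have e2 := offDiag_mul hη hζ
    have e3 := offDiag_mul (offDiag_mul_stable hy hζ) hζ
    have : (1 + ζ) * (y + η) * (1 - ζ) =
      y + η + (ζ * y - y * ζ) + ζ * η - η * ζ - ζ * y * ζ - (ζ * η) * ζ := by noncomm_ring
    rw [this, e1, e2, e3, adR_apply]
    simp
  have hdec : ∀ η : offDiag W, ∃ θ ∈ offDiag W, ∃ ζ ∈ offDiag W, Commute s θ ∧
      η.1 = θ + adR y ζ := by
    intro η
    have hA : adR y ^ L = adR s := by rw [adR_pow h2, hys]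
    have hA' : adR y ^ (L * L) = adR s := by rw [pow_mul, hA, adR_pow h2, hs]
    refine ⟨η.1 - (adR y ^ (L * L - L)) η.1, (offDiag W).sub_mem η.2 (hadp _ _ η.2),
      (adR y ^ (L * L - L - 1)) η.1, hadp _ _ η.2, ?_, ?_⟩
    · have : adR s (η.1 - (adR y ^ (L * L - L)) η.1) = 0 := by
        rw [map_sub, ← hA, ← Module.End.mul_apply, ← pow_add, hA,
          show L + (L * L - L) = L * L by have : L ≤ L * L := by nlinarith
                                          omega, hA', sub_self]
      rw [adR_apply, sub_eq_zero] at this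
      exact this.symm
    · rw [← Module.End.mul_apply, ← pow_succ',
        show L * L - L - 1 + 1 = L * L - L by have : L + 1 ≤ L * L := by nlinarith
                                              omega, sub_add_cancel]
  set E₀ : AddSubgroup (offDiag W) :=
    { carrier := {θ | Commute s θ.1}
      zero_mem' := Commute.zero_right s
      add_mem' := fun h h' => Commute.add_right h h'
      neg_mem' := fun h => Commute.neg_right h } with hE₀
  have hsum : ∀ g : offDiag W → F, ∑ θ : offDiag W with Commute s θ.1, g θ = ∑ θ : E₀, g θ.1 := by
    intro g
    exact Finset.sum_subtype _ (fun x => by rw [Finset.mem_filter]; exact ⟨fun h => h.2, fun h => ⟨Finset.mem_univ _, h⟩⟩) g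
  rw [hsum]
  set S := ∑ θ : E₀, χ (y + θ.1.1) with hS
  have h1 : ∀ η : offDiag W, ∑ θ : E₀, χ (y + (θ.1.1 + η.1)) = S := by
    intro η
    obtain ⟨θ', hθ', ζ, hζ, hc, he⟩ := hdec η
    rw [hS, ← Equiv.sum_comp (Equiv.addRight (⟨⟨θ', hθ'⟩, hc⟩ : E₀)) fun θ : E₀ => χ (y + θ.1.1)]
    refine Finset.sum_congr rfl fun θ _ => ?_
    rw [he, ← add_assoc, ← add_assoc, add_assoc y]
    exact htr (θ.1.1 + θ') ((offDiag W).add_mem θ.1.2 hθ') ζ hζ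
  have h3 : ∑ η : offDiag W, ∑ θ : E₀, χ (y + (θ.1.1 + η.1)) = 0 := by
    rw [Finset.sum_comm]
    refine Finset.sum_eq_zero fun θ _ => ?_
    rw [← hχ.sum_add hW hW' hy, ← Equiv.sum_comp (Equiv.addLeft θ.1) fun θ : offDiag W => χ (y + θ.1)]
    rfl
  rw [Finset.sum_congr rfl fun η _ => h1 η, Finset.sum_const, nsmul_eq_mul] at h3
  refine (mul_eq_zero.1 h3).resolve_left ?_
  simp [Finset.card_univ, Fintype.card_ne_zero]

lemma IsCuspClassFun.sum_mul_eq_zero [CharZero F] (hχ : IsCuspClassFun χ) (hW : W ≠ ⊥)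
    (hW' : W ≠ ⊤) {g : Module.End K V → F}
    (hg : ∀ y, ∀ θ ∈ offDiag W, g (y * (1 + θ)) = g y) : ∑ y, χ y * g y = 0 := by
  have h1 : ∀ θ : offDiag W, ∑ y, χ (y * (1 + θ.1)) * g y = ∑ y, χ y * g y := by
    intro θ
    have hb : Function.Bijective fun y : Module.End K V => y * (1 + θ.1) :=
      Finite.injective_iff_bijective.1 fun a b h => (isUnit_one_add θ.2).mul_right_cancel h
    refine Fintype.sum_bijective _ hb _ _ fun y => ?_
    rw [hg y _ θ.2]
  have h3 : ∑ θ : offDiag W, ∑ y, χ (y * (1 + θ.1)) * g y = 0 := by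
    rw [Finset.sum_comm]
    refine Finset.sum_eq_zero fun y _ => ?_
    rw [← Finset.sum_mul, hχ.cusp W hW hW', zero_mul]
  rw [Finset.sum_congr rfl fun η _ => h1 η, Finset.sum_const, nsmul_eq_mul] at h3
  refine (mul_eq_zero.1 h3).resolve_left ?_
  simp [Finset.card_univ, Fintype.card_ne_zero]

end ClassFunctions

lemma eq_zero_of_pow_eq_self {B : Type} [MonoidWithZero B] {w : B} {L : ℕ} (hL : 2 ≤ L)
    (hw : w ^ L = w) (hn : IsNilpotent w) : w = 0 := by
  obtain ⟨n, hn⟩ := hn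
  have h : ∀ i, w ^ (L ^ i) = w := fun i => by
    induction i with
    | zero => simp
    | succ i ih => rw [pow_succ, pow_mul, ih, hw]
  rw [← h n]
  exact pow_eq_zero_of_le (Nat.lt_pow_self (by omega)).le hn

lemma two_le_natCard_pow (K : Type) [Field K] [Finite K] {N : ℕ} (hN : 1 ≤ N) :
    2 ≤ Nat.card K ^ N :=
  (Finite.one_lt_card (α := K)).trans_le (Nat.le_self_pow (by omega) _)

section NonField

variable {K : Type} [Field K] [Finite K] {V : Type} [AddCommGroup V] [Module K V] [Finite V]
  [Nontrivial V] {F : Type} [Field F] [CharZero F] {χ : Module.End K V → F}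

lemma IsCuspClassFun.eq_zero_of_not_irreducible (h2 : (2 : K) ≠ 0) (hχ : IsCuspClassFun χ)
    {N : ℕ} (hN : 1 ≤ N) {y s : Module.End K V} (hys : y ^ (Nat.card K ^ N) = s)
    (hs : s ^ (Nat.card K ^ N) = s) (hirr : ¬ Irreducible (minpoly K s)) : χ y = 0 := by
  classical
  have h_int : IsIntegral K s := Algebra.IsIntegral.isIntegral s
  rw [irreducible_iff, not_and] at hirr
  have h := hirr (minpoly.not_isUnit K s)
  push Not at h
  obtain ⟨a, b, hab, ha, hb⟩ := h
  have hne : a * b ≠ 0 := hab ▸ minpoly.ne_zero h_int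
  have hmon := minpoly.monic h_int
  have hda : a.natDegree ≠ 0 := fun h => ha (Polynomial.isUnit_iff_degree_eq_zero.2
    (by rw [Polynomial.degree_eq_natDegree (left_ne_zero_of_mul hne), h]; rfl))
  have hdb : b.natDegree ≠ 0 := fun h => hb (Polynomial.isUnit_iff_degree_eq_zero.2
    (by rw [Polynomial.degree_eq_natDegree (right_ne_zero_of_mul hne), h]; rfl))
  have hdeg : (minpoly K s).natDegree = a.natDegree + b.natDegree := by
    rw [hab, Polynomial.natDegree_mul (left_ne_zero_of_mul hne) (right_ne_zero_of_mul hne)]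
  have hnz : ∀ c : Polynomial K, c ≠ 0 → c.natDegree < (minpoly K s).natDegree →
      Polynomial.aeval s c ≠ 0 := fun c hc hlt h0 => by
    have := Polynomial.natDegree_le_of_dvd (minpoly.dvd K s h0) hc
    omega
  have hco : IsCoprime a b := by
    obtain ⟨p, hp⟩ := CharP.exists K
    have : Fintype K := Fintype.ofFinite K
    obtain ⟨n, hpr, hn⟩ := FiniteField.card K p
    have hdvd : p ∣ Nat.card K ^ N := by
      rw [Nat.card_eq_fintype_card, hn, ← pow_mul]
      exact dvd_pow_self p (Nat.mul_ne_zero n.pos.ne' (by omega))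
    have hd : minpoly K s ∣ Polynomial.X ^ (Nat.card K ^ N) - Polynomial.X :=
      minpoly.dvd K s (by rw [map_sub, map_pow, Polynomial.aeval_X, hs, sub_self])
    rw [hab] at hd
    exact Polynomial.Separable.isCoprime
      (Polynomial.Separable.of_dvd (galois_poly_separable p _ hdvd) hd)
  have hsy : Commute s y := hys ▸ (Commute.refl y).pow_left _
  set A := Polynomial.aeval s a with hA
  set B := Polynomial.aeval s b with hB
  have hAB : A * B = 0 := by rw [← map_mul, ← hab, minpoly.aeval]
  have hcomm : ∀ (c : Polynomial K) {x : Module.End K V}, Commute s x →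
      Commute (Polynomial.aeval s c) x := fun c x hx => by
    induction c using Polynomial.induction_on' with
    | add p q hp hq => rw [map_add]; exact hp.add_left hq
    | monomial n r =>
      rw [Polynomial.aeval_monomial]
      exact ((Algebra.commute_algebraMap_left r x).mul_left (hx.pow_left n))
  obtain ⟨u, v, huv⟩ := hco
  have hW : LinearMap.ker A ≠ ⊥ := by
    intro h
    have hinj := LinearMap.ker_eq_bot.1 h
    refine hnz b (right_ne_zero_of_mul hne) (by omega) (LinearMap.ext fun x => hinj ?_)
    rw [LinearMap.zero_apply, map_zero]
    exact LinearMap.congr_fun hAB x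
  have hW' : LinearMap.ker A ≠ ⊤ := fun h =>
    hnz a (left_ne_zero_of_mul hne) (by omega) (LinearMap.ker_eq_top.1 h)
  have key := hχ.sum_commute h2 hW hW' hN hys hs (fun w hw => by
    rw [LinearMap.mem_ker] at hw ⊢
    rw [← Module.End.mul_apply, (hcomm a hsy).eq, Module.End.mul_apply, hw, map_zero])
  rw [Finset.sum_eq_single_of_mem (0 : offDiag (LinearMap.ker A))
    (Finset.mem_filter.2 ⟨Finset.mem_univ _, Commute.zero_right s⟩)] at key
  · simpa using key
  · intro η hη hne
    refine absurd (Subtype.ext (LinearMap.ext fun x => ?_)) hne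
    have hc : Commute s η.1 := (Finset.mem_filter.1 hη).2
    have h1 : B (η.1 x) = 0 := by
      rw [← Module.End.mul_apply, (hcomm b hc).eq, Module.End.mul_apply]
      exact η.2.1 _ (LinearMap.congr_fun hAB x)
    have h3 := LinearMap.congr_fun (congrArg (Polynomial.aeval s) huv) (η.1 x)
    rw [map_add, map_mul, map_mul, map_one, LinearMap.add_apply, Module.End.mul_apply,
      Module.End.mul_apply, ← hA, ← hB, LinearMap.mem_ker.1 (η.2.2 x), h1, map_zero, map_zero,
      zero_add] at h3
    exact h3.symm

end NonField

section FieldCase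

variable {K K' : Type} [Field K] [Field K'] [Algebra K K'] [Finite K] [Finite K'] {θ : K'}
  {V : Type} [AddCommGroup V] [Module K V] [Module K' V] [IsScalarTower K K' V] [Finite V]
  {F : Type} [Field F] [CharZero F]

local notation "sE" => Algebra.lsmul K K V θ

lemma isBalanced_restrictScalars {e : Module.End K' V} [Nontrivial V] :
    IsBalanced (e.restrictScalars K : Module.End K V) ↔ IsBalanced e := by
  have h1 : (e.restrictScalars K : Module.End K V) * e.restrictScalars K = 1 ↔ e * e = 1 :=
    (LinearMap.restrictScalars_injective K (M := V) (S := K')).eq_iff (a := e * e) (b := 1)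
  have h3 := finrank_ker_restrictScalars (K := K) (e - 1)
  have h4 : 0 < Module.finrank K K' := Module.finrank_pos
  rw [IsBalanced, IsBalanced, h1]
  change _ ∧ 2 * Module.finrank K (LinearMap.ker ((e - 1).restrictScalars K)) = _ ↔ _
  rw [h3, ← Module.finrank_mul_finrank K K' V]
  refine and_congr_right fun _ => ⟨fun h => ?_, fun h => ?_⟩
  · exact Nat.eq_of_mul_eq_mul_left h4 (by linarith)
  · rw [← h]; ring

lemma lsmul_add_restrictScalars_pow {N : ℕ} (hN : 1 ≤ N)
    (hs : sE ^ (Nat.card K ^ N) = sE)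
    (hL : ∀ x : Module.End K V, (x ^ (Nat.card K ^ N)) ^ (Nat.card K ^ N) = x ^ (Nat.card K ^ N))
    (hθ : Algebra.adjoin K {θ} = ⊤) {y : Module.End K V} :
    y ^ (Nat.card K ^ N) = sE ↔
      ∃ ν : Module.End K' V, IsNilpotent ν ∧ y = sE + ν.restrictScalars K := by
  have h2 := two_le_natCard_pow K hN
  constructor
  · intro h
    have hc : Commute sE y := h ▸ (Commute.refl y).pow_left _
    obtain ⟨y', rfl⟩ := (commute_lsmul_iff hθ).1 hc
    refine ⟨y' - θ • 1, ?_, ?_⟩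
    · rw [← isNilpotent_restrictScalars (K := K)]
      have : ((y' - θ • 1 : Module.End K' V).restrictScalars K : Module.End K V) =
        y'.restrictScalars K + -sE := by ext v; simp [sub_eq_add_neg]
      rw [this]
      have h3 := add_pow_natCard_pow (K := K) (x := (y'.restrictScalars K : Module.End K V))
        (y := -sE) hc.symm.neg_right N
      have h4 := add_pow_natCard_pow (K := K) (x := sE) (y := -sE) (Commute.refl sE).neg_right N
      rw [add_neg_cancel, zero_pow (by omega), hs] at h4
      exact ⟨_, by rw [h3, h, ← h4]⟩
    · ext v; simp
  · rintro ⟨ν, hν, rfl⟩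
    rw [add_pow_natCard_pow (K := K) ((commute_lsmul_iff hθ).2 ⟨ν, rfl⟩), hs]
    rw [eq_zero_of_pow_eq_self h2 (hL (ν.restrictScalars K)), add_zero]
    exact (isNilpotent_restrictScalars.2 hν).pow_of_pos (by omega)

open Classical in
lemma sum_pow_eq_lsmul {N : ℕ} (hN : 1 ≤ N) (hs : sE ^ (Nat.card K ^ N) = sE)
    (hL : ∀ x : Module.End K V, (x ^ (Nat.card K ^ N)) ^ (Nat.card K ^ N) = x ^ (Nat.card K ^ N))
    (hθ : Algebra.adjoin K {θ} = ⊤) (g : Module.End K V → F) :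
    ∑ y : Module.End K V with y ^ (Nat.card K ^ N) = sE, g y =
      ∑ ν : Module.End K' V with IsNilpotent ν, g (sE + ν.restrictScalars K) := by
  symm
  refine Finset.sum_bij (fun ν _ => sE + ν.restrictScalars K) ?_ ?_ ?_ ?_
  · intro ν hν
    exact Finset.mem_filter.2 ⟨Finset.mem_univ _, (lsmul_add_restrictScalars_pow hN hs hL hθ).2
      ⟨ν, (Finset.mem_filter.1 hν).2, rfl⟩⟩
  · intro a _ b _ h
    exact LinearMap.restrictScalars_injective K (add_left_cancel h)
  · intro y hy
    obtain ⟨ν, hν, h⟩ := (lsmul_add_restrictScalars_pow hN hs hL hθ).1 (Finset.mem_filter.1 hy).2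
    exact ⟨ν, Finset.mem_filter.2 ⟨Finset.mem_univ _, hν⟩, h.symm⟩
  · intro _ _; rfl

open Classical in
lemma sum_sq_pow_eq_lsmul {N : ℕ} (hN : 1 ≤ N) (hs : sE ^ (Nat.card K ^ N) = sE)
    (hL : ∀ x : Module.End K V, (x ^ (Nat.card K ^ N)) ^ (Nat.card K ^ N) = x ^ (Nat.card K ^ N))
    (hθ : Algebra.adjoin K {θ} = ⊤) (g : Module.End K V → F) :
    ∑ x : Module.End K V with (x * x) ^ (Nat.card K ^ N) = sE, g (x * x) =
      ∑ x : Module.End K' V with IsNilpotent (x * x - θ • 1),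
        g (sE + (x * x - θ • 1 : Module.End K' V).restrictScalars K) := by
  symm
  have he : ∀ x : Module.End K' V, sE + (x * x - θ • 1 : Module.End K' V).restrictScalars K =
      x.restrictScalars K * x.restrictScalars K := fun x => by ext v; simp
  refine Finset.sum_bij (fun x _ => x.restrictScalars K) ?_ ?_ ?_ ?_
  · intro x hx
    refine Finset.mem_filter.2 ⟨Finset.mem_univ _, (lsmul_add_restrictScalars_pow hN hs hL hθ).2
      ⟨_, (Finset.mem_filter.1 hx).2, (he x).symm⟩⟩
  · intro a _ b _ h
    exact LinearMap.restrictScalars_injective K h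
  · intro y hy
    have h := (Finset.mem_filter.1 hy).2
    have hc : Commute sE y := h ▸ ((Commute.refl y).mul_left (Commute.refl y)).pow_left _
    obtain ⟨x, rfl⟩ := (commute_lsmul_iff hθ).1 hc
    obtain ⟨ν, hν, h'⟩ := (lsmul_add_restrictScalars_pow hN hs hL hθ).1 h
    refine ⟨x, Finset.mem_filter.2 ⟨Finset.mem_univ _, ?_⟩, rfl⟩
    rw [← he] at h'
    rwa [LinearMap.restrictScalars_injective K (add_left_cancel h')]
  · intro x _
    rw [he]

open Classical in
lemma sum_isBalanced_pow_eq_lsmul {N : ℕ} (hN : 1 ≤ N) (hs : sE ^ (Nat.card K ^ N) = sE)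
    (hL : ∀ x : Module.End K V, (x ^ (Nat.card K ^ N)) ^ (Nat.card K ^ N) = x ^ (Nat.card K ^ N))
    (hθ : Algebra.adjoin K {θ} = ⊤) [Nontrivial V] (g : Module.End K V → F) :
    ∑ e : Module.End K V with IsBalanced e,
      ∑ y : Module.End K V with y ^ (Nat.card K ^ N) = sE, (if Commute e y then g y else 0) =
      ∑ e : Module.End K' V with IsBalanced e,
        ∑ ν : Module.End K' V with IsNilpotent ν ∧ Commute e ν, g (sE + ν.restrictScalars K) := by
  have hcm : ∀ e ν : Module.End K' V, IsNilpotent ν →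
      (Commute (e.restrictScalars K : Module.End K V) (sE + ν.restrictScalars K) ↔
        Commute e ν) := fun e ν hν => by
    have h1 : Commute (e.restrictScalars K : Module.End K V) sE :=
      ((commute_lsmul_iff hθ).2 ⟨e, rfl⟩).symm
    constructor
    · intro h
      have := h.sub_right h1
      rw [add_sub_cancel_left] at this
      exact LinearMap.restrictScalars_injective K this
    · intro h
      exact h1.add_right (congrArg (fun x : Module.End K' V => x.restrictScalars K) h.eq)
  have h1 : ∀ e' : Module.End K' V, ∑ y : Module.End K V with y ^ (Nat.card K ^ N) = sE,
      (if Commute (e'.restrictScalars K : Module.End K V) y then g y else 0) =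
      ∑ ν : Module.End K' V with IsNilpotent ν ∧ Commute e' ν, g (sE + ν.restrictScalars K) := by
    intro e'
    rw [sum_pow_eq_lsmul hN hs hL hθ, ← Finset.filter_filter, Finset.sum_filter (Commute e')]
    refine Finset.sum_congr rfl fun ν hν => ?_
    simp only [hcm e' ν (Finset.mem_filter.1 hν).2]
  symm
  rw [Finset.sum_congr rfl fun e _ => (h1 e).symm]
  refine Finset.sum_bij_ne_zero (fun e _ _ => e.restrictScalars K) ?_ ?_ ?_ ?_
  · intro e he _
    exact Finset.mem_filter.2 ⟨Finset.mem_univ _,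
      isBalanced_restrictScalars.2 (Finset.mem_filter.1 he).2⟩
  · intro a _ _ b _ _ h
    exact LinearMap.restrictScalars_injective K h
  · intro e he hne
    obtain ⟨y, hy, hy'⟩ := Finset.exists_ne_zero_of_sum_ne_zero hne
    have hc : Commute e y := by
      by_contra hc
      exact hy' (if_neg hc)
    have hc' : Commute sE e := (Finset.mem_filter.1 hy).2 ▸ (hc.pow_right _).symm
    obtain ⟨e', rfl⟩ := (commute_lsmul_iff hθ).1 hc'
    exact ⟨e', Finset.mem_filter.2 ⟨Finset.mem_univ _,
      isBalanced_restrictScalars.1 (Finset.mem_filter.1 he).2⟩, hne, rfl⟩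
  · intro _ _ _; rfl

lemma isSquare_norm_iff (h2 : (2 : K) ≠ 0) (hθ0 : θ ≠ 0) :
    IsSquare (Algebra.norm K θ) ↔ IsSquare θ := by
  have hK : Fintype K := Fintype.ofFinite K
  have hK' : Fintype K' := Fintype.ofFinite K'
  have hc : ringChar K ≠ 2 := fun h => h2 (by
    have := ringChar.Nat.cast_ringChar (R := K); rw [h] at this; exact_mod_cast this)
  have hc' : ringChar K' ≠ 2 := by rwa [← Algebra.ringChar_eq K K']
  have h2' : (2 : K') ≠ 0 := fun h => h2 ((algebraMap K K').injective (by rw [map_ofNat, map_zero, h]))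
  have hn0 : Algebra.norm K θ ≠ 0 := Algebra.norm_ne_zero_iff.2 hθ0
  rw [FiniteField.isSquare_iff hc hn0, FiniteField.isSquare_iff hc' hθ0,
    ← (algebraMap K K').injective.eq_iff, map_pow, map_one, FiniteField.algebraMap_norm_eq_pow,
    ← pow_mul]
  have e1 : (Nat.card K' - 1) / (Nat.card K - 1) * (Fintype.card K / 2) = Fintype.card K' / 2 := by
    have o1 := odd_natCard h2
    have o2 := odd_natCard h2'
    have hd : Nat.card K - 1 ∣ Nat.card K' - 1 := by
      rw [Module.natCard_eq_pow_finrank (K := K) (V := K')]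
      simpa using Nat.sub_dvd_pow_sub_pow (Nat.card K) 1 (Module.finrank K K')
    have hgt : 1 < Nat.card K := Finite.one_lt_card
    obtain ⟨c, hc⟩ := hd
    rw [← Nat.card_eq_fintype_card, ← Nat.card_eq_fintype_card, hc,
      Nat.mul_div_cancel_left _ (by omega)]
    obtain ⟨a, ha⟩ := o1
    obtain ⟨b, hb⟩ := o2
    rw [ha, hb] at hc
    rw [ha, hb, show (2 * b + 1) / 2 = b by omega, show (2 * a + 1) / 2 = a by omega]
    have : 2 * b = 2 * (c * a) := by
      rw [show 2 * b = 2 * b + 1 - 1 by omega, hc, Nat.add_sub_cancel]; ring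
    omega
  rw [e1]

lemma isSquare_det_iff (h2 : (2 : K) ≠ 0) (hθ0 : θ ≠ 0) {N : ℕ} {y : Module.End K V}
    (hy : y ^ (Nat.card K ^ N) = sE) :
    IsSquare (LinearMap.det y) ↔ IsSquare θ ∨ Even (Module.finrank K' V) := by
  have h1 : LinearMap.det y ^ (Nat.card K ^ N) = Algebra.norm K θ ^ (Module.finrank K' V) := by
    rw [← map_pow, hy]
    have : (sE : Module.End K V) = (θ • (1 : Module.End K' V)).restrictScalars K := by ext v; simp
    rw [this, LinearMap.det_restrictScalars, LinearMap.det_smul, map_one, mul_one, map_pow]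
  have h0 : Algebra.norm K θ ≠ 0 := Algebra.norm_ne_zero_iff.2 hθ0
  have hodd : ∀ {x : K} {m : ℕ}, x ≠ 0 → Odd m → (IsSquare (x ^ m) ↔ IsSquare x) := by
    rintro x m hx ⟨c, rfl⟩
    refine ⟨?_, fun h => h.pow _⟩
    rintro ⟨b, hb⟩
    refine ⟨b / x ^ c, ?_⟩
    field_simp
    rw [← pow_two b] at hb
    rw [← hb]
    ring
  have hy0 : LinearMap.det y ≠ 0 := by
    intro h
    have hp : Nat.card K ^ N ≠ 0 := pow_ne_zero _ Nat.card_pos.ne'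
    rw [h, zero_pow hp] at h1
    exact pow_ne_zero _ h0 h1.symm
  rw [← hodd hy0 (odd_natCard h2).pow, h1]
  rcases Nat.even_or_odd (Module.finrank K' V) with he | ho
  · exact ⟨fun _ => Or.inr he, fun _ => he.isSquare_pow _⟩
  · rw [hodd h0 ho, isSquare_norm_iff h2 hθ0, or_iff_left (Nat.not_even_iff_odd.2 ho)]

end FieldCase

section FieldCaseIdentity

variable {K K' : Type} [Field K] [Field K'] [Algebra K K'] [Finite K] [Finite K'] {θ : K'}
  {V : Type} [AddCommGroup V] [Module K V] [Module K' V] [IsScalarTower K K' V] [Finite V]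
  {F : Type} [Field F] [CharZero F] {χ : Module.End K V → F}

local notation "sE" => Algebra.lsmul K K V θ

lemma phiQ_natCard_ne_zero {a : ℕ} (ha : 1 ≤ a) :
    phiQ ((Nat.card K : ℕ) : F) a ≠ 0 := by
  induction a, ha using Nat.le_induction with
  | base => rw [phiQ_one]; exact one_ne_zero
  | succ a ha ih =>
    rw [phiQ_succ _ ha]
    refine mul_ne_zero ih ?_
    have := natCard_pow_sub_one_ne_zero (K := K) (F := F) ha
    intro h
    apply this
    linear_combination -h

open Classical in
lemma IsCuspClassFun.sum_commute_lsmul (h2 : (2 : K) ≠ 0) (hχ : IsCuspClassFun χ) {N : ℕ}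
    (hN : 1 ≤ N) (hs : sE ^ (Nat.card K ^ N) = sE)
    (hL : ∀ x : Module.End K V, (x ^ (Nat.card K ^ N)) ^ (Nat.card K ^ N) = x ^ (Nat.card K ^ N))
    (hθ : Algebra.adjoin K {θ} = ⊤) {W : Submodule K' V} (hW : W ≠ ⊥) (hW' : W ≠ ⊤)
    {ν : Module.End K' V} (hν : IsNilpotent ν) (hνW : ∀ w ∈ W, ν w ∈ W) :
    ∑ η : Module.End K' V with (∀ w ∈ W, η w = 0) ∧ (∀ v, η v ∈ W),
      χ (sE + (ν + η).restrictScalars K) = 0 := by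
  have key := hχ.sum_commute h2 (W := W.restrictScalars K) (by simpa using hW) (by simpa using hW')
    hN ((lsmul_add_restrictScalars_pow hN hs hL hθ).2 ⟨ν, hν, rfl⟩) hs
    (fun w hw => W.add_mem (W.smul_mem θ hw) (hνW w hw))
  rw [← key]
  refine Finset.sum_bij (fun η hη => ⟨η.restrictScalars K, (Finset.mem_filter.1 hη).2⟩) ?_ ?_ ?_ ?_
  · intro η _
    exact Finset.mem_filter.2 ⟨Finset.mem_univ _, (commute_lsmul_iff hθ).2 ⟨η, rfl⟩⟩
  · intro a _ b _ h
    exact LinearMap.restrictScalars_injective K (congrArg Subtype.val h)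
  · intro b hb
    obtain ⟨η, hη⟩ := (commute_lsmul_iff hθ).1 (Finset.mem_filter.1 hb).2
    refine ⟨η, Finset.mem_filter.2 ⟨Finset.mem_univ _, ?_⟩, Subtype.ext hη⟩
    have := b.2
    rw [← hη] at this
    exact this
  · intro η _
    congr 1
    ext v
    simp [add_assoc]

open Classical in
lemma IsCuspClassFun.sum_sq_lsmul [Nontrivial V] (h2 : (2 : K) ≠ 0) (hχ : IsCuspClassFun χ) {N : ℕ}
    (hN : 1 ≤ N) (hs : sE ^ (Nat.card K ^ N) = sE)
    (hL : ∀ x : Module.End K V, (x ^ (Nat.card K ^ N)) ^ (Nat.card K ^ N) = x ^ (Nat.card K ^ N))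
    (hθ : Algebra.adjoin K {θ} = ⊤) (hθ0 : θ ≠ 0) :
    ∑ x : Module.End K V with (x * x) ^ (Nat.card K ^ N) = sE, χ (x * x) =
      ∑ e : Module.End K V with IsBalanced e,
        ∑ y : Module.End K V with y ^ (Nat.card K ^ N) = sE, (if Commute e y then χ y else 0) +
      ∑ y : Module.End K V with y ^ (Nat.card K ^ N) = sE,
        (if IsSquare (LinearMap.det y) then 2 else 0) * χ y := by
  have h2' : (2 : K') ≠ 0 := fun h => h2 ((algebraMap K K').injective (by rw [map_ofNat, map_zero, h]))
  have hfin : 1 ≤ Module.finrank K' V := Module.finrank_pos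
  obtain ⟨ψ, hψ⟩ := exists_addChar_ne_one (k := K') (R := AlgebraicClosure F)
    (Nat.cast_ne_zero.2 Fintype.card_ne_zero)
  set f : Module.End K' V → F := fun ν => χ (sE + ν.restrictScalars K) with hf
  have key : ∀ ν : Module.End K' V, IsNilpotent ν →
      phiQ ((Nat.card K' : ℕ) : F) (Module.finrank K' V) * f ν =
      f 0 * phiQ ((Nat.card K' : ℕ) : F) (Module.finrank K' (LinearMap.ker ν)) := by
    intro ν hν
    have := cuspFun_apply_eq (f := fun ν => algebraMap F (AlgebraicClosure F) (f ν)) hψ hfin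
      ?_ ?_ hν
    · apply (algebraMap F (AlgebraicClosure F)).injective
      rw [map_mul, map_mul, map_phiQ, map_phiQ, map_natCast]
      exact this
    · intro h ν _
      congr 1
      simp only [hf]
      rw [← hχ.conj (h.restrictScalars K) (sE + ν.restrictScalars K)]
      congr 1
      ext v
      simp [LinearEquiv.conj_apply]
    · intro W hW hW' ν hν hνW
      rw [← map_sum, hχ.sum_commute_lsmul h2 hN hs hL hθ hW hW' hν hνW, map_zero]
  refine mul_left_cancel₀ (phiQ_natCard_ne_zero (K := K') (F := F) hfin) ?_
  have hD : ∑ y : Module.End K V with y ^ (Nat.card K ^ N) = sE,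
        (if IsSquare (LinearMap.det y) then 2 else 0) * χ y =
      (if IsSquare θ ∨ Even (Module.finrank K' V) then 2 else 0) *
        ∑ y : Module.End K V with y ^ (Nat.card K ^ N) = sE, χ y := by
    rw [Finset.mul_sum]
    refine Finset.sum_congr rfl fun y hy => ?_
    simp only [isSquare_det_iff h2 hθ0 (Finset.mem_filter.1 hy).2]
  rw [hD, sum_sq_pow_eq_lsmul hN hs hL hθ, sum_isBalanced_pow_eq_lsmul hN hs hL hθ,
    sum_pow_eq_lsmul hN hs hL hθ, mul_add, Finset.mul_sum, Finset.mul_sum, mul_left_comm,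
    Finset.mul_sum, Finset.sum_congr rfl fun x hx => key _ (Finset.mem_filter.1 hx).2,
    Finset.sum_congr rfl fun (ν : Module.End K' V) hν => key ν (Finset.mem_filter.1 hν).2,
    ← Finset.mul_sum, sum_sq_sub_eq h2' hθ0 hfin]
  have h3 : ∀ e : Module.End K' V, phiQ ((Nat.card K' : ℕ) : F) (Module.finrank K' V) *
      ∑ ν : Module.End K' V with IsNilpotent ν ∧ Commute e ν, χ (sE + ν.restrictScalars K) =
      f 0 * commNilSum e (phiQ ((Nat.card K' : ℕ) : F)) := by
    intro e
    rw [commNilSum, Finset.mul_sum, Finset.mul_sum]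
    exact Finset.sum_congr rfl fun ν hν => key ν (Finset.mem_filter.1 hν).2.1
  rw [Finset.sum_congr rfl fun e _ => h3 e, ← Finset.mul_sum, ← Finset.mul_sum, nilSum]
  ring

end FieldCaseIdentity

section Main

variable {K : Type} [Field K] [Finite K] {V : Type} [AddCommGroup V] [Module K V] [Finite V]
  {F : Type} [Field F] [CharZero F] {χ : Module.End K V → F}

open Classical in
lemma IsCuspClassFun.sum_sq_fiber [Nontrivial V] (h2 : (2 : K) ≠ 0) (hχ : IsCuspClassFun χ) {N : ℕ}
    (hN : 1 ≤ N) {s : Module.End K V} (hs : s ^ (Nat.card K ^ N) = s)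
    (hL : ∀ x : Module.End K V, (x ^ (Nat.card K ^ N)) ^ (Nat.card K ^ N) = x ^ (Nat.card K ^ N)) :
    ∑ x : Module.End K V with (x * x) ^ (Nat.card K ^ N) = s, χ (x * x) =
      ∑ e : Module.End K V with IsBalanced e,
        ∑ y : Module.End K V with y ^ (Nat.card K ^ N) = s, (if Commute e y then χ y else 0) +
      ∑ y : Module.End K V with y ^ (Nat.card K ^ N) = s,
        (if IsSquare (LinearMap.det y) then 2 else 0) * χ y := by
  have hzero : (∀ y : Module.End K V, y ^ (Nat.card K ^ N) = s → χ y = 0) →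
    ∑ x : Module.End K V with (x * x) ^ (Nat.card K ^ N) = s, χ (x * x) =
      ∑ e : Module.End K V with IsBalanced e,
        ∑ y : Module.End K V with y ^ (Nat.card K ^ N) = s, (if Commute e y then χ y else 0) +
      ∑ y : Module.End K V with y ^ (Nat.card K ^ N) = s,
        (if IsSquare (LinearMap.det y) then 2 else 0) * χ y := by
    intro h
    rw [Finset.sum_eq_zero fun x hx => h _ (Finset.mem_filter.1 hx).2,
      Finset.sum_eq_zero fun e _ => Finset.sum_eq_zero fun x hx => by
        rw [h _ (Finset.mem_filter.1 hx).2, ite_self],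
      Finset.sum_eq_zero fun x hx => by rw [h _ (Finset.mem_filter.1 hx).2, mul_zero], add_zero]
  by_cases hirr : Irreducible (minpoly K s)
  · by_cases hs0 : s = 0
    · refine hzero fun y hy => hχ.nonunit y fun hu => ?_
      have := hu.pow (Nat.card K ^ N)
      rw [hy, hs0] at this
      exact not_isUnit_zero this
    have := Fact.mk hirr
    obtain ⟨φ, hφ⟩ := exists_adjoinRoot_algHom (minpoly K s) s (minpoly.aeval K s)
    have : Finite (AdjoinRoot (minpoly K s)) := Finite.of_injective φ φ.toRingHom.injective
    let _ : Module (AdjoinRoot (minpoly K s)) V := Module.compHom V φ.toRingHom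
    have hsm : ∀ (c : AdjoinRoot (minpoly K s)) (v : V), c • v = φ c v := fun _ _ => rfl
    have : IsScalarTower K (AdjoinRoot (minpoly K s)) V := ⟨fun c d v => by
      rw [hsm, hsm, map_smul, LinearMap.smul_apply]⟩
    have hE : Algebra.lsmul K K V (AdjoinRoot.root (minpoly K s)) = s := by
      ext v
      exact (hsm _ _).trans (by rw [hφ])
    have := hχ.sum_sq_lsmul (θ := AdjoinRoot.root (minpoly K s)) h2 hN (by rw [hE, hs]) hL
      (AdjoinRoot.adjoinRoot_eq_top) (by
        rintro h
        rw [h, map_zero] at hφ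
        exact hs0 hφ.symm)
    rwa [hE] at this
  · exact hzero fun y hy => hχ.eq_zero_of_not_irreducible h2 hN hy hs hirr

open Classical in
/-- The sum of a cuspidal class function over squares equals its sum over the centralizers of
the balanced involutions. -/
theorem IsCuspClassFun.sum_sq (h2 : (2 : K) ≠ 0) (hV : 2 ≤ Module.finrank K V)
    (hχ : IsCuspClassFun χ) :
    ∑ x, χ (x * x) =
      ∑ e : Module.End K V with IsBalanced e, ∑ y, (if Commute e y then χ y else 0) := by
  have : Nontrivial V := Module.finrank_pos_iff.1 (by omega : 0 < Module.finrank K V)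
  obtain ⟨N, hN, hL⟩ := exists_pow_pow_idempotent (Module.End K V) (Nat.card K)
  set φ : Module.End K V → Module.End K V := fun y => y ^ (Nat.card K ^ N) with hφ
  have hD : ∑ y : Module.End K V, (if IsSquare (LinearMap.det y) then 2 else 0) * χ y = 0 := by
    obtain ⟨v, hv⟩ := exists_ne (0 : V)
    have h1 : Module.finrank K (Submodule.span K {v}) = 1 := finrank_span_singleton hv
    refine (Finset.sum_congr rfl fun _ _ => mul_comm _ _).trans (hχ.sum_mul_eq_zero (W := Submodule.span K {v}) (by simpa using hv)
      (fun h => by rw [h, finrank_top] at h1; omega)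
      (g := fun y => if IsSquare (LinearMap.det y) then 2 else 0) ?_)
    · intro y θ hθ
      have hsq : (1 + θ) = (1 + (2 : K)⁻¹ • θ) * (1 + (2 : K)⁻¹ • θ) := by
        rw [mul_add, add_mul, add_mul, smul_mul_smul_comm, offDiag_mul hθ hθ, smul_zero, add_zero, one_mul,
          mul_one, one_mul, add_assoc, ← add_smul]
        rw [show (2 : K)⁻¹ + 2⁻¹ = 1 by field_simp; norm_num, one_smul]
      have hu := (isUnit_one_add ((offDiag (Submodule.span K {v})).smul_mem (2 : K)⁻¹ hθ)).map LinearMap.det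
      simp only [map_mul, hsq]
      have : IsSquare (LinearMap.det y * (LinearMap.det (1 + (2 : K)⁻¹ • θ) *
        LinearMap.det (1 + (2 : K)⁻¹ • θ))) ↔ IsSquare (LinearMap.det y) := by
        constructor
        · rintro ⟨b, hb⟩
          refine ⟨b / LinearMap.det (1 + (2 : K)⁻¹ • θ), ?_⟩
          have := hu.ne_zero
          rw [div_mul_div_comm, ← hb, mul_div_assoc, div_self (mul_ne_zero this this), mul_one]
        · rintro ⟨b, hb⟩
          exact ⟨b * LinearMap.det (1 + (2 : K)⁻¹ • θ), by rw [hb]; ring⟩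
      simp only [this]
  have hfib : ∀ s : Module.End K V, ∑ x : Module.End K V with φ (x * x) = s, χ (x * x) =
      ∑ y : Module.End K V with φ y = s, (∑ e : Module.End K V with IsBalanced e,
        (if Commute e y then χ y else 0) + (if IsSquare (LinearMap.det y) then 2 else 0) * χ y) := by
    intro s
    by_cases hs : s ^ (Nat.card K ^ N) = s
    · rw [hχ.sum_sq_fiber h2 hN hs hL, Finset.sum_add_distrib, Finset.sum_comm]
    · have hne : ∀ y : Module.End K V, φ y ≠ s := fun y h => hs (by rw [← h]; exact hL y)
      rw [Finset.sum_eq_zero fun x hx => absurd (Finset.mem_filter.1 hx).2 (hne _),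
        Finset.sum_eq_zero fun x hx => absurd (Finset.mem_filter.1 hx).2 (hne _)]
  rw [← Finset.sum_fiberwise _ (fun x => φ (x * x)), Finset.sum_congr rfl fun s _ => hfib s,
    Finset.sum_fiberwise, Finset.sum_add_distrib, hD, add_zero, Finset.sum_comm]

end Main

section Transfer

variable {k : Type} [Field k] {n : ℕ}

/-- Any proper nonzero subspace is a coordinate subspace in suitable coordinates. -/
lemma exists_coordinates {W : Submodule k (Fin n → k)} (h0 : W ≠ ⊥) (h1 : W ≠ ⊤) :
    ∃ j, 0 < j ∧ j < n ∧ ∃ h : (Fin n → k) ≃ₗ[k] (Fin n → k),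
      ∀ v, v ∈ W ↔ ∀ a : Fin n, j ≤ a → h v a = 0 := by
  obtain ⟨W', hW⟩ := Submodule.exists_isCompl W
  have hn : Module.finrank k W + Module.finrank k W' = n := by
    rw [Submodule.finrank_add_eq_of_isCompl hW, Module.finrank_fin_fun]
  have hj : 0 < Module.finrank k W := by
    rw [Nat.pos_iff_ne_zero]; exact fun h => h0 (Submodule.finrank_eq_zero.1 h)
  have hj' : Module.finrank k W < n := by
    have := Submodule.finrank_lt (s := W) h1
    rwa [Module.finrank_fin_fun] at this
  let b := Module.finBasis k W
  let b' := Module.finBasis k W'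
  let B : Module.Basis (Fin n) k (Fin n → k) :=
    ((b.prod b').map (Submodule.prodEquivOfIsCompl W W' hW)).reindex
      (finSumFinEquiv.trans (finCongr hn))
  refine ⟨_, hj, hj', B.equivFun, fun v => ?_⟩
  have hval : ∀ i : Fin (Module.finrank k W'), B.equivFun v (finCongr hn (Fin.natAdd _ i)) =
      b'.repr ((Submodule.prodEquivOfIsCompl W W' hW).symm v).2 i := fun i => by
    rw [Module.Basis.equivFun_apply, Module.Basis.repr_reindex_apply, Equiv.symm_trans_apply,
      Equiv.symm_apply_apply, finSumFinEquiv_symm_apply_natAdd, Module.Basis.map_repr,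
      LinearEquiv.trans_apply, Module.Basis.prod_repr_inr]
  have hv := Submodule.prodEquivOfIsCompl_symm_apply_snd_eq_zero W W' hW (x := v)
  rw [← hv, ← b'.repr.map_eq_zero_iff, Finsupp.ext_iff]
  constructor
  · intro h a ha
    have hlt := a.2
    have ha' : a = finCongr hn (Fin.natAdd _ ⟨a - Module.finrank k W, by omega⟩) := by
      ext; simp; omega
    rw [ha', hval, h]
    rfl
  · intro h i
    rw [← hval]
    exact h _ (by simp)

variable {F X : Type} [Field F] [AddCommGroup X] [Module F X]

open Classical in
/-- The character of a representation of `GL`, extended by zero to all matrices. -/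
noncomputable def extChar (π : Representation F (GL (Fin n) k) X) (y : Matrix (Fin n) (Fin n) k) :
    F := if h : IsUnit y then LinearMap.trace F X (π h.unit) else 0

lemma extChar_val (π : Representation F (GL (Fin n) k) X) (g : GL (Fin n) k) :
    extChar π g.val = LinearMap.trace F X (π g) := by
  rw [extChar, dif_pos g.isUnit, IsUnit.unit_of_val_units]

lemma extChar_of_not_isUnit (π : Representation F (GL (Fin n) k) X) {y : Matrix (Fin n) (Fin n) k}
    (h : ¬ IsUnit y) : extChar π y = 0 := dif_neg h

lemma extChar_conj (π : Representation F (GL (Fin n) k) X) (P : GL (Fin n) k)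
    (y : Matrix (Fin n) (Fin n) k) : extChar π (P.val * y * P⁻¹.val) = extChar π y := by
  by_cases h : IsUnit y
  · obtain ⟨g, rfl⟩ := h
    rw [← Units.val_mul, ← Units.val_mul, extChar_val, extChar_val, map_mul π, map_mul π,
      LinearMap.trace_mul_comm, ← mul_assoc, ← map_mul π, inv_mul_cancel, map_one, one_mul]
  · rw [extChar_of_not_isUnit π h, extChar_of_not_isUnit]
    intro h'
    have := (P⁻¹.isUnit.mul h').mul P.isUnit
    apply h
    rwa [mul_assoc, mul_assoc, ← Units.val_mul, inv_mul_cancel, Units.val_one, mul_one,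
      ← mul_assoc, ← Units.val_mul, inv_mul_cancel, Units.val_one, one_mul] at this

/-- The matrix of a linear automorphism. -/
noncomputable def equivGL (h : (Fin n → k) ≃ₗ[k] (Fin n → k)) : GL (Fin n) k :=
  ⟨LinearMap.toMatrix' h, LinearMap.toMatrix' h.symm, by
    rw [← LinearMap.toMatrix'_comp]; simp, by rw [← LinearMap.toMatrix'_comp]; simp⟩

lemma toMatrix'_conj (h : (Fin n → k) ≃ₗ[k] (Fin n → k)) (y : Module.End k (Fin n → k)) :
    LinearMap.toMatrix' (h.conj y) =
      (equivGL h).val * LinearMap.toMatrix' y * (equivGL h)⁻¹.val := by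
  change _ = LinearMap.toMatrix' _ * _ * LinearMap.toMatrix' _
  rw [← LinearMap.toMatrix'_comp, ← LinearMap.toMatrix'_comp]
  rfl

lemma mem_offDiag_iff_matrix {W : Submodule k (Fin n → k)} {j : ℕ}
    {h : (Fin n → k) ≃ₗ[k] (Fin n → k)} (hW : ∀ v, v ∈ W ↔ ∀ a : Fin n, j ≤ a → h v a = 0)
    (θ : Module.End k (Fin n → k)) : θ ∈ offDiag W ↔
      ∀ a b : Fin n, ¬ ((a : ℕ) < j ∧ j ≤ (b : ℕ)) → LinearMap.toMatrix' (h.conj θ) a b = 0 := by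
  constructor
  · intro hθ a b hab
    rw [LinearMap.toMatrix'_apply, LinearEquiv.conj_apply_apply]
    by_cases hb : (b : ℕ) < j
    · rw [hθ.1, map_zero, Pi.zero_apply]
      rw [hW]
      intro c hc
      rw [LinearEquiv.apply_symm_apply, Pi.single_eq_of_ne]
      rintro rfl
      omega
    · exact (hW _).1 (hθ.2 _) a (by omega)
  · intro hM
    have key : ∀ v a, h (θ v) a = ∑ b, LinearMap.toMatrix' (h.conj θ) a b * h v b := fun v a => by
      have : h (θ v) = h.conj θ (h v) := by simp [LinearEquiv.conj_apply_apply]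
      rw [this, ← LinearMap.toMatrix'_mulVec]
      rfl
    refine ⟨fun w hw => ?_, fun v => ?_⟩
    · rw [← h.map_eq_zero_iff]
      ext a
      rw [key]
      refine Finset.sum_eq_zero fun b _ => ?_
      by_cases hb : (b : ℕ) < j
      · rw [hM a b (by omega), zero_mul]
      · rw [(hW w).1 hw b (by omega), mul_zero]
    · rw [hW]
      intro a ha
      rw [key]
      refine Finset.sum_eq_zero fun b _ => ?_
      rw [hM a b (by omega), zero_mul]

variable [Fintype k] [DecidableEq k]

lemma IsCuspidal.sum_extChar {π : Representation F (GL (Fin n) k) X} (hπ : IsCuspidal π) {j : ℕ}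
    (h0 : 0 < j) (hj : j < n) (y : Matrix (Fin n) (Fin n) k) :
    ∑ u : uniRad k n j, extChar π (y * u.1.val) = 0 := by
  by_cases h : IsUnit y
  · obtain ⟨g, rfl⟩ := h
    simp only [← Units.val_mul, extChar_val, map_mul]
    rw [← map_sum, ← Finset.mul_sum, hπ j h0 hj, mul_zero, map_zero]
  · refine Finset.sum_eq_zero fun u _ => extChar_of_not_isUnit π fun h' => h ?_
    have := h'.mul u.1⁻¹.isUnit
    rwa [mul_assoc, ← Units.val_mul, mul_inv_cancel, Units.val_one, mul_one] at this

lemma IsCuspidal.isCuspClassFun {π : Representation F (GL (Fin n) k) X} (hπ : IsCuspidal π) :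
    IsCuspClassFun fun y : Module.End k (Fin n → k) => extChar π (LinearMap.toMatrix' y) where
  conj h y := by rw [toMatrix'_conj, extChar_conj]
  nonunit y hy := by
    refine extChar_of_not_isUnit π fun h => hy ?_
    have := h.map Matrix.toLinAlgEquiv'
    simpa using this
  cusp W hW0 hW1 y := by
    obtain ⟨j, h0, hj, h, hW⟩ := exists_coordinates hW0 hW1
    rw [← hπ.sum_extChar h0 hj (LinearMap.toMatrix' (h.conj y))]
    have hval : ∀ θ : offDiag W, (equivGL h * equivGL (oneAddEquiv θ.2) * (equivGL h)⁻¹).val =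
        1 + LinearMap.toMatrix' (h.conj θ.1) := fun θ => by
      rw [Units.val_mul, Units.val_mul]
      change _ * LinearMap.toMatrix' (1 + θ.1) * _ = _
      rw [← toMatrix'_conj, map_add h.conj, map_add]
      congr 1
      rw [show h.conj (1 : Module.End k (Fin n → k)) = 1 from h.conjRingEquiv.map_one]
      exact LinearMap.toMatrix'_one
    refine Finset.sum_bij' (fun θ _ => ⟨equivGL h * equivGL (oneAddEquiv θ.2) * (equivGL h)⁻¹, ?_⟩)
      (fun u _ => ⟨h.symm.conj (Matrix.toLin' (u.1.val - 1)), ?_⟩) ?_ ?_ ?_ ?_ ?_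
    · rw [mem_uniRad]
      intro a b hab
      rw [hval, Matrix.add_apply, (mem_offDiag_iff_matrix hW θ.1).1 θ.2 a b hab, add_zero]
    · rw [mem_offDiag_iff_matrix hW]
      intro a b hab
      rw [LinearEquiv.conj_conj_symm, LinearMap.toMatrix'_toLin', Matrix.sub_apply, u.2 a b hab,
        sub_self]
    · simp
    · simp
    · intro θ _
      ext1
      simp only [hval, add_sub_cancel_left, Matrix.toLin'_toMatrix', LinearEquiv.conj_symm_conj]
    · intro u _
      ext1
      apply Units.ext
      rw [hval]
      simp
    · intro θ _
      simp only [hval]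
      have h1 : h.conj (y * (1 + θ.1)) = h.conj y * (1 + h.conj θ.1) :=
        (h.conjRingEquiv.map_mul _ _).trans
          (congrArg (h.conj y * ·) ((map_add h.conjRingEquiv _ _).trans
            (congrArg (· + h.conj θ.1) (map_one h.conjRingEquiv))))
      rw [← extChar_conj π (equivGL h), ← toMatrix'_conj, h1, LinearMap.toMatrix'_mul, map_add,
        LinearMap.toMatrix'_one]

end Transfer

section BalancedConj

variable {K V : Type} [Field K] [AddCommGroup V] [Module K V] [Finite V]

/-- Balanced involutions are conjugate. -/
lemma IsBalanced.exists_conj_eq (h2 : (2 : K) ≠ 0) {e e' : Module.End K V} (he : IsBalanced e)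
    (he' : IsBalanced e') : ∃ h : V ≃ₗ[K] V, h.conj e = e' := by
  obtain ⟨h, hh⟩ := exists_conj_prodInvolution h2 he.1
  obtain ⟨h', hh'⟩ := exists_conj_prodInvolution h2 he'.1
  have h1 := he.2
  have h1' := he'.2
  have h3 := finrank_ker_add_finrank_ker h2 he.1
  have h3' := finrank_ker_add_finrank_ker h2 he'.1
  let u := LinearEquiv.ofFinrankEq (R := K) (LinearMap.ker (e - 1)) (LinearMap.ker (e' - 1)) (by omega)
  let w := LinearEquiv.ofFinrankEq (R := K) (LinearMap.ker (e + 1)) (LinearMap.ker (e' + 1)) (by omega)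
  refine ⟨h.symm.trans ((u.prodCongr w).trans h'), ?_⟩
  rw [← LinearEquiv.conj_trans, ← LinearEquiv.conj_trans, LinearEquiv.trans_apply,
    LinearEquiv.trans_apply]
  refine Eq.trans (congrArg h'.conj ?_) hh'
  refine (congrArg (u.prodCongr w).conj ((congrArg h.symm.conj hh.symm).trans
    (LinearEquiv.conj_symm_conj _ _))).trans (LinearMap.ext fun x => ?_)
  rw [LinearEquiv.conj_apply_apply, prodInvolution_apply, prodInvolution_apply]
  exact Prod.ext (by simp) (by simp)

end BalancedConj

section Transfer

variable {k : Type} [Field k] {n : ℕ}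

/-- The standard balanced involution. -/
noncomputable def stdInvolution (k : Type) [Field k] (n r : ℕ) : Matrix (Fin n) (Fin n) k :=
  Matrix.diagonal fun i => if (i : ℕ) < r then 1 else -1

lemma isBalanced_stdInvolution [Finite k] (h2 : (2 : k) ≠ 0) {r : ℕ} (hn : n = 2 * r) :
    IsBalanced (Matrix.toLin' (stdInvolution k n r)) := by
  classical
  constructor
  · rw [Module.End.mul_eq_comp, ← Matrix.toLin'_mul, stdInvolution, Matrix.diagonal_mul_diagonal,
      Module.End.one_eq_id, ← Matrix.toLin'_one, ← Matrix.diagonal_one]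
    congr 2
    ext i
    split_ifs <;> simp
  · have h1 : Matrix.toLin' (stdInvolution k n r) - 1 =
        Matrix.toLin' (Matrix.diagonal fun i : Fin n => if (i : ℕ) < r then (0 : k) else -2) := by
      rw [show (1 : Module.End k (Fin n → k)) = Matrix.toLin' 1 from Matrix.toLin'_one.symm,
        ← map_sub, stdInvolution, ← Matrix.diagonal_one, Matrix.diagonal_sub]
      congr 2
      ext i
      split_ifs
      · ring
      · ring
    have h3 := Matrix.rank_diagonal (fun i : Fin n => if (i : ℕ) < r then (0 : k) else -2)
    have h4 := LinearMap.finrank_range_add_finrank_ker (Matrix.toLin' (stdInvolution k n r) - 1)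
    rw [h1] at h4 ⊢
    rw [Matrix.rank] at h3
    rw [Matrix.toLin'_apply', h3, Module.finrank_fin_fun] at h4
    have h5 : Fintype.card {i : Fin n // (if (i : ℕ) < r then (0 : k) else -2) ≠ 0} = r := by
      have : ∀ i : Fin n, (if (i : ℕ) < r then (0 : k) else -2) ≠ 0 ↔ ¬ (i : ℕ) < r := fun i => by
        split_ifs <;> simp_all
      let E : {i : Fin n // (if (i : ℕ) < r then (0 : k) else -2) ≠ 0} ≃ Fin r :=
        { toFun i := (⟨i - r, by have := (this _).1 i.2; have := i.1.2; omega⟩ : Fin r)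
          invFun j := ⟨⟨r + j, by have := j.2; omega⟩, by rw [this]; simp⟩
          left_inv i := by
            have := (this _).1 i.2
            ext; simp; omega
          right_inv j := by ext; simp }
      exact (Fintype.card_congr E).trans (Fintype.card_fin r)
    rw [h5] at h4
    rw [Module.finrank_fin_fun, Matrix.toLin'_apply']
    omega

lemma commute_stdInvolution (h2 : (2 : k) ≠ 0) {r : ℕ} (M : Matrix (Fin n) (Fin n) k) :
    stdInvolution k n r * M = M * stdInvolution k n r ↔
      ∀ i j, twoBlocks n r i ≠ twoBlocks n r j → M i j = 0 := by
  rw [stdInvolution]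
  constructor
  · intro h i j hij
    have := congrFun (congrFun h i) j
    rw [Matrix.diagonal_mul, Matrix.mul_diagonal] at this
    rw [twoBlocks, twoBlocks] at hij
    have hz : (2 : k) * M i j = 0 := by
      split_ifs at this hij <;> first | exact absurd rfl hij | linear_combination this | linear_combination -this
    exact (mul_eq_zero.1 hz).resolve_left h2
  · intro h
    ext i j
    rw [Matrix.diagonal_mul, Matrix.mul_diagonal]
    by_cases hij : twoBlocks n r i = twoBlocks n r j
    · simp only [twoBlocks] at hij
      split_ifs at hij ⊢ <;> simp_all
    · rw [h i j hij, mul_zero, zero_mul]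

variable {F X : Type} [Field F] [CharZero F] [AddCommGroup X] [Module F X]
variable [Fintype k] [DecidableEq k]

lemma sum_eq_sum_units {A : Type} [Monoid A] [Fintype A] [Fintype Aˣ] {f : A → F}
    (hf : ∀ a, ¬ IsUnit a → f a = 0) : ∑ a, f a = ∑ u : Aˣ, f u := by
  symm
  refine Finset.sum_of_injOn Units.val (fun a _ b _ h => Units.ext h) (fun _ _ => Finset.mem_univ _)
    (fun a _ ha => hf a fun h => ha ?_) fun _ _ => rfl
  exact ⟨h.unit, by simp, rfl⟩

/-- The sum of a cuspidal character over squares is a positive multiple of its sum over the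
block diagonal subgroup. -/
theorem IsCuspidal.exists_sum_sq {π : Representation F (GL (Fin n) k) X} (hπ : IsCuspidal π)
    (h2 : (2 : k) ≠ 0) {r : ℕ} (hr : 1 ≤ r) (hn : n = 2 * r) : ∃ N : ℕ, N ≠ 0 ∧
    ∑ g, LinearMap.trace F X (π (g * g)) =
      N * ∑ h : levi k n 2 (twoBlocks n r), LinearMap.trace F X (π h) := by
  classical
  have hχ := hπ.isCuspClassFun
  have key := hχ.sum_sq h2 (by rw [Module.finrank_fin_fun]; omega)
  set e₀ := Matrix.toLin' (stdInvolution k n r)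
  have he₀ : IsBalanced e₀ := isBalanced_stdInvolution h2 hn
  refine ⟨(Finset.univ.filter fun e : Module.End k (Fin n → k) => IsBalanced e).card,
    Finset.card_ne_zero.2 ⟨e₀, by simpa using he₀⟩, ?_⟩
  have h1 : ∑ x : Module.End k (Fin n → k), extChar π (LinearMap.toMatrix' (x * x)) =
      ∑ g, LinearMap.trace F X (π (g * g)) := by
    rw [← Equiv.sum_comp (LinearMap.toMatrix' (R := k) (m := Fin n) (n := Fin n)).symm.toEquiv]
    rw [sum_eq_sum_units]
    · refine Finset.sum_congr rfl fun g _ => ?_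
      rw [← extChar_val, Units.val_mul, LinearMap.toMatrix'_mul]
      simp
    · intro a ha
      refine extChar_of_not_isUnit π fun h => ha ?_
      rw [LinearMap.toMatrix'_mul] at h
      have := isUnit_of_mul_isUnit_left h
      simpa using this
  have h3 : ∀ e : Module.End k (Fin n → k), IsBalanced e →
      ∑ y, (if Commute e y then extChar π (LinearMap.toMatrix' y) else 0) =
      ∑ y, (if Commute e₀ y then extChar π (LinearMap.toMatrix' y) else 0) := by
    intro e he
    obtain ⟨h, hh⟩ := he₀.exists_conj_eq h2 he
    rw [← Equiv.sum_comp h.conj.toEquiv]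
    refine Finset.sum_congr rfl fun y _ => ?_
    refine if_congr ?_ (hχ.conj h y) rfl
    rw [← hh]
    exact commute_map_iff h.conjRingEquiv.injective
  have h4 : ∑ y, (if Commute e₀ y then extChar π (LinearMap.toMatrix' y) else 0) =
      ∑ h : levi k n 2 (twoBlocks n r), LinearMap.trace F X (π h) := by
    rw [← Equiv.sum_comp (LinearMap.toMatrix' (R := k) (m := Fin n) (n := Fin n)).symm.toEquiv]
    rw [sum_eq_sum_units]
    · rw [← Finset.sum_subtype (Finset.univ.filter fun g => g ∈ levi k n 2 (twoBlocks n r))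
        (by simp) fun g => LinearMap.trace F X (π g), Finset.sum_filter]
      refine Finset.sum_congr rfl fun g _ => if_congr ?_ ?_ rfl
      · refine Iff.trans ?_ (commute_stdInvolution h2 (r := r) g.val)
        change Matrix.toLin' _ * Matrix.toLin' g.val = Matrix.toLin' g.val * Matrix.toLin' _ ↔ _
        rw [Module.End.mul_eq_comp, Module.End.mul_eq_comp, ← Matrix.toLin'_mul,
          ← Matrix.toLin'_mul]
        exact Matrix.toLin'.injective.eq_iff
      · rw [← extChar_val]
        simp
    · intro a ha
      rw [extChar_of_not_isUnit, ite_self]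
      simpa using ha
  rw [← h1, key, Finset.sum_congr rfl (fun e he => h3 e (by simpa using he)), Finset.sum_const, h4,
    nsmul_eq_mul]

end Transfer

section FrobeniusSchur

variable {F : Type} [Field F] {G : Type} [Group G] [Fintype G] {V : Type} [AddCommGroup V]
  [Module F V] {ρ : Representation F G V}

lemma IsIrreducibleRep.exists_eq_smul_one [IsAlgClosed F] (h : IsIrreducibleRep ρ)
    (f : Module.End F V) (hf : ∀ g, ρ g * f = f * ρ g) : ∃ c : F, f = c • 1 := by
  have := h.finiteDimensional
  have := h.nontrivial
  obtain ⟨c, hc⟩ := Module.End.exists_eigenvalue f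
  refine ⟨c, ?_⟩
  rcases h.2 (f.eigenspace c) (fun g v hv => by
    rw [Module.End.mem_eigenspace_iff] at hv ⊢
    have := LinearMap.congr_fun (hf g) v
    simp only [Module.End.mul_apply] at this
    rw [← this, hv, map_smul]) with h1 | h1
  · exact absurd h1 hc
  · ext v
    have : v ∈ f.eigenspace c := h1 ▸ Submodule.mem_top
    simpa using Module.End.mem_eigenspace_iff.1 this

lemma IsIrreducibleRep.finrank_smul_sum_conj [IsAlgClosed F] (h : IsIrreducibleRep ρ)
    (E : Module.End F V) : (Module.finrank F V : F) • ∑ g, ρ g * E * ρ g⁻¹ =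
      (Fintype.card G * LinearMap.trace F V E) • (1 : Module.End F V) := by
  have := h.finiteDimensional
  obtain ⟨c, hc⟩ := h.exists_eq_smul_one (∑ g, ρ g * E * ρ g⁻¹) (fun a => by
    rw [Finset.mul_sum, Finset.sum_mul, ← Equiv.sum_comp (Equiv.mulLeft a) fun x => _ * ρ a]
    refine Finset.sum_congr rfl fun g _ => ?_
    rw [Equiv.coe_mulLeft, _root_.mul_inv_rev, map_mul, map_mul]
    simp only [mul_assoc]
    rw [← map_mul ρ a⁻¹ a, inv_mul_cancel, map_one, mul_one])
  have ht := congrArg (LinearMap.trace F V) hc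
  rw [map_sum, map_smul, LinearMap.trace_one, smul_eq_mul, Finset.sum_congr rfl (fun g _ => by
    rw [LinearMap.trace_mul_comm, ← mul_assoc, ← map_mul ρ, inv_mul_cancel, map_one, one_mul]),
    Finset.sum_const, nsmul_eq_mul, Finset.card_univ] at ht
  rw [hc, ht, smul_smul, mul_comm]

lemma trace_sq_eq_sum {ι : Type} [Fintype ι] [DecidableEq ι] (b : Module.Basis ι F V)
    (f : Module.End F V) : LinearMap.trace F V (f * f) =
      ∑ i, ∑ j, b.coord i (f (b j)) * b.coord j (f (b i)) := by
  rw [LinearMap.trace_eq_matrix_trace F b, LinearMap.toMatrix_mul]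
  simp [Matrix.trace, Matrix.mul_apply, LinearMap.toMatrix_apply]

lemma IsIrreducibleRep.dual [FiniteDimensional F V] (h : IsIrreducibleRep ρ) :
    IsIrreducibleRep ρ.dual :=
  h.of_transpose (·⁻¹) inv_surjective fun _ _ _ => rfl

/-- The sum of the character over squares vanishes unless the representation is selfdual. -/
lemma IsIrreducibleRep.repIso_dual_of_sum_ne_zero (h : IsIrreducibleRep ρ)
    (hs : ∑ g, LinearMap.trace F V (ρ (g * g)) ≠ 0) : RepIso ρ ρ.dual := by
  have := h.finiteDimensional
  let b := Module.finBasis F V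
  have h1 : ∑ g, LinearMap.trace F V (ρ (g * g)) =
      ∑ i, ∑ j, ∑ g, b.coord i (ρ g (b j)) * b.coord j (ρ g (b i)) := by
    simp only [map_mul ρ, trace_sq_eq_sum b]
    rw [Finset.sum_comm]
    exact Finset.sum_congr rfl fun i _ => Finset.sum_comm
  rw [h1] at hs
  obtain ⟨i, -, hi⟩ := Finset.exists_ne_zero_of_sum_ne_zero hs
  obtain ⟨j, -, hj⟩ := Finset.exists_ne_zero_of_sum_ne_zero hi
  let f : V →ₗ[F] Module.Dual F V :=
    ∑ g, (b.coord i ∘ₗ ρ g).smulRight (b.coord j ∘ₗ ρ g)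
  have hf : ∀ v w, f v w = ∑ g, b.coord i (ρ g v) * b.coord j (ρ g w) := fun v w => by
    simp [f, LinearMap.sum_apply]
  refine repIso_of_ne_zero h h.dual f (fun h0 => hj ?_) fun a v => ?_
  · rw [← hf, h0]; rfl
  · ext w
    rw [hf, Representation.dual_apply, Module.Dual.transpose_apply]
    change _ = f v (ρ a⁻¹ w)
    rw [hf, ← Equiv.sum_comp (Equiv.mulRight a) fun g => b.coord i (ρ g v) * _]
    refine Finset.sum_congr rfl fun g _ => ?_
    rw [Equiv.coe_mulRight, ← Module.End.mul_apply, ← map_mul ρ, ← Module.End.mul_apply (ρ (g * a)),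
      ← map_mul ρ, mul_inv_cancel_right]

/-- An equivariant isomorphism with the dual is symmetric or alternating. -/
lemma IsIrreducibleRep.exists_symm_sign [IsAlgClosed F] (h : IsIrreducibleRep ρ) (T : V ≃ₗ[F] Module.Dual F V)
    (hT : ∀ g v, T (ρ g v) = ρ.dual g (T v)) : ∃ ε : F, ε * ε = 1 ∧ ∀ v w, T v w = ε * T w v := by
  have := h.finiteDimensional
  have := h.nontrivial
  have hinv : ∀ g v w, T (ρ g v) (ρ g w) = T v w := fun g v w => by
    rw [hT, Representation.dual_apply, Module.Dual.transpose_apply]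
    change T v (ρ g⁻¹ (ρ g w)) = _
    rw [← Module.End.mul_apply, ← map_mul, inv_mul_cancel, map_one, Module.End.one_apply]
  let f : Module.End F V := T.symm.toLinearMap ∘ₗ T.toLinearMap.flip
  have hf : ∀ v w, T (f v) w = T w v := fun v w => by simp [f]
  obtain ⟨ε, hε⟩ := h.exists_eq_smul_one f (fun g => by
    ext v
    apply T.injective
    ext w
    rw [Module.End.mul_apply, Module.End.mul_apply, hf]
    have hw : w = ρ g (ρ g⁻¹ w) := by
      rw [← Module.End.mul_apply, ← map_mul, mul_inv_cancel, map_one, Module.End.one_apply]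
    rw [hw, hinv, hinv, hf])
  have h1 : ∀ v w, T w v = ε * T v w := fun v w => by
    rw [← hf, hε]; simp
  refine ⟨ε, ?_, fun v w => h1 w v⟩
  obtain ⟨v, hv⟩ := exists_ne (0 : V)
  have hv' : T v ≠ 0 := fun h0 => hv (T.map_eq_zero_iff.1 h0)
  obtain ⟨w, hw⟩ : ∃ w, T v w ≠ 0 := by
    by_contra! h0
    exact hv' (LinearMap.ext h0)
  have h2 := h1 w v
  rw [h1 v w, ← mul_assoc] at h2
  exact mul_right_cancel₀ hw (by rw [← h2, one_mul])

/-- The sum of the character of a selfdual irreducible representation over squares is nonzero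
in characteristic zero. -/
lemma IsIrreducibleRep.sum_sq_ne_zero [IsAlgClosed F] [CharZero F] (h : IsIrreducibleRep ρ)
    (hd : RepIso ρ ρ.dual) : ∑ g, LinearMap.trace F V (ρ (g * g)) ≠ 0 := by
  have := h.finiteDimensional
  have := h.nontrivial
  obtain ⟨T, hT⟩ := hd
  obtain ⟨ε, hε, hsym⟩ := h.exists_symm_sign T hT
  let b := Module.finBasis F V
  have hT' : ∀ g v w, T v (ρ g w) = ε * T w (ρ g⁻¹ v) := fun g v w => by
    rw [hsym w, ← mul_assoc, hε, one_mul, hT, Representation.dual_apply,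
      Module.Dual.transpose_apply, inv_inv]
    rfl
  have hcoord : ∀ j g v, b.coord j (ρ g v) = ε * T v (ρ g⁻¹ (T.symm (b.coord j))) := fun j g v => by
    rw [← hT', T.apply_symm_apply]
  have key : (Module.finrank F V : F) * ∑ g, LinearMap.trace F V (ρ (g * g)) =
      ε * (Fintype.card G * Module.finrank F V) := by
    have h1 : ∑ g, LinearMap.trace F V (ρ (g * g)) = ∑ j, ∑ i,
        ε * b.coord i ((∑ g, ρ g * rankOne (b j) (T (b i)) * ρ g⁻¹) (T.symm (b.coord j))) := by
      simp only [map_mul ρ, trace_sq_eq_sum b]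
      rw [Finset.sum_comm]
      simp_rw [Finset.sum_comm (s := Finset.univ (α := G))]
      rw [Finset.sum_comm]
      refine Finset.sum_congr rfl fun j _ => Finset.sum_congr rfl fun i _ => ?_
      rw [LinearMap.sum_apply, map_sum, Finset.mul_sum]
      refine Finset.sum_congr rfl fun g _ => ?_
      rw [hcoord j]
      simp [rankOne, Module.End.mul_apply]
      ring
    rw [h1, Finset.mul_sum]
    have h2 : ∀ j, (Module.finrank F V : F) * ∑ i,
        ε * b.coord i ((∑ g, ρ g * rankOne (b j) (T (b i)) * ρ g⁻¹) (T.symm (b.coord j))) =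
        ε * Fintype.card G := fun j => by
      rw [Finset.mul_sum]
      have h3 : ∀ i, (Module.finrank F V : F) *
          (ε * b.coord i ((∑ g, ρ g * rankOne (b j) (T (b i)) * ρ g⁻¹) (T.symm (b.coord j)))) =
          ε * Fintype.card G * (b.coord i (T.symm (b.coord j)) * T (b i) (b j)) := fun i => by
        have h4 := h.finrank_smul_sum_conj (rankOne (b j) (T (b i)))
        have h5 := congrArg (b.coord i) (LinearMap.congr_fun h4 (T.symm (b.coord j)))
        rw [LinearMap.smul_apply, map_smul, LinearMap.smul_apply, map_smul, Module.End.one_apply,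
          trace_rankOne, smul_eq_mul, smul_eq_mul] at h5
        linear_combination ε * h5
      rw [Finset.sum_congr rfl fun i _ => h3 i, ← Finset.mul_sum]
      have h6 : ∑ i, b.coord i (T.symm (b.coord j)) * T (b i) (b j) = 1 := by
        have h7 := b.sum_repr (T.symm (b.coord j))
        have h8 := congrArg (fun x => T x (b j)) h7
        simp only [map_sum, map_smul, LinearMap.sum_apply, LinearMap.smul_apply, smul_eq_mul,
          T.apply_symm_apply] at h8
        simpa using h8
      rw [h6, mul_one]
    rw [Finset.sum_congr rfl fun j _ => h2 j, Finset.sum_const, Finset.card_univ, Fintype.card_fin,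
      nsmul_eq_mul]
    ring
  intro h0
  rw [h0, mul_zero] at key
  have hε0 : ε ≠ 0 := fun h => by simp [h] at hε
  have hd : (Module.finrank F V : F) ≠ 0 := Nat.cast_ne_zero.2 Module.finrank_pos.ne'
  have hG : (Fintype.card G : F) ≠ 0 := Nat.cast_ne_zero.2 Fintype.card_ne_zero
  exact mul_ne_zero hε0 (mul_ne_zero hG hd) key.symm

open Classical in
/-- In characteristic zero, invariant forms are detected by the sum of the character. -/
lemma sum_trace_ne_zero_iff [CharZero F] [FiniteDimensional F V] (ρ : Representation F G V) (H : Subgroup G) :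
    ∑ h : H, LinearMap.trace F V (ρ h) ≠ 0 ↔ invariantForms ρ (H : Set G) ≠ ⊥ := by
  have hG : (Nat.card H : F) ≠ 0 := Nat.cast_ne_zero.2 Nat.card_pos.ne'
  have : Invertible (Nat.card H : F) := invertibleOfNonzero hG
  have h1 := Representation.card_inv_mul_sum_char_eq_finrank
    (show Representation F H (Module.Dual F V) from ρ.dual.comp H.subtype)
  have h2 : Representation.invariants (ρ.dual.comp H.subtype) = invariantForms ρ (H : Set G) := by
    ext l
    constructor
    · intro h g hg v
      have := LinearMap.congr_fun (h ⟨g⁻¹, H.inv_mem hg⟩) v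
      change l (ρ g⁻¹⁻¹ v) = l v at this
      rwa [inv_inv] at this
    · intro h g
      ext v
      exact h _ (H.inv_mem g.2) v
  have h3 : ∑ h : H, LinearMap.trace F V (ρ h) =
      ∑ g : H, Representation.character (ρ.dual.comp H.subtype) g := by
    rw [← Equiv.sum_comp (Equiv.inv H)]
    refine Finset.sum_congr rfl fun g _ => ?_
    exact (LinearMap.trace_transpose' (ρ ((g : G)⁻¹))).symm
  have h4 := h1
  erw [h2, ← h3] at h4
  rw [← Submodule.one_le_finrank_iff, Nat.one_le_iff_ne_zero, ← Nat.cast_ne_zero (R := F), ← h4]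
  simp

end FrobeniusSchur

/-- In characteristic zero, a cuspidal irreducible representation is selfdual if and only if it
is distinguished. -/
theorem IsIrreducibleRep.repIso_dual_iff {k : Type} [Field k] [Fintype k] {n : ℕ} {F X : Type}
    [Field F] [IsAlgClosed F] [CharZero F] [AddCommGroup X] [Module F X]
    {π : Representation F (GL (Fin n) k) X} (h : IsIrreducibleRep π) (hπ : IsCuspidal π)
    (h2 : (2 : k) ≠ 0) {r : ℕ} (hr : 1 ≤ r) (hn : n = 2 * r) : RepIso π π.dual ↔
      invariantForms π (levi k n 2 (twoBlocks n r) : Set (GL (Fin n) k)) ≠ ⊥ := by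
  classical
  have := h.finiteDimensional
  obtain ⟨N, hN, hs⟩ := hπ.exists_sum_sq h2 hr hn
  have h1 := sum_trace_ne_zero_iff π (levi k n 2 (twoBlocks n r))
  have h3 : RepIso π π.dual ↔ ∑ g, LinearMap.trace F X (π (g * g)) ≠ 0 :=
    ⟨fun hd => h.sum_sq_ne_zero hd, fun hs => h.repIso_dual_of_sum_ne_zero hs⟩
  rw [h3, hs, ← h1, mul_ne_zero_iff, and_iff_right (Nat.cast_ne_zero.2 hN)]

/-- A nonzero polynomial over the Witt vectors may be divided by a power of `p` so that its
reduction is nonzero. -/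
lemma WittVector.exists_map_constantCoeff_ne_zero {R : Type} [Field R] (p : ℕ) [Fact p.Prime]
    [CharP R p] [PerfectRing R p] (f : Polynomial (WittVector p R)) (hf : f ≠ 0) :
    ∃ (m : ℕ) (g : Polynomial (WittVector p R)), f = Polynomial.C ((p : WittVector p R) ^ m) * g ∧
      g.map WittVector.constantCoeff ≠ 0 := by
  obtain ⟨m, b, hb, hm⟩ := WittVector.exists_eq_pow_p_mul f.leadingCoeff (by simpa using hf)
  induction m generalizing f with
  | zero =>
    refine ⟨0, f, by simp, fun h => hb ?_⟩
    have := congrArg (fun q => q.coeff f.natDegree) h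
    simp only [Polynomial.coeff_map, Polynomial.coeff_zero] at this
    rw [Polynomial.coeff_natDegree, hm, pow_zero, one_mul] at this
    exact this
  | succ m ih =>
    by_cases h : f.map WittVector.constantCoeff = 0
    · have hd : Polynomial.C (p : WittVector p R) ∣ f := by
        rw [Polynomial.C_dvd_iff_dvd_coeff]
        intro i
        rw [← Ideal.mem_span_singleton, ← WittVector.ker_constantCoeff, RingHom.mem_ker]
        simpa using congrArg (fun q => q.coeff i) h
      obtain ⟨f', rfl⟩ := hd
      have hp := WittVector.p_nonzero p R
      obtain ⟨m', g, h1, h2⟩ := ih f' (right_ne_zero_of_mul hf) (by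
        rw [Polynomial.leadingCoeff_mul, Polynomial.leadingCoeff_C, pow_succ', mul_assoc] at hm
        exact mul_left_cancel₀ hp hm)
      exact ⟨m' + 1, g, by rw [h1, pow_succ', Polynomial.C_mul, mul_assoc], h2⟩
    · exact ⟨0, f, by simp, h⟩

lemma WittVector.exists_valuationSubring_reduction {R : Type} [Field R] [IsAlgClosed R] {p : ℕ}
    [Fact p.Prime] [CharP R p] {F : Type} [Field F] (f : WittVector p R →+* F)
    (hfi : Function.Injective f)
    (halg : ∀ x : F, ∃ q : Polynomial (WittVector p R), q ≠ 0 ∧ Polynomial.eval₂ f x q = 0) :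
    CharZero F ∧ ∃ (O : ValuationSubring F) (red : O →+* R), Function.Surjective red ∧
        ∀ x, red x ≠ 0 → IsUnit x := by
  have hp : (p : F) ≠ 0 := fun h => WittVector.p_nonzero p R (hfi (by rw [map_natCast, h, map_zero]))
  obtain ⟨A, hA, hl⟩ := IsLocalRing.exists_factor_valuationRing f
  let g : WittVector p R →+* A := f.codRestrict A.toSubring hA
  have hl : IsLocalHom g := hl
  let c : WittVector p R →+* IsLocalRing.ResidueField A := (IsLocalRing.residue A).comp g
  have hcp : c p = 0 := by
    rw [RingHom.comp_apply, IsLocalRing.residue_eq_zero_iff, IsLocalRing.mem_maximalIdeal]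
    exact fun h => (WittVector.irreducible p (k := R)).not_isUnit (hl.map_nonunit _ h)
  have hck : RingHom.ker (WittVector.constantCoeff : WittVector p R →+* R) ≤ RingHom.ker c := by
    rw [WittVector.ker_constantCoeff, Ideal.span_singleton_le_iff_mem]
    exact hcp
  let ψ : R →+* IsLocalRing.ResidueField A :=
    RingHom.liftOfSurjective (WittVector.constantCoeff : WittVector p R →+* R)
      (WittVector.constantCoeff_surjective p) ⟨c, hck⟩
  have hψ : ψ.comp (WittVector.constantCoeff : WittVector p R →+* R) = c :=
    RingHom.liftOfRightInverse_comp _ _ _ _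
  have hchar : CharZero F := by
    obtain ⟨q, hq⟩ := CharP.exists F
    rcases CharP.char_is_prime_or_zero F q with h | h
    · exfalso
      have h1 : (q : WittVector p R) = 0 := hfi (by rw [map_natCast, map_zero, CharP.cast_eq_zero])
      have h2 : (q : R) = 0 := by simpa using congrArg (WittVector.constantCoeff (p := p)) h1
      have h3 := (CharP.cast_eq_zero_iff R p q).1 h2
      rw [Nat.prime_dvd_prime_iff_eq Fact.out h] at h3
      exact hp (h3 ▸ CharP.cast_eq_zero F q)
    · subst h; exact CharP.charP_to_charZero F
  have h_int : ψ.IsIntegral := by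
    intro y
    obtain ⟨x, rfl⟩ := IsLocalRing.residue_surjective y
    obtain ⟨q, hq0, hq⟩ := halg x
    obtain ⟨m, q', rfl, hq'⟩ := WittVector.exists_map_constantCoeff_ne_zero p q hq0
    have hq1 : Polynomial.eval₂ g x q' = 0 := by
      apply Subtype.ext
      have h2 : Polynomial.eval₂ f (x : F) q' = 0 := by
        have h3 : Polynomial.eval₂ f (x : F) (Polynomial.C ((p : WittVector p R) ^ m) * q') = 0 := hq
        rw [Polynomial.eval₂_mul, Polynomial.eval₂_C, map_pow, map_natCast] at h3
        exact (mul_eq_zero.1 h3).resolve_left (pow_ne_zero _ hp)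
      exact (Polynomial.hom_eval₂ q' g A.subtype x).trans h2
    have hq2 : Polynomial.eval₂ ψ (IsLocalRing.residue A x) (q'.map WittVector.constantCoeff) = 0 := by
      rw [Polynomial.eval₂_map, hψ, ← Polynomial.hom_eval₂, hq1, map_zero]
    refine ⟨Polynomial.C (q'.map WittVector.constantCoeff).leadingCoeff⁻¹ *
      q'.map WittVector.constantCoeff, ?_, ?_⟩
    · rw [mul_comm]; exact Polynomial.monic_mul_leadingCoeff_inv hq'
    · rw [Polynomial.eval₂_mul, hq2, mul_zero]
  have hbij := IsAlgClosed.ringHom_bijective_of_isIntegral ψ h_int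
  let e : R ≃+* IsLocalRing.ResidueField A := RingEquiv.ofBijective ψ hbij
  refine ⟨hchar, A, e.symm.toRingHom.comp (IsLocalRing.residue A),
    e.symm.surjective.comp IsLocalRing.residue_surjective, fun x hx => ?_⟩
  by_contra h
  refine hx ?_
  have : IsLocalRing.residue A x = 0 := (IsLocalRing.residue_eq_zero_iff x).2 h
  simp [this]

/-- An algebraically closed field of positive characteristic is the residue field of a valuation
ring in an algebraically closed field of characteristic zero. -/
lemma exists_valuationSubring_reduction (R : Type) [Field R] [IsAlgClosed R] (p : ℕ)
    [Fact p.Prime] [CharP R p] : ∃ (F : Type) (_ : Field F) (_ : IsAlgClosed F) (_ : CharZero F)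
      (O : ValuationSubring F) (red : O →+* R), Function.Surjective red ∧
        ∀ x, red x ≠ 0 → IsUnit x := by
  have hinj : Function.Injective (algebraMap (WittVector p R)
      (AlgebraicClosure (FractionRing (WittVector p R)))) := by
    rw [IsScalarTower.algebraMap_eq (WittVector p R) (FractionRing (WittVector p R))]
    exact (algebraMap (FractionRing (WittVector p R)) _).injective.comp
      (IsFractionRing.injective (WittVector p R) (FractionRing (WittVector p R)))
  obtain ⟨h1, h2⟩ := WittVector.exists_valuationSubring_reduction _ hinj fun x =>
    (IsFractionRing.isAlgebraic_iff (WittVector p R) (FractionRing (WittVector p R)) _).2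
      (Algebra.IsAlgebraic.isAlgebraic (R := FractionRing (WittVector p R)) x)
  exact ⟨_, inferInstance, inferInstance, h1, h2⟩

section Lattice

variable {F : Type} [Field F] {O : ValuationSubring F} {X : Type} [AddCommGroup X] [Module F X]

/-- A finite family spanning a vector space contains a basis with respect to which all members of
the family have integral coordinates. -/
lemma ValuationSubring.exists_basis_of_span (O : ValuationSubring F) {ι : Type} [Fintype ι]
    (v : ι → X) (hv : Submodule.span F (Set.range v) = ⊤) : ∃ (d : ℕ) (b : Module.Basis (Fin d) F X),
      (∀ j, ∃ i, b j = v i) ∧ ∀ i j, b.repr (v i) j ∈ O := by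
  classical
  let : Module O X := Module.compHom X (algebraMap O F)
  have hsmul : ∀ (c : O) (x : X), c • x = (c : F) • x := fun _ _ => rfl
  let P : Finset ι → Prop := fun S => ∀ i, v i ∈ Submodule.span O (v '' S)
  obtain ⟨S, hS, hmin⟩ := (Set.toFinite {S | P S}).exists_minimalFor Finset.card _
    ⟨Finset.univ, fun i => Submodule.subset_span ⟨i, by simp, rfl⟩⟩
  have hli : LinearIndependent F (fun j : S => v j) := by
    rw [Fintype.linearIndependent_iff]
    by_contra! h
    obtain ⟨a, ha, i, hi⟩ := h
    obtain ⟨i₀, -, hmax⟩ := Finset.exists_max_image Finset.univ (fun j => O.valuation (a j)) ⟨i, by simp⟩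
    have h0 : a i₀ ≠ 0 := fun h => by
      have := hmax i (by simp)
      rw [h, map_zero, le_zero_iff, Valuation.zero_iff] at this
      exact hi this
    have hmem : ∀ j, a j / a i₀ ∈ O := fun j => by
      rw [← ValuationSubring.valuation_le_one_iff, map_div₀]
      exact div_le_one_of_le₀ (hmax j (by simp)) zero_le
    have hvi : v i₀ ∈ Submodule.span O (v '' (S.erase i₀ : Finset ι)) := by
      have h1 : v i₀ = - ∑ j ∈ Finset.univ.erase i₀, (a j / a i₀) • v j := by
        rw [← Finset.add_sum_erase _ _ (Finset.mem_univ i₀)] at ha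
        have := congrArg (fun y => (a i₀)⁻¹ • y) ha
        rw [smul_add, smul_smul, inv_mul_cancel₀ h0, one_smul, smul_zero, Finset.smul_sum] at this
        rw [eq_neg_iff_add_eq_zero, ← this]
        exact congrArg _ (Finset.sum_congr rfl fun j _ => by rw [smul_smul, div_eq_inv_mul])
      rw [h1]
      refine Submodule.neg_mem _ (Submodule.sum_mem _ fun j hj => ?_)
      exact Submodule.smul_mem _ (⟨_, hmem j⟩ : O) (Submodule.subset_span ⟨j, Finset.mem_coe.2
        (Finset.mem_erase.2 ⟨fun h => (Finset.mem_erase.1 hj).1 (Subtype.ext h), j.2⟩), rfl⟩)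
    have hP : P (S.erase i₀) := fun i => by
      refine (Submodule.span_le.2 ?_) (hS i)
      rintro _ ⟨j, hj, rfl⟩
      by_cases hji : j = i₀
      · rw [hji]; exact hvi
      · exact Submodule.subset_span ⟨j, by simpa [hji] using hj, rfl⟩
    have h2 := Finset.card_erase_lt_of_mem i₀.2
    have h3 := hmin hP h2.le
    omega
  have hmem : ∀ i, ∃ c : S → O, v i = ∑ j, (c j : F) • v j := fun i => by
    have := hS i
    obtain ⟨c, hc⟩ := (Submodule.mem_span_image_finset_iff_exists_fun O).1 (hS i)
    exact ⟨c, hc.symm⟩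
  have hsp : ⊤ ≤ Submodule.span F (Set.range fun j : S => v j) := by
    rw [← hv, Submodule.span_le]
    rintro _ ⟨i, rfl⟩
    obtain ⟨c, hc⟩ := hmem i
    rw [hc]
    exact Submodule.sum_mem _ fun j _ => Submodule.smul_mem _ _ (Submodule.subset_span ⟨j, rfl⟩)
  let b := Module.Basis.mk hli hsp
  refine ⟨_, b.reindex S.equivFin, fun j => ⟨S.equivFin.symm j, by simp [b]⟩, fun i j => ?_⟩
  obtain ⟨c, hc⟩ := hmem i
  have : v i = ∑ j, (c j : F) • b j := by simpa [b] using hc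
  rw [this]
  simp only [map_sum, map_smul, Module.Basis.repr_reindex, Finsupp.coe_finsetSum, Finset.sum_apply]
  refine sum_mem fun x _ => ?_
  simp only [Finsupp.mapDomain_equiv_apply, Finsupp.smul_apply, Module.Basis.repr_self,
    Finsupp.single_apply, smul_eq_mul, mul_ite, mul_one, mul_zero]
  split_ifs
  exacts [(c x).2, O.zero_mem]

variable {R : Type} [Field R] {G : Type} [Group G] {J : Type} [Fintype J] [DecidableEq J]

/-- The matrices of the representation with respect to the basis are the given integral matrices. -/
def IsIntegralForm (σ : Representation F G X) (b : Module.Basis J F X)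
    (r : G →* Matrix J J O) : Prop :=
  ∀ g, LinearMap.toMatrix b b (σ g) = (r g).map O.subtype

/-- The reduction of an integral matrix representation. -/
noncomputable def redRep (red : O →+* R) (r : G →* Matrix J J O) : Representation R G (J → R) :=
  (Matrix.toLinAlgEquiv' : Matrix J J R ≃ₐ[R] _).toMonoidHom.comp
    ((red.mapMatrix : Matrix J J O →+* Matrix J J R).toMonoidHom.comp r)

lemma redRep_apply (red : O →+* R) (r : G →* Matrix J J O) (g : G) :
    redRep red r g = Matrix.toLin' ((r g).map red) := rfl

lemma trace_redRep (red : O →+* R) (r : G →* Matrix J J O) (g : G) :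
    LinearMap.trace R _ (redRep red r g) = red (r g).trace := by
  rw [redRep_apply, Matrix.trace_toLin'_eq]
  simp [Matrix.trace]

lemma IsIntegralForm.trace_eq {σ : Representation F G X} {b : Module.Basis J F X}
    {r : G →* Matrix J J O} (h : IsIntegralForm σ b r) (g : G) :
    LinearMap.trace F X (σ g) = ((r g).trace : F) := by
  rw [LinearMap.trace_eq_matrix_trace F b, h g]
  simp [Matrix.trace]

lemma IsIntegralForm.redRep_single {σ : Representation F G X} {b : Module.Basis J F X}
    {r : G →* Matrix J J O} (h : IsIntegralForm σ b r) (red : O →+* R) {g : G} {j : J}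
    (hg : σ g (b j) = b j) : redRep red r g (Pi.single j 1) = Pi.single j 1 := by
  have h1 : ∀ i, r g i j = if i = j then 1 else 0 := fun i => by
    apply Subtype.ext
    have := congrFun (congrFun (h g) i) j
    rw [LinearMap.toMatrix_apply, hg, Module.Basis.repr_self, Finsupp.single_apply] at this
    rw [Matrix.map_apply] at this
    refine this.symm.trans ?_
    simp only [eq_comm (a := j)]
    split_ifs <;> rfl
  ext i
  rw [redRep_apply, Matrix.toLin'_apply, Matrix.mulVec_single_one, Matrix.col_apply, Matrix.map_apply, h1,
    Pi.single_apply]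
  split_ifs <;> simp

lemma IsIntegralForm.sum_redRep_eq_zero {σ : Representation F G X} {b : Module.Basis J F X}
    {r : G →* Matrix J J O} (h : IsIntegralForm σ b r) (red : O →+* R) {ι : Type} [Fintype ι]
    (u : ι → G) (hu : ∑ i, σ (u i) = 0) : ∑ i, redRep red r (u i) = 0 := by
  have h1 : ∑ i, r (u i) = 0 := by
    apply (Matrix.map_injective Subtype.val_injective : Function.Injective
      fun M : Matrix J J O => M.map O.subtype)
    have := congrArg (LinearMap.toMatrix b b) hu
    rw [map_sum, map_zero, Finset.sum_congr rfl fun i _ => h (u i)] at this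
    exact (map_sum (O.subtype.mapMatrix : Matrix J J O →+* Matrix J J F) _ _).trans
      (this.trans (map_zero (O.subtype.mapMatrix : Matrix J J O →+* Matrix J J F)).symm)
  have h2 := congrArg (fun M => Matrix.toLin' ((red.mapMatrix : Matrix J J O →+* Matrix J J R) M)) h1
  rw [map_sum, map_sum, map_zero, map_zero] at h2
  exact h2

variable [Fintype G]

/-- The integral matrix by which a group algebra element acts. -/
def actMat (r : G →* Matrix J J O) (x : G → O) : Matrix J J O := ∑ g, x g • r g

lemma act_redRep (red : O →+* R) (r : G →* Matrix J J O) (x : G → O) :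
    act (redRep red r) (fun g => red (x g)) = Matrix.toLin' ((actMat r x).map red) := by
  have : (actMat r x).map red = ∑ g, red (x g) • (r g).map red := by
    refine (map_sum (red.mapMatrix : Matrix J J O →+* Matrix J J R) _ _).trans ?_
    refine Finset.sum_congr rfl fun g _ => ?_
    ext i j; simp
  rw [this, act_def, map_sum]
  exact Finset.sum_congr rfl fun g _ => by rw [map_smul, redRep_apply]

lemma IsIntegralForm.toMatrix_act {σ : Representation F G X} {b : Module.Basis J F X}
    {r : G →* Matrix J J O} (h : IsIntegralForm σ b r) (x : G → O) :
    LinearMap.toMatrix b b (act σ fun g => (x g : F)) = (actMat r x).map O.subtype := by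
  rw [act_def, map_sum]
  refine Eq.trans ?_ (map_sum (O.subtype.mapMatrix : Matrix J J O →+* Matrix J J F) _ _).symm
  refine Finset.sum_congr rfl fun g _ => ?_
  rw [map_smul, h g]
  ext i j; simp

/-- A cyclic representation of a finite group has an integral form with a basis consisting of
translates of the generator. -/
lemma exists_isIntegralForm (O : ValuationSubring F) (σ : Representation F G X) (w : X)
    (hw : Submodule.span F (Set.range fun g => σ g w) = ⊤) :
    ∃ (d : ℕ) (b : Module.Basis (Fin d) F X) (r : G →* Matrix (Fin d) (Fin d) O),
      IsIntegralForm σ b r ∧ ∀ j, ∃ g, b j = σ g w := by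
  obtain ⟨d, b, h1, h2⟩ := O.exists_basis_of_span _ hw
  have h3 : ∀ g i j, b.repr (σ g (b j)) i ∈ O := fun g i j => by
    obtain ⟨a, ha⟩ := h1 j
    rw [ha, ← Module.End.mul_apply, ← map_mul σ]
    exact h2 _ _
  let m : G → Matrix (Fin d) (Fin d) O := fun g => .of fun i j => ⟨_, h3 g i j⟩
  have hm : ∀ g, (m g).map O.subtype = LinearMap.toMatrix b b (σ g) := fun g => by
    ext i j; rw [LinearMap.toMatrix_apply]; rfl
  have hinj : Function.Injective (O.subtype.mapMatrix : Matrix (Fin d) (Fin d) O →+* _) :=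
    Matrix.map_injective Subtype.val_injective
  refine ⟨d, b, { toFun := m, map_one' := hinj ?_, map_mul' := fun x y => hinj ?_ },
    fun g => (hm g).symm, h1⟩
  · exact (hm 1).trans (by rw [map_one σ, LinearMap.toMatrix_one, map_one])
  · rw [map_mul O.subtype.mapMatrix]
    exact (hm _).trans (by rw [map_mul σ, LinearMap.toMatrix_mul, ← hm, ← hm]; rfl)

lemma IsIrreducibleRep.span_range_eq_top {σ : Representation F G X} (h : IsIrreducibleRep σ) {w : X}
    (hw : w ≠ 0) : Submodule.span F (Set.range fun g => σ g w) = ⊤ := by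
  refine (h.2 _ fun g v hv => ?_).resolve_left fun h0 => hw ?_
  · induction hv using Submodule.span_induction with
    | mem x hx =>
      obtain ⟨a, rfl⟩ := hx
      exact Submodule.subset_span ⟨g * a, by simp [map_mul σ]⟩
    | zero => simp
    | add x y _ _ hx hy => rw [map_add]; exact add_mem hx hy
    | smul c x _ hx => rw [map_smul]; exact Submodule.smul_mem _ _ hx
  · have : w ∈ Submodule.span F (Set.range fun g => σ g w) :=
      Submodule.subset_span ⟨1, by simp⟩
    rw [h0] at this
    simpa using this

end Lattice

section DirectSum

variable {F : Type} [Field F] {X : Type} [AddCommGroup X] [Module F X] {W₁ W₂ : Submodule F X}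

lemma eq_conj_prodMap_of_isCompl (h : IsCompl W₁ W₂) {f : Module.End F X} {f₁ : Module.End F W₁}
    {f₂ : Module.End F W₂} (h₁ : ∀ w, (f₁ w : X) = f w) (h₂ : ∀ w, (f₂ w : X) = f w) :
    f = (Submodule.prodEquivOfIsCompl W₁ W₂ h).conj (f₁.prodMap f₂) := by
  ext x
  obtain ⟨⟨y, z⟩, rfl⟩ := (Submodule.prodEquivOfIsCompl W₁ W₂ h).surjective x
  rw [LinearEquiv.conj_apply_apply, LinearEquiv.symm_apply_apply]
  simp [Submodule.coe_prodEquivOfIsCompl', h₁, h₂]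

variable [FiniteDimensional F X]

lemma det_eq_mul_of_isCompl (h : IsCompl W₁ W₂) {f : Module.End F X} {f₁ : Module.End F W₁}
    {f₂ : Module.End F W₂} (h₁ : ∀ w, (f₁ w : X) = f w) (h₂ : ∀ w, (f₂ w : X) = f w) :
    LinearMap.det f = LinearMap.det f₁ * LinearMap.det f₂ := by
  rw [eq_conj_prodMap_of_isCompl h h₁ h₂]
  exact (LinearMap.det_conj (f₁.prodMap f₂) (Submodule.prodEquivOfIsCompl W₁ W₂ h)).trans
    (LinearMap.det_prodMap f₁ f₂)

lemma trace_eq_add_of_isCompl (h : IsCompl W₁ W₂) {f : Module.End F X} {f₁ : Module.End F W₁}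
    {f₂ : Module.End F W₂} (h₁ : ∀ w, (f₁ w : X) = f w) (h₂ : ∀ w, (f₂ w : X) = f w) :
    LinearMap.trace F X f = LinearMap.trace F W₁ f₁ + LinearMap.trace F W₂ f₂ := by
  rw [eq_conj_prodMap_of_isCompl h h₁ h₂, LinearMap.trace_conj', LinearMap.trace_prodMap']

end DirectSum

section Maschke

variable {F : Type} [Field F] [CharZero F] {G : Type} [Group G] [Fintype G]

/-- A stable subspace has a stable complement. -/
lemma exists_isCompl_stable {X : Type} [AddCommGroup X] [Module F X] (σ : Representation F G X)
    (W : Submodule F X) (hW : ∀ g, ∀ v ∈ W, σ g v ∈ W) :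
    ∃ W' : Submodule F X, (∀ g, ∀ v ∈ W', σ g v ∈ W') ∧ IsCompl W W' := by
  obtain ⟨p, hp⟩ := LinearMap.exists_leftInverse_of_injective W.subtype W.ker_subtype
  have hp' : ∀ w : W, p w = w := fun w => LinearMap.congr_fun hp w
  have hG : (Fintype.card G : F) ≠ 0 := Nat.cast_ne_zero.2 Fintype.card_ne_zero
  let τ := restrictRep σ W hW
  let P : X →ₗ[F] W := (Fintype.card G : F)⁻¹ • ∑ g, τ g⁻¹ ∘ₗ p ∘ₗ σ g
  have hP : ∀ v, P v = (Fintype.card G : F)⁻¹ • ∑ g, τ g⁻¹ (p (σ g v)) := fun v => by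
    simp [P, LinearMap.sum_apply]
  have hPw : ∀ w : W, P w = w := fun w => by
    rw [hP, Finset.sum_congr rfl (g := fun _ => w) fun g _ => ?_]
    · rw [Finset.sum_const, Finset.card_univ, ← Nat.cast_smul_eq_nsmul F, smul_smul,
        inv_mul_cancel₀ hG, one_smul]
    · rw [show σ g w = (τ g w : W) from rfl, hp', ← Module.End.mul_apply, ← map_mul,
        inv_mul_cancel, map_one, Module.End.one_apply]
  have hPg : ∀ g v, P (σ g v) = τ g (P v) := fun g v => by
    rw [hP, hP, map_smul, map_sum, ← Equiv.sum_comp (Equiv.mulRight g) fun a => τ g (τ a⁻¹ _)]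
    refine congrArg _ (Finset.sum_congr rfl fun a _ => ?_)
    simp only [Equiv.coe_mulRight, ← Module.End.mul_apply, ← map_mul, _root_.mul_inv_rev,
      mul_inv_cancel_left]
  refine ⟨LinearMap.ker P, fun g v hv => ?_, LinearMap.isCompl_of_proj hPw⟩
  rw [LinearMap.mem_ker] at hv ⊢
  rw [hPg, hv, map_zero]

/-- Induction on finite-dimensional representations of a finite group in characteristic zero. -/
lemma rep_induction (Q : ∀ (X : Type) [AddCommGroup X] [Module F X], Representation F G X → Prop)
    (h0 : ∀ (X : Type) [AddCommGroup X] [Module F X] (σ : Representation F G X),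
      Subsingleton X → Q X σ)
    (h1 : ∀ (X : Type) [AddCommGroup X] [Module F X] (σ : Representation F G X),
      IsIrreducibleRep σ → Q X σ)
    (h2 : ∀ (X : Type) [AddCommGroup X] [Module F X] [FiniteDimensional F X]
      (σ : Representation F G X) (W₁ W₂ : Submodule F X) (hW₁ : ∀ g, ∀ v ∈ W₁, σ g v ∈ W₁)
      (hW₂ : ∀ g, ∀ v ∈ W₂, σ g v ∈ W₂), IsCompl W₁ W₂ → Q W₁ (restrictRep σ W₁ hW₁) →
        Q W₂ (restrictRep σ W₂ hW₂) → Q X σ)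
    (X : Type) [AddCommGroup X] [Module F X] [FiniteDimensional F X] (σ : Representation F G X) :
    Q X σ := by
  induction hd : Module.finrank F X using Nat.strong_induction_on generalizing X with
  | _ d ih =>
  subst hd
  by_cases hs : Subsingleton X
  · exact h0 X σ hs
  by_cases hi : IsIrreducibleRep σ
  · exact h1 X σ hi
  have hbt : (⊥ : Submodule F X) ≠ ⊤ := fun h => hs ((Submodule.subsingleton_iff F).1
    (subsingleton_of_bot_eq_top h))
  obtain ⟨W, hW, hWb, hWt⟩ : ∃ W : Submodule F X, (∀ g, ∀ v ∈ W, σ g v ∈ W) ∧ W ≠ ⊥ ∧ W ≠ ⊤ := by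
    by_contra! h
    exact hi ⟨hbt, fun W hW => or_iff_not_imp_left.2 fun hb => h W hW hb⟩
  obtain ⟨W', hW', hc⟩ := exists_isCompl_stable σ W hW
  have hWt' : W' ≠ ⊤ := fun h => hWb (by simpa [h] using hc.inf_eq_bot)
  exact h2 X σ W W' hW hW' hc (ih _ (Submodule.finrank_lt hWt) W _ rfl)
    (ih _ (Submodule.finrank_lt hWt') W' _ rfl)

end Maschke

section Dichotomy

variable {k : Type} [Field k] [Fintype k] {n : ℕ} {R : Type} [Field R] {F : Type} [Field F]
  {O : ValuationSubring F}

lemma act_apply_eq_zero_of_fixed {V : Type} [AddCommGroup V] [Module R V]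
    (ρ : Representation R (GL (Fin n) k) V) {j : ℕ} (hU : (Fintype.card (uniRad k n j) : R) ≠ 0)
    {x : GL (Fin n) k → R} (hx : x ∈ aIdeal k n R j) (a : GL (Fin n) k) {v : V}
    (hv : ∀ u ∈ uniRad k n j, ρ (a * u * a⁻¹) v = v) : act ρ x v = 0 := by
  have h1 : act ρ x * ρ a * ∑ u : uniRad k n j, ρ u = 0 := by
    have : act ρ x * ρ a = act ρ (fun g => x (1 * g * a⁻¹)) := by
      rw [act_translate, inv_one, map_one, one_mul, inv_inv]
    rw [this]
    exact act_mul_sum_uniRad ρ (isTwoSided_aIdeal j x hx 1 a⁻¹)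
  have h2 := LinearMap.congr_fun h1 (ρ a⁻¹ v)
  rw [Module.End.mul_apply, LinearMap.sum_apply, Finset.sum_congr rfl (g := fun _ => ρ a⁻¹ v)
    fun u _ => ?_, Finset.sum_const, Finset.card_univ, ← Nat.cast_smul_eq_nsmul R, map_smul,
    Module.End.mul_apply, ← Module.End.mul_apply (ρ a), ← map_mul ρ, mul_inv_cancel, map_one,
    Module.End.one_apply] at h2
  · exact (smul_eq_zero.1 h2).resolve_left hU
  · have h3 := congrArg (ρ a⁻¹) (hv u u.2)
    refine Eq.trans ?_ h3
    simp only [← Module.End.mul_apply, ← map_mul ρ]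
    congr 2
    group

variable [IsAlgClosed R] [IsAlgClosed F] [CharZero F]

/-- An irreducible representation in characteristic zero either reduces to something killed by an
ideal acting fully on `ρ`, or is a cuspidal lift of `ρ`. -/
lemma exists_isIntegralForm_dichotomy (p : ℕ) [Fact p.Prime] [CharP k p] (hR : (p : R) ≠ 0)
    (hn : 1 ≤ n) (red : O →+* R) {V : Type} [AddCommGroup V] [Module R V]
    {ρ : Representation R (GL (Fin n) k) V} (hirr : IsIrreducibleRep ρ)
    (hc : ActsFully ρ (cuspIdeal k n R)) {G : Type} [Group G] [Fintype G] (ι : GL (Fin n) k →* G)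
    (hι : ∀ (g : G) j, 0 < j → j < n → ∃ j' a, 0 < j' ∧ j' < n ∧ ∀ u ∈ uniRad k n j',
      ∃ u' ∈ uniRad k n j, ι (a * u * a⁻¹) * g = g * ι u')
    {X : Type} [AddCommGroup X] [Module F X] {σ : Representation F G X} (h : IsIrreducibleRep σ)
    (hcusp : IsCuspidal (MonoidHom.comp σ ι) → IsIrreducibleRep (MonoidHom.comp σ ι)) :
    ∃ (d : ℕ) (b : Module.Basis (Fin d) F X) (r : G →* Matrix (Fin d) (Fin d) O),
      IsIntegralForm σ b r ∧
      ((∃ J, IsTwoSided J ∧ ActsFully ρ J ∧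
          ∀ x ∈ J, act (MonoidHom.comp (redRep red r) ι) x = 0) ∨
        IsCuspidal (MonoidHom.comp σ ι) ∧ RepIso (MonoidHom.comp (redRep red r) ι) ρ) := by
  by_cases hπ : IsCuspidal (MonoidHom.comp σ ι)
  · have := h.nontrivial
    obtain ⟨w, hw⟩ := exists_ne (0 : X)
    obtain ⟨d, b, r, hr, -⟩ := exists_isIntegralForm O σ w (h.span_range_eq_top hw)
    refine ⟨d, b, r, hr, ?_⟩
    have hF : (p : F) ≠ 0 := Nat.cast_ne_zero.2 (Fact.out : p.Prime).ne_zero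
    have hd : d = cuspidalDim k n := by
      rw [← (hcusp hπ).finrank_eq_cuspidalDim hπ p hF hn, Module.finrank_eq_card_basis b,
        Fintype.card_fin]
    have hrc : IsCuspidal (MonoidHom.comp (redRep red r) ι) := fun j h0 hj =>
      hr.sum_redRep_eq_zero red (fun u : uniRad k n j => ι u) (hπ j h0 hj)
    have hri := hrc.isIrreducibleRep (by simpa using hd) p hR hn
    by_cases hiso : RepIso (MonoidHom.comp (redRep red r) ι) ρ
    · exact Or.inr ⟨hπ, hiso⟩
    · exact Or.inl ⟨_, isTwoSided_ker _, actsFully_ker_of_not_repIso hirr hri hiso, fun x hx => hx⟩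
  · have hj : ∃ j, 0 < j ∧ j < n ∧ ∑ u : uniRad k n j, σ (ι u) ≠ 0 := by
      by_contra! h'
      exact hπ fun j h0 hj => h' j h0 hj
    obtain ⟨j, h0, hj, hne⟩ := hj
    obtain ⟨w₀, hw₀⟩ : ∃ w₀, (∑ u : uniRad k n j, σ (ι u)) w₀ ≠ 0 := by
      by_contra! h'
      exact hne (LinearMap.ext h')
    set w := (∑ u : uniRad k n j, σ (ι u)) w₀ with hw
    have hfix : ∀ u ∈ uniRad k n j, σ (ι u) w = w := fun u hu => by
      rw [hw, ← Module.End.mul_apply, Finset.mul_sum,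
        ← Equiv.sum_comp (Equiv.mulLeft (⟨u, hu⟩ : uniRad k n j)) fun u => σ (ι u)]
      simp [map_mul]
    obtain ⟨d, b, r, hr, hb⟩ := exists_isIntegralForm O σ w (h.span_range_eq_top hw₀)
    refine ⟨d, b, r, hr, Or.inl ⟨_, isTwoSided_cuspIdeal, hc, fun x hx => ?_⟩⟩
    refine (Pi.basisFun R (Fin d)).ext fun i => ?_
    obtain ⟨g, hg⟩ := hb i
    obtain ⟨j', a, h0', hj', ha⟩ := hι g j h0 hj
    rw [Pi.basisFun_apply, LinearMap.zero_apply]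
    refine act_apply_eq_zero_of_fixed _ (card_uniRad_ne_zero p hR j')
      (mem_aIdeal_of_mem_cuspIdeal hx h0' hj') a fun u hu => ?_
    obtain ⟨u', hu', he⟩ := ha u hu
    refine hr.redRep_single red ?_
    rw [hg, ← Module.End.mul_apply, ← map_mul σ, he, map_mul σ, Module.End.mul_apply, hfix u' hu']

end Dichotomy

section PermutationMatrices

variable {G : Type} [Group G] {Y : Type} [Fintype Y] [DecidableEq Y] [MulAction G Y]

/-- Permutation matrices of a group action. -/
def permMat (A : Type) [CommRing A] (G Y : Type) [Group G] [Fintype Y] [DecidableEq Y]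
    [MulAction G Y] : G →* Matrix Y Y A where
  toFun g := .of fun i j => if g • j = i then 1 else 0
  map_one' := by ext i j; simp [Matrix.one_apply, eq_comm]
  map_mul' a b := by
    ext i j
    simp [Matrix.mul_apply, mul_smul]

lemma permMat_apply (A : Type) [CommRing A] (g : G) (i j : Y) :
    permMat A G Y g i j = if g • j = i then 1 else 0 := rfl

variable {F : Type} [Field F] {O : ValuationSubring F} {R : Type} [Field R]

lemma redRep_permMat_apply (red : O →+* R) (g : G) (f : Y → R) (y : Y) :
    redRep red (permMat O G Y) g f y = f (g⁻¹ • y) := by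
  rw [redRep_apply, Matrix.toLin'_apply, Matrix.mulVec, dotProduct,
    Finset.sum_eq_single (g⁻¹ • y)]
  · simp [permMat_apply]
  · intro j _ hj
    rw [Matrix.map_apply, permMat_apply, if_neg (fun h => hj (by rw [← h, inv_smul_smul])),
      map_zero, zero_mul]
  · simp

lemma isIntegralForm_redRep {J : Type} [Fintype J] [DecidableEq J] (r : G →* Matrix J J O) :
    IsIntegralForm (redRep O.subtype r) (Pi.basisFun F J) r := fun g => by
  rw [redRep_apply, LinearMap.toMatrix_eq_toMatrix', LinearMap.toMatrix'_toLin']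

end PermutationMatrices

section Determinant

variable {F : Type} [Field F] {O : ValuationSubring F} {X : Type} [AddCommGroup X] [Module F X]
  {R : Type} [Field R] {G : Type} [Group G] [Fintype G] {J : Type} [Fintype J] [DecidableEq J]

lemma IsIntegralForm.det_one_sub_act {σ : Representation F G X} {b : Module.Basis J F X}
    {r : G →* Matrix J J O} (h : IsIntegralForm σ b r) (x : G → O) :
    LinearMap.det ((1 : Module.End F X) - act σ fun g => (x g : F)) =
      (((1 - actMat r x).det : O) : F) := by
  rw [← LinearMap.det_toMatrix b, map_sub (LinearMap.toMatrix b b), LinearMap.toMatrix_one,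
    h.toMatrix_act]
  change _ = O.subtype _
  rw [RingHom.map_det, map_sub, map_one]
  rfl

lemma det_one_sub_act_redRep (red : O →+* R) (r : G →* Matrix J J O) (x : G → O) :
    LinearMap.det ((1 : Module.End R (J → R)) - act (redRep red r) fun g => red (x g)) =
      red (1 - actMat r x).det := by
  rw [act_redRep, RingHom.map_det, map_sub red.mapMatrix, map_one red.mapMatrix,
    ← LinearMap.det_toLin', map_sub Matrix.toLin', Matrix.toLin'_one]
  rfl

lemma act_restrictRep_coe {W : Submodule F X} (σ : Representation F G X)
    (hW : ∀ g, ∀ v ∈ W, σ g v ∈ W) (x : G → F) (w : W) :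
    (act (restrictRep σ W hW) x w : X) = act σ x w := by
  simp [act_apply]

end Determinant

section Distinguished

variable {k : Type} [Field k] [Fintype k] {n : ℕ} {R : Type} [Field R] {F : Type} [Field F]
  {O : ValuationSubring F} [IsAlgClosed R] [IsAlgClosed F] [CharZero F]

/-- A distinguished representation on which the cuspidal ideal acts fully has a distinguished
cuspidal lift. -/
lemma exists_distinguished_lift (p : ℕ) [Fact p.Prime] [CharP k p] (hR : (p : R) ≠ 0)
    (hn : 1 ≤ n) (red : O →+* R) (hred : Function.Surjective red) {V : Type} [AddCommGroup V]
    [Module R V] {ρ : Representation R (GL (Fin n) k) V} (hirr : IsIrreducibleRep ρ)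
    (hc : ActsFully ρ (cuspIdeal k n R)) (H : Subgroup (GL (Fin n) k))
    (hH : invariantForms ρ (H : Set (GL (Fin n) k)) ≠ ⊥) :
    ∃ (X : Type) (_ : AddCommGroup X) (_ : Module F X) (π : Representation F (GL (Fin n) k) X)
      (d : ℕ) (b : Module.Basis (Fin d) F X) (r : GL (Fin n) k →* Matrix (Fin d) (Fin d) O),
      IsIrreducibleRep π ∧ IsCuspidal π ∧ invariantForms π (H : Set (GL (Fin n) k)) ≠ ⊥ ∧
        IsIntegralForm π b r ∧ RepIso (redRep red r) ρ := by
  classical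
  by_contra hno
  let Q : ∀ (X : Type) [AddCommGroup X] [Module F X], Representation F (GL (Fin n) k) X → Prop :=
    fun X _ _ σ => (∀ v, v ≠ 0 → ∃ l ∈ invariantForms σ (H : Set (GL (Fin n) k)),
      ∃ g, l (σ g v) ≠ 0) → ∃ J, IsTwoSided J ∧ ActsFully ρ J ∧
        ∀ x : GL (Fin n) k → O, (fun g => red (x g)) ∈ J →
          ∃ c : O, LinearMap.det ((1 : Module.End F X) - act σ fun g => (x g : F)) = (c : F) ∧ red c = 1
  let Y := GL (Fin n) k ⧸ H
  let r₀ := permMat O (GL (Fin n) k) Y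
  have hQ : Q (Y → F) (redRep O.subtype r₀) := by
    refine rep_induction Q ?_ ?_ ?_ _ _
    · intro X _ _ σ hX _
      exact ⟨⊤, fun _ _ _ _ => trivial, actsFully_top hirr, fun x _ => ⟨1, by
        rw [LinearMap.det_eq_one_of_subsingleton]; rfl, map_one _⟩⟩
    · intro X _ _ σ hσ hsep
      have := hσ.nontrivial
      obtain ⟨v, hv⟩ := exists_ne (0 : X)
      obtain ⟨l, hl, g, hg⟩ := hsep v hv
      have hd : invariantForms σ (H : Set (GL (Fin n) k)) ≠ ⊥ := fun h0 => hg (by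
        rw [h0, Submodule.mem_bot] at hl
        rw [hl, LinearMap.zero_apply])
      obtain ⟨d, b, r, hr, h | h⟩ := exists_isIntegralForm_dichotomy p hR hn red hirr hc
        (MonoidHom.id (GL (Fin n) k)) (fun g j h0 hj => ⟨j, g, h0, hj, fun u hu => ⟨u, hu, by simp⟩⟩)
        hσ fun _ => hσ
      · obtain ⟨J, h1, h2, h3⟩ := h
        refine ⟨J, h1, h2, fun x hx => ⟨_, hr.det_one_sub_act x, ?_⟩⟩
        rw [← det_one_sub_act_redRep]
        have h4 : act (redRep red r) (fun g => red (x g)) = 0 := h3 _ hx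
        rw [h4, sub_zero, map_one]
      · exact absurd ⟨X, _, _, σ, d, b, r, hσ, h.1, hd, hr, h.2⟩ hno
    · intro X _ _ _ σ W₁ W₂ hW₁ hW₂ hcompl ih₁ ih₂ hsep
      have hs : ∀ (W : Submodule F X) (hW : ∀ g, ∀ v ∈ W, σ g v ∈ W) (v : W), v ≠ 0 →
          ∃ l ∈ invariantForms (restrictRep σ W hW) (H : Set (GL (Fin n) k)),
            ∃ g, l (restrictRep σ W hW g v) ≠ 0 := fun W hW v hv => by
        obtain ⟨l, hl, g, hg⟩ := hsep v (by simpa using hv)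
        exact ⟨l ∘ₗ W.subtype, fun a ha w => hl a ha w, g, hg⟩
      obtain ⟨J₁, a₁, b₁, c₁⟩ := ih₁ (hs W₁ hW₁)
      obtain ⟨J₂, a₂, b₂, c₂⟩ := ih₂ (hs W₂ hW₂)
      refine ⟨J₁ ⊓ J₂, a₁.inf a₂, b₁.inf b₂ a₁ a₂, fun x hx => ?_⟩
      obtain ⟨e₁, h₁, h₁'⟩ := c₁ x hx.1
      obtain ⟨e₂, h₂, h₂'⟩ := c₂ x hx.2
      refine ⟨e₁ * e₂, ?_, by rw [map_mul, h₁', h₂', one_mul]⟩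
      rw [det_eq_mul_of_isCompl hcompl (f₁ := 1 - act (restrictRep σ W₁ hW₁) fun g => (x g : F))
        (f₂ := 1 - act (restrictRep σ W₂ hW₂) fun g => (x g : F)), h₁, h₂]
      · rfl
      · intro w; simp [act_restrictRep_coe]
      · intro w; simp [act_restrictRep_coe]
  obtain ⟨J, -, hJ, hdet⟩ := hQ fun v hv => by
    obtain ⟨y, hy⟩ := Function.ne_iff.1 hv
    obtain ⟨g, rfl⟩ := QuotientGroup.mk_surjective y
    refine ⟨LinearMap.proj ((1 : GL (Fin n) k) : Y), fun h hh f => ?_, g⁻¹, ?_⟩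
    · rw [LinearMap.proj_apply, LinearMap.proj_apply, redRep_permMat_apply]
      congr 1
      rw [MulAction.Quotient.smul_coe, QuotientGroup.eq]
      simpa using hh
    · rw [LinearMap.proj_apply, redRep_permMat_apply, MulAction.Quotient.smul_coe]
      simpa using hy
  obtain ⟨x, hx, hx1⟩ := hJ 1
  choose y hy using fun g => hred (x g)
  have hxy : x = fun g => red (y g) := funext fun g => (hy g).symm
  obtain ⟨c, h1, h2⟩ := hdet y (hxy ▸ hx)
  rw [(isIntegralForm_redRep r₀).det_one_sub_act] at h1
  rw [← Subtype.ext h1, ← det_one_sub_act_redRep, ← hxy] at h2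
  obtain ⟨l, hl, hl0⟩ := Submodule.exists_mem_ne_zero_of_ne_bot hH
  obtain ⟨v, hv⟩ : ∃ v, l v ≠ 0 := by
    by_contra! h
    exact hl0 (LinearMap.ext h)
  let e : V → Y → R := fun v y => Quotient.liftOn' y (fun g => l (ρ g⁻¹ v)) fun a b hab => by
    have := hl _ (QuotientGroup.leftRel_apply.1 hab) (ρ b⁻¹ v)
    rw [← Module.End.mul_apply, ← map_mul] at this
    simpa using this
  have he : ∀ v g, e v (g : GL (Fin n) k) = l (ρ g⁻¹ v) := fun v g => rfl
  have hact : act (redRep red r₀) x (e v) = e v := by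
    ext y
    obtain ⟨a, rfl⟩ := QuotientGroup.mk_surjective y
    rw [act_apply, Finset.sum_apply]
    have h3 := congrArg (fun f => l (ρ a⁻¹ (f v))) hx1
    simp only [act_apply, map_sum, map_smul, Module.End.one_apply] at h3
    rw [he, ← h3]
    refine Finset.sum_congr rfl fun g _ => ?_
    rw [Pi.smul_apply, redRep_permMat_apply, MulAction.Quotient.smul_coe, he, ← Module.End.mul_apply,
      ← map_mul ρ]
    simp
  have hker : LinearMap.det ((1 : Module.End R (Y → R)) - act (redRep red r₀) x) = 0 := by
    by_contra hne
    have hinj := (LinearMap.isUnit_iff_ker_eq_bot _).1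
      ((LinearMap.isUnit_iff_isUnit_det _).2 (Ne.isUnit hne))
    have h3 : e v ∈ LinearMap.ker ((1 : Module.End R (Y → R)) - act (redRep red r₀) x) := by
      rw [LinearMap.mem_ker, LinearMap.sub_apply, hact, Module.End.one_apply, sub_self]
    rw [hinj, Submodule.mem_bot] at h3
    have h4 := congrFun h3 ((1 : GL (Fin n) k) : Y)
    rw [he, inv_one, map_one] at h4
    exact hv h4
  rw [hker] at h2
  exact zero_ne_one h2

end Distinguished

lemma RepIso.trace_eq {R G V W : Type} [Field R] [Group G] [AddCommGroup V] [Module R V]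
    [AddCommGroup W] [Module R W] {ρ : Representation R G V} {τ : Representation R G W}
    (h : RepIso ρ τ) (g : G) : LinearMap.trace R V (ρ g) = LinearMap.trace R W (τ g) := by
  obtain ⟨e, he⟩ := h
  rw [← LinearMap.trace_conj' (ρ g) e]
  congr 1
  ext w
  rw [LinearEquiv.conj_apply_apply, he, e.apply_symm_apply]

lemma trace_dual {R G V : Type} [Field R] [Group G] [AddCommGroup V] [Module R V]
    [FiniteDimensional R V] (ρ : Representation R G V) (g : G) :
    LinearMap.trace R _ (ρ.dual g) = LinearMap.trace R V (ρ g⁻¹) := by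
  rw [Representation.dual_apply]
  exact LinearMap.trace_transpose' (ρ g⁻¹)

lemma trace_mul_eq_of_unipotent {R V : Type} [Field R] {p : ℕ} [Fact p.Prime] [CharP R p]
    [AddCommGroup V] [Module R V] [FiniteDimensional R V] {S U : Module.End R V} (h : Commute S U)
    {a : ℕ} (hU : U ^ p ^ a = 1) : LinearMap.trace R V (S * U) = LinearMap.trace R V S := by
  by_cases hV : Subsingleton V
  · rw [Subsingleton.elim (S * U) S]
  rw [not_subsingleton_iff_nontrivial] at hV
  have : CharP (Module.End R V) p := charP_of_injective_algebraMap
    (FaithfulSMul.algebraMap_injective R (Module.End R V)) p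
  have h1 : (U - 1) ^ p ^ a = 0 := by
    rw [sub_pow_char_pow_of_commute _ _ (Commute.one_right U), hU, one_pow, sub_self]
  have h2 : IsNilpotent (S * (U - 1)) :=
    ⟨p ^ a, by rw [(h.sub_right (Commute.one_right S)).mul_pow, h1, mul_zero]⟩
  have h3 := (LinearMap.isNilpotent_trace_of_isNilpotent h2).eq_zero
  rwa [mul_sub, mul_one, map_sub, sub_eq_zero] at h3

section IrreducibleTraces

variable {F : Type} [Field F] [IsAlgClosed F] [CharZero F] {O : ValuationSubring F} {G : Type}
  [Group G] [Fintype G]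

/-- The function is the character of an irreducible representation. -/
def IsIrrTrace (t : G → O) : Prop :=
  ∃ (X : Type) (_ : AddCommGroup X) (_ : Module F X) (σ : Representation F G X),
    IsIrreducibleRep σ ∧ ∀ g, (t g : F) = LinearMap.trace F X (σ g)

lemma IsIrreducibleRep.exists_isIrrTrace {X : Type} [AddCommGroup X] [Module F X]
    {σ : Representation F G X} (h : IsIrreducibleRep σ) :
    ∃ t : G → O, IsIrrTrace t ∧ ∀ g, (t g : F) = LinearMap.trace F X (σ g) := by
  have := h.nontrivial
  obtain ⟨w, hw⟩ := exists_ne (0 : X)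
  obtain ⟨d, b, r, hr, -⟩ := exists_isIntegralForm O σ w (h.span_range_eq_top hw)
  have ht : ∀ g, ((r g).trace : F) = LinearMap.trace F X (σ g) := fun g => (hr.trace_eq g).symm
  exact ⟨fun g => (r g).trace, ⟨X, _, _, σ, h, ht⟩, ht⟩

lemma ValuationSubring.mem_of_pow_eq_one (O : ValuationSubring F) {ζ : F} {m : ℕ} (hm : m ≠ 0)
    (h : ζ ^ m = 1) : ζ ∈ O := by
  rw [← ValuationSubring.valuation_le_one_iff]
  have := congrArg O.valuation h
  rw [map_pow, map_one] at this
  exact ((pow_eq_one_iff_of_nonneg zero_le hm).1 this).le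

/-- The trace along a coset of a cyclic direct factor is an integral combination of irreducible
characters. -/
lemma trace_prod_mem_span {s : G} {X : Type} [AddCommGroup X] [Module F X] [FiniteDimensional F X]
    (Θ : Representation F (G × Subgroup.zpowers s) X) :
    ∃ f ∈ Submodule.span O {t : G → O | IsIrrTrace t},
      ∀ g, (f g : F) = LinearMap.trace F X (Θ (g, ⟨s, Subgroup.mem_zpowers s⟩)) := by
  refine rep_induction (fun X _ _ Θ => ∃ f ∈ Submodule.span O {t : G → O | IsIrrTrace t},
      ∀ g, (f g : F) = LinearMap.trace F X (Θ (g, ⟨s, Subgroup.mem_zpowers s⟩))) ?_ ?_ ?_ X Θ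
  · intro X _ _ σ hX
    refine ⟨0, Submodule.zero_mem _, fun g => ?_⟩
    rw [Subsingleton.elim (σ _) 0, map_zero]; rfl
  · intro X _ _ σ hσ
    have := hσ.nontrivial
    set z : Subgroup.zpowers s := ⟨s, Subgroup.mem_zpowers s⟩
    have hz : ∀ y : Subgroup.zpowers s, ∃ m : ℕ, y = z ^ m := fun y => by
      obtain ⟨m, hm⟩ := mem_powers_iff_mem_zpowers.2 y.2
      exact ⟨m, Subtype.ext hm.symm⟩
    obtain ⟨ζ, hζ⟩ := hσ.exists_eq_smul_one (σ (1, z)) fun g => by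
      rw [← map_mul σ, ← map_mul σ]
      congr 1
      obtain ⟨m, hm⟩ := hz g.2
      exact Prod.ext (by simp) (by simp [hm, ← pow_succ, ← pow_succ'])
    have hζ' : ∀ m : ℕ, σ (1, z ^ m) = ζ ^ m • 1 := fun m => by
      rw [show ((1 : G), z ^ m) = (1, z) ^ m by simp, map_pow, hζ, smul_pow, one_pow]
    have hO : ζ ∈ O := by
      refine O.mem_of_pow_eq_one (orderOf_pos z).ne' ?_
      have h1 := hζ' (orderOf z)
      rw [pow_orderOf_eq_one, show ((1 : G), (1 : Subgroup.zpowers s)) = 1 from rfl, map_one] at h1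
      obtain ⟨v, hv⟩ := exists_ne (0 : X)
      have h2 := LinearMap.congr_fun h1 v
      simp only [Module.End.one_apply, LinearMap.smul_apply] at h2
      rw [← sub_eq_zero, ← one_smul F v, smul_smul, ← sub_smul, smul_eq_zero] at h2
      have h3 := h2.resolve_right hv
      rw [mul_one, sub_eq_zero] at h3
      exact h3.symm
    have hirr : IsIrreducibleRep (MonoidHom.comp σ (MonoidHom.inl G (Subgroup.zpowers s))) := by
      refine ⟨hσ.1, fun W hW => hσ.2 W fun g v hv => ?_⟩
      obtain ⟨a, y⟩ := g
      obtain ⟨m, rfl⟩ := hz y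
      rw [show (a, z ^ m) = (a, 1) * (1, z ^ m) by simp, map_mul, hζ', Module.End.mul_apply,
        LinearMap.smul_apply, Module.End.one_apply, map_smul]
      exact W.smul_mem _ (hW a v hv)
    obtain ⟨t, ht, ht'⟩ := hirr.exists_isIrrTrace (O := O)
    refine ⟨(⟨ζ, hO⟩ : O) • t, Submodule.smul_mem _ _ (Submodule.subset_span ht), fun g => ?_⟩
    rw [show (g, z) = (g, 1) * (1, z) by simp, map_mul, hζ, mul_smul_comm, mul_one, map_smul]
    change ζ * (t g : F) = _
    rw [ht']
    rfl
  · intro X _ _ _ σ W₁ W₂ hW₁ hW₂ hc h₁ h₂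
    obtain ⟨f₁, a₁, b₁⟩ := h₁
    obtain ⟨f₂, a₂, b₂⟩ := h₂
    refine ⟨f₁ + f₂, Submodule.add_mem _ a₁ a₂, fun g => ?_⟩
    rw [trace_eq_add_of_isCompl hc (f₁ := restrictRep σ W₁ hW₁ _) (f₂ := restrictRep σ W₂ hW₂ _)
      (fun w => restrictRep_coe σ W₁ hW₁ _ w) (fun w => restrictRep_coe σ W₂ hW₂ _ w),
      ← b₁, ← b₂]
    rfl

end IrreducibleTraces

section RegularExponent

variable {G : Type} [Group G] [Fintype G]

/-- The exponent `N` is such that `g ^ N` is the `p`-regular part of `g` up to a `p`-element. -/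
structure IsRegularExponent (G : Type) [Group G] (p N : ℕ) : Prop where
  pow_pow (g : G) : (g ^ N) ^ N = g ^ N
  exists_eq_mul (g : G) : ∃ v : G, g ^ N = g * v ∧ Commute g v ∧ ∃ a, v ^ p ^ a = 1
  pow_eq_one (x : G) (j : ℕ) (hx : x ^ p ^ j = 1) : x ^ N = 1

lemma exists_isRegularExponent (G : Type) [Group G] [Fintype G] (p : ℕ) [Fact p.Prime] :
    ∃ N, IsRegularExponent G p N := by
  obtain ⟨a, m, hm, hG⟩ := Nat.exists_eq_pow_mul_and_not_dvd (Fintype.card_ne_zero (α := G)) p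
    (Fact.out : p.Prime).ne_one
  have hco : (p ^ a).Coprime m :=
    Nat.Coprime.pow_left a (((Fact.out : p.Prime).coprime_iff_not_dvd).2 hm)
  have hm0 : 0 < m := Nat.pos_of_ne_zero fun h => hm (h ▸ dvd_zero p)
  obtain ⟨x, hx0, hx1⟩ := Nat.chineseRemainder hco 0 1
  obtain ⟨d, rfl⟩ := (Nat.modEq_zero_iff_dvd).1 hx0
  have hcard : ∀ g : G, g ^ (p ^ a * m) = 1 := fun g => by rw [← hG, pow_card_eq_one]
  obtain ⟨c, hc⟩ : ∃ c, p ^ a * (d + m) = m * c + 1 := by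
    have h1 : 1 ≡ p ^ a * (d + m) [MOD m] := by
      have : p ^ a * (d + m) = p ^ a * d + m * p ^ a := by ring
      rw [this]
      exact (hx1.symm.trans (by simp [Nat.ModEq]))
    have h2 : 0 < p ^ a * (d + m) :=
      Nat.mul_pos (pow_pos (Fact.out : p.Prime).pos a) (by omega)
    obtain ⟨c, hc⟩ := (Nat.modEq_iff_dvd' h2).1 h1
    exact ⟨c, by omega⟩
  refine ⟨p ^ a * (d + m), fun g => ?_, fun g => ⟨g ^ (m * c), ?_, Commute.self_pow g _, a, ?_⟩,
    fun x j hx => ?_⟩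
  · nth_rewrite 2 [hc]
    rw [pow_succ, ← pow_mul, show p ^ a * (d + m) * (m * c) = p ^ a * m * ((d + m) * c) by ring,
      pow_mul, hcard, one_pow, one_mul]
  · rw [hc, pow_succ']
  · rw [← pow_mul, show m * c * p ^ a = p ^ a * m * c by ring, pow_mul, hcard, one_pow]
  · have h1 : (orderOf x).Coprime m := Nat.Coprime.coprime_dvd_left (orderOf_dvd_of_pow_eq_one hx)
      (Nat.Coprime.pow_left j (((Fact.out : p.Prime).coprime_iff_not_dvd).2 hm))
    rw [pow_mul, orderOf_dvd_iff_pow_eq_one.1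
      (h1.dvd_of_dvd_mul_right (orderOf_dvd_of_pow_eq_one (hcard x))), one_pow]

end RegularExponent

section Span

variable {G : Type} [Group G] [Fintype G] {p : ℕ} [Fact p.Prime]

/-- The subgroup of pairs `(x z, z)` with `x` in a subgroup centralizing `s`. -/
def twistedSubgroup (s : G) (P : Subgroup G) (hP : ∀ x ∈ P, Commute s x) :
    Subgroup (G × Subgroup.zpowers s) where
  carrier := {d | d.1 * (d.2 : G)⁻¹ ∈ P}
  one_mem' := by simp [P.one_mem]
  mul_mem' := by
    rintro ⟨a, z⟩ ⟨b, w⟩ ha hb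
    obtain ⟨i, hi⟩ := z.2
    have := (hP _ hb).zpow_left i
    dsimp only at hi ha hb this
    rw [hi] at this
    have h : a * b * ((z : G) * w)⁻¹ = a * (z : G)⁻¹ * (b * (w : G)⁻¹) := by
      rw [mul_assoc a (z : G)⁻¹, (Commute.inv_left this).eq]
      group
    change a * b * ((z : G) * w)⁻¹ ∈ P
    rw [h]
    exact P.mul_mem ha hb
  inv_mem' := by
    rintro ⟨a, z⟩ ha
    obtain ⟨i, hi⟩ := z.2
    have := (hP _ ha).zpow_left i
    dsimp only at hi ha this
    rw [hi] at this
    change a⁻¹ * ((z : G)⁻¹)⁻¹ ∈ P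
    have h : a⁻¹ * ((z : G)⁻¹)⁻¹ = (a * (z : G)⁻¹)⁻¹ := by
      rw [← mul_left_inj (z : G)⁻¹, ← (Commute.inv_left this).inv_right.eq]
      group
    rw [h]
    exact P.inv_mem ha

variable {F : Type} [Field F] [IsAlgClosed F] [CharZero F] {O : ValuationSubring F}
  {R : Type} [Field R] [CharP R p]

lemma exists_span_of_regular (red : O →+* R) {N : ℕ} (hN : IsRegularExponent G p N) {s : G}
    (hs : s ^ N = s) : ∃ h : G → R,
      h ∈ Submodule.span R {h : G → R | ∃ t : G → O, IsIrrTrace t ∧ h = fun g => red (t g)} ∧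
      (∀ g x, h (x * g * x⁻¹) = h g) ∧ (∀ g, h (g ^ N) = h g) ∧ h s ≠ 0 ∧
      ∀ g, g ^ N = g → h g ≠ 0 → ∃ x, x * s * x⁻¹ = g := by
  classical
  let C := Subgroup.centralizer ({s} : Set G)
  obtain ⟨P⟩ : Nonempty (Sylow p C) := inferInstance
  let P' : Subgroup G := (P : Subgroup C).map C.subtype
  have hP' : ∀ x ∈ P', Commute s x := by
    rintro _ ⟨c, -, rfl⟩
    exact (Subgroup.mem_centralizer_singleton_iff.1 c.2).symm
  have hPN : ∀ x ∈ P', x ^ N = 1 := by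
    rintro _ ⟨c, hc, rfl⟩
    obtain ⟨j, hj⟩ := P.isPGroup' ⟨c, hc⟩
    exact hN.pow_eq_one _ j (congrArg (fun y : P => ((y : C) : G)) hj)
  let S := twistedSubgroup s P' hP'
  let z : Subgroup.zpowers s := ⟨s, Subgroup.mem_zpowers s⟩
  let Y := (G × Subgroup.zpowers s) ⧸ S
  have : Fintype Y := Fintype.ofFinite Y
  let r := permMat O (G × Subgroup.zpowers s) Y
  let h : G → R := fun g => LinearMap.trace R _ (redRep red r (g, z))
  have hcard : ∀ g, h g = ((Finset.univ.filter fun y : Y => (g, z) • y = y).card : R) := fun g => by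
    simp only [h, trace_redRep, Matrix.trace, Matrix.diag_apply, r, permMat_apply, map_sum,
      apply_ite red, map_one, map_zero]
    exact Finset.sum_boole _ _
  have hfix : ∀ g (a : G) (w : Subgroup.zpowers s), (g, z) • (QuotientGroup.mk (a, w) : Y) =
      QuotientGroup.mk (a, w) ↔ a⁻¹ * g * a * s⁻¹ ∈ P' := fun g a w => by
    obtain ⟨i, hi⟩ := w.2
    dsimp only at hi
    rw [MulAction.Quotient.smul_coe, eq_comm, QuotientGroup.eq]
    change a⁻¹ * (g * a) * ((w : G)⁻¹ * (s * w))⁻¹ ∈ P' ↔ _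
    rw [← hi, ((Commute.refl s).zpow_right i).eq, inv_mul_cancel_left, ← mul_assoc a⁻¹]
  have hreg : ∀ g a, g ^ N = g → a⁻¹ * g * a * s⁻¹ ∈ P' → a * s * a⁻¹ = g := fun g a hg ha => by
    have h1 : (a⁻¹ * g * a * s⁻¹ * s) ^ N = s := by
      rw [(hP' _ ha).symm.mul_pow, hPN _ ha, hs, one_mul]
    have h2 : (a⁻¹ * g * a) ^ N = a⁻¹ * g * a := by
      have := conj_pow (a := a⁻¹) (b := g) (i := N)
      rwa [inv_inv, hg] at this
    rw [inv_mul_cancel_right, h2] at h1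
    rw [← h1]
    group
  refine ⟨h, ?_, fun g x => ?_, fun g => ?_, ?_, fun g hg hne => ?_⟩
  · obtain ⟨f, hf, hft⟩ := trace_prod_mem_span (O := O) (redRep O.subtype r)
    have : h = fun g => red (f g) := funext fun g => by
      have := hft g
      rw [trace_redRep] at this
      rw [show f g = (r (g, z)).trace from Subtype.ext this, ← trace_redRep]
    rw [this]
    clear this hft
    induction hf using Submodule.span_induction with
    | mem t ht => exact Submodule.subset_span ⟨t, ht, rfl⟩
    | zero => convert Submodule.zero_mem _; exact map_zero red
    | add a b _ _ ha hb =>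
      convert Submodule.add_mem _ ha hb using 1
      exact funext fun g => map_add red _ _
    | smul c a _ ha =>
      convert Submodule.smul_mem _ (red c) ha using 1
      exact funext fun g => map_mul red _ _
  · have : (x * g * x⁻¹, z) = (x, 1) * (g, z) * (x, 1)⁻¹ := by simp
    simp only [h]
    rw [this, map_mul (redRep red r), map_mul (redRep red r), LinearMap.trace_mul_comm, ← mul_assoc, ← map_mul,
      inv_mul_cancel, map_one, one_mul]
  · obtain ⟨v, hv, hgv, a, ha⟩ := hN.exists_eq_mul g
    have h1 : (g ^ N, z) = (g, z) * (v, 1) := by simp [hv]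
    simp only [h]
    rw [h1, map_mul]
    refine trace_mul_eq_of_unipotent (p := p) (a := a) ?_ ?_
    · refine Commute.map (?_ : Commute (g, z) (v, 1)) _
      exact Prod.ext hgv.eq (by simp)
    · rw [← map_pow]
      convert map_one (redRep red r)
      exact Prod.ext ha (one_pow _)
  · rw [hcard, Ne, CharP.cast_eq_zero_iff R p]
    have hC : ∀ a, a⁻¹ * s * a * s⁻¹ ∈ P' ↔ a ∈ C := fun a => by
      refine ⟨fun ha => Subgroup.mem_centralizer_singleton_iff.2
        (mul_inv_eq_iff_eq_mul.1 (hreg s a hs ha)), fun ha => ?_⟩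
      rw [mul_assoc a⁻¹, ← Subgroup.mem_centralizer_singleton_iff.1 ha]
      simp [P'.one_mem]
    have hjj : ∀ c c' : C, (QuotientGroup.mk ((c : G), 1) : Y) = QuotientGroup.mk ((c' : G), 1) ↔
        c⁻¹ * c' ∈ (P : Subgroup C) := fun c c' => by
      rw [QuotientGroup.eq, ← Subgroup.mem_map_iff_mem C.subtype_injective]
      change (c : G)⁻¹ * c' * ((1 : G)⁻¹ * 1)⁻¹ ∈ P' ↔ (c : G)⁻¹ * c' ∈ P'
      simp
    let j : C ⧸ (P : Subgroup C) → Y := Quotient.lift (fun c : C => QuotientGroup.mk ((c : G), 1))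
      fun c c' hcc => (hjj c c').2 (QuotientGroup.leftRel_apply.1 hcc)
    have hj : Function.Injective j := fun x y => by
      obtain ⟨c, rfl⟩ := QuotientGroup.mk_surjective x
      obtain ⟨c', rfl⟩ := QuotientGroup.mk_surjective y
      exact fun h => QuotientGroup.eq.2 ((hjj c c').1 h)
    have : (Finset.univ.filter fun y : Y => (s, z) • y = y) = Finset.univ.image j := by
      ext y
      simp only [Finset.mem_filter, Finset.mem_univ, true_and, Finset.mem_image]
      refine ⟨fun hy => ?_, ?_⟩
      · obtain ⟨⟨a, w⟩, rfl⟩ := QuotientGroup.mk_surjective y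
        have ha := (hC a).1 ((hfix s a w).1 hy)
        have hw : (w : G) ∈ C := by
          obtain ⟨i, hi⟩ := w.2
          dsimp only at hi
          rw [← hi]
          exact C.zpow_mem (Subgroup.mem_centralizer_singleton_iff.2 rfl) i
        refine ⟨QuotientGroup.mk ⟨a * (w : G)⁻¹, C.mul_mem ha (C.inv_mem hw)⟩,
          QuotientGroup.eq.2 ?_⟩
        change (a * (w : G)⁻¹)⁻¹ * a * ((1 : G)⁻¹ * w)⁻¹ ∈ P'
        simp [P'.one_mem]
      · rintro ⟨x, rfl⟩
        obtain ⟨c, rfl⟩ := QuotientGroup.mk_surjective x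
        exact (hfix s c 1).2 ((hC c).2 c.2)
    rw [this, Finset.card_image_of_injective _ hj, Finset.card_univ, ← Nat.card_eq_fintype_card]
    exact P.not_dvd_index
  · rw [hcard] at hne
    obtain ⟨y, hy⟩ := Finset.card_ne_zero.1 fun h0 => hne (by rw [h0, Nat.cast_zero])
    obtain ⟨⟨a, w⟩, rfl⟩ := QuotientGroup.mk_surjective y
    exact ⟨a, hreg g a hg ((hfix g a w).1 (Finset.mem_filter.1 hy).2)⟩

/-- Reductions of irreducible characters span all class functions that are constant along
`p`-elements. -/
lemma mem_span_isIrrTrace (red : O →+* R) {N : ℕ} (hN : IsRegularExponent G p N) {f : G → R}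
    (hf : ∀ g x, f (x * g * x⁻¹) = f g) (hfN : ∀ g, f (g ^ N) = f g) :
    f ∈ Submodule.span R {h : G → R | ∃ t : G → O, IsIrrTrace t ∧ h = fun g => red (t g)} := by
  classical
  suffices H : ∀ m : ℕ, ∀ f : G → R, (∀ g x, f (x * g * x⁻¹) = f g) → (∀ g, f (g ^ N) = f g) →
      (Finset.univ.filter fun g => f g ≠ 0).card = m →
      f ∈ Submodule.span R {h : G → R | ∃ t : G → O, IsIrrTrace t ∧ h = fun g => red (t g)} from
    H _ f hf hfN rfl
  intro m
  induction m using Nat.strong_induction_on with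
  | _ m ih =>
    intro f hf hfN hm
    by_cases h0 : ∀ g, f g = 0
    · rw [show f = 0 from funext h0]
      exact Submodule.zero_mem _
    push Not at h0
    obtain ⟨g₀, hg₀⟩ := h0
    rw [← hfN] at hg₀
    set s := g₀ ^ N
    obtain ⟨h, h1, h2, h3, h4, h5⟩ := exists_span_of_regular (O := O) red hN (hN.pow_pow g₀ : s ^ N = s)
    set f' : G → R := f - (f s / h s) • h
    have hs : f' s = 0 := by
      change f s - f s / h s * h s = 0
      rw [div_mul_cancel₀ _ h4, sub_self]
    have hz : ∀ g, f g = 0 → f' g = 0 := fun g hg => by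
      change f g - f s / h s * h g = 0
      by_cases hh : h g = 0
      · rw [hg, hh, mul_zero, sub_self]
      obtain ⟨x, hx⟩ := h5 _ (hN.pow_pow g) (by rwa [h3])
      exact absurd (by rw [← hf s x, hx, hfN, hg]) hg₀
    have hf' : f' ∈ Submodule.span R
        {h : G → R | ∃ t : G → O, IsIrrTrace t ∧ h = fun g => red (t g)} := by
      refine ih _ ?_ f' (fun g x => ?_) (fun g => ?_) rfl
      · rw [← hm]
        refine Finset.card_lt_card ⟨fun g hg => ?_, fun hsub => ?_⟩
        · simp only [Finset.mem_filter, Finset.mem_univ, true_and] at hg ⊢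
          exact fun h => hg (hz g h)
        · have := hsub (Finset.mem_filter.2 ⟨Finset.mem_univ s, hg₀⟩)
          exact (Finset.mem_filter.1 this).2 hs
      · change f _ - _ * h _ = f g - _ * h g
        rw [hf, h2]
      · change f _ - _ * h (g ^ N) = f g - _ * h g
        rw [hfN, h3 g]
    rw [show f = f' + (f s / h s) • h by simp [f']]
    exact Submodule.add_mem _ hf' (Submodule.smul_mem _ _ h1)

end Span

/-- The homomorphism from the group of order two attached to an involution. -/
def involutionHom {M : Type} [Monoid M] (t : M) (ht : t * t = 1) : ℤˣ →* M where
  toFun u := if u = 1 then 1 else t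
  map_one' := if_pos rfl
  map_mul' u v := by
    rcases Int.units_eq_one_or u with rfl | rfl <;> rcases Int.units_eq_one_or v with rfl | rfl <;>
      simp [ht]

lemma involutionHom_neg_one {M : Type} [Monoid M] (t : M) (ht : t * t = 1) :
    involutionHom t ht (-1) = t := by
  change (if (-1 : ℤˣ) = 1 then 1 else t) = t
  exact if_neg (by decide)

section InvolutionExtension

variable {G : Type} [Group G] (θ : MulAut G) (hθ : θ * θ = 1)

/-- The extension of a group by an involutive automorphism. -/
abbrev InvolutionExtension := G ⋊[involutionHom θ hθ] ℤˣ

noncomputable instance [Fintype G] : Fintype (InvolutionExtension θ hθ) :=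
  Fintype.ofEquiv _ SemidirectProduct.equivProd.symm

variable {θ hθ}

/-- The involution in the nontrivial coset. -/
abbrev invElt (θ : MulAut G) (hθ : θ * θ = 1) : InvolutionExtension θ hθ := SemidirectProduct.inr (-1)

lemma invElt_mul_inl (g : G) : invElt θ hθ * .inl g = .inl (θ g) * invElt θ hθ := by
  rw [← mul_inv_eq_iff_eq_mul, ← map_inv, ← SemidirectProduct.inl_aut, involutionHom_neg_one]

lemma invElt_mul_self : invElt θ hθ * invElt θ hθ = 1 := by
  rw [← map_mul]; exact map_one _

lemma InvolutionExtension.eq_or (x : InvolutionExtension θ hθ) :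
    ∃ g, x = .inl g ∨ x = .inl g * invElt θ hθ := by
  refine ⟨x.left, ?_⟩
  have hx := SemidirectProduct.inl_left_mul_inr_right x
  rcases Int.units_eq_one_or x.right with h | h <;> rw [h] at hx
  · exact Or.inl (by rw [← hx]; simp)
  · exact Or.inr hx.symm

variable {F X : Type} [Field F] [AddCommGroup X] [Module F X]

/-- Extending a representation by an intertwining involution. -/
def extendRep (ρ : Representation F G X) {T : Module.End F X} (hT : T * T = 1)
    (h : ∀ g, T * ρ g = ρ (θ g) * T) : Representation F (InvolutionExtension θ hθ) X where
  toFun x := ρ x.left * involutionHom T hT x.right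
  map_one' := by simp
  map_mul' x y := by
    have : involutionHom T hT x.right * ρ y.left =
        ρ (involutionHom θ hθ x.right y.left) * involutionHom T hT x.right := by
      rcases Int.units_eq_one_or x.right with hx | hx <;> rw [hx]
      · simp
      · rw [involutionHom_neg_one, involutionHom_neg_one, h]
    rw [SemidirectProduct.mul_left, SemidirectProduct.mul_right, map_mul ρ, map_mul, mul_assoc,
      ← mul_assoc (ρ (involutionHom θ hθ x.right y.left)), ← this]
    simp only [mul_assoc]

lemma extendRep_apply (ρ : Representation F G X) {T : Module.End F X} (hT : T * T = 1)
    (h : ∀ g, T * ρ g = ρ (θ g) * T) (g : G) :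
    extendRep (hθ := hθ) ρ hT h (.inl g * invElt θ hθ) = ρ g * T := by
  change ρ (SemidirectProduct.inl g * invElt θ hθ : InvolutionExtension θ hθ).left *
    involutionHom T hT (SemidirectProduct.inl g * invElt θ hθ : InvolutionExtension θ hθ).right = _
  simp [involutionHom_neg_one]

/-- The character of an irreducible representation of the extension whose restriction is reducible
vanishes on the nontrivial coset. -/
lemma IsIrreducibleRep.trace_inl_mul_invElt [FiniteDimensional F X]
    {σ : Representation F (InvolutionExtension θ hθ) X} (h : IsIrreducibleRep σ)
    (hr : ¬ IsIrreducibleRep (MonoidHom.comp σ SemidirectProduct.inl)) (g : G) :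
    LinearMap.trace F X (σ (.inl g * invElt θ hθ)) = 0 := by
  obtain ⟨W, hW, hW0, hW1⟩ : ∃ W : Submodule F X, (∀ (g : G), ∀ v ∈ W, σ (.inl g) v ∈ W) ∧
      W ≠ ⊥ ∧ W ≠ ⊤ := by
    by_contra! hc
    exact hr ⟨h.1, fun W hW => or_iff_not_imp_left.2 (hc W hW)⟩
  set t := σ (invElt θ hθ) with ht
  have htt : ∀ v, t (t v) = v := fun v => by
    rw [← Module.End.mul_apply, ht, ← map_mul, invElt_mul_self, map_one, Module.End.one_apply]
  have hti : ∀ g v, t (σ (.inl g) v) = σ (.inl (θ g)) (t v) := fun g v => by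
    simp only [ht, ← Module.End.mul_apply, ← map_mul, invElt_mul_inl]
  let W' := W.comap t
  have hW' : ∀ (g : G), ∀ v ∈ W', σ (.inl g) v ∈ W' := fun g v hv => by
    rw [Submodule.mem_comap, hti]
    exact hW _ _ hv
  have hstab : ∀ U : Submodule F X, (∀ (g : G), ∀ v ∈ U, σ (.inl g) v ∈ U) →
      (∀ v ∈ U, t v ∈ U) → U = ⊥ ∨ U = ⊤ := fun U h1 h2 => h.2 U fun x v hv => by
    obtain ⟨g, rfl | rfl⟩ := x.eq_or
    · exact h1 g v hv
    · rw [map_mul, Module.End.mul_apply]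
      exact h1 g _ (h2 v hv)
  have hcompl : IsCompl W W' := by
    constructor
    · rw [disjoint_iff]
      refine (hstab (W ⊓ W') (fun g v hv => ⟨hW g v hv.1, hW' g v hv.2⟩)
        fun v hv => ⟨hv.2, ?_⟩).resolve_right fun h1 => hW1 (eq_top_iff.2 (h1 ▸ inf_le_left))
      change t (t v) ∈ W
      rw [htt]
      exact hv.1
    · rw [codisjoint_iff]
      refine (hstab (W ⊔ W') (fun g v hv => ?_) fun v hv => ?_).resolve_left fun h1 =>
        hW0 (eq_bot_iff.2 (h1 ▸ le_sup_left))
      · obtain ⟨a, ha, b, hb, rfl⟩ := Submodule.mem_sup.1 hv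
        rw [map_add]
        exact Submodule.add_mem_sup (hW g a ha) (hW' g b hb)
      · obtain ⟨a, ha, b, hb, rfl⟩ := Submodule.mem_sup.1 hv
        rw [map_add, add_comm]
        exact Submodule.add_mem_sup hb (by rw [Submodule.mem_comap, htt]; exact ha)
  refine LinearMap.trace_eq_zero_of_mapsTo_ne (N := fun b : Bool => cond b W W')
    ((DirectSum.isInternal_submodule_iff_isCompl _ (i := true) (j := false) (by simp)
      (by ext b; cases b <;> simp)).2 hcompl) Bool.not Bool.not_ne_self ?_
  rintro (_ | _) v hv
  · rw [map_mul, Module.End.mul_apply]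
    exact hW _ _ hv
  · rw [map_mul, Module.End.mul_apply]
    exact hW' _ _ (by rw [Submodule.mem_comap, htt]; exact hv)

end InvolutionExtension

section IntegralForms

lemma IsIrreducibleRep.repIso_dual_of_trace {F G X : Type} [Field F] [IsAlgClosed F] [Group G]
    [Fintype G] [AddCommGroup X] [Module F X] {π : Representation F G X} (h : IsIrreducibleRep π)
    (ht : ∀ g, LinearMap.trace F X (π g⁻¹) = LinearMap.trace F X (π g)) : RepIso π π.dual := by
  have := h.finiteDimensional
  have := h.nontrivial
  refine (repIso_of_trace_eq h h.dual one_ne_zero 1 fun g => ?_).symm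
  rw [mul_one, mul_one, trace_dual, ht]

lemma RepIso.invariantForms_ne_bot {F G X Y : Type} [Field F] [Group G] [AddCommGroup X]
    [Module F X] [AddCommGroup Y] [Module F Y] {π : Representation F G X}
    {τ : Representation F G Y} (h : RepIso π τ) {H : Set G} (hτ : invariantForms τ H ≠ ⊥) :
    invariantForms π H ≠ ⊥ := by
  obtain ⟨e, he⟩ := h
  obtain ⟨l, hl, hl0⟩ := Submodule.exists_mem_ne_zero_of_ne_bot hτ
  refine fun h0 => hl0 (LinearMap.ext fun w => ?_)
  have hmem : l ∘ₗ e.toLinearMap ∈ invariantForms π H := fun g hg v => by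
    simpa [he] using hl g hg (e v)
  rw [h0, Submodule.mem_bot] at hmem
  simpa using LinearMap.congr_fun hmem (e.symm w)

variable {F : Type} [Field F] {O : ValuationSubring F} {R : Type} [Field R]

/-- Nonzero invariant forms can be reduced. -/
lemma IsIntegralForm.invariantForms_redRep_ne_bot {G J X : Type} [Group G] [Fintype J]
    [DecidableEq J] [AddCommGroup X] [Module F X] {π : Representation F G X}
    {b : Module.Basis J F X} {r : G →* Matrix J J O} (h : IsIntegralForm π b r) (red : O →+* R)
    {H : Set G} (hH : invariantForms π H ≠ ⊥) : invariantForms (redRep red r) H ≠ ⊥ := by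
  obtain ⟨l, hl, hl0⟩ := Submodule.exists_mem_ne_zero_of_ne_bot hH
  obtain ⟨j₀, hj₀⟩ : ∃ j, l (b j) ≠ 0 := by
    by_contra! h0
    exact hl0 (b.ext h0)
  have : Nonempty J := ⟨j₀⟩
  obtain ⟨m, hm⟩ := Finite.exists_max fun j => O.valuation (l (b j))
  have hm0 : l (b m) ≠ 0 := fun h0 => hj₀ (by
    have := hm j₀
    rw [h0, map_zero, le_zero_iff, map_eq_zero] at this
    exact this)
  have hc : ∀ j, l (b j) / l (b m) ∈ O := fun j => by
    rw [← ValuationSubring.valuation_le_one_iff, map_div₀]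
    exact div_le_one_of_le₀ (hm j) zero_le
  let c : J → O := fun j => ⟨_, hc j⟩
  have hcm : c m = 1 := Subtype.ext (div_self hm0)
  have hinv : ∀ g ∈ H, ∀ j, ∑ i, c i * r g i j = c j := fun g hg j => by
    apply Subtype.ext
    have h1 := hl g hg (b j)
    rw [← b.sum_repr (π g (b j)), map_sum] at h1
    rw [AddSubmonoidClass.coe_finsetSum]
    change _ = l (b j) / l (b m)
    rw [← h1, Finset.sum_div]
    refine Finset.sum_congr rfl fun i _ => ?_
    have h2 := congrFun (congrFun (h g) i) j
    rw [LinearMap.toMatrix_apply] at h2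
    rw [h2, map_smul, smul_eq_mul]
    change l (b i) / l (b m) * (r g i j : F) = (r g i j : F) * _ / _
    ring
  let l' : (J → R) →ₗ[R] R := ∑ j, red (c j) • LinearMap.proj j
  have hl' : ∀ v, l' v = ∑ j, red (c j) * v j := fun v => by simp [l']
  have hmem : l' ∈ invariantForms (redRep red r) H := fun g hg v => by
    rw [hl', hl', redRep_apply]
    simp only [Matrix.toLin'_apply, Matrix.mulVec, dotProduct, Finset.mul_sum, Matrix.map_apply]
    rw [Finset.sum_comm]
    refine Finset.sum_congr rfl fun j _ => ?_
    rw [← hinv g hg j, map_sum, Finset.sum_mul]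
    exact Finset.sum_congr rfl fun i _ => by rw [map_mul, mul_assoc]
  intro h0
  rw [h0, Submodule.mem_bot] at hmem
  have := LinearMap.congr_fun hmem (Pi.single m 1)
  rw [hl', Finset.sum_eq_single m (fun j _ hj => by simp [hj]) (by simp), hcm] at this
  simp at this

variable {k : Type} [Field k] {n : ℕ}

/-- The automorphism of the general linear group given by the inverse of the transpose along the
antidiagonal. -/
def sigInv (k : Type) [Field k] (n : ℕ) : MulAut (GL (Fin n) k) where
  toFun g := (sig g)⁻¹
  invFun g := (sig g)⁻¹
  left_inv g := by simp [sig_inv, sig_sig]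
  right_inv g := by simp [sig_inv, sig_sig]
  map_mul' g h := by rw [sig_mul, _root_.mul_inv_rev]

lemma sigInv_sigInv (g : GL (Fin n) k) : sigInv k n (sigInv k n g) = g := (sigInv k n).left_inv g

lemma sigInv_mul_self : sigInv k n * sigInv k n = 1 := MulEquiv.ext sigInv_sigInv

lemma sigInv_mem_uniRad {j : ℕ} (hj : j ≤ n) {u : GL (Fin n) k} (hu : u ∈ uniRad k n (n - j)) :
    sigInv k n u ∈ uniRad k n j := by
  refine (uniRad k n j).inv_mem fun a b hab => ?_
  rw [sig_apply, hu _ _ (by rw [Fin.val_rev, Fin.val_rev]; omega)]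
  simp [Matrix.one_apply, eq_comm]

variable [Fintype k] [IsAlgClosed R]

lemma exists_involution_of_repIso_dual (p : ℕ) [Fact p.Prime] [CharP k p] (hR : (p : R) ≠ 0)
    (hn : 1 ≤ n) {V : Type} [AddCommGroup V] [Module R V] {ρ : Representation R (GL (Fin n) k) V}
    (h : IsIrreducibleRep ρ) (hcusp : IsCuspidal ρ) (hd : RepIso ρ ρ.dual) :
    ∃ T : Module.End R V, T * T = 1 ∧ ∀ g, T * ρ g = ρ (sigInv k n g) * T := by
  have := h.nontrivial
  obtain ⟨ψ, hψ⟩ := exists_addChar_ne_one (card_field_ne_zero (k := k) p hR)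
  obtain ⟨e₁, h₁⟩ := hd
  obtain ⟨e₂, h₂⟩ := h.repIso_sigDual hψ p hR (h.whSpace_ne_bot hcusp p hR hn hψ)
  let T : Module.End R V := (e₁.trans e₂.symm).toLinearMap
  have hT : ∀ g, T * ρ g = ρ (sigInv k n g) * T := fun g => by
    ext v
    apply e₂.injective
    change e₂ (e₂.symm (e₁ (ρ g v))) = e₂ (ρ (sig g)⁻¹ (e₂.symm (e₁ v)))
    rw [h₂, e₂.apply_symm_apply, e₂.apply_symm_apply, h₁]
    ext w
    rw [sigDual_apply, sig_inv, sig_sig]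
    rfl
  obtain ⟨c, hc⟩ := h.exists_eq_smul_one (T * T) fun g => by
    rw [mul_assoc T T, hT, ← mul_assoc T, hT, sigInv_sigInv, mul_assoc]
  obtain ⟨s, hs⟩ := IsAlgClosed.exists_eq_mul_self c
  have hs0 : s ≠ 0 := by
    rintro rfl
    obtain ⟨v, hv⟩ := exists_ne (0 : V)
    have := LinearMap.congr_fun hc v
    rw [hs, mul_zero, zero_smul] at this
    exact hv ((e₁.trans e₂.symm).map_eq_zero_iff.1 ((e₁.trans e₂.symm).map_eq_zero_iff.1 this))
  refine ⟨s⁻¹ • T, ?_, fun g => by rw [smul_mul_assoc, hT, mul_smul_comm]⟩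
  rw [smul_mul_smul_comm, hc, hs, smul_smul, ← _root_.mul_inv_rev, inv_mul_cancel₀ (mul_ne_zero hs0 hs0),
    one_smul]

end IntegralForms

section SelfdualLift

variable {k : Type} [Field k] [Fintype k] {n : ℕ} {R : Type} [Field R] [IsAlgClosed R] {F : Type}
  [Field F] [IsAlgClosed F] [CharZero F] {O : ValuationSubring F}

/-- An irreducible representation that is isomorphic to its twist by `sigInv` has a cuspidal lift
with the same property. -/
lemma exists_sigInv_lift (p : ℕ) [Fact p.Prime] [CharP k p] (hR : (p : R) ≠ 0) (hn : 1 ≤ n)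
    (ℓ : ℕ) [Fact ℓ.Prime] [CharP R ℓ] (red : O →+* R) {V : Type} [AddCommGroup V] [Module R V]
    {ρ : Representation R (GL (Fin n) k) V} (hirr : IsIrreducibleRep ρ)
    (hc : ActsFully ρ (cuspIdeal k n R)) {T : Module.End R V} (hT : T * T = 1)
    (hTρ : ∀ g, T * ρ g = ρ (sigInv k n g) * T) :
    ∃ (X : Type) (_ : AddCommGroup X) (_ : Module F X) (π : Representation F (GL (Fin n) k) X)
      (d : ℕ) (b : Module.Basis (Fin d) F X) (r : GL (Fin n) k →* Matrix (Fin d) (Fin d) O),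
      IsIrreducibleRep π ∧ IsCuspidal π ∧
        (∀ g, LinearMap.trace F X (π (sigInv k n g)) = LinearMap.trace F X (π g)) ∧
        IsIntegralForm π b r ∧ RepIso (redRep red r) ρ := by
  classical
  by_contra hno
  have := hirr.nontrivial
  have := hirr.finiteDimensional
  let E := InvolutionExtension (sigInv k n) sigInv_mul_self
  let τ : E := invElt (sigInv k n) sigInv_mul_self
  let ρE : Representation R E V := extendRep ρ hT hTρ
  obtain ⟨N, hN⟩ := exists_isRegularExponent E ℓ
  have hspan := mem_span_isIrrTrace (F := F) (O := O) red hN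
    (f := fun x => LinearMap.trace R V (ρE x)) (fun g x => by
      rw [map_mul ρE, map_mul ρE, LinearMap.trace_mul_comm, ← mul_assoc, ← map_mul ρE,
        inv_mul_cancel, map_one, one_mul]) fun g => by
      obtain ⟨v, hv, hgv, a, ha⟩ := hN.exists_eq_mul g
      rw [hv, map_mul ρE]
      exact trace_mul_eq_of_unipotent (p := ℓ) (a := a) (hgv.map ρE) (by rw [← map_pow, ha, map_one])
  have key : ∀ h ∈ Submodule.span R
      {h : E → R | ∃ t : E → O, IsIrrTrace t ∧ h = fun g => red (t g)},
      ∃ J, IsTwoSided J ∧ ActsFully ρ J ∧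
        ∀ x ∈ J, ∑ g : GL (Fin n) k, x g * h (.inl g * τ) = 0 := by
    intro h hh
    induction hh using Submodule.span_induction with
    | mem h hmem =>
      obtain ⟨t, ⟨X, _, _, σ, hσ, ht⟩, rfl⟩ := hmem
      have := hσ.finiteDimensional
      by_cases hr : IsIrreducibleRep (MonoidHom.comp σ SemidirectProduct.inl)
      · obtain ⟨d, b, r, hbr, hJ⟩ := exists_isIntegralForm_dichotomy p hR hn red hirr hc
          (SemidirectProduct.inl : _ →* E) (fun x j h0 hj => by
            obtain ⟨g, rfl | rfl⟩ := InvolutionExtension.eq_or x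
            · exact ⟨j, g, h0, hj, fun u hu => ⟨u, hu, by simp⟩⟩
            · refine ⟨n - j, g, by omega, by omega, fun u hu =>
                ⟨_, sigInv_mem_uniRad hj.le hu, ?_⟩⟩
              rw [mul_assoc (SemidirectProduct.inl g), invElt_mul_inl, sigInv_sigInv]
              simp [← mul_assoc]) hσ (fun _ => hr)
        rcases hJ with ⟨J, h1, h2, h3⟩ | ⟨h1, h2⟩
        · refine ⟨J, h1, h2, fun x hx => ?_⟩
          have h4 : ∀ y, red (t y) = LinearMap.trace R _ (redRep red r y) := fun y => by
            rw [trace_redRep]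
            congr 1
            exact Subtype.ext ((ht y).trans (hbr.trace_eq y))
          have h5 := congrArg (fun f => LinearMap.trace R _ (f * redRep red r τ)) (h3 x hx)
          simp only [act_def, Finset.sum_mul, map_sum, smul_mul_assoc, map_smul, zero_mul,
            map_zero, smul_eq_mul] at h5
          rw [← h5]
          refine Finset.sum_congr rfl fun g _ => ?_
          change x g * red (t (.inl g * τ)) = _
          rw [h4, map_mul (redRep red r)]
          rfl
        · refine absurd ⟨X, _, _, MonoidHom.comp σ SemidirectProduct.inl, d, b,
            MonoidHom.comp r SemidirectProduct.inl, hr, h1, fun g => ?_, fun g => hbr _, h2⟩ hno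
          have h6 : (SemidirectProduct.inl (sigInv k n g) : E) = τ * .inl g * τ := by
            rw [invElt_mul_inl, mul_assoc, invElt_mul_self, mul_one]
          change LinearMap.trace F X (σ (SemidirectProduct.inl (sigInv k n g))) = _
          rw [h6, map_mul σ, LinearMap.trace_mul_comm, ← map_mul, ← mul_assoc, invElt_mul_self,
            one_mul]
          rfl
      · refine ⟨⊤, fun _ _ _ _ => trivial, actsFully_top hirr, fun x _ =>
          Finset.sum_eq_zero fun g _ => ?_⟩
        have h1 : t (.inl g * τ) = 0 :=
          Subtype.ext ((ht _).trans (hσ.trace_inl_mul_invElt hr g))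
        change x g * red (t (.inl g * τ)) = 0
        rw [h1, map_zero, mul_zero]
    | zero => exact ⟨⊤, fun _ _ _ _ => trivial, actsFully_top hirr, fun x _ => by simp⟩
    | add f g _ _ hf hg =>
      obtain ⟨J, h1, h2, h3⟩ := hf
      obtain ⟨J', h1', h2', h3'⟩ := hg
      refine ⟨J ⊓ J', h1.inf h1', h2.inf h2' h1 h1', fun x hx => ?_⟩
      simp only [Pi.add_apply, mul_add, Finset.sum_add_distrib, h3 x hx.1, h3' x hx.2, add_zero]
    | smul c f _ hf =>
      obtain ⟨J, h1, h2, h3⟩ := hf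
      refine ⟨J, h1, h2, fun x hx => ?_⟩
      simp only [Pi.smul_apply, smul_eq_mul, mul_left_comm _ c, ← Finset.mul_sum, h3 x hx, mul_zero]
  obtain ⟨J, -, h2, h3⟩ := key _ hspan
  obtain ⟨f, hf⟩ := exists_trace_mul_ne_zero (P := T) (fun h0 => by
    rw [h0, mul_zero] at hT
    exact zero_ne_one hT)
  obtain ⟨x, hx, rfl⟩ := h2 f
  refine hf ?_
  rw [← h3 x hx, act_def, Finset.sum_mul, map_sum]
  refine Finset.sum_congr rfl fun g _ => ?_
  rw [smul_mul_assoc, map_smul, smul_eq_mul]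
  congr 2
  exact (extendRep_apply ρ hT hTρ g).symm

end SelfdualLift

section Criterion

variable {k : Type} [Field k] [Fintype k] {n : ℕ} {R : Type} [Field R] [IsAlgClosed R] {V : Type}
  [AddCommGroup V] [Module R V] {ρ : Representation R (GL (Fin n) k) V}

lemma repIso_dual_iff_of_charP (p : ℕ) [Fact p.Prime] [CharP k p] (hR : (p : R) ≠ 0) (ℓ : ℕ) [Fact ℓ.Prime] [CharP R ℓ] {r : ℕ} (hr : 1 ≤ r) (hn : n = 2 * r)
    (hirr : IsIrreducibleRep ρ) (hc : ActsFully ρ (cuspIdeal k n R)) (h2 : (2 : k) ≠ 0) :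
    RepIso ρ ρ.dual ↔
      invariantForms ρ (levi k n 2 (twoBlocks n r) : Set (GL (Fin n) k)) ≠ ⊥ := by
  have hn1 : 1 ≤ n := by omega
  obtain ⟨F, _, _, _, O, red, hred, -⟩ := exists_valuationSubring_reduction R ℓ
  have hF : (p : F) ≠ 0 := Nat.cast_ne_zero.2 (Fact.out : p.Prime).ne_zero
  refine ⟨fun hd => ?_, fun hH => ?_⟩
  · obtain ⟨T, hT, hTρ⟩ := exists_involution_of_repIso_dual p hR hn1 hirr
      (IsCuspidal.of_actsFully hc) hd
    obtain ⟨X, _, _, π, d, b, s, hπ, hcusp, htr, hbs, hiso⟩ :=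
      exists_sigInv_lift (O := O) p hR hn1 ℓ red hirr hc hT hTρ
    have := hπ.finiteDimensional
    obtain ⟨ψ, hψ⟩ := exists_addChar_ne_one (card_field_ne_zero (R := F) (k := k) p hF)
    have hsig := hπ.repIso_sigDual hψ p hF (hπ.whSpace_ne_bot hcusp p hF hn1 hψ)
    have hdual := hπ.repIso_dual_of_trace fun g => by
      rw [hsig.trace_eq, ← htr g]
      change LinearMap.trace F _ (Module.Dual.transpose (π (sig g⁻¹))) = _
      rw [LinearMap.trace_transpose', sig_inv]
      rfl
    exact hiso.symm.invariantForms_ne_bot (hbs.invariantForms_redRep_ne_bot red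
      ((hπ.repIso_dual_iff hcusp h2 hr hn).1 hdual))
  · obtain ⟨X, _, _, π, d, b, s, hπ, hcusp, hH', hbs, hiso⟩ :=
      exists_distinguished_lift (O := O) p hR hn1 red hred hirr hc _ hH
    have := hπ.finiteDimensional
    have hdual := (hπ.repIso_dual_iff hcusp h2 hr hn).2 hH'
    refine hirr.repIso_dual_of_trace fun g => ?_
    rw [← hiso.trace_eq, ← hiso.trace_eq, trace_redRep, trace_redRep]
    congr 1
    apply Subtype.ext
    rw [← hbs.trace_eq, ← hbs.trace_eq, ← trace_dual, hdual.trace_eq]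

lemma rank_eq_one_iff_ne_bot {K M : Type} [Field K] [AddCommGroup M] [Module K M]
    [FiniteDimensional K M] {W : Submodule K M} (h : Module.finrank K W ≤ 1) :
    W ≠ ⊥ ↔ Module.rank K W = 1 := by
  rw [← Submodule.one_le_finrank_iff, ← Module.finrank_eq_rank]
  norm_cast
  omega

end Criterion

/-- For `n = 2r` and `ρ` supercuspidal irreducible (`p ≠ 2`):
selfdual ↔ `(GL r × GL r)(k)`-distinguished ↔ the space of invariant forms is
one-dimensional. -/
theorem supercuspidal_even_distinction_criterion
    (p : ℕ) [Fact p.Prime] (hp : p ≠ 2)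
    (k : Type) [Field k] [Fintype k] [CharP k p]
    (R : Type) [Field R] [IsAlgClosed R] (hchar : ringChar R ≠ p)
    (n r : ℕ) (hr : 1 ≤ r) (hn : n = 2 * r)
    (V : Type) [AddCommGroup V] [Module R V]
    (ρ : Representation R (GL (Fin n) k) V)
    (hirr : IsIrreducibleRep ρ) (hsc : IsSupercuspidal k ρ) :
    (RepIso ρ ρ.dual ↔
        invariantForms ρ (levi k n 2 (twoBlocks n r) : Set (GL (Fin n) k)) ≠ ⊥) ∧
      (invariantForms ρ (levi k n 2 (twoBlocks n r) : Set (GL (Fin n) k)) ≠ ⊥ ↔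
        Module.rank R
          ↥(invariantForms ρ (levi k n 2 (twoBlocks n r) : Set (GL (Fin n) k))) = 1) := by
  have h2 : (2 : k) ≠ 0 := fun h => by
    have h1 := (CharP.cast_eq_zero_iff k p 2).1 (by exact_mod_cast h)
    exact hp ((Nat.prime_dvd_prime_iff_eq Fact.out Nat.prime_two).1 h1)
  have hR : (p : R) ≠ 0 := fun h => by
    rcases (Nat.dvd_prime (Fact.out : p.Prime)).1 (ringChar.dvd h) with h1 | h1
    · exact CharP.ringChar_ne_one h1
    · exact hchar h1
  have hc := hsc.actsFully_cuspIdeal hirr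
  have hcusp := IsCuspidal.of_actsFully hc
  have := hirr.finiteDimensional
  refine ⟨?_, rank_eq_one_iff_ne_bot (hirr.finrank_invariantForms_le hcusp p hR (by omega) r hn)⟩
  rcases CharP.exists' R with _ | ⟨ℓ, _, _⟩
  · exact hirr.repIso_dual_iff hcusp h2 hr hn
  · exact repIso_dual_iff_of_charP p hR ℓ hr hn hirr hc h2
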